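/- For every convex body K in R^2, lim_{n→∞} n^{-2/3} log |P_n(K)| = 3 · (ζ(3)/(4ζ(2)))^{1/3} · A(K), where P_n(K) is the set of convex polygons contained in K with vertices in the lattice (1/n)Z^2. -/

import Mathlib

open MeasureTheory Set Filter
noncomputable section

/-- Euclidean space `ℝ^d`. -/
abbrev E (d : ℕ) := EuclideanSpace ℝ (Fin d)

/-- The scaled integer lattice `(1/m)ℤ^d` in `ℝ^d`. -/
def scaledLattice (d m : ℕ) : Set (E d) := {v | ∀ i, ∃ z : ℤ, v i = z / m}

/-- `𝒫_m(K)`: the collection of (nonempty) convex polytopes contained in `K` all of whose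
vertices lie in the lattice `(1/m)ℤ^d`. -/
def latticePolytopes (d m : ℕ) (K : Set (E d)) : Set (Set (E d)) :=
  {P | P.Nonempty ∧ P ⊆ K ∧
    ∃ F : Finset (E d), (↑F : Set (E d)) ⊆ scaledLattice d m ∧ P = convexHull ℝ (↑F : Set (E d))}
/-- The (convex) floating body: points of `S` not cut off by any halfplane slicing
off volume at most `δ` from `S`. -/
def floatingBody (S : Set (E 2)) (δ : ℝ) : Set (E 2) :=
  {x ∈ S | ∀ (f : E 2 →L[ℝ] ℝ) (c : ℝ),
    volume {y ∈ S | c < f y} ≤ ENNReal.ofReal δ → f x ≤ c}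

/-- The affine perimeter of a planar convex body, defined via the floating-body
asymptotics `Area(S \ S_δ) ∼ (3/(4√2))^{2/3} AP(S) δ^{2/3}` (equivalent to
`∫_{∂S} κ^{1/3} ds` for smooth bodies). -/
def affinePerimeter (S : Set (E 2)) : ℝ :=
  (4 * Real.sqrt 2 / 3) ^ ((2:ℝ)/3) *
    limUnder (nhdsWithin 0 (Set.Ioi 0)) fun δ : ℝ =>
      ((volume S).toReal - (volume (floatingBody S δ)).toReal) / δ ^ ((2:ℝ)/3)

/-- `A(K)`: the supremum of affine perimeters of convex compact subsets of `K`. -/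
def maxAffinePerimeter (K : Set (E 2)) : ℝ :=
  sSup {a | ∃ S, S ⊆ K ∧ Convex ℝ S ∧ IsCompact S ∧ a = affinePerimeter S}

section Part1
set_option linter.all false
open scoped Classical

/-! ## Part 1a: asymptotics of the generating function -/
namespace BL
open Topology

def PV : Set (ℕ × ℕ) := {v | 0 < v.1 ∧ 0 < v.2 ∧ Nat.Coprime v.1 v.2}

def wt (s t : ℝ) (v : ℕ × ℕ) : ℝ := Real.exp (-(s * v.1 + t * v.2))

def pos2 : Set (ℕ × ℕ) := {v | 0 < v.1 ∧ 0 < v.2}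

def phi (s t : ℝ) : ℝ := 1 / ((Real.exp s - 1) * (Real.exp t - 1))

def psi (s t : ℝ) : ℝ := ∑' v, PV.indicator (wt s t) v

def F0 : Filter (ℝ × ℝ) := (𝓝[>] (0:ℝ)) ×ˢ (𝓝[>] (0:ℝ))

lemma hs_conv {β : Type*} {f g : β → ℝ} {a b : ℝ} (h : HasSum f a) (hf : ∀ x, g x = f x)
    (hab : b = a) : HasSum g b := by
  have : g = f := funext hf
  rw [this, hab]; exact h

lemma sum3 : Summable (fun k : ℕ => 1 / ((k+1:ℕ):ℝ) ^ 3) :=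
  (summable_nat_add_iff (f := fun k : ℕ => 1 / (k:ℝ) ^ 3) 1).mpr (Real.summable_one_div_nat_pow.mpr (show 1 < 3 by norm_num))

lemma wt_pos (s t : ℝ) (v) : 0 < wt s t v := Real.exp_pos _

lemma wt_eq (s t : ℝ) (v : ℕ × ℕ) : wt s t v = Real.exp (-s) ^ v.1 * Real.exp (-t) ^ v.2 := by
  rw [wt, ← Real.exp_nat_mul, ← Real.exp_nat_mul, ← Real.exp_add]; congr 1; ring

lemma hasSum_geo1 {s : ℝ} (hs : 0 < s) :
    HasSum (fun i : ℕ => if 0 < i then Real.exp (-s) ^ i else 0) (1 / (Real.exp s - 1)) := by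
  have h1 : Real.exp (-s) < 1 := by simpa using hs
  have h2 := (hasSum_geometric_of_lt_one (Real.exp_pos (-s)).le h1)
  have h3 := (hasSum_ite_sub_hasSum h2 0)
  have e : (fun n : ℕ => if n = 0 then 0 else Real.exp (-s) ^ n) =
    (fun i : ℕ => if 0 < i then Real.exp (-s) ^ i else 0) := by
    funext i; rcases i with _ | i <;> simp
  rw [e] at h3
  refine hs_conv h3 (fun _ => rfl) ?_
  have h4 : Real.exp s - 1 > 0 := by have := Real.add_one_lt_exp hs.ne'; linarith
  have h5 : (1 - Real.exp (-s)) ≠ 0 := by linarith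
  have h6 : Real.exp (-s) * Real.exp s = 1 := by rw [← Real.exp_add]; simp
  have h7 : (1 - Real.exp (-s))⁻¹ = Real.exp s / (Real.exp s - 1) := by
    rw [eq_div_iff h4.ne', inv_mul_eq_iff_eq_mul₀ h5]; linarith
  rw [h7]
  field_simp
  ring

lemma hasSum_pos2 {s t : ℝ} (hs : 0 < s) (ht : 0 < t) :
    HasSum (pos2.indicator (wt s t)) (phi s t) := by
  have h0 : ∀ s : ℝ, 0 ≤ fun i : ℕ => if 0 < i then Real.exp (-s) ^ i else 0 := by
    intro s i; dsimp only; split_ifs <;> positivity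
  have h := (hasSum_geo1 hs).mul (hasSum_geo1 ht) ((hasSum_geo1 hs).summable.mul_of_nonneg (hasSum_geo1 ht).summable (h0 s) (h0 t))
  · refine hs_conv h (fun v => ?_) ?_
    · simp only [indicator, pos2, mem_setOf_eq, wt_eq]
      by_cases h1 : 0 < v.1 <;> by_cases h2 : 0 < v.2 <;> simp [h1, h2]
    · rw [phi]; rw [one_div_mul_one_div]

lemma PV_sub : PV ⊆ pos2 := fun v hv => ⟨hv.1, hv.2.1⟩

lemma summable_PV {s t : ℝ} (hs : 0 < s) (ht : 0 < t) : Summable (PV.indicator (wt s t)) := by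
  refine Summable.of_nonneg_of_le (fun v => indicator_nonneg (fun v _ => (wt_pos s t v).le) v)
    (fun v => ?_) (hasSum_pos2 hs ht).summable
  exact indicator_le_indicator_of_subset PV_sub (fun v => (wt_pos s t v).le) v

lemma psi_nonneg (s t : ℝ) : 0 ≤ psi s t :=
  tsum_nonneg (fun v => indicator_nonneg (fun v _ => (wt_pos s t v).le) v)

lemma phi_le {s t : ℝ} (hs : 0 < s) (ht : 0 < t) : phi s t ≤ 1 / (s * t) := by
  unfold phi
  have h1 := Real.add_one_le_exp s
  have h2 := Real.add_one_le_exp t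
  apply one_div_le_one_div_of_le (by positivity)
  apply mul_le_mul <;> linarith

lemma phi_nonneg {s t : ℝ} (hs : 0 ≤ s) (ht : 0 ≤ t) : 0 ≤ phi s t := by
  unfold phi
  have h1 := Real.add_one_le_exp s
  have h2 := Real.add_one_le_exp t
  have : 0 ≤ Real.exp s - 1 := by linarith
  have : 0 ≤ Real.exp t - 1 := by linarith
  positivity

lemma psi_le_phi {s t : ℝ} (hs : 0 < s) (ht : 0 < t) : psi s t ≤ phi s t := by
  rw [← (hasSum_pos2 hs ht).tsum_eq]
  exact Summable.tsum_le_tsum (fun v => indicator_le_indicator_of_subset PV_sub (fun v => (wt_pos s t v).le) v) (summable_PV hs ht) (hasSum_pos2 hs ht).summable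

open ArithmeticFunction in
lemma moebius_ind (v : ℕ × ℕ) (hv : v ∈ pos2) :
    HasSum (fun j : ℕ => if 0 < j ∧ j ∣ v.1 ∧ j ∣ v.2 then (moebius j : ℝ) else 0)
      (if v ∈ PV then 1 else 0) := by
  have hg : Nat.gcd v.1 v.2 ≠ 0 := by
    have := Nat.gcd_pos_of_pos_left v.2 hv.1; omega
  have h1 : (∑ j ∈ (Nat.gcd v.1 v.2).divisors, (moebius j : ℝ)) = if v ∈ PV then 1 else 0 := by
    have h := congrArg (fun f => f (Nat.gcd v.1 v.2)) moebius_mul_coe_zeta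
    simp only [coe_mul_zeta_apply, one_apply] at h
    have : v ∈ PV ↔ Nat.gcd v.1 v.2 = 1 := by
      simp only [PV, mem_setOf_eq, Nat.Coprime]; exact ⟨fun h => h.2.2, fun h => ⟨hv.1, hv.2, h⟩⟩
    rw [if_congr this rfl rfl]
    rw [← Int.cast_sum, h]; split_ifs <;> simp
  rw [← h1]
  have h2 : ∑ j ∈ (Nat.gcd v.1 v.2).divisors, (moebius j : ℝ) = 
      ∑ j ∈ (Nat.gcd v.1 v.2).divisors, (fun j : ℕ => if 0 < j ∧ j ∣ v.1 ∧ j ∣ v.2 then (moebius j : ℝ) else 0) j := by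
    apply Finset.sum_congr rfl
    intro j hj
    rw [Nat.mem_divisors] at hj
    have h3 : j ∣ v.1 ∧ j ∣ v.2 := Nat.dvd_gcd_iff.mp hj.1
    have : 0 < j := Nat.pos_of_dvd_of_pos h3.1 hv.1
    simp [h3, this]
  rw [h2]
  apply hasSum_sum_of_ne_finset_zero
  intro j hj
  rw [if_neg]
  rintro ⟨_, h3⟩
  exact hj (Nat.mem_divisors.mpr ⟨Nat.dvd_gcd_iff.mpr h3, hg⟩)

lemma hasSum_dvd {s t : ℝ} (hs : 0 < s) (ht : 0 < t) {j : ℕ} (hj : 0 < j) :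
    HasSum (fun v : ℕ × ℕ => if v ∈ pos2 ∧ (0 < j ∧ j ∣ v.1 ∧ j ∣ v.2) then wt s t v else 0) (phi (j * s) (j * t)) := by
  have hj' : (0:ℝ) < j := by exact_mod_cast hj
  have h := hasSum_pos2 (mul_pos hj' hs) (mul_pos hj' ht)
  let g : ℕ × ℕ → ℕ × ℕ := fun v => (j * v.1, j * v.2)
  have hg : Function.Injective g := by
    rintro ⟨a, b⟩ ⟨c, d⟩ h
    simp only [g, Prod.mk.injEq, mul_eq_mul_left_iff] at h ⊢
    omega
  rw [← hg.hasSum_iff]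
  · refine hs_conv h (fun v => ?_) rfl
    simp only [Function.comp, g, indicator, pos2, mem_setOf_eq, wt]
    have e1 : (0 < j * v.1 ∧ 0 < j * v.2) ↔ (0 < v.1 ∧ 0 < v.2) := by
      simp [hj]
    simp only [e1, dvd_mul_right, hj, and_true]
    by_cases h : 0 < v.1 ∧ 0 < v.2
    · simp only [h, and_self, if_true]; congr 1; push_cast; ring
    · simp only [h, if_false]
  · rintro ⟨a, b⟩ hv
    rw [if_neg]
    rintro ⟨_, _, ⟨c, rfl⟩, ⟨d, rfl⟩⟩
    exact hv ⟨(c, d), rfl⟩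

open ArithmeticFunction in
lemma psi_moebius {s t : ℝ} (hs : 0 < s) (ht : 0 < t) :
    HasSum (fun j : ℕ => (moebius j : ℝ) * phi (j * s) (j * t)) (psi s t) := by
  let G : ℕ → (ℕ × ℕ) → ℝ := fun j v => if v ∈ pos2 ∧ (0 < j ∧ j ∣ v.1 ∧ j ∣ v.2) then wt s t v else 0
  have hGnn : ∀ j v, 0 ≤ G j v := by
    intro j v; simp only [G]; split_ifs; exact (wt_pos _ _ _).le; exact le_rfl
  have hG : ∀ j, HasSum (G j) (if 0 < j then phi (j * s) (j * t) else 0) := by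
    intro j
    by_cases hj : 0 < j
    · simp only [hj, if_true]
      simpa [G, hj] using hasSum_dvd hs ht hj
    · simp only [hj, if_false, G, false_and, and_false]; exact hasSum_zero
  have hb : ∀ j : ℕ, (if 0 < j then phi (j * s) (j * t) else 0) ≤ (1 / (s * t)) * (1 / (j:ℝ) ^ 2) := by
    intro j
    by_cases hj : 0 < j
    · simp only [hj, if_true]
      have hj' : (0:ℝ) < j := by exact_mod_cast hj
      refine (phi_le (mul_pos hj' hs) (mul_pos hj' ht)).trans (le_of_eq ?_)
      field_simp
    · simp only [hj, if_false]; positivity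
  have hS : Summable (fun p : ℕ × (ℕ × ℕ) => G p.1 p.2) := by
    rw [summable_prod_of_nonneg (fun p => hGnn _ _)]
    refine ⟨fun j => (hG j).summable, ?_⟩
    refine Summable.of_nonneg_of_le (fun j => tsum_nonneg (hGnn j)) (fun j => ?_)
      ((Real.summable_one_div_nat_pow.mpr one_lt_two).mul_left (1 / (s * t)))
    rw [(hG j).tsum_eq]; exact hb j
  have hS2 : Summable (fun p : ℕ × (ℕ × ℕ) => (moebius p.1 : ℝ) * G p.1 p.2) := by
    refine Summable.of_norm_bounded hS (fun p => ?_)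
    rw [norm_mul, Real.norm_of_nonneg (hGnn _ _)]
    have : |(moebius p.1 : ℤ)| ≤ 1 := abs_moebius_le_one
    have h2 : ‖((moebius p.1 : ℤ):ℝ)‖ ≤ 1 := by
      rw [Real.norm_eq_abs]; exact_mod_cast this
    exact mul_le_of_le_one_left (hGnn _ _) h2
  have e1 : ∀ j, HasSum (fun v => (moebius j : ℝ) * G j v) ((moebius j : ℝ) * phi (j * s) (j * t)) := by
    intro j
    by_cases hj : 0 < j
    · have := (hG j).mul_left (moebius j : ℝ); simpa [hj] using this
    · have : j = 0 := by omega
      subst this; simpa using hasSum_zero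
  have e2 : ∀ v, HasSum (fun j => (moebius j : ℝ) * G j v) (PV.indicator (wt s t) v) := by
    intro v
    by_cases hv : v ∈ pos2
    · have := (moebius_ind v hv).mul_right (wt s t v)
      refine hs_conv this (fun j => ?_) ?_
      · simp only [G, hv, true_and]; split_ifs <;> simp
      · simp only [indicator]; split_ifs <;> simp
    · have : v ∉ PV := fun h => hv (PV_sub h)
      simp only [G, hv, false_and, if_false, mul_zero, indicator, this]; exact hasSum_zero
  have t1 := hS2.hasSum.prod_fiberwise e1
  have hS3 := (Equiv.prodComm ℕ (ℕ × ℕ)).symm.summable_iff.mpr hS2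
  have h3 := (Equiv.prodComm ℕ (ℕ × ℕ)).symm.hasSum_iff.mpr hS2.hasSum
  have t2 := h3.prod_fiberwise e2
  convert t1 using 1
  exact t2.tsum_eq

lemma tendsto_exp_ratio : Tendsto (fun s : ℝ => s / (Real.exp s - 1)) (𝓝[>] 0) (𝓝 1) := by
  have h := (Real.hasDerivAt_exp 0).tendsto_slope_zero_right
  simp only [zero_add, Real.exp_zero, smul_eq_mul] at h
  have := h.inv₀ one_ne_zero
  simp only [inv_one] at this
  refine this.congr (fun s => ?_)
  rw [mul_inv, inv_inv]; rfl

lemma tendsto_phi (j : ℕ) (hj : 0 < j) :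
    Tendsto (fun p : ℝ × ℝ => p.1 * p.2 * phi (j * p.1) (j * p.2)) F0 (𝓝 (1 / (j:ℝ) ^ 2)) := by
  have hj' : (0:ℝ) < j := by exact_mod_cast hj
  have hm : Tendsto (fun s : ℝ => (j:ℝ) * s) (𝓝[>] 0) (𝓝[>] 0) := by
    apply tendsto_nhdsWithin_of_tendsto_nhds_of_eventually_within
    · have : Tendsto (fun s : ℝ => (j:ℝ) * s) (𝓝 0) (𝓝 ((j:ℝ) * 0)) := (continuous_const.mul continuous_id).tendsto 0
      rw [mul_zero] at this
      exact this.mono_left nhdsWithin_le_nhds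
    · filter_upwards [self_mem_nhdsWithin] with s hs
      exact mul_pos hj' hs
  have h1 := (tendsto_exp_ratio.comp hm)
  have h2 : Tendsto (fun p : ℝ × ℝ => ((j * p.1) / (Real.exp (j * p.1) - 1)) * ((j * p.2) / (Real.exp (j * p.2) - 1))) F0 (𝓝 (1 * 1)) :=
    (h1.comp tendsto_fst).mul (h1.comp tendsto_snd)
  have h3 := h2.mul_const (1 / (j:ℝ) ^ 2)
  simp only [one_mul, mul_one] at h3
  refine h3.congr (fun p => ?_)
  unfold phi
  rw [div_mul_div_comm]
  field_simp

lemma F0_pos : ∀ᶠ p in F0, 0 < p.1 ∧ 0 < p.2 := by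
  exact (eventually_mem_nhdsWithin.prod_mk eventually_mem_nhdsWithin)

open ArithmeticFunction in
lemma tsum_moebius : ∑' j : ℕ, (moebius j : ℝ) * (1 / (j:ℝ) ^ 2) = 1 / (riemannZeta 2).re := by
  have h1 : (1:ℝ) < (2:ℂ).re := by norm_num
  have h := LSeries_one_mul_Lseries_moebius h1
  rw [LSeries_one_eq_riemannZeta h1] at h
  have h2 : LSeries (fun n => ((moebius n : ℤ) : ℂ)) 2 = ((∑' j : ℕ, (moebius j : ℝ) * (1 / (j:ℝ) ^ 2) : ℝ) : ℂ) := by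
    rw [LSeries, Complex.ofReal_tsum]
    apply tsum_congr
    intro j
    rw [LSeries.term_def]
    by_cases hj : j = 0
    · simp [hj]
    · simp only [hj, if_false]
      push_cast
      rw [show (2:ℂ) = ((2:ℕ):ℂ) by norm_num, Complex.cpow_natCast]
      ring
  rw [h2] at h
  have h3 := congrArg Complex.re h
  rw [Complex.re_mul_ofReal, Complex.one_re] at h3
  have : (riemannZeta 2).re ≠ 0 := by
    intro h0; rw [h0] at h3; simp at h3
  rw [eq_div_iff this]
  linarith

open ArithmeticFunction in
lemma tendsto_psi : Tendsto (fun p : ℝ × ℝ => p.1 * p.2 * psi p.1 p.2) F0 (𝓝 (1 / (riemannZeta 2).re)) := by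
  rw [← tsum_moebius]
  have key := tendsto_tsum_of_dominated_convergence (𝓕 := F0) (f := fun (p : ℝ × ℝ) (j : ℕ) => (moebius j : ℝ) * (p.1 * p.2 * phi (j * p.1) (j * p.2)))
    (g := fun j : ℕ => (moebius j : ℝ) * (1 / (j:ℝ) ^ 2)) (bound := fun j : ℕ => (1 / (j:ℝ) ^ 2))
    (Real.summable_one_div_nat_pow.mpr one_lt_two) ?_ ?_
  · refine key.congr' ?_
    filter_upwards [F0_pos] with p hp
    rw [← (psi_moebius hp.1 hp.2).tsum_eq, ← tsum_mul_left]
    apply tsum_congr; intro j; ring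
  · intro j
    by_cases hj : 0 < j
    · exact (tendsto_phi j hj).const_mul _
    · have : j = 0 := by omega
      subst this; simpa using tendsto_const_nhds
  · filter_upwards [F0_pos] with p hp j
    by_cases hj : 0 < j
    · have hj' : (0:ℝ) < j := by exact_mod_cast hj
      have h1 := phi_le (mul_pos hj' hp.1) (mul_pos hj' hp.2)
      have h0 := phi_nonneg (mul_pos hj' hp.1).le (mul_pos hj' hp.2).le
      have : |(moebius j : ℤ)| ≤ 1 := abs_moebius_le_one
      have h2 : ‖((moebius j : ℤ):ℝ)‖ ≤ 1 := by
        rw [Real.norm_eq_abs]; exact_mod_cast this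
      have hpp := mul_pos hp.1 hp.2
      rw [norm_mul, Real.norm_of_nonneg (mul_nonneg hpp.le h0)]
      refine (mul_le_of_le_one_left (mul_nonneg hpp.le h0) h2).trans ?_
      refine (mul_le_mul_of_nonneg_left h1 hpp.le).trans (le_of_eq ?_)
      have := hp.1.ne'
      have := hp.2.ne'
      field_simp
    · have : j = 0 := by omega
      subst this; simp

lemma psi_bound {s t : ℝ} (hs : 0 < s) (ht : 0 < t) : s * t * psi s t ≤ 1 := by
  have h := (psi_le_phi hs ht).trans (phi_le hs ht)
  have := mul_pos hs ht
  calc s * t * psi s t ≤ s * t * (1 / (s * t)) := by gcongr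
    _ = 1 := by field_simp

/-- log generating function -/
def LL (s t : ℝ) : ℝ := ∑' v, PV.indicator (fun v => -Real.log (1 - wt s t v)) v

lemma wt_lt_one {s t : ℝ} (hs : 0 < s) (ht : 0 < t) {v : ℕ × ℕ} (hv : v ∈ PV) : wt s t v < 1 := by
  unfold wt
  rw [Real.exp_lt_one_iff]
  have h1 : (0:ℝ) < v.1 := by exact_mod_cast hv.1
  have h2 : (0:ℝ) < v.2 := by exact_mod_cast hv.2.1
  have := mul_pos hs h1
  have := mul_pos ht h2
  linarith

lemma LL_term {s t : ℝ} (hs : 0 < s) (ht : 0 < t) (v : ℕ × ℕ) :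
    HasSum (fun k : ℕ => PV.indicator (wt ((k+1:ℕ) * s) ((k+1:ℕ) * t)) v / (k+1:ℕ)) (PV.indicator (fun v => -Real.log (1 - wt s t v)) v) := by
  by_cases hv : v ∈ PV
  · simp only [indicator, hv, if_true]
    have := Real.hasSum_pow_div_log_of_abs_lt_one (x := wt s t v) (by rw [abs_of_pos (wt_pos _ _ _)]; exact wt_lt_one hs ht hv)
    convert this using 2 with k
    rw [wt, wt, ← Real.exp_nat_mul]
    push_cast; ring_nf
  · simp only [indicator, hv, if_false, zero_div]; exact hasSum_zero

lemma LL_prop {s t : ℝ} (hs : 0 < s) (ht : 0 < t) :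
    HasSum (PV.indicator (fun v => -Real.log (1 - wt s t v))) (LL s t) ∧ 
    HasSum (fun k : ℕ => psi ((k+1:ℕ) * s) ((k+1:ℕ) * t) / (k+1:ℕ)) (LL s t) := by
  have hk : ∀ k : ℕ, (0:ℝ) < (k+1:ℕ) := fun k => by positivity
  let G : ℕ → (ℕ × ℕ) → ℝ := fun k v => PV.indicator (wt ((k+1:ℕ) * s) ((k+1:ℕ) * t)) v / (k+1:ℕ)
  have hGnn : ∀ k v, 0 ≤ G k v := fun k v => div_nonneg (indicator_nonneg (fun v _ => (wt_pos _ _ v).le) v) (hk k).le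
  have hG : ∀ k : ℕ, HasSum (G k) (psi ((k+1:ℕ) * s) ((k+1:ℕ) * t) / (k+1:ℕ)) := fun k => 
    ((summable_PV (mul_pos (hk k) hs) (mul_pos (hk k) ht)).hasSum).div_const _
  have hS : Summable (fun p : ℕ × (ℕ × ℕ) => G p.1 p.2) := by
    rw [summable_prod_of_nonneg (fun p => hGnn _ _)]
    refine ⟨fun j => (hG j).summable, ?_⟩
    refine Summable.of_nonneg_of_le (fun j => tsum_nonneg (hGnn j)) (fun k => ?_)
      (sum3.mul_left (1 / (s * t)))
    rw [(hG k).tsum_eq]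
    have := psi_bound (mul_pos (hk k) hs) (mul_pos (hk k) ht)
    have h0 := hk k
    rw [div_mul_div_comm, div_le_div_iff₀ h0 (by positivity)]
    calc _ = (k+1:ℕ) * (((k+1:ℕ) * s * ((k+1:ℕ) * t)) * psi ((k+1:ℕ) * s) ((k+1:ℕ) * t)) := by ring
      _ ≤ (k+1:ℕ) * 1 := by gcongr
      _ = _ := by ring
  have t1 := hS.hasSum.prod_fiberwise hG
  have h3 := (Equiv.prodComm ℕ (ℕ × ℕ)).symm.hasSum_iff.mpr hS.hasSum
  have t2 := h3.prod_fiberwise (LL_term hs ht)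
  have e : LL s t = _ := t2.tsum_eq
  rw [e]
  exact ⟨t2, t1⟩

def kap : ℝ := (riemannZeta 3).re / (riemannZeta 2).re

lemma tsum_three : ∑' k : ℕ, 1 / ((k+1:ℕ):ℝ) ^ 3 = (riemannZeta 3).re := by
  have h := zeta_nat_eq_tsum_of_gt_one (k := 3) (by norm_num)
  have h2 : riemannZeta 3 = ((∑' n : ℕ, 1 / (n:ℝ) ^ 3 : ℝ) : ℂ) := by
    rw [Complex.ofReal_tsum]; push_cast at h ⊢; exact h
  rw [h2, Complex.ofReal_re, (Real.summable_one_div_nat_pow.mpr (show 1 < 3 by norm_num)).tsum_eq_zero_add]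
  simp

lemma tendsto_LL : Tendsto (fun p : ℝ × ℝ => p.1 * p.2 * LL p.1 p.2) F0 (𝓝 kap) := by
  have key := tendsto_tsum_of_dominated_convergence (𝓕 := F0) (f := fun (p : ℝ × ℝ) (k : ℕ) => (1 / ((k+1:ℕ):ℝ) ^ 3) * ((((k+1:ℕ) * p.1) * ((k+1:ℕ) * p.2)) * psi ((k+1:ℕ) * p.1) ((k+1:ℕ) * p.2)))
    (g := fun k : ℕ => (1 / ((k+1:ℕ):ℝ) ^ 3) * (1 / (riemannZeta 2).re)) (bound := fun k : ℕ => (1 / ((k+1:ℕ):ℝ) ^ 3))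
    sum3 ?_ ?_
  · rw [tsum_mul_right, tsum_three] at key
    have e : kap = (riemannZeta 3).re * (1 / (riemannZeta 2).re) := by rw [kap]; ring
    rw [e]
    refine key.congr' ?_
    filter_upwards [F0_pos] with p hp
    rw [← (LL_prop hp.1 hp.2).2.tsum_eq, ← tsum_mul_left]
    apply tsum_congr; intro j
    have : ((j+1:ℕ):ℝ) ≠ 0 := by positivity
    field_simp
  · intro k
    have hj' : (0:ℝ) < (k+1:ℕ) := by positivity
    have hm : Tendsto (fun s : ℝ => ((k+1:ℕ):ℝ) * s) (𝓝[>] 0) (𝓝[>] 0) := by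
      apply tendsto_nhdsWithin_of_tendsto_nhds_of_eventually_within
      · have : Tendsto (fun s : ℝ => ((k+1:ℕ):ℝ) * s) (𝓝 0) (𝓝 (((k+1:ℕ):ℝ) * 0)) := (continuous_const.mul continuous_id).tendsto 0
        rw [mul_zero] at this
        exact this.mono_left nhdsWithin_le_nhds
      · filter_upwards [self_mem_nhdsWithin] with s hs
        exact mul_pos hj' hs
    exact (tendsto_psi.comp (hm.prodMap hm)).const_mul _
  · filter_upwards [F0_pos] with p hp k
    have hj' : (0:ℝ) < (k+1:ℕ) := by positivity
    have h1 := psi_bound (mul_pos hj' hp.1) (mul_pos hj' hp.2)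
    have h0 := psi_nonneg ((k+1:ℕ) * p.1) ((k+1:ℕ) * p.2)
    have := hp.1
    have := hp.2
    rw [norm_mul, Real.norm_of_nonneg (by positivity), Real.norm_of_nonneg (by positivity)]
    exact mul_le_of_le_one_right (by positivity) h1

lemma zeta2_pos : 0 < (riemannZeta 2).re := by
  rw [riemannZeta_two]
  have : ((Real.pi:ℂ) ^ 2 / 6) = ((Real.pi ^ 2 / 6 : ℝ) : ℂ) := by push_cast; ring
  rw [this, Complex.ofReal_re]; positivity

lemma kap_pos : 0 < kap := by
  apply div_pos _ zeta2_pos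
  rw [← tsum_three]
  refine Summable.tsum_pos sum3 (fun k => by positivity) 0 (by positivity)

/-- usable form -/
lemma LL_asymp {ε : ℝ} (hε : 0 < ε) : ∃ σ > 0, ∀ s t, 0 < s → s < σ → 0 < t → t < σ →
    (1 - ε) * (kap / (s * t)) ≤ LL s t ∧ LL s t ≤ (1 + ε) * (kap / (s * t)) := by
  have h := tendsto_LL
  have hk := kap_pos
  have h2 := h.eventually (Icc_mem_nhds (show (1 - ε) * kap < kap by nlinarith) (show kap < (1 + ε) * kap by nlinarith))
  rw [F0, eventually_prod_iff] at h2
  obtain ⟨p, hp, q, hq, H⟩ := h2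
  rw [eventually_nhdsWithin_iff, Metric.eventually_nhds_iff] at hp hq
  obtain ⟨a, ha, hp⟩ := hp
  obtain ⟨b, hb, hq⟩ := hq
  refine ⟨min a b, lt_min ha hb, fun s t hs hs' ht ht' => ?_⟩
  have h3 := H (hp (by rw [Real.dist_eq, sub_zero, abs_of_pos hs]; exact hs'.trans_le (min_le_left _ _)) hs)
    (hq (by rw [Real.dist_eq, sub_zero, abs_of_pos ht]; exact ht'.trans_le (min_le_right _ _)) ht)
  have hst := mul_pos hs ht
  simp only [mem_Icc] at h3
  constructor
  · rw [← mul_div_assoc, div_le_iff₀ hst]; linarith [h3.1]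
  · rw [← mul_div_assoc, le_div_iff₀ hst]; linarith [h3.2]

end BL

end Part1

section Part2
set_option linter.all false
open scoped Classical

/-! ## Part 1b: counting multisets of primitive vectors -/
namespace BL
open Topology

def ms1 (m : ℕ × ℕ →₀ ℕ) : ℕ := m.sum fun v k => k * v.1
def ms2 (m : ℕ × ℕ →₀ ℕ) : ℕ := m.sum fun v k => k * v.2

def CS (α β : ℕ) : Set (ℕ × ℕ →₀ ℕ) := {m | ↑m.support ⊆ PV ∧ ms1 m ≤ α ∧ ms2 m ≤ β}

def cnt (α β : ℕ) : ℕ := (CS α β).ncard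

def box (V : Finset (ℕ × ℕ)) (B : ℕ) : Finset (ℕ × ℕ →₀ ℕ) := V.finsupp (fun _ => Finset.range B)

lemma mem_box {V B} {m : ℕ × ℕ →₀ ℕ} : m ∈ box V B ↔ m.support ⊆ V ∧ ∀ v ∈ V, m v < B := by
  simp [box, Finset.mem_finsupp_iff]

lemma CS_sub_box (α β : ℕ) : CS α β ⊆ 
    ↑(box ((Finset.range (α+1) ×ˢ Finset.range (β+1)).filter (· ∈ PV)) (α+1)) := by
  rintro m ⟨h1, h2, h3⟩
  have key : ∀ v ∈ m.support, m v * v.1 ≤ α ∧ m v * v.2 ≤ β := by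
    intro v hv
    constructor
    · refine le_trans ?_ h2
      exact Finset.single_le_sum (f := fun v => m v * v.1) (fun _ _ => Nat.zero_le _) hv
    · refine le_trans ?_ h3
      exact Finset.single_le_sum (f := fun v => m v * v.2) (fun _ _ => Nat.zero_le _) hv
  rw [Finset.mem_coe, mem_box]
  refine ⟨fun v hv => ?_, fun v hv => ?_⟩
  · have hk := key v hv
    have hm : 1 ≤ m v := Nat.one_le_iff_ne_zero.mpr (Finsupp.mem_support_iff.mp hv)
    simp only [Finset.mem_filter, Finset.mem_product, Finset.mem_range]
    refine ⟨⟨?_, ?_⟩, h1 hv⟩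
    · nlinarith [hk.1]
    · nlinarith [hk.2]
  · by_cases hv' : v ∈ m.support
    · have hk := (key v hv').1
      have := (h1 hv').1
      nlinarith
    · rw [Finsupp.notMem_support_iff] at hv'; omega

lemma CS_finite (α β : ℕ) : (CS α β).Finite := (Finset.finite_toSet _).subset (CS_sub_box α β)

lemma cnt_pos (α β : ℕ) : 0 < cnt α β := by
  rw [cnt, Set.ncard_pos (CS_finite α β)]
  exact ⟨0, by simp [CS, ms1, ms2]⟩

def mw (s t : ℝ) (m : ℕ × ℕ →₀ ℕ) : ℝ := Real.exp (-(s * ms1 m + t * ms2 m))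

lemma mw_prod (s t : ℝ) {V B} {m} (hm : m ∈ box V B) : mw s t m = ∏ v ∈ V, wt s t v ^ m v := by
  have h := (mem_box.mp hm).1
  simp only [wt, ← Real.exp_nat_mul]
  rw [← Real.exp_sum, mw, ms1, ms2, Finsupp.sum_of_support_subset _ h _ (by simp), Finsupp.sum_of_support_subset _ h _ (by simp)]
  congr 1
  push_cast
  rw [Finset.mul_sum, Finset.mul_sum, ← Finset.sum_add_distrib, ← Finset.sum_neg_distrib]
  apply Finset.sum_congr rfl; intro v _; ring

def WW (s t : ℝ) (V : Finset (ℕ × ℕ)) (B : ℕ) : ℝ := ∑ m ∈ box V B, mw s t m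

lemma WW_eq (s t : ℝ) (V B) : WW s t V B = ∏ v ∈ V, ∑ k ∈ Finset.range B, wt s t v ^ k := by
  rw [WW, Finset.sum_congr rfl (fun m hm => mw_prod s t hm), Finset.prod_sum, box, Finset.finsupp, Finset.sum_map]
  refine Finset.sum_congr (by congr!) ?_
  intro p hp
  rw [← Finset.prod_attach]
  apply Finset.prod_congr rfl
  intro v hv
  simp [Finsupp.indicator_of_mem v.2]

lemma exp_neglog {s t : ℝ} (hs : 0 < s) (ht : 0 < t) {v} (hv : v ∈ PV) : 
    Real.exp (-Real.log (1 - wt s t v)) = (1 - wt s t v)⁻¹ := by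
  rw [Real.exp_neg, Real.exp_log]; linarith [wt_lt_one hs ht hv]

lemma neglog_nonneg {s t : ℝ} (hs : 0 < s) (ht : 0 < t) {v} (hv : v ∈ PV) : 
    0 ≤ (-Real.log (1 - wt s t v)) := by
  have := Real.log_nonpos (x := 1 - wt s t v) (by linarith [wt_lt_one hs ht hv]) (by linarith [wt_pos s t v])
  linarith

lemma WW_le {s t : ℝ} (hs : 0 < s) (ht : 0 < t) {V : Finset (ℕ × ℕ)} (hV : ↑V ⊆ PV) (B : ℕ) :
    WW s t V B ≤ Real.exp (LL s t) := by
  rw [WW_eq]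
  have h1 : ∏ v ∈ V, ∑ k ∈ Finset.range B, wt s t v ^ k ≤ ∏ v ∈ V, Real.exp (-Real.log (1 - wt s t v)) := by
    apply Finset.prod_le_prod
    · intro v _; apply Finset.sum_nonneg; intro k _; exact pow_nonneg (wt_pos _ _ _).le _
    · intro v hv
      rw [exp_neglog hs ht (hV hv)]
      exact sum_le_hasSum _ (fun k _ => pow_nonneg (wt_pos _ _ _).le _) (hasSum_geometric_of_lt_one (wt_pos _ _ _).le (wt_lt_one hs ht (hV hv)))
  refine h1.trans ?_
  rw [← Real.exp_sum]
  apply Real.exp_le_exp.mpr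
  have := sum_le_hasSum V (f := PV.indicator (fun v => -Real.log (1 - wt s t v))) (fun v _ => indicator_nonneg (fun v hv => neglog_nonneg hs ht hv) v) (LL_prop hs ht).1
  refine le_trans (le_of_eq ?_) this
  apply Finset.sum_congr rfl; intro v hv; simp [indicator, hV hv]

lemma exists_WW {s t : ℝ} (hs : 0 < s) (ht : 0 < t) : ∃ V : Finset (ℕ × ℕ), ∃ B, ↑V ⊆ PV ∧ 
    Real.exp (LL s t) / 2 ≤ WW s t V B := by
  have h := (LL_prop hs ht).1
  have h1 : ∀ᶠ V in atTop, LL s t - Real.log (3/2) ≤ ∑ v ∈ V, PV.indicator (fun v => -Real.log (1 - wt s t v)) v :=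
    h.eventually (eventually_ge_nhds (by have := Real.log_pos (show (1:ℝ) < 3/2 by norm_num); linarith))
  obtain ⟨V, hV⟩ := h1.exists
  have hVV : ((V.filter (· ∈ PV) : Finset _) : Set (ℕ × ℕ)) ⊆ PV := by intro v hv; simp at hv; exact hv.2
  have h2 : Tendsto (fun B => WW s t (V.filter (· ∈ PV)) B) atTop (𝓝 (∏ v ∈ V.filter (· ∈ PV), (1 - wt s t v)⁻¹)) := by
    simp only [WW_eq]
    apply tendsto_finset_prod
    intro v hv
    exact (hasSum_geometric_of_lt_one (wt_pos _ _ _).le (wt_lt_one hs ht (hVV hv))).tendsto_sum_nat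
  have h3 : Real.exp (LL s t) / 2 < ∏ v ∈ V.filter (· ∈ PV), (1 - wt s t v)⁻¹ := by
    rw [Finset.prod_congr rfl (fun v hv => (exp_neglog hs ht (hVV hv)).symm), ← Real.exp_sum]
    have e : ∑ v ∈ V, PV.indicator (fun v => -Real.log (1 - wt s t v)) v = ∑ v ∈ V.filter (· ∈ PV), -Real.log (1 - wt s t v) := by
      rw [Finset.sum_filter]; rfl
    rw [← e]
    have h4 := Real.exp_le_exp.mpr hV
    rw [Real.exp_sub, Real.exp_log (by norm_num)] at h4
    have := Real.exp_pos (LL s t)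
    linarith
  obtain ⟨B, hB⟩ := (h2.eventually (eventually_ge_nhds h3)).exists
  exact ⟨_, B, hVV, hB⟩

lemma cnt_le {s t : ℝ} (hs : 0 < s) (ht : 0 < t) (α β : ℕ) : 
    (cnt α β : ℝ) ≤ Real.exp (s * α + t * β + LL s t) := by
  set V := ((Finset.range (α+1) ×ˢ Finset.range (β+1)).filter (· ∈ PV))
  have hV : (V : Set (ℕ × ℕ)) ⊆ PV := by intro v hv; simp [V] at hv; exact hv.2
  have h := WW_le hs ht hV (α + 1)
  have e : cnt α β = (CS_finite α β).toFinset.card := Set.ncard_eq_toFinset_card _ _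
  have h1 : ∑ m ∈ (CS_finite α β).toFinset, Real.exp (-(s * α + t * β)) ≤ WW s t V (α+1) := by
    calc _ ≤ ∑ m ∈ (CS_finite α β).toFinset, mw s t m := by
          apply Finset.sum_le_sum
          intro m hm
          rw [Set.Finite.mem_toFinset] at hm
          apply Real.exp_le_exp.mpr
          have h1 : (ms1 m : ℝ) ≤ α := by exact_mod_cast hm.2.1
          have h2 : (ms2 m : ℝ) ≤ β := by exact_mod_cast hm.2.2
          nlinarith
      _ ≤ _ := by
          apply Finset.sum_le_sum_of_subset_of_nonneg
          · intro m hm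
            rw [Set.Finite.mem_toFinset] at hm
            exact CS_sub_box α β hm
          · intro m _ _; exact (Real.exp_pos _).le
  rw [Finset.sum_const, nsmul_eq_mul, ← e] at h1
  have h2 := h1.trans h
  rw [Real.exp_neg, ← div_eq_mul_inv, div_le_iff₀ (Real.exp_pos _)] at h2
  rw [Real.exp_add]; linarith

lemma chern {s t h Z : ℝ} (hs : 0 < s) (ht : 0 < t) (h0 : 0 < h) (h1 : h < 1) (α β : ℕ) :
    Real.exp (LL s t) / 2 ≤ cnt α β * Real.exp (-Z) + Real.exp (-(h * (s * α)) + LL ((1 - h) * s) t)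
      + Real.exp (-(h * (t * β)) + LL s ((1 - h) * t)) + Real.exp (h * Z + LL ((1 + h) * s) ((1 + h) * t)) := by
  obtain ⟨V, B, hV, hW⟩ := exists_WW hs ht
  refine hW.trans ?_
  have hh : 0 < 1 - h := by linarith
  have t1 := WW_le (mul_pos hh hs) ht hV B
  have t2 := WW_le hs (mul_pos hh ht) hV B
  have t3 := WW_le (mul_pos (show 0 < 1 + h by linarith) hs) (mul_pos (show 0 < 1 + h by linarith) ht) hV B
  rw [Real.exp_add, Real.exp_add, Real.exp_add]
  have u1 := mul_le_mul_of_nonneg_left t1 (Real.exp_pos (-(h * (s * α)))).le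
  have u2 := mul_le_mul_of_nonneg_left t2 (Real.exp_pos (-(h * (t * β)))).le
  have u3 := mul_le_mul_of_nonneg_left t3 (Real.exp_pos (h * Z)).le
  let g : (ℕ × ℕ →₀ ℕ) → ℝ := fun m => if m ∈ CS α β then Real.exp (-Z) else 0
  have h5 : ∑ m ∈ box V B, g m ≤ cnt α β * Real.exp (-Z) := by
    simp only [g]
    rw [← Finset.sum_filter, Finset.sum_const, nsmul_eq_mul]
    gcongr
    rw [cnt, Set.ncard_eq_toFinset_card _ (CS_finite α β)]
    apply Finset.card_le_card
    intro m hm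
    simp at hm ⊢; exact hm.2
  have h6 : WW s t V B ≤ ∑ m ∈ box V B, (g m + Real.exp (-(h * (s * α))) * mw ((1 - h) * s) t m + Real.exp (-(h * (t * β))) * mw s ((1 - h) * t) m + Real.exp (h * Z) * mw ((1 + h) * s) ((1 + h) * t) m) := by
    apply Finset.sum_le_sum
    intro m hm
    have p1 : 0 ≤ Real.exp (-(h * (s * α))) * mw ((1 - h) * s) t m := mul_nonneg (Real.exp_pos _).le (Real.exp_pos _).le
    have p2 : 0 ≤ Real.exp (-(h * (t * β))) * mw s ((1 - h) * t) m := mul_nonneg (Real.exp_pos _).le (Real.exp_pos _).le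
    have p3 : 0 ≤ Real.exp (h * Z) * mw ((1 + h) * s) ((1 + h) * t) m := mul_nonneg (Real.exp_pos _).le (Real.exp_pos _).le
    have p4 : 0 ≤ g m := by simp only [g]; split_ifs; exact (Real.exp_pos _).le; exact le_rfl
    by_cases c1 : ms1 m ≤ α
    · by_cases c2 : ms2 m ≤ β
      · by_cases c3 : s * ms1 m + t * ms2 m < Z
        · have : mw s t m ≤ Real.exp (h * Z) * mw ((1 + h) * s) ((1 + h) * t) m := by
            rw [mw, mw, ← Real.exp_add]
            apply Real.exp_le_exp.mpr
            nlinarith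
          linarith
        · have : mw s t m ≤ g m := by
            have hc : m ∈ CS α β := ⟨fun v hv => hV ((mem_box.mp hm).1 hv), c1, c2⟩
            simp only [g, hc, if_true, mw]
            apply Real.exp_le_exp.mpr; linarith
          linarith
      · have : mw s t m ≤ Real.exp (-(h * (t * β))) * mw s ((1 - h) * t) m := by
          rw [mw, mw, ← Real.exp_add]
          apply Real.exp_le_exp.mpr
          have : (β:ℝ) ≤ ms2 m := by exact_mod_cast (not_le.mp c2).le
          have := mul_le_mul_of_nonneg_left this (mul_pos h0 ht).le
          nlinarith
        linarith
    · have : mw s t m ≤ Real.exp (-(h * (s * α))) * mw ((1 - h) * s) t m := by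
        rw [mw, mw, ← Real.exp_add]
        apply Real.exp_le_exp.mpr
        have : (α:ℝ) ≤ ms1 m := by exact_mod_cast (not_le.mp c1).le
        have := mul_le_mul_of_nonneg_left this (mul_pos h0 hs).le
        nlinarith
      linarith
  rw [Finset.sum_add_distrib, Finset.sum_add_distrib, Finset.sum_add_distrib, ← Finset.mul_sum, ← Finset.mul_sum, ← Finset.mul_sum] at h6
  simp only [WW] at u1 u2 u3 h6 ⊢
  linarith

set_option maxHeartbeats 1000000 in
lemma cnt_low {ε : ℝ} (hε : 0 < ε) (hε1 : ε ≤ 1) : ∃ σ > 0, ∀ s t, 0 < s → s < σ → 0 < t → t < σ →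
    ∀ α β : ℕ, (1 + ε) * (kap / (s * t)) ≤ s * α → (1 + ε) * (kap / (s * t)) ≤ t * β →
    (3 - 2 * ε) * (kap / (s * t)) ≤ Real.log (cnt α β) := by
  have hc0 : 0 < ε ^ 2 / 64 := by positivity
  obtain ⟨c, hc⟩ : ∃ c, c = ε ^ 2 / 64 := ⟨_, rfl⟩
  rw [← hc] at hc0
  obtain ⟨σ, hσ, H⟩ := LL_asymp hc0
  have hk := kap_pos
  refine ⟨min (σ / 2) (min 1 (c * kap / 5)), by positivity, ?_⟩
  intro s t hs hs' ht ht' α β hα hβ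
  have hs1 : s < σ / 2 := hs'.trans_le (min_le_left _ _)
  have ht1 : t < σ / 2 := ht'.trans_le (min_le_left _ _)
  have hs2 : s < 1 := hs'.trans_le ((min_le_right _ _).trans (min_le_left _ _))
  have ht2 : t < c * kap / 5 := ht'.trans_le ((min_le_right _ _).trans (min_le_right _ _))
  obtain ⟨Λ, hΛ⟩ : ∃ Λ, Λ = kap / (s * t) := ⟨_, rfl⟩
  rw [← hΛ] at hα hβ ⊢
  have hst := mul_pos hs ht
  have hΛ5 : 5 ≤ c * Λ := by
    rw [hΛ, ← mul_div_assoc, le_div_iff₀ hst]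
    nlinarith
  have hΛ0 : 0 < Λ := by rw [hΛ]; positivity
  obtain ⟨h, hh⟩ : ∃ h, h = ε / 4 := ⟨_, rfl⟩
  have hh0 : 0 < h := by rw [hh]; positivity
  have hh1 : h ≤ 1 / 4 := by linarith
  have a0 := H s t hs (by linarith) ht (by linarith)
  have a1 := (H ((1 - h) * s) t (by nlinarith) (by nlinarith) ht (by linarith)).2
  have a2 := (H s ((1 - h) * t) hs (by linarith) (by nlinarith) (by nlinarith)).2
  have a3 := (H ((1 + h) * s) ((1 + h) * t) (by nlinarith) (by nlinarith) (by nlinarith) (by nlinarith)).2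
  have e1 : kap / ((1 - h) * s * t) = Λ * (1 / (1 - h)) := by
    have : 1 - h ≠ 0 := by linarith
    rw [hΛ]; field_simp
  have e2 : kap / (s * ((1 - h) * t)) = Λ * (1 / (1 - h)) := by
    have : 1 - h ≠ 0 := by linarith
    rw [hΛ]; field_simp
  have e3 : kap / ((1 + h) * s * ((1 + h) * t)) = Λ * (1 / (1 + h) ^ 2) := by
    have : 1 + h ≠ 0 := by linarith
    rw [hΛ]; field_simp
  rw [e1] at a1; rw [e2] at a2; rw [e3] at a3; rw [← hΛ] at a0
  have b1 : 1 / (1 - h) ≤ 1 + h + 2 * h ^ 2 := by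
    rw [div_le_iff₀ (by linarith)]; nlinarith only [mul_pos hh0 hh0, hh0, hh1]
  have b3 : 1 / (1 + h) ^ 2 ≤ 1 - 2 * h + 3 * h ^ 2 := by
    rw [div_le_iff₀ (by positivity)]
    nlinarith only [hh0, hh1, mul_pos hh0 hh0, mul_pos hh0 (mul_pos hh0 hh0), mul_pos (mul_pos hh0 hh0) (mul_pos hh0 hh0)]
  have hcle : c ≤ 1 / 64 := by rw [hc]; nlinarith only [hε, hε1]
  have q1 : (1 + c) * (Λ * (1 / (1 - h))) ≤ Λ * ((1 + c) * (1 + h + 2 * h ^ 2)) := by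
    have : (1 + c) * (Λ * (1 / (1 - h))) = Λ * ((1 + c) * (1 / (1 - h))) := by ring
    rw [this]; gcongr
  have q3 : (1 + c) * (Λ * (1 / (1 + h) ^ 2)) ≤ Λ * ((1 + c) * (1 - 2 * h + 3 * h ^ 2)) := by
    have : (1 + c) * (Λ * (1 / (1 + h) ^ 2)) = Λ * ((1 + c) * (1 / (1 + h) ^ 2)) := by ring
    rw [this]; gcongr
  have ch := chern (Z := (2 - ε) * Λ) hs ht hh0 (by linarith) α β
  have r1 : (1 + c) * (1 + h + 2 * h ^ 2) ≤ 1 - 2 * c + h * (1 + ε) := by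
    have e1 : h ^ 2 = 4 * c := by rw [hh, hc]; ring
    have e2 : h * ε = 16 * c := by rw [hh, hc]; ring
    rw [e1]
    nlinarith only [e2, hc0, hcle, hh1, hh0]
  have r3 : h * (2 - ε) + (1 + c) * (1 - 2 * h + 3 * h ^ 2) ≤ 1 - 2 * c := by
    have e1 : h ^ 2 = 4 * c := by rw [hh, hc]; ring
    have e2 : h * ε = 16 * c := by rw [hh, hc]; ring
    rw [e1]
    nlinarith only [e2, hc0, hcle, hh1, hh0]
  have E1 : -(h * (s * α)) + LL ((1 - h) * s) t ≤ LL s t - 5 := by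
    have := mul_le_mul_of_nonneg_left r1 hΛ0.le
    have := mul_le_mul_of_nonneg_left hα hh0.le
    linarith
  have E2 : -(h * (t * β)) + LL s ((1 - h) * t) ≤ LL s t - 5 := by
    have := mul_le_mul_of_nonneg_left r1 hΛ0.le
    have := mul_le_mul_of_nonneg_left hβ hh0.le
    linarith
  have E3 : h * ((2 - ε) * Λ) + LL ((1 + h) * s) ((1 + h) * t) ≤ LL s t - 5 := by
    have := mul_le_mul_of_nonneg_left r3 hΛ0.le
    linarith
  have F1 := Real.exp_le_exp.mpr E1
  have F2 := Real.exp_le_exp.mpr E2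
  have F3 := Real.exp_le_exp.mpr E3
  rw [Real.exp_sub] at F1 F2 F3
  have h5 : (12:ℝ) ≤ Real.exp 5 := by
    have h1 := Real.exp_one_gt_d9
    have : Real.exp 5 = Real.exp 1 ^ 5 := by rw [← Real.exp_nat_mul]; norm_num
    rw [this]
    have : (2:ℝ) ^ 5 ≤ Real.exp 1 ^ 5 := by gcongr; linarith
    linarith
  have h6 : Real.exp (LL s t) / Real.exp 5 ≤ Real.exp (LL s t) / 12 := by
    apply div_le_div_of_nonneg_left (Real.exp_pos _).le (by norm_num) h5
  have h7 : Real.exp (LL s t) / 4 ≤ cnt α β * Real.exp (-((2 - ε) * Λ)) := by linarith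
  have h8 : Real.exp ((2 - ε) * Λ + LL s t - 5) ≤ cnt α β := by
    rw [Real.exp_neg, ← div_eq_mul_inv, le_div_iff₀ (Real.exp_pos _)] at h7
    rw [Real.exp_sub, Real.exp_add, div_le_iff₀ (Real.exp_pos _)]
    have : (0:ℝ) < cnt α β := by exact_mod_cast cnt_pos α β
    have h10 := mul_le_mul_of_nonneg_left h5 this.le
    linarith only [h7, h10, this]
  have h9 := Real.log_le_log (Real.exp_pos _) h8
  rw [Real.log_exp] at h9
  have : c ≤ ε / 64 := by rw [hc]; nlinarith only [hε, hε1]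
  have := mul_le_mul_of_nonneg_right this hΛ0.le
  linarith only [mul_pos hε hΛ0, this, h9, a0.1, hΛ5]

lemma cnt_upp {ε : ℝ} (hε : 0 < ε) : ∃ σ > 0, ∀ s t, 0 < s → s < σ → 0 < t → t < σ →
    ∀ α β : ℕ, Real.log (cnt α β) ≤ s * α + t * β + (1 + ε) * (kap / (s * t)) := by
  obtain ⟨σ, hσ, H⟩ := LL_asymp hε
  refine ⟨σ, hσ, fun s t hs hs' ht ht' α β => ?_⟩
  have h := Real.log_le_log (by exact_mod_cast cnt_pos α β) (cnt_le hs ht α β)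
  rw [Real.log_exp] at h
  linarith [(H s t hs hs' ht ht').2]

end BL

end Part2

section Part3
set_option linter.all false
open scoped Classical

/-! ## Part 1c: counting asymptotics -/
namespace BL
open Topology

def cb (x : ℝ) : ℝ := x ^ ((1:ℝ)/3)

lemma cb_nonneg {x : ℝ} (hx : 0 ≤ x) : 0 ≤ cb x := Real.rpow_nonneg hx _
lemma cb_pos {x : ℝ} (hx : 0 < x) : 0 < cb x := Real.rpow_pos_of_pos hx _
lemma cb_zero : cb 0 = 0 := by rw [cb, Real.zero_rpow]; norm_num
lemma cb_one : cb 1 = 1 := Real.one_rpow _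
lemma cb_mul {x y : ℝ} (hx : 0 ≤ x) (hy : 0 ≤ y) : cb (x * y) = cb x * cb y := Real.mul_rpow hx hy
lemma cb_mono {x y : ℝ} (hx : 0 ≤ x) (h : x ≤ y) : cb x ≤ cb y := Real.rpow_le_rpow hx h (by norm_num)
lemma cb_cube {x : ℝ} (hx : 0 ≤ x) : cb x ^ 3 = x := by
  rw [cb, ← Real.rpow_natCast, ← Real.rpow_mul hx]; norm_num
lemma cb_of_cube {x : ℝ} (hx : 0 ≤ x) : cb (x ^ 3) = x := by
  rw [cb, ← Real.rpow_natCast, ← Real.rpow_mul hx]; norm_num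
lemma cb_add_le {x y : ℝ} (hx : 0 ≤ x) (hy : 0 ≤ y) : cb (x + y) ≤ cb x + cb y :=
  Real.rpow_add_le_add_rpow hx hy (by norm_num) (by norm_num)
lemma cb_sq {x : ℝ} (hx : 0 ≤ x) : cb (x ^ 2) = cb x ^ 2 := by rw [sq, sq, cb_mul hx hx]
lemma cb_cont : Continuous cb := Real.continuous_rpow_const (by norm_num)
lemma rpow23 {x : ℝ} (hx : 0 ≤ x) : x ^ ((2:ℝ)/3) = cb x ^ 2 := by
  rw [cb, ← Real.rpow_natCast, ← Real.rpow_mul hx]; norm_num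

lemma cb_small (c : ℝ) {ε : ℝ} (hε : 0 < ε) : ∃ η > 0, η ≤ 1 ∧ cb (c * η) ≤ ε := by
  have h : Tendsto (fun η : ℝ => cb (c * η)) (𝓝[>] 0) (𝓝 (cb (c * 0))) :=
    ((cb_cont.comp (continuous_const.mul continuous_id)).tendsto 0).mono_left nhdsWithin_le_nhds
  rw [mul_zero, cb_zero] at h
  have h1 := h.eventually (eventually_le_nhds hε)
  have h2 : ∀ᶠ η : ℝ in 𝓝[>] 0, η ∈ Ioc (0:ℝ) 1 := Ioc_mem_nhdsGT one_pos
  obtain ⟨η, ha, hb⟩ := (h1.and h2).exists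
  exact ⟨η, hb.1, hb.2, ha⟩

lemma cb_large (C : ℝ) : ∀ᶠ n : ℕ in atTop, C < cb n := by
  have h : Tendsto (fun n : ℕ => cb n) atTop atTop :=
    (tendsto_rpow_atTop (show (0:ℝ) < 1/3 by norm_num)).comp tendsto_natCast_atTop_atTop
  exact h.eventually_gt_atTop C

theorem cnt_asymp_upper (R ε : ℝ) (hR : 0 < R) (hε : 0 < ε) : ∀ᶠ n : ℕ in atTop, ∀ α β : ℕ,
    (α:ℝ) ≤ R * n → (β:ℝ) ≤ R * n → Real.log (cnt α β) ≤ 3 * cb (kap * (α * β)) + ε * cb n ^ 2 := by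
  have hk := kap_pos
  obtain ⟨η, hη, hη1, hη2⟩ := cb_small (kap * (2 * R + 1)) (show 0 < ε / 6 by positivity)
  obtain ⟨M, hM⟩ : ∃ M, M = cb (kap * (R + 1) ^ 2) := ⟨_, rfl⟩
  have hM0 : 0 < M := by rw [hM]; exact cb_pos (by positivity)
  obtain ⟨σ, hσ, H⟩ := cnt_upp (show 0 < ε / (2 * M) by positivity)
  filter_upwards [cb_large (M / (η * σ)), eventually_gt_atTop 0] with n hn hn0 α β hα hβ
  have hn1 : (0:ℝ) < n := by exact_mod_cast hn0
  have hc := cb_pos hn1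
  have hα0 : (0:ℝ) ≤ α := by positivity
  have hβ0 : (0:ℝ) ≤ β := by positivity
  obtain ⟨a, ha⟩ : ∃ a, a = α + η * n := ⟨_, rfl⟩
  obtain ⟨b, hb⟩ : ∃ b, b = β + η * n := ⟨_, rfl⟩
  have hηn : 0 < η * n := by positivity
  have ha0 : η * n ≤ a := by rw [ha]; linarith
  have hb0 : η * n ≤ b := by rw [hb]; linarith
  have ha1 : 0 < a := by linarith
  have hb1 : 0 < b := by linarith
  obtain ⟨D, hD⟩ : ∃ D, D = cb (kap * (a * b)) := ⟨_, rfl⟩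
  have hD0 : 0 < D := by rw [hD]; exact cb_pos (by positivity)
  have hD3 : D ^ 3 = kap * (a * b) := by rw [hD]; exact cb_cube (by positivity)
  have hDM : D ≤ M * cb n ^ 2 := by
    rw [hM, hD, ← cb_sq hn1.le, ← cb_mul (by positivity) (by positivity)]
    apply cb_mono (by positivity)
    have h1 : a ≤ (R + 1) * n := by rw [ha]; nlinarith
    have h2 : b ≤ (R + 1) * n := by rw [hb]; nlinarith
    calc kap * (a * b) ≤ kap * (((R + 1) * n) * ((R + 1) * n)) := by gcongr
      _ = _ := by ring
  have hD2 : D ≤ cb (kap * (α * β)) + ε / 6 * cb n ^ 2 := by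
    have h1 : D ≤ cb (kap * (α * β) + kap * (2 * R + 1) * η * n ^ 2) := by
      rw [hD]; apply cb_mono (by positivity)
      have : a * b = α * β + (η * n * (α + β) + η * (η * n ^ 2)) := by rw [ha, hb]; ring
      rw [this]
      have h3 : η * n * (α + β) ≤ η * n * (2 * R * n) := by gcongr; linarith
      have h4 : η * (η * n ^ 2) ≤ η * (1 * n ^ 2) := by gcongr
      have : kap * (η * n * (α + β) + η * (η * n ^ 2)) ≤ kap * (η * n * (2 * R * n) + η * (1 * n ^ 2)) := by gcongr
      linarith
    refine h1.trans ((cb_add_le (by positivity) (by positivity)).trans ?_)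
    rw [cb_mul (x := kap * (2 * R + 1) * η) (by positivity) (by positivity), cb_sq hn1.le]
    gcongr
  have hsm : ∀ x, η * n ≤ x → D / x < σ := by
    intro x hx
    rw [div_lt_iff₀ (by linarith)]
    have h1 : M < cb n * (η * σ) := by rwa [div_lt_iff₀ (by positivity)] at hn
    calc D ≤ M * cb n ^ 2 := hDM
      _ < cb n * (η * σ) * cb n ^ 2 := by gcongr
      _ = σ * (η * cb n ^ 3) := by ring
      _ = σ * (η * n) := by rw [cb_cube hn1.le]
      _ ≤ σ * x := by gcongr
  have h := H (D / a) (D / b) (by positivity) (hsm a ha0) (by positivity) (hsm b hb0) α β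
  have e : kap / (D / a * (D / b)) = D := by
    field_simp
    linarith
  rw [e] at h
  have h1 : D / a * α ≤ D := by
    rw [div_mul_eq_mul_div, div_le_iff₀ ha1]; gcongr; rw [ha]; linarith
  have h2 : D / b * β ≤ D := by
    rw [div_mul_eq_mul_div, div_le_iff₀ hb1]; gcongr; rw [hb]; linarith
  have h3 : ε / (2 * M) * D ≤ ε / 2 * cb n ^ 2 := by
    calc ε / (2 * M) * D ≤ ε / (2 * M) * (M * cb n ^ 2) := by gcongr
      _ = _ := by field_simp
  linarith

theorem cnt_asymp_lower (R ε : ℝ) (hR : 0 < R) (hε : 0 < ε) : ∀ᶠ n : ℕ in atTop, ∀ α β : ℕ,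
    (α:ℝ) ≤ R * n → (β:ℝ) ≤ R * n → 3 * cb (kap * (α * β)) - ε * cb n ^ 2 ≤ Real.log (cnt α β) := by
  have hk := kap_pos
  obtain ⟨η, hη, hη1, hη2⟩ := cb_small (kap * R) (show 0 < ε / 3 by positivity)
  obtain ⟨M, hM⟩ : ∃ M, M = cb (kap * R ^ 2) := ⟨_, rfl⟩
  have hM0 : 0 < M := by rw [hM]; exact cb_pos (by positivity)
  obtain ⟨e1, he1, he11, he12⟩ : ∃ e1 > 0, e1 ≤ 1 ∧ 8 * e1 * M ≤ ε := by
    refine ⟨min 1 (ε / (8 * M)), by positivity, min_le_left _ _, ?_⟩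
    calc 8 * min 1 (ε / (8 * M)) * M ≤ 8 * (ε / (8 * M)) * M := by gcongr; exact min_le_right _ _
      _ = ε := by field_simp
  obtain ⟨σ, hσ, H⟩ := cnt_low he1 he11
  filter_upwards [cb_large (2 * M / (η * σ)), eventually_gt_atTop 0] with n hn hn0 α β hα hβ
  have hn1 : (0:ℝ) < n := by exact_mod_cast hn0
  have hc := cb_pos hn1
  have hα0 : (0:ℝ) ≤ α := by positivity
  have hβ0 : (0:ℝ) ≤ β := by positivity
  by_cases hsmall : (α:ℝ) * β ≤ η * n * (R * n)
  · have h0 : 0 ≤ Real.log (cnt α β) := Real.log_nonneg (by exact_mod_cast cnt_pos α β)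
    have h1 : cb (kap * (α * β)) ≤ ε / 3 * cb n ^ 2 := by
      calc cb (kap * (α * β)) ≤ cb (kap * (η * n * (R * n))) := cb_mono (by positivity) (by gcongr)
        _ = cb (kap * R * η * n ^ 2) := by congr 1; ring
        _ = cb (kap * R * η) * cb n ^ 2 := by rw [cb_mul (by positivity) (by positivity), cb_sq hn1.le]
        _ ≤ _ := by gcongr
    linarith
  push_neg at hsmall
  have hηn : 0 < η * n := by positivity
  have ha : η * n ≤ α := by
    by_contra hcon; push_neg at hcon
    exact absurd (mul_le_mul hcon.le hβ hβ0 hηn.le) (by linarith)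
  have hb : η * n ≤ β := by
    by_contra hcon; push_neg at hcon
    exact absurd (mul_le_mul hcon.le hα hα0 hηn.le) (by linarith)
  have ha1 : (0:ℝ) < α := by linarith
  have hb1 : (0:ℝ) < β := by linarith
  obtain ⟨D, hD⟩ : ∃ D, D = cb (kap * (α * β)) := ⟨_, rfl⟩
  have hD0 : 0 < D := by rw [hD]; exact cb_pos (by positivity)
  have hD3 : D ^ 3 = kap * (α * β) := by rw [hD]; exact cb_cube (by positivity)
  have hDM : D ≤ M * cb n ^ 2 := by
    rw [hM, hD, ← cb_sq hn1.le, ← cb_mul (by positivity) (by positivity)]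
    apply cb_mono (by positivity)
    calc kap * ((α:ℝ) * β) ≤ kap * ((R * n) * (R * n)) := by gcongr
      _ = _ := by ring
  have hq0 : 0 < 1 + e1 := by linarith
  have hsm : ∀ x, η * n ≤ x → (1 + e1) * D / x < σ := by
    intro x hx
    rw [div_lt_iff₀ (by linarith)]
    have h1 : 2 * M < cb n * (η * σ) := by rwa [div_lt_iff₀ (by positivity)] at hn
    calc (1 + e1) * D ≤ 2 * (M * cb n ^ 2) := by gcongr; linarith
      _ = (2 * M) * cb n ^ 2 := by ring
      _ < cb n * (η * σ) * cb n ^ 2 := by gcongr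
      _ = σ * (η * cb n ^ 3) := by ring
      _ = σ * (η * n) := by rw [cb_cube hn1.le]
      _ ≤ σ * x := by gcongr
  have e : kap / ((1 + e1) * D / α * ((1 + e1) * D / β)) = D / (1 + e1) ^ 2 := by
    field_simp
    linarith
  have hcond : (1 + e1) * (D / (1 + e1) ^ 2) ≤ (1 + e1) * D := by
    gcongr
    apply div_le_self hD0.le
    nlinarith
  have h := H ((1 + e1) * D / α) ((1 + e1) * D / β) (by positivity) (hsm _ ha) (by positivity) (hsm _ hb) α β
    (by rw [e, div_mul_cancel₀ _ ha1.ne']; exact hcond) (by rw [e, div_mul_cancel₀ _ hb1.ne']; exact hcond)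
  rw [e] at h
  have h1 : (3 - 8 * e1) * D ≤ (3 - 2 * e1) * (D / (1 + e1) ^ 2) := by
    rw [← mul_div_assoc, le_div_iff₀ (by positivity)]
    have : (3 - 8 * e1) * (1 + e1) ^ 2 ≤ 3 - 2 * e1 := by nlinarith only [he1, he11, mul_pos he1 he1, mul_pos he1 (mul_pos he1 he1)]
    nlinarith only [this, hD0]
  have h2 : 8 * e1 * D ≤ ε * cb n ^ 2 := by
    calc 8 * e1 * D ≤ 8 * e1 * (M * cb n ^ 2) := by gcongr
      _ = (8 * e1 * M) * cb n ^ 2 := by ring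
      _ ≤ _ := by gcongr
  rw [← hD]
  linarith

end BL

end Part3

section Part4
set_option linter.all false
open scoped Classical

/-! ## Part 2a: fans and chains -/
namespace BL
open Topology

def dt {R : Type*} [CommRing R] (u v : R × R) : R := u.1 * v.2 - u.2 * v.1

def cR (v : ℤ × ℤ) : ℝ × ℝ := ((v.1 : ℝ), (v.2 : ℝ))

@[simp] lemma cR_fst (v) : (cR v).1 = v.1 := rfl
@[simp] lemma cR_snd (v) : (cR v).2 = v.2 := rfl
lemma cR_add (u v) : cR (u + v) = cR u + cR v := by ext <;> simp [cR]
lemma cR_sub (u v) : cR (u - v) = cR u - cR v := by ext <;> simp [cR]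
lemma cR_zero : cR 0 = 0 := by ext <;> simp [cR]
lemma cR_nsmul (k : ℕ) (v) : cR (k • v) = (k : ℝ) • cR v := by ext <;> simp [cR]
lemma dt_cR (u v : ℤ × ℤ) : dt (cR u) (cR v) = ((dt u v : ℤ) : ℝ) := by simp [dt]
lemma cR_sum {ι} (s : Finset ι) (f : ι → ℤ × ℤ) : cR (∑ i ∈ s, f i) = ∑ i ∈ s, cR (f i) := by
  induction s using Finset.induction_on with
  | empty => simp [cR_zero]
  | insert a s ha ih => rw [Finset.sum_insert ha, Finset.sum_insert ha, cR_add, ih]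

section dt
variable {R : Type*} [CommRing R]
lemma dt_add_left (u v w : R × R) : dt (u + v) w = dt u w + dt v w := by simp [dt]; ring
lemma dt_add_right (u v w : R × R) : dt w (u + v) = dt w u + dt w v := by simp [dt]; ring
lemma dt_sub_right (u v w : R × R) : dt w (u - v) = dt w u - dt w v := by simp [dt]; ring
lemma dt_sub_left (u v w : R × R) : dt (u - v) w = dt u w - dt v w := by simp [dt]; ring
lemma dt_smul_left (c : R) (u v : R × R) : dt (c • u) v = c * dt u v := by simp [dt]; ring
lemma dt_smul_right (c : R) (u v : R × R) : dt u (c • v) = c * dt u v := by simp [dt]; ring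
lemma dt_self (u : R × R) : dt u u = 0 := by simp [dt]; ring
lemma dt_swap (u v : R × R) : dt u v = - dt v u := by simp only [dt]; ring
lemma dt_zero_right (u : R × R) : dt u 0 = 0 := by simp [dt]
lemma dt_zero_left (u : R × R) : dt 0 u = 0 := by simp [dt]
lemma plucker (u v w : R × R) : dt u w * v.1 = dt u v * w.1 + dt v w * u.1 := by
  simp only [dt]; ring
lemma dt_sum_right {ι} (s : Finset ι) (u : R × R) (f : ι → R × R) : dt u (∑ i ∈ s, f i) = ∑ i ∈ s, dt u (f i) := by
  induction s using Finset.induction_on with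
  | empty => simp [dt_zero_right]
  | insert a s ha ih => rw [Finset.sum_insert ha, Finset.sum_insert ha, dt_add_right, ih]
end dt

/-! ### fan -/
def fan : ℕ → ℕ → ℤ × ℤ
  | 0, i => if i = 0 then (0, -1) else if i = 1 then (1, 0) else (0, 1)
  | N + 1, i => if i % 2 = 0 then fan N (i / 2) else fan N (i / 2) + fan N (i / 2 + 1)

def kf (N : ℕ) : ℕ := 2 ^ (N + 1)

lemma kf_succ (N) : kf (N+1) = 2 * kf N := by simp [kf, pow_succ]; ring
lemma kf_pos (N) : 0 < kf N := by simp [kf]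

lemma fan_even (N i) : fan (N+1) (2 * i) = fan N i := by simp [fan]
lemma fan_odd (N i) : fan (N+1) (2 * i + 1) = fan N i + fan N (i + 1) := by
  have h1 : (2 * i + 1) % 2 = 1 := by omega
  have h2 : (2 * i + 1) / 2 = i := by omega
  simp [fan, h1, h2]

lemma fan_zero (N) : fan N 0 = (0, -1) := by
  induction N with
  | zero => simp [fan]
  | succ N ih => simpa [ih] using fan_even N 0

lemma fan_last (N) : fan N (kf N) = (0, 1) := by
  induction N with
  | zero => simp [fan, kf]
  | succ N ih => rw [kf_succ, fan_even, ih]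

lemma fan_mid (N) : fan N (2 ^ N) = (1, 0) := by
  induction N with
  | zero => simp [fan]
  | succ N ih => rw [pow_succ, mul_comm, fan_even, ih]

def l1 (v : ℤ × ℤ) : ℤ := |v.1| + |v.2|

lemma fan_props (N) : ∀ i < kf N, dt (fan N i) (fan N (i+1)) = 1 ∧ 0 ≤ (fan N i).1 ∧ 0 ≤ (fan N (i+1)).1 ∧
    0 ≤ (fan N i).2 * (fan N (i+1)).2 ∧ 1 ≤ l1 (fan N i) ∧ 1 ≤ l1 (fan N (i+1)) ∧ 
    (N:ℤ) + 1 ≤ l1 (fan N i) * l1 (fan N (i+1)) ∧ (0 < i → 0 < (fan N i).1) := by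
  induction N with
  | zero =>
    intro i hi
    have : i < 2 := by simpa [kf] using hi
    interval_cases i <;> simp [fan, dt, l1]
  | succ N ih =>
    intro i hi
    rw [kf_succ] at hi
    obtain ⟨j, rfl | rfl⟩ := Nat.even_or_odd' i
    · have hj : j < kf N := by omega
      obtain ⟨h1, h2, h3, h4, h5, h6, h7, h8⟩ := ih j hj
      rw [fan_even, fan_odd]
      have ha : l1 (fan N j + fan N (j+1)) = l1 (fan N j) + l1 (fan N (j+1)) := by
        simp only [l1, Prod.fst_add, Prod.snd_add]
        rw [abs_add_eq_add_abs_iff _ _ |>.mpr, abs_add_eq_add_abs_iff _ _ |>.mpr]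
        · ring
        · rcases mul_nonneg_iff.mp h4 with h | h
          · left; exact h
          · right; exact h
        · left; exact ⟨h2, h3⟩
      rw [ha]
      refine ⟨?_, h2, by simp only [Prod.fst_add]; omega, ?_, h5, by omega, ?_, fun h => h8 (by omega)⟩
      · rw [dt_add_right, dt_self, h1]; ring
      · simp only [Prod.snd_add]; nlinarith [sq_nonneg (fan N j).2]
      · push_cast; nlinarith
    · have hj : j < kf N := by omega
      obtain ⟨h1, h2, h3, h4, h5, h6, h7, h8⟩ := ih j hj
      rw [fan_odd, show 2 * j + 1 + 1 = 2 * (j + 1) by ring, fan_even]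
      have ha : l1 (fan N j + fan N (j+1)) = l1 (fan N j) + l1 (fan N (j+1)) := by
        simp only [l1, Prod.fst_add, Prod.snd_add]
        rw [abs_add_eq_add_abs_iff _ _ |>.mpr, abs_add_eq_add_abs_iff _ _ |>.mpr]
        · ring
        · rcases mul_nonneg_iff.mp h4 with h | h
          · left; exact h
          · right; exact h
        · left; exact ⟨h2, h3⟩
      rw [ha]
      refine ⟨?_, by simp only [Prod.fst_add]; omega, h3, ?_, by omega, h6, ?_, fun h => ?_⟩
      · rw [dt_add_left, dt_self, h1]; ring
      · simp only [Prod.snd_add]; nlinarith [sq_nonneg (fan N (j+1)).2]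
      · push_cast; nlinarith
      · simp only [Prod.fst_add]
        by_contra hc
        have e1 : (fan N j).1 = 0 := by omega
        have e2 : (fan N (j+1)).1 = 0 := by omega
        simp [dt, e1, e2] at h1

/-- `v` is in the half-open sector `i` -/
def insec (N i : ℕ) (v : ℤ × ℤ) : Prop := 0 ≤ dt (fan N i) v ∧ 0 < dt v (fan N (i+1))

lemma fan_step {N i : ℕ} (hi : i < kf N) {v : ℤ × ℤ} (hv : 0 < v.1) (h : 0 < dt v (fan N i)) :
    0 < dt v (fan N (i+1)) := by
  obtain ⟨h1, h2, h3, h4, h5, h6, h7, h8⟩ := fan_props N i hi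
  have hp := plucker v (fan N i) (fan N (i+1))
  rcases h2.eq_or_lt with h0 | h0
  · exfalso
    have : i = 0 := by
      by_contra hc; have := h8 (by omega); omega
    subst this
    rw [fan_zero] at h; simp [dt] at h; omega
  · rw [h1] at hp
    have : 0 < dt v (fan N (i+1)) * (fan N i).1 := by rw [hp]; nlinarith
    exact pos_of_mul_pos_left this h0.le

lemma fan_mono {N i j : ℕ} (hij : i ≤ j) (hj : j ≤ kf N) {v : ℤ × ℤ} (hv : 0 < v.1) (h : 0 < dt v (fan N i)) :
    0 < dt v (fan N j) := by
  induction j, hij using Nat.le_induction with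
  | base => exact h
  | succ j hij ih => exact fan_step (by omega) hv (ih (by omega))

lemma exists_sec (N : ℕ) {v : ℤ × ℤ} (hv : 0 < v.1) : ∃ i < kf N, insec N i v := by
  have hex : ∃ j, j ≤ kf N ∧ 0 < dt v (fan N j) := ⟨kf N, le_rfl, by rw [fan_last]; simp [dt, hv]⟩
  have hspec := Nat.find_spec hex
  have hmin := @Nat.find_min _ _ hex
  set j := Nat.find hex
  have hj0 : j ≠ 0 := by
    intro h0; rw [h0, fan_zero] at hspec; simp [dt] at hspec; omega
  obtain ⟨i, hi⟩ := Nat.exists_eq_succ_of_ne_zero hj0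
  refine ⟨i, by omega, ?_, ?_⟩
  · have := hmin (m := i) (by omega)
    rw [dt_swap]
    by_contra hc
    exact this ⟨by omega, by omega⟩
  · rw [show i + 1 = j by omega]; exact hspec.2

lemma sec_unique {N i j : ℕ} (hi : i < kf N) (hj : j < kf N) {v : ℤ × ℤ} (hv : 0 < v.1) (h1 : insec N i v) (h2 : insec N j v) :
    i = j := by
  by_contra hne
  rcases lt_or_gt_of_ne hne with h | h
  · have := fan_mono (show i + 1 ≤ j by omega) hj.le hv h1.2
    have := h2.1; rw [dt_swap] at this; omega
  · have := fan_mono (show j + 1 ≤ i by omega) hi.le hv h2.2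
    have := h1.1; rw [dt_swap] at this; omega

/-- coordinates of any vector in sector basis -/
lemma sec_coord {N i : ℕ} (hi : i < kf N) (v : ℤ × ℤ) :
    v = (dt v (fan N (i+1))) • fan N i + (dt (fan N i) v) • fan N (i+1) := by
  have h := (fan_props N i hi).1
  simp only [dt] at h ⊢
  ext
  · simp
    linear_combination (-v.1) * h
  · simp
    linear_combination (-v.2) * h

lemma sec_coordR {N i : ℕ} (hi : i < kf N) (v : ℝ × ℝ) :
    v = (dt v (cR (fan N (i+1)))) • cR (fan N i) + (dt (cR (fan N i)) v) • cR (fan N (i+1)) := by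
  have h := (fan_props N i hi).1
  have h' : dt (cR (fan N i)) (cR (fan N (i+1))) = 1 := by rw [dt_cR, h]; simp
  simp only [dt] at h' ⊢
  ext
  · simp at h' ⊢
    linear_combination (-v.1) * h'
  · simp at h' ⊢
    linear_combination (-v.2) * h'

/-! ### chains -/
def Chn (m : ℤ × ℤ →₀ ℕ) : Prop := ∀ v ∈ m.support, 0 < v.1 ∧ IsCoprime v.1 v.2

def VV (p : ℤ × ℤ) (m : ℤ × ℤ →₀ ℕ) (a : ℝ × ℝ) : ℤ × ℤ :=
  p + m.sum fun v k => if 0 < dt (cR v) a then k • v else 0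

lemma VV_add_single (p : ℤ × ℤ) (m : ℤ × ℤ →₀ ℕ) (a : ℝ × ℝ) (v : ℤ × ℤ) (k : ℕ) :
    VV p (m + Finsupp.single v k) a = VV p m a + (if 0 < dt (cR v) a then k • v else 0) := by
  rw [VV, VV, Finsupp.sum_add_index', Finsupp.sum_single_index, add_assoc]
  · simp
  · intro v; simp
  · intro v k1 k2; split_ifs <;> simp [add_smul]

/-- the chain statement -/
def ChainOf (F : Finset (ℤ × ℤ)) (p : ℤ × ℤ) (m : ℤ × ℤ →₀ ℕ) : Prop :=
  ∀ a : ℝ × ℝ, 0 ≤ a.1 → VV p m a ∈ F ∧ ∀ w ∈ F, 0 ≤ dt a (cR (w - VV p m a))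

def LexMin (F : Finset (ℤ × ℤ)) (p : ℤ × ℤ) : Prop := p ∈ F ∧ ∀ w ∈ F, p.1 < w.1 ∨ (p.1 = w.1 ∧ p.2 ≤ w.2)

lemma exists_prim {u : ℤ × ℤ} (hu : 0 < u.1) : ∃ v : ℤ × ℤ, ∃ k : ℕ, 0 < v.1 ∧ IsCoprime v.1 v.2 ∧ u = k • v ∧ 0 < k := by
  have hg : 0 < Int.gcd u.1 u.2 := Int.gcd_pos_of_ne_zero_left _ hu.ne'
  obtain ⟨a, ha⟩ := Int.gcd_dvd_left u.1 u.2
  obtain ⟨b, hb⟩ := Int.gcd_dvd_right u.1 u.2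
  have hg' : (0:ℤ) < Int.gcd u.1 u.2 := by exact_mod_cast hg
  refine ⟨(a, b), Int.gcd u.1 u.2, ?_, ?_, ?_, hg⟩
  · have : 0 < (Int.gcd u.1 u.2 : ℤ) * a := by rw [← ha]; exact hu
    exact pos_of_mul_pos_right this hg'.le
  · rw [Int.isCoprime_iff_gcd_eq_one]
    have h2 := Int.gcd_mul_left (Int.gcd u.1 u.2 : ℤ) a b
    have h3 : Int.gcd (Int.gcd u.1 u.2 * a) (Int.gcd u.1 u.2 * b) = Int.gcd u.1 u.2 :=
      (congrArg₂ Int.gcd ha hb).symm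
    rw [h3, Int.natAbs_natCast] at h2
    exact Nat.eq_of_mul_eq_mul_left hg (by rw [← h2, mul_one])
  · ext
    · simp; exact ha
    · simp; exact hb

theorem exists_chain_aux : ∀ (c : ℕ) (F : Finset (ℤ × ℤ)) (p : ℤ × ℤ), F.card ≤ c → LexMin F p → 
    ∃ m : ℤ × ℤ →₀ ℕ, Chn m ∧ (∀ u ∈ m.support, ∃ w ∈ F, p.1 < w.1 ∧ dt u (w - p) ≤ 0) ∧ ChainOf F p m := by
  intro c
  induction c with
  | zero => intro F p hc hp; exfalso; rw [Nat.le_zero, Finset.card_eq_zero] at hc; rw [hc] at hp; exact absurd hp.1 (Finset.notMem_empty _)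
  | succ c ih =>
    intro F p hc hp
    by_cases hG : (F.filter (fun w => p.1 < w.1)).Nonempty
    · obtain ⟨z, hz, hzmin⟩ := Finset.exists_min_image _ (fun w : ℤ × ℤ => ((w.2 - p.2 : ℤ) : ℚ) / ((w.1 - p.1 : ℤ) : ℚ)) hG
      rw [Finset.mem_filter] at hz
      obtain ⟨v, k, hv1, hvc, hzv, hk⟩ := exists_prim (u := z - p) (by simp; exact hz.2)
      have hz' : z = p + k • v := by rw [← hzv]; abel
      have hkz : (0:ℤ) < k := by exact_mod_cast hk
      have hslope0 : ∀ w ∈ F, 0 ≤ dt (z - p) (w - p) := by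
        intro w hw
        rcases hp.2 w hw with h | h
        · have := hzmin w (Finset.mem_filter.mpr ⟨hw, h⟩)
          have e1 : (0:ℚ) < ((z.1 - p.1 : ℤ) : ℚ) := by exact_mod_cast (by linarith [hz.2] : (0:ℤ) < z.1 - p.1)
          have e2 : (0:ℚ) < ((w.1 - p.1 : ℤ) : ℚ) := by exact_mod_cast (by linarith : (0:ℤ) < w.1 - p.1)
          rw [div_le_div_iff₀ e1 e2] at this
          have h3 : (z.2 - p.2) * (w.1 - p.1) ≤ (w.2 - p.2) * (z.1 - p.1) := by exact_mod_cast this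
          simp only [dt, Prod.fst_sub, Prod.snd_sub]; linarith
        · simp only [dt, Prod.fst_sub, Prod.snd_sub]
          rw [← h.1, sub_self, mul_zero, sub_zero]
          exact mul_nonneg (by linarith [hz.2]) (by linarith [h.2])
      have hslope : ∀ w ∈ F, 0 ≤ dt v (w - p) := by
        intro w hw
        have := hslope0 w hw
        rw [hzv, ← natCast_zsmul, dt_smul_left] at this
        exact nonneg_of_mul_nonneg_right this hkz
      set F' := F.filter (fun w => z.1 ≤ w.1) with hF'
      have hzF' : z ∈ F' := Finset.mem_filter.mpr ⟨hz.1, le_rfl⟩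
      have hF'F : F' ⊆ F := Finset.filter_subset _ _
      have hcard : F'.card < F.card := by
        apply Finset.card_lt_card
        refine ⟨hF'F, fun h => ?_⟩
        have := h hp.1
        rw [Finset.mem_filter] at this
        exact absurd this.2 (by linarith [hz.2])
      have hvz : ∀ w ∈ F, 0 ≤ dt v (w - z) := by
        intro w hw
        have h1 := hslope w hw
        have : w - z = (w - p) - (k:ℤ) • v := by rw [hz', ← natCast_zsmul]; abel
        rw [this, dt_sub_right, dt_smul_right, dt_self]; linarith
      have hlex : LexMin F' z := by
        refine ⟨hzF', fun w hw => ?_⟩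
        rw [Finset.mem_filter] at hw
        rcases hw.2.eq_or_lt with h | h
        · right
          refine ⟨h, ?_⟩
          have := hvz w hw.1
          simp only [dt, Prod.fst_sub, Prod.snd_sub] at this
          rw [← h, sub_self, mul_zero, sub_zero] at this
          have := nonneg_of_mul_nonneg_right this hv1
          linarith
        · left; exact h
      obtain ⟨m, hm1, hm2, hm3⟩ := ih F' z (by omega) hlex
      have hvu : ∀ u ∈ m.support, 0 ≤ dt v u := by
        intro u hu
        obtain ⟨w, hw, hw1, hw2⟩ := hm2 u hu
        have h1 := hvz w (hF'F hw)
        have h3 := plucker v (w - z) u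
        have h4 : 0 < (w - z).1 := by simp; exact hw1
        have h5 : 0 ≤ dt (w - z) u := by rw [dt_swap]; linarith
        have h6 : 0 ≤ dt v u * (w - z).1 := by
          rw [h3]
          exact add_nonneg (mul_nonneg h1 (hm1 u hu).1.le) (mul_nonneg h5 hv1.le)
        exact nonneg_of_mul_nonneg_left h6 h4
      refine ⟨m + Finsupp.single v k, ?_, ?_, ?_⟩
      · intro u hu
        have := Finsupp.support_add hu
        rw [Finset.mem_union] at this
        rcases this with h | h
        · exact hm1 u h
        · have := Finsupp.support_single_subset h
          rw [Finset.mem_singleton] at this; subst this; exact ⟨hv1, hvc⟩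
      · intro u hu
        refine ⟨z, hz.1, hz.2, ?_⟩
        rw [hzv, ← natCast_zsmul, dt_smul_right]
        have h0 : 0 ≤ dt v u := by
          have := Finsupp.support_add hu
          rw [Finset.mem_union] at this
          rcases this with h | h
          · exact hvu u h
          · have := Finsupp.support_single_subset h
            rw [Finset.mem_singleton] at this; subst this; rw [dt_self]
        rw [dt_swap]
        nlinarith
      · intro a ha
        rw [VV_add_single]
        have hcv : (0:ℝ) < (cR v).1 := by simp; exact hv1
        by_cases hva : 0 < dt (cR v) a
        · rw [if_pos hva]
          have e : VV p m a + k • v = VV z m a := by rw [VV, VV, hz']; abel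
          rw [e]
          obtain ⟨h1, h2⟩ := hm3 a ha
          refine ⟨hF'F h1, fun w hw => ?_⟩
          by_cases hwz : z.1 ≤ w.1
          · exact h2 w (Finset.mem_filter.mpr ⟨hw, hwz⟩)
          · push_neg at hwz
            have h3 := h2 z hzF'
            have h4 : 0 ≤ dt a (cR (w - z)) := by
              have h5 := plucker (cR (z - w)) (cR v) a
              have h6 : 0 ≤ dt (cR (z - w)) (cR v) := by
                rw [dt_cR]; have := hvz w hw
                have h7 : dt (z - w) v = dt v (w - z) := by simp [dt]; ring
                rw [h7]; exact_mod_cast this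
              have h8 : (0:ℝ) < (cR (z - w)).1 := by simp; exact_mod_cast hwz
              have h9 : 0 ≤ dt (cR (z - w)) a := by
                have : 0 ≤ dt (cR (z - w)) a * (cR v).1 := by
                  rw [h5]; exact add_nonneg (mul_nonneg h6 ha) (mul_nonneg hva.le h8.le)
                exact nonneg_of_mul_nonneg_left this hcv
              have : dt a (cR (w - z)) = dt (cR (z - w)) a := by simp [dt]; ring
              rw [this]; exact h9
            have : cR (w - VV z m a) = cR (w - z) + cR (z - VV z m a) := by rw [← cR_add]; congr 1; abel
            rw [this, dt_add_right]; linarith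
        · rw [if_neg hva, add_zero]
          push_neg at hva
          have e : VV p m a = p := by
            rw [VV, Finsupp.sum, Finset.sum_eq_zero, add_zero]
            intro u hu
            rw [if_neg]
            have h3 := plucker (cR u) (cR v) a
            have h4 : dt (cR u) (cR v) ≤ 0 := by
              rw [dt_cR]; have := hvu u hu; rw [dt_swap] at this; exact_mod_cast (by linarith)
            have h5 : (0:ℝ) < (cR u).1 := by simp; exact (hm1 u hu).1
            have h6 : dt (cR u) a * (cR v).1 ≤ 0 := by
              rw [h3]; exact add_nonpos (mul_nonpos_of_nonpos_of_nonneg h4 ha) (mul_nonpos_of_nonpos_of_nonneg hva h5.le)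
            intro h7
            exact absurd (mul_pos h7 hcv) (by linarith)
          rw [e]
          refine ⟨hp.1, fun w hw => ?_⟩
          have h3 := plucker a (cR v) (cR (w - p))
          have h4 : 0 ≤ dt a (cR v) := by rw [dt_swap]; linarith
          have h5 : 0 ≤ dt (cR v) (cR (w - p)) := by rw [dt_cR]; exact_mod_cast hslope w hw
          have h6 : (0:ℝ) ≤ (cR (w - p)).1 := by
            simp; rcases hp.2 w hw with h | h
            · exact_mod_cast h.le
            · exact_mod_cast h.1.le
          have : 0 ≤ dt a (cR (w - p)) * (cR v).1 := by
            rw [h3]; exact add_nonneg (mul_nonneg h4 h6) (mul_nonneg h5 ha)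
          exact nonneg_of_mul_nonneg_left this hcv
    · refine ⟨0, by intro v hv; simp at hv, by intro v hv; simp at hv, ?_⟩
      intro a ha
      have e : VV p 0 a = p := by simp [VV]
      rw [e]
      refine ⟨hp.1, fun w hw => ?_⟩
      rcases hp.2 w hw with h | h
      · exact absurd ⟨w, Finset.mem_filter.mpr ⟨hw, h⟩⟩ hG
      · simp only [dt, cR_fst, cR_snd, Prod.fst_sub, Prod.snd_sub, h.1, sub_self, Int.cast_zero, mul_zero, sub_zero]
        apply mul_nonneg ha
        exact_mod_cast (by linarith [h.2] : 0 ≤ w.2 - p.2)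

theorem exists_chain (F : Finset (ℤ × ℤ)) (hF : F.Nonempty) : ∃ p m, Chn m ∧ ChainOf F p m := by
  obtain ⟨p, hp, hmin⟩ := Finset.exists_min_image F (fun w => toLex w) hF
  have : LexMin F p := by
    refine ⟨hp, fun w hw => ?_⟩
    have := hmin w hw
    rw [Prod.Lex.le_iff] at this
    exact this
  obtain ⟨m, h1, _, h3⟩ := exists_chain_aux _ F p le_rfl this
  exact ⟨p, m, h1, h3⟩

end BL

end Part4

section Part5
set_option linter.all false
open scoped Classical

/-! ## Part 2b: sectors of chains -/
namespace BL
open Topology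

lemma sum_fst {ι} (s : Finset ι) (f : ι → ℤ × ℤ) : (∑ i ∈ s, f i).1 = ∑ i ∈ s, (f i).1 := Prod.fst_sum
lemma dt_sum_left {R : Type*} [CommRing R] {ι} (s : Finset ι) (u : R × R) (f : ι → R × R) : dt (∑ i ∈ s, f i) u = ∑ i ∈ s, dt (f i) u := by
  rw [dt_swap, dt_sum_right, ← Finset.sum_neg_distrib]
  exact Finset.sum_congr rfl fun i _ => (dt_swap _ _).symm

lemma dt_nsmul_left {R : Type*} [CommRing R] (k : ℕ) (u v : R × R) : dt (k • u) v = k * dt u v := by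
  simp [dt]; ring
lemma dt_nsmul_right {R : Type*} [CommRing R] (k : ℕ) (u v : R × R) : dt u (k • v) = k * dt u v := by
  simp [dt]; ring

lemma dt_cR_pos (u v : ℤ × ℤ) : 0 < dt (cR u) (cR v) ↔ 0 < dt u v := by
  rw [dt_cR]; exact_mod_cast Iff.rfl

lemma VV_eq (p : ℤ × ℤ) (m : ℤ × ℤ →₀ ℕ) (a : ℝ × ℝ) :
    VV p m a = p + ∑ v ∈ m.support.filter (fun v => 0 < dt (cR v) a), m v • v := by
  rw [VV, Finsupp.sum, Finset.sum_filter]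

lemma VV_diff (p : ℤ × ℤ) (m : ℤ × ℤ →₀ ℕ) (a b : ℝ × ℝ) (h : ∀ v ∈ m.support, 0 < dt (cR v) a → 0 < dt (cR v) b) :
    VV p m b - VV p m a = ∑ v ∈ m.support.filter (fun v => 0 < dt (cR v) b ∧ ¬ 0 < dt (cR v) a), m v • v := by
  have : m.support.filter (fun v => 0 < dt (cR v) b) = 
     m.support.filter (fun v => 0 < dt (cR v) b ∧ ¬ 0 < dt (cR v) a) ∪ m.support.filter (fun v => 0 < dt (cR v) a) := by
    ext v; simp only [Finset.mem_filter, Finset.mem_union]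
    constructor
    · rintro ⟨h1, h2⟩
      by_cases h3 : 0 < dt (cR v) a
      · right; exact ⟨h1, h3⟩
      · left; exact ⟨h1, h2, h3⟩
    · rintro (⟨h1, h2, h3⟩ | ⟨h1, h2⟩)
      · exact ⟨h1, h2⟩
      · exact ⟨h1, h v h1 h2⟩
  rw [VV_eq, VV_eq, this, Finset.sum_union]
  · abel
  · rw [Finset.disjoint_filter]
    rintro v hv ⟨_, h2⟩ h3; exact h2 h3

lemma VV_start (N : ℕ) (p : ℤ × ℤ) {m : ℤ × ℤ →₀ ℕ} (hm : Chn m) : VV p m (cR (fan N 0)) = p := by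
  rw [VV_eq, Finset.filter_false_of_mem, Finset.sum_empty, add_zero]
  intro v hv
  have := (hm v hv).1
  rw [dt_cR_pos, fan_zero]; simp [dt]; omega

lemma VV_end (N : ℕ) (p : ℤ × ℤ) {m : ℤ × ℤ →₀ ℕ} (hm : Chn m) : VV p m (cR (fan N (kf N))) = p + ∑ v ∈ m.support, m v • v := by
  rw [VV_eq, Finset.filter_true_of_mem]
  intro v hv
  have := (hm v hv).1
  rw [dt_cR_pos, fan_last]; simp [dt]; omega

/-- edge of the coarse chain -/
def EE (N i : ℕ) (m : ℤ × ℤ →₀ ℕ) : ℤ × ℤ := ∑ v ∈ m.support.filter (insec N i), m v • v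

lemma VV_succ {N i : ℕ} (hi : i < kf N) (p : ℤ × ℤ) {m : ℤ × ℤ →₀ ℕ} (hm : Chn m) :
    VV p m (cR (fan N (i+1))) - VV p m (cR (fan N i)) = EE N i m := by
  rw [VV_diff, EE]
  · congr 1
    apply Finset.filter_congr
    intro v hv
    rw [dt_cR_pos, dt_cR_pos, insec, dt_swap (fan N i) v]
    constructor
    · rintro ⟨h1, h2⟩; exact ⟨by omega, h1⟩
    · rintro ⟨h1, h2⟩; exact ⟨h2, by omega⟩
  · intro v hv h
    rw [dt_cR_pos] at h ⊢
    exact fan_step hi (hm v hv).1 h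

def osec (N i : ℕ) (v : ℤ × ℤ) : Prop := 0 < dt (fan N i) v ∧ 0 < dt v (fan N (i+1))
def cI (N i : ℕ) (v : ℤ × ℤ) : ℕ × ℕ := ((dt v (fan N (i+1))).toNat, (dt (fan N i) v).toNat)
def iI (N i : ℕ) (x : ℕ × ℕ) : ℤ × ℤ := (x.1 : ℤ) • fan N i + (x.2 : ℤ) • fan N (i+1)

lemma dt_iI_left {N i : ℕ} (hi : i < kf N) (x : ℕ × ℕ) : dt (iI N i x) (fan N (i+1)) = x.1 := by
  rw [iI, dt_add_left, dt_smul_left, dt_smul_left, dt_self, (fan_props N i hi).1]; ring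
lemma dt_iI_right {N i : ℕ} (hi : i < kf N) (x : ℕ × ℕ) : dt (fan N i) (iI N i x) = x.2 := by
  rw [iI, dt_add_right, dt_smul_right, dt_smul_right, dt_self, (fan_props N i hi).1]; ring

lemma cI_iI {N i : ℕ} (hi : i < kf N) (x : ℕ × ℕ) : cI N i (iI N i x) = x := by
  rw [cI, dt_iI_left hi, dt_iI_right hi]; simp

lemma iI_cI {N i : ℕ} (hi : i < kf N) {v : ℤ × ℤ} (h : osec N i v) : iI N i (cI N i v) = v := by
  rw [iI, cI]
  simp only
  rw [Int.toNat_of_nonneg h.2.le, Int.toNat_of_nonneg h.1.le]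
  exact (sec_coord hi v).symm

lemma osec_iI {N i : ℕ} (hi : i < kf N) {x : ℕ × ℕ} (hx : x ∈ PV) : osec N i (iI N i x) := by
  rw [osec, dt_iI_left hi, dt_iI_right hi]
  exact ⟨by exact_mod_cast hx.2.1, by exact_mod_cast hx.1⟩

lemma coprime_iI {N i : ℕ} (hi : i < kf N) {x : ℕ × ℕ} (hx : x ∈ PV) : IsCoprime (iI N i x).1 (iI N i x).2 := by
  obtain ⟨r, s, h⟩ := Nat.isCoprime_iff_coprime.mpr hx.2.2
  rw [← dt_iI_left hi x, ← dt_iI_right hi x] at h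
  simp only [dt] at h
  refine ⟨r * (fan N (i+1)).2 - s * (fan N i).2, s * (fan N i).1 - r * (fan N (i+1)).1, ?_⟩
  rw [← h]; ring

lemma osec_fst_pos {N i : ℕ} (hi : i < kf N) {v : ℤ × ℤ} (h : osec N i v) : 0 < v.1 := by
  have h0 := (fan_props N i hi)
  have := congrArg Prod.fst (sec_coord hi v)
  simp only [Prod.fst_add, Prod.smul_fst, smul_eq_mul] at this
  rw [this]
  rcases h0.2.1.eq_or_lt with h1 | h1
  · rcases h0.2.2.1.eq_or_lt with h2 | h2
    · have := h0.1; simp [dt, ← h1, ← h2] at this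
    · have := mul_pos h.1 h2; have := mul_nonneg h.2.le h0.2.1; omega
  · have := mul_pos h.2 h1; have := mul_nonneg h.1.le h0.2.2.1; omega

lemma cI_PV {N i : ℕ} (hi : i < kf N) {v : ℤ × ℤ} (h : osec N i v) (hc : IsCoprime v.1 v.2) : cI N i v ∈ PV := by
  refine ⟨?_, ?_, ?_⟩
  · simp [cI]; exact h.2
  · simp [cI]; exact h.1
  · rw [← Nat.isCoprime_iff_coprime]
    simp only [cI]
    rw [Int.toNat_of_nonneg h.2.le, Int.toNat_of_nonneg h.1.le]
    obtain ⟨r, s, h1⟩ := hc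
    have h2 := sec_coord hi v
    have e1 := congrArg Prod.fst h2
    have e2 := congrArg Prod.snd h2
    simp only [Prod.fst_add, Prod.smul_fst, Prod.snd_add, Prod.smul_snd, smul_eq_mul] at e1 e2
    refine ⟨r * (fan N i).1 + s * (fan N i).2, r * (fan N (i+1)).1 + s * (fan N (i+1)).2, ?_⟩
    calc _ = r * (dt v (fan N (i + 1)) * (fan N i).1 + dt (fan N i) v * (fan N (i + 1)).1) + s * (dt v (fan N (i + 1)) * (fan N i).2 + dt (fan N i) v * (fan N (i + 1)).2) := by ring
      _ = 1 := by rw [← e1, ← e2, h1]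

lemma insec_cases {N i : ℕ} (hi : i < kf N) {v : ℤ × ℤ} (hc : IsCoprime v.1 v.2) (h : insec N i v) : osec N i v ∨ v = fan N i := by
  rcases h.1.eq_or_lt with h0 | h0
  · right
    have h2 := sec_coord hi v
    rw [← h0, zero_smul, add_zero] at h2
    have e1 := congrArg Prod.fst h2
    have e2 := congrArg Prod.snd h2
    simp only [Prod.smul_fst, Prod.smul_snd, smul_eq_mul] at e1 e2
    have h3 : IsUnit (dt v (fan N (i+1))) := by
      apply hc.isUnit_of_dvd'
      · exact ⟨_, e1⟩
      · exact ⟨_, e2⟩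
    have h4 : dt v (fan N (i+1)) = 1 := by
      rcases Int.isUnit_iff.mp h3 with h5 | h5
      · exact h5
      · have := h.2; omega
    rw [h4, one_smul] at h2; exact h2
  · left; exact ⟨h0, h.2⟩

def mg (N i : ℕ) (m : ℤ × ℤ →₀ ℕ) : ℕ × ℕ →₀ ℕ := Finsupp.mapDomain (cI N i) (m.filter (osec N i))

lemma mg_supp {N i : ℕ} (hi : i < kf N) {m : ℤ × ℤ →₀ ℕ} (hm : Chn m) : ↑(mg N i m).support ⊆ PV := by
  intro x hx
  have := Finsupp.mapDomain_support hx
  rw [Finset.mem_image] at this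
  obtain ⟨v, hv, rfl⟩ := this
  rw [Finsupp.support_filter, Finset.mem_filter] at hv
  exact cI_PV hi hv.2 (hm v hv.1).2

lemma mapDomain_iI_mg {N i : ℕ} (hi : i < kf N) (m : ℤ × ℤ →₀ ℕ) : Finsupp.mapDomain (iI N i) (mg N i m) = m.filter (osec N i) := by
  rw [mg, ← Finsupp.mapDomain_comp]
  conv_rhs => rw [← Finsupp.mapDomain_id (v := m.filter (osec N i))]
  apply Finsupp.mapDomain_congr
  intro v hv
  rw [Finsupp.support_filter, Finset.mem_filter] at hv
  exact iI_cI hi hv.2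

lemma ms1_mg {N i : ℕ} (m : ℤ × ℤ →₀ ℕ) : 
    (ms1 (mg N i m) : ℤ) = ∑ v ∈ m.support.filter (osec N i), (m v : ℤ) * dt v (fan N (i+1)) := by
  rw [ms1, mg, Finsupp.sum_mapDomain_index (by simp) (by intro v a b; ring), Finsupp.sum, Finsupp.support_filter]
  push_cast
  apply Finset.sum_congr rfl
  intro v hv
  rw [Finset.mem_filter] at hv
  rw [Finsupp.filter_apply_pos _ _ hv.2, cI]
  simp only
  rw [Int.toNat_of_nonneg hv.2.2.le]

lemma ms2_mg {N i : ℕ} (m : ℤ × ℤ →₀ ℕ) : 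
    (ms2 (mg N i m) : ℤ) = ∑ v ∈ m.support.filter (osec N i), (m v : ℤ) * dt (fan N i) v := by
  rw [ms2, mg, Finsupp.sum_mapDomain_index (by simp) (by intro v a b; ring), Finsupp.sum, Finsupp.support_filter]
  push_cast
  apply Finset.sum_congr rfl
  intro v hv
  rw [Finset.mem_filter] at hv
  rw [Finsupp.filter_apply_pos _ _ hv.2, cI]
  simp only
  rw [Int.toNat_of_nonneg hv.2.1.le]

lemma insec_sum {N i : ℕ} (hi : i < kf N) {m : ℤ × ℤ →₀ ℕ} (hm : Chn m) (g : ℤ × ℤ → ℤ) :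
    ∑ v ∈ m.support.filter (insec N i), (m v : ℤ) * g v = 
     (∑ v ∈ m.support.filter (osec N i), (m v : ℤ) * g v) + m (fan N i) * g (fan N i) := by
  have h1 : m.support.filter (insec N i) = m.support.filter (osec N i) ∪ m.support.filter (· = fan N i) := by
    ext v
    simp only [Finset.mem_union, Finset.mem_filter]
    constructor
    · rintro ⟨h1, h2⟩
      rcases insec_cases hi (hm v h1).2 h2 with h | h
      · left; exact ⟨h1, h⟩
      · right; exact ⟨h1, h⟩
    · rintro (⟨h1, h2⟩ | ⟨h1, h2⟩)
      · exact ⟨h1, h2.1.le, h2.2⟩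
      · refine ⟨h1, ?_⟩
        rw [h2, insec, dt_self, (fan_props N i hi).1]; simp
  rw [h1, Finset.sum_union]
  · congr 1
    rw [Finset.filter_eq']
    split_ifs with h
    · simp
    · rw [Finsupp.notMem_support_iff] at h; simp [h]
  · rw [Finset.disjoint_filter]
    rintro v hv h2 rfl
    have := h2.1; rw [dt_self] at this; omega

lemma EE_alpha {N i : ℕ} (hi : i < kf N) {m : ℤ × ℤ →₀ ℕ} (hm : Chn m) :
    dt (EE N i m) (fan N (i+1)) = m (fan N i) + ms1 (mg N i m) := by
  rw [EE, dt_sum_left, ms1_mg]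
  simp only [dt_nsmul_left]
  rw [insec_sum hi hm (fun v => dt v (fan N (i+1))), (fan_props N i hi).1]; ring

lemma EE_beta {N i : ℕ} (hi : i < kf N) {m : ℤ × ℤ →₀ ℕ} (hm : Chn m) :
    dt (fan N i) (EE N i m) = ms2 (mg N i m) := by
  rw [EE, dt_sum_right, ms2_mg]
  simp only [dt_nsmul_right]
  rw [insec_sum hi hm (fun v => dt (fan N i) v), dt_self]; ring

lemma Chn_ext {N : ℕ} {m m' : ℤ × ℤ →₀ ℕ} (hm : Chn m) (hm' : Chn m') (h1 : ∀ i < kf N, mg N i m = mg N i m')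
    (h2 : ∀ i < kf N, m (fan N i) = m' (fan N i)) : m = m' := by
  have key : ∀ v : ℤ × ℤ, 0 < v.1 → IsCoprime v.1 v.2 → m v = m' v := by
    intro v hv hc
    obtain ⟨i, hi, hs⟩ := exists_sec N hv
    rcases insec_cases hi hc hs with h | h
    · have e := mapDomain_iI_mg hi m
      rw [h1 i hi, mapDomain_iI_mg hi m'] at e
      have := DFunLike.congr_fun e v
      rw [Finsupp.filter_apply_pos _ _ h, Finsupp.filter_apply_pos _ _ h] at this
      exact this.symm
    · rw [h]; exact h2 i hi
  ext v
  by_cases hv : 0 < v.1 ∧ IsCoprime v.1 v.2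
  · exact key v hv.1 hv.2
  · have e1 : m v = 0 := by
      by_contra h; exact hv (hm v (Finsupp.mem_support_iff.mpr h))
    have e2 : m' v = 0 := by
      by_contra h; exact hv (hm' v (Finsupp.mem_support_iff.mpr h))
    rw [e1, e2]

/-- sector membership for real vectors -/
lemma exists_secR (N : ℕ) {a : ℝ × ℝ} (hv : 0 < a.1) : ∃ i < kf N, 0 ≤ dt (cR (fan N i)) a ∧ 0 ≤ dt a (cR (fan N (i+1))) := by
  have hex : ∃ j, j ≤ kf N ∧ 0 < dt a (cR (fan N j)) := ⟨kf N, le_rfl, by rw [fan_last]; simp [dt, hv]⟩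
  have hspec := Nat.find_spec hex
  have hmin := @Nat.find_min _ _ hex
  set j := Nat.find hex
  have hj0 : j ≠ 0 := by
    intro h0; rw [h0, fan_zero] at hspec; simp [dt] at hspec; linarith
  obtain ⟨i, hi⟩ := Nat.exists_eq_succ_of_ne_zero hj0
  refine ⟨i, by omega, ?_, ?_⟩
  · have := hmin (m := i) (by omega)
    rw [dt_swap]
    by_contra hc
    exact this ⟨by omega, by linarith⟩
  · rw [show i + 1 = j by omega]; exact hspec.2.le

lemma VV_sector {N i : ℕ} (hi : i < kf N) (p : ℤ × ℤ) {m : ℤ × ℤ →₀ ℕ} (hm : Chn m) {a : ℝ × ℝ} (ha : 0 < a.1)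
    (h1 : 0 ≤ dt (cR (fan N i)) a) (h2 : 0 ≤ dt a (cR (fan N (i+1)))) :
    0 ≤ dt (VV p m a - VV p m (cR (fan N i))) (fan N (i+1)) ∧ 
    0 ≤ dt (fan N i) (VV p m a - VV p m (cR (fan N i))) ∧
    0 ≤ dt (VV p m (cR (fan N (i+1))) - VV p m a) (fan N (i+1)) ∧ 
    0 ≤ dt (fan N i) (VV p m (cR (fan N (i+1))) - VV p m a) := by
  have hp := fan_props N i hi
  have i1 : ∀ v ∈ m.support, 0 < dt (cR v) (cR (fan N i)) → 0 < dt (cR v) a := by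
    intro v hv h
    have hv1 : (0:ℝ) < (cR v).1 := by simp; exact (hm v hv).1
    have h3 := plucker (cR v) (cR (fan N i)) a
    rcases hp.2.1.eq_or_lt with h0 | h0
    · exfalso
      have : i = 0 := by by_contra hc; have := hp.2.2.2.2.2.2.2 (by omega); omega
      subst this
      rw [fan_zero] at h; simp [dt] at h; have := (hm v hv).1
      simp at hv1
      linarith
    · have h0' : (0:ℝ) < (cR (fan N i)).1 := by simp; exact h0
      have : 0 < dt (cR v) a * (cR (fan N i)).1 := by
        rw [h3]; exact add_pos_of_pos_of_nonneg (mul_pos h ha) (mul_nonneg h1 hv1.le)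
      exact pos_of_mul_pos_left this h0'.le
  have i2 : ∀ v ∈ m.support, 0 < dt (cR v) a → 0 < dt (cR v) (cR (fan N (i+1))) := by
    intro v hv h
    have hv1 : (0:ℝ) < (cR v).1 := by simp; exact (hm v hv).1
    have h3 := plucker (cR v) a (cR (fan N (i+1)))
    by_cases hk : i + 1 = kf N
    · rw [hk, fan_last]; simp [dt]; exact (hm v hv).1
    · have h0 := (fan_props N (i+1) (by omega)).2.2.2.2.2.2.2 (by omega)
      have h0' : (0:ℝ) < (cR (fan N (i+1))).1 := by simp; exact h0
      have : 0 < dt (cR v) (cR (fan N (i+1))) * a.1 := by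
        rw [h3]; exact add_pos_of_pos_of_nonneg (mul_pos h h0') (mul_nonneg h2 hv1.le)
      exact pos_of_mul_pos_left this ha.le
  have key : ∀ v ∈ m.support, 0 < dt (cR v) (cR (fan N (i+1))) → ¬ 0 < dt (cR v) (cR (fan N i)) → 
      0 ≤ dt v (fan N (i+1)) ∧ 0 ≤ dt (fan N i) v := by
    intro v hv h3 h4
    rw [dt_cR_pos] at h3 h4
    rw [dt_swap (fan N i)]
    exact ⟨h3.le, by omega⟩
  rw [VV_diff p m _ _ i1, VV_diff p m _ _ i2]
  simp only [dt_sum_left, dt_sum_right, dt_nsmul_left, dt_nsmul_right]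
  refine ⟨?_, ?_, ?_, ?_⟩ <;> apply Finset.sum_nonneg <;> intro v hv <;> rw [Finset.mem_filter] at hv <;>
    apply mul_nonneg (by positivity)
  · exact (key v hv.1 (i2 v hv.1 hv.2.1) hv.2.2).1
  · exact (key v hv.1 (i2 v hv.1 hv.2.1) hv.2.2).2
  · exact (key v hv.1 hv.2.1 (fun h => hv.2.2 (i1 v hv.1 h))).1
  · exact (key v hv.1 hv.2.1 (fun h => hv.2.2 (i1 v hv.1 h))).2

/-- converse: chain vertices are minimizers among themselves -/
lemma VV_min (p : ℤ × ℤ) (m : ℤ × ℤ →₀ ℕ) (a b : ℝ × ℝ) : 0 ≤ dt a (cR (VV p m b) - cR (VV p m a)) := by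
  rw [VV_eq, VV_eq, cR_add, cR_add, add_sub_add_left_eq_sub, cR_sum, cR_sum, dt_sub_right, dt_sum_right, dt_sum_right,
    Finset.sum_filter, Finset.sum_filter, ← Finset.sum_sub_distrib]
  apply Finset.sum_nonneg
  intro v hv
  rw [cR_nsmul, dt_smul_right, dt_swap a (cR v)]
  have : (0:ℝ) ≤ m v := by positivity
  split_ifs <;> nlinarith

end BL

end Part5

section Part6
set_option linter.all false
open scoped Classical

/-! ## Part 2c: upper count -/
namespace BL
open Topology

def rf {R : Type*} [CommRing R] (v : R × R) : R × R := (v.1, -v.2)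
@[simp] lemma rf_fst {R : Type*} [CommRing R] (v : R × R) : (rf v).1 = v.1 := rfl
@[simp] lemma rf_snd {R : Type*} [CommRing R] (v : R × R) : (rf v).2 = -v.2 := rfl
@[simp] lemma rf_rf {R : Type*} [CommRing R] (v : R × R) : rf (rf v) = v := by ext <;> simp
lemma rf_cR (v : ℤ × ℤ) : rf (cR v) = cR (rf v) := by ext <;> simp
lemma rf_smul (c : ℝ) (v : ℝ × ℝ) : rf (c • v) = c • rf v := by ext <;> simp
lemma rf_inj {R : Type*} [CommRing R] : Function.Injective (rf : R × R → R × R) := fun u v h => by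
  rw [← rf_rf u, h, rf_rf]

def LPn (n : ℕ) (K : Set (ℝ × ℝ)) : Set (Set (ℝ × ℝ)) :=
  {P | ∃ F : Finset (ℤ × ℤ), F.Nonempty ∧ P = convexHull ℝ (cR '' (F : Set (ℤ × ℤ))) ∧ ∀ w ∈ F, (1 / n : ℝ) • cR w ∈ K}

lemma hull_sub {F F' : Finset (ℤ × ℤ)} {p p' m m'} (h1 : ChainOf F p m) (h2 : ChainOf (F.image rf) p' m')
    (h1' : ChainOf F' p m) (h2' : ChainOf (F'.image rf) p' m') :
    convexHull ℝ (cR '' (F' : Set (ℤ × ℤ))) ⊆ convexHull ℝ (cR '' (F : Set (ℤ × ℤ))) := by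
  apply convexHull_min _ (convex_convexHull ℝ _)
  rintro _ ⟨w, hw, rfl⟩
  by_contra hc
  have hcl : IsClosed (convexHull ℝ (cR '' (F : Set (ℤ × ℤ)))) := 
    ((F.finite_toSet.image cR).isCompact_convexHull ℝ).isClosed
  obtain ⟨f, u, hf1, hf2⟩ := geometric_hahn_banach_closed_point (convex_convexHull ℝ _) hcl hc
  have hfe : ∀ z : ℝ × ℝ, f z = z.1 * f (1, 0) + z.2 * f (0, 1) := by
    intro z
    have : z = z.1 • ((1:ℝ), (0:ℝ)) + z.2 • ((0:ℝ), (1:ℝ)) := by ext <;> simp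
    conv_lhs => rw [this, map_add, map_smul, map_smul]
    simp
  have hF : ∀ w ∈ F, f (cR w) < u := fun w hw => hf1 _ (subset_convexHull ℝ _ ⟨w, hw, rfl⟩)
  have hw : w ∈ F' := by simpa using hw
  by_cases hv : 0 ≤ - f (0, 1)
  · obtain ⟨e1, _⟩ := h1 (-f (0,1), f (1,0)) hv
    obtain ⟨_, e2⟩ := h1' (-f (0,1), f (1,0)) hv
    have e3 := e2 w hw
    have e4 := hF _ e1
    rw [hfe] at e4 hf2
    simp only [dt, cR_sub, Prod.fst_sub, Prod.snd_sub] at e3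
    linarith
  · push_neg at hv
    have hv' : 0 ≤ f (0, 1) := by linarith
    obtain ⟨e1, _⟩ := h2 (f (0,1), f (1,0)) hv'
    obtain ⟨_, e2⟩ := h2' (f (0,1), f (1,0)) hv'
    have e3 := e2 (rf w) (Finset.mem_image_of_mem _ hw)
    rw [Finset.mem_image] at e1
    obtain ⟨z, hz, hz2⟩ := e1
    have e4 := hF z hz
    rw [← hz2] at e3
    rw [hfe] at e4 hf2
    simp only [dt, cR_sub, ← rf_cR, rf_fst, rf_snd, Prod.fst_sub, Prod.snd_sub] at e3
    linarith

/-! real data -/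
def al (N : ℕ) (p : ℕ → ℝ × ℝ) (i : ℕ) : ℝ := dt (p (i+1) - p i) (cR (fan N (i+1)))
def be (N : ℕ) (p : ℕ → ℝ × ℝ) (i : ℕ) : ℝ := dt (cR (fan N i)) (p (i+1) - p i)
def Dat (N : ℕ) (p : ℕ → ℝ × ℝ) : Prop := ∀ i < kf N, 0 ≤ al N p i ∧ 0 ≤ be N p i
def TT (N : ℕ) (p : ℕ → ℝ × ℝ) : ℝ := ∑ i ∈ Finset.range (kf N), cb (4 * (al N p i * be N p i))
def GoodPair (N : ℕ) (K : Set (ℝ × ℝ)) (p p' : ℕ → ℝ × ℝ) : Prop :=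
  Dat N p ∧ Dat N p' ∧ (∀ i ≤ kf N, p i ∈ K) ∧ (∀ i ≤ kf N, rf (p' i) ∈ K) ∧ (p 0).1 = (p' 0).1 ∧
  (p (kf N)).1 = (p' (kf N)).1 ∧ (p 0).2 ≤ -(p' 0).2 ∧ (p (kf N)).2 ≤ -(p' (kf N)).2

def dx {N : ℕ} (d : Fin (kf N + 1) → ℤ × ℤ) (i : ℕ) : ℤ × ℤ := if h : i < kf N + 1 then d ⟨i, h⟩ else 0

def aN (N : ℕ) (q : ℕ → ℤ × ℤ) (i : ℕ) : ℕ := (dt (q (i+1) - q i) (fan N (i+1))).toNat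
def bN (N : ℕ) (q : ℕ → ℤ × ℤ) (i : ℕ) : ℕ := (dt (fan N i) (q (i+1) - q i)).toNat

def CHd (N : ℕ) (q : ℕ → ℤ × ℤ) : Set (ℤ × ℤ →₀ ℕ) := {m | Chn m ∧ ∀ i ≤ kf N, VV (q 0) m (cR (fan N i)) = q i}

lemma CHd_edge {N : ℕ} {q : ℕ → ℤ × ℤ} {m} (h : m ∈ CHd N q) {i : ℕ} (hi : i < kf N) : q (i+1) - q i = EE N i m := by
  rw [← VV_succ hi (q 0) h.1, h.2 i hi.le, h.2 (i+1) hi]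

lemma CHd_aN {N : ℕ} {q : ℕ → ℤ × ℤ} {m} (h : m ∈ CHd N q) {i : ℕ} (hi : i < kf N) : aN N q i = m (fan N i) + ms1 (mg N i m) := by
  rw [aN, CHd_edge h hi, EE_alpha hi h.1]; omega
lemma CHd_bN {N : ℕ} {q : ℕ → ℤ × ℤ} {m} (h : m ∈ CHd N q) {i : ℕ} (hi : i < kf N) : bN N q i = ms2 (mg N i m) := by
  rw [bN, CHd_edge h hi, EE_beta hi h.1]; omega

lemma CHd_count (N : ℕ) (q : ℕ → ℤ × ℤ) : (CHd N q).Finite ∧ (CHd N q).ncard ≤ ∏ i ∈ Finset.range (kf N), cnt (aN N q i) (bN N q i) := by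
  set T : Finset (Fin (kf N) → (ℕ × ℕ →₀ ℕ)) := Fintype.piFinset (fun i : Fin (kf N) => (CS_finite (aN N q i) (bN N q i)).toFinset) with hT
  have hmap : ∀ m ∈ CHd N q, (fun i : Fin (kf N) => mg N i m) ∈ (T : Set (Fin (kf N) → (ℕ × ℕ →₀ ℕ))) := by
    intro m hm
    rw [Finset.mem_coe, hT, Fintype.mem_piFinset]
    intro i
    rw [Set.Finite.mem_toFinset]
    refine ⟨mg_supp i.2 hm.1, ?_, ?_⟩
    · rw [CHd_aN hm i.2]; omega
    · rw [CHd_bN hm i.2]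
  have hinj : Set.InjOn (fun m => (fun i : Fin (kf N) => mg N i m)) (CHd N q) := by
    intro m hm m' hm' h
    have h1 : ∀ i < kf N, mg N i m = mg N i m' := fun i hi => congrFun h ⟨i, hi⟩
    refine Chn_ext hm.1 hm'.1 h1 fun i hi => ?_
    have e1 := CHd_aN hm hi
    have e2 := CHd_aN hm' hi
    rw [h1 i hi] at e1; omega
  refine ⟨Set.Finite.of_injOn hmap hinj T.finite_toSet, ?_⟩
  have := Set.ncard_le_ncard_of_injOn _ hmap hinj T.finite_toSet
  rw [Set.ncard_coe_finset, hT, Fintype.card_piFinset] at this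
  refine this.trans (le_of_eq ?_)
  rw [Finset.prod_range]
  apply Finset.prod_congr rfl
  intro i _
  rw [cnt, Set.ncard_eq_toFinset_card _ (CS_finite _ _)]

end BL

end Part6

section Part7
set_option linter.all false
open scoped Classical

namespace BL
open Topology

lemma VV_inf (p : ℤ × ℤ) {m : ℤ × ℤ →₀ ℕ} (hm : Chn m) : ∃ t : ℝ, VV p m (1, -t) = p ∧ VV p m (1, t) = p + ∑ v ∈ m.support, m v • v := by
  have hb : ∀ v ∈ m.support, |(v.2 : ℝ)| ≤ ∑ v ∈ m.support, |(v.2 : ℝ)| := fun v hv =>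
    Finset.single_le_sum (f := fun v : ℤ × ℤ => |(v.2:ℝ)|) (fun _ _ => abs_nonneg _) hv
  have hS : 0 ≤ ∑ v ∈ m.support, |(v.2 : ℝ)| := Finset.sum_nonneg fun _ _ => abs_nonneg _
  refine ⟨(∑ v ∈ m.support, |(v.2 : ℝ)|) + 1, ?_, ?_⟩
  · rw [VV_eq, Finset.filter_false_of_mem, Finset.sum_empty, add_zero]
    intro v hv
    have h1 := (hm v hv).1
    have h1' : (1:ℝ) ≤ v.1 := by exact_mod_cast h1
    have := hb v hv
    have := neg_abs_le (v.2:ℝ)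
    simp [dt]; nlinarith
  · rw [VV_eq, Finset.filter_true_of_mem]
    intro v hv
    have h1 := (hm v hv).1
    have h1' : (1:ℝ) ≤ v.1 := by exact_mod_cast h1
    have := hb v hv
    have := le_abs_self (v.2:ℝ)
    simp [dt]; nlinarith

lemma chain_ends {F : Finset (ℤ × ℤ)} {p m p' m'} (h1 : ChainOf F p m) (h2 : ChainOf (F.image rf) p' m') (hm : Chn m) (hm' : Chn m') :
    p.1 ≤ p'.1 ∧ (p + ∑ v ∈ m.support, m v • v).1 ≥ (p' + ∑ v ∈ m'.support, m' v • v).1 ∧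
    (p.1 = p'.1 → p.2 ≤ -p'.2) ∧ 
    ((p + ∑ v ∈ m.support, m v • v).1 = (p' + ∑ v ∈ m'.support, m' v • v).1 → 
      (p + ∑ v ∈ m.support, m v • v).2 ≤ - (p' + ∑ v ∈ m'.support, m' v • v).2) := by
  have b1 := h1 (cR (fan 0 0)) (by rw [fan_zero]; simp)
  have b2 := h1 (cR (fan 0 (kf 0))) (by rw [fan_last]; simp)
  rw [VV_start 0 p hm] at b1
  rw [VV_end 0 p hm] at b2
  obtain ⟨t, ht1, ht2⟩ := VV_inf p hm
  obtain ⟨t', ht1', ht2'⟩ := VV_inf p' hm'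
  have c1 := h1 (1, -t) (by simp)
  have c2 := h1 (1, t) (by simp)
  have c1' := (h2 (1, -t') (by simp)).1
  have c2' := (h2 (1, t') (by simp)).1
  rw [ht1] at c1; rw [ht2] at c2
  rw [ht1'] at c1'; rw [ht2'] at c2'
  rw [Finset.mem_image] at c1' c2'
  obtain ⟨z, hz, rfl⟩ := c1'
  obtain ⟨z', hz', hz''⟩ := c2'
  rw [← hz'']
  have d1 := b1.2 z hz
  have d2 := b2.2 z' hz'
  have d3 := c1.2 z hz
  have d4 := c2.2 z' hz'
  rw [fan_zero] at d1; rw [fan_last] at d2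
  obtain ⟨R, hR⟩ : ∃ R, R = p + ∑ v ∈ m.support, m v • v := ⟨_, rfl⟩
  rw [← hR] at d2 d4 ⊢
  simp [dt] at d1 d2 d3 d4 ⊢
  refine ⟨by exact_mod_cast d1, by exact_mod_cast d2, fun h => ?_, fun h => ?_⟩
  · rw [h] at d3; simp at d3; exact_mod_cast d3
  · rw [h] at d4; simp at d4; exact_mod_cast d4

def sc (n : ℕ) (q : ℕ → ℤ × ℤ) (i : ℕ) : ℝ × ℝ := (1 / n : ℝ) • cR (q i)

lemma al_sc (N n q i) : al N (sc n q) i = (1 / n : ℝ) * (dt (q (i+1) - q i) (fan N (i+1)) : ℤ) := by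
  rw [al, sc, sc, ← smul_sub, dt_smul_left, ← cR_sub, dt_cR]
lemma be_sc (N n q i) : be N (sc n q) i = (1 / n : ℝ) * (dt (fan N i) (q (i+1) - q i) : ℤ) := by
  rw [be, sc, sc, ← smul_sub, dt_smul_right, ← cR_sub, dt_cR]

lemma CHd_dat {N n : ℕ} {q m} (h : m ∈ CHd N q) : Dat N (sc n q) := by
  intro i hi
  rw [al_sc, be_sc, CHd_edge h hi, EE_alpha hi h.1, EE_beta hi h.1]
  constructor <;> positivity

lemma chain_good (N : ℕ) {n : ℕ} {K : Set (ℝ × ℝ)} {F : Finset (ℤ × ℤ)} {p m p' m'} (h1 : ChainOf F p m) (h2 : ChainOf (F.image rf) p' m') (hm : Chn m) (hm' : Chn m')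
    (hK : ∀ w ∈ F, (1 / n : ℝ) • cR w ∈ K) {q q' : ℕ → ℤ × ℤ} (hq : ∀ i ≤ kf N, q i = VV p m (cR (fan N i))) 
    (hq' : ∀ i ≤ kf N, q' i = VV p' m' (cR (fan N i))) : 
    m ∈ CHd N q ∧ m' ∈ CHd N q' ∧ GoodPair N K (sc n q) (sc n q') := by
  have e0 : q 0 = p := by rw [hq 0 (by omega), VV_start N p hm]
  have e0' : q' 0 = p' := by rw [hq' 0 (by omega), VV_start N p' hm']
  have c1 : m ∈ CHd N q := ⟨hm, fun i hi => by rw [e0, hq i hi]⟩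
  have c2 : m' ∈ CHd N q' := ⟨hm', fun i hi => by rw [e0', hq' i hi]⟩
  have ek : q (kf N) = p + ∑ v ∈ m.support, m v • v := by rw [hq _ le_rfl, VV_end N p hm]
  have ek' : q' (kf N) = p' + ∑ v ∈ m'.support, m' v • v := by rw [hq' _ le_rfl, VV_end N p' hm']
  obtain ⟨x1, x2, x3, x4⟩ := chain_ends h1 h2 hm hm'
  obtain ⟨y1, y2, y3, y4⟩ := chain_ends (F := F.image rf) h2 (p' := p) (m' := m) (by
    rw [Finset.image_image]; convert h1; simp [Function.comp_def]) hm' hm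
  have fx : ∀ i ≤ kf N, 0 ≤ (cR (fan N i)).1 := by
    intro i hi
    rcases hi.eq_or_lt with h | h
    · rw [h, fan_last]; simp
    · simp; exact (fan_props N i h).2.1
  rw [← ek, ← ek'] at x2 x4 
  rw [← e0, ← e0'] at x3 x1 
  rw [← ek, ← ek'] at y2 y4 
  rw [← e0, ← e0'] at y3 y1 
  have z1 := le_antisymm x1 y1
  have z2 := le_antisymm y2 x2
  have hn : (0:ℝ) ≤ 1 / n := by positivity
  refine ⟨c1, c2, CHd_dat c1, CHd_dat c2, ?_, ?_, ?_, ?_, ?_, ?_⟩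
  · intro i hi
    rw [sc, hq i hi]; exact hK _ (h1 _ (fx i hi)).1
  · intro i hi
    rw [sc, hq' i hi, rf_smul, rf_cR]
    have := (h2 _ (fx i hi)).1
    rw [Finset.mem_image] at this
    obtain ⟨z, hz, hz'⟩ := this
    rw [← hz', rf_rf]; exact hK _ hz
  · simp [sc, z1]
  · simp [sc, z2]
  · have : ((q 0).2 : ℝ) ≤ -(q' 0).2 := by exact_mod_cast x3 z1
    simp only [sc, Prod.smul_snd, smul_eq_mul, cR_snd]; nlinarith
  · have : ((q (kf N)).2 : ℝ) ≤ -(q' (kf N)).2 := by exact_mod_cast x4 z2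
    simp only [sc, Prod.smul_snd, smul_eq_mul, cR_snd]; nlinarith

lemma dx_mk {N : ℕ} (g : ℕ → ℤ × ℤ) : ∀ i ≤ kf N, dx (fun j : Fin (kf N + 1) => g j) i = g i := by
  intro i hi
  rw [dx, dif_pos (by omega)]

def bx (M : ℤ) : Finset (ℤ × ℤ) := Finset.Icc (-M) M ×ˢ Finset.Icc (-M) M

lemma bx_card {M : ℤ} (hM : 0 ≤ M) : ((bx M).card : ℝ) = (2 * M + 1) ^ 2 := by
  rw [bx, Finset.card_product, Int.card_Icc]
  have : ((M + 1 - -M).toNat : ℝ) = 2 * M + 1 := by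
    have h : ((M + 1 - -M).toNat : ℤ) = 2 * M + 1 := by rw [Int.toNat_of_nonneg (by omega)]; ring
    exact_mod_cast h
  push_cast
  rw [this]; ring

lemma mem_bx {R : ℝ} {n : ℕ} (hn : 0 < n) {w : ℤ × ℤ} (h : |((1 / n : ℝ) • cR w).1| ≤ R ∧ |((1 / n : ℝ) • cR w).2| ≤ R) :
    w ∈ bx ⌊R * n⌋ := by
  have hn' : (0:ℝ) < n := by exact_mod_cast hn
  have key : ∀ x : ℤ, |(1 / n : ℝ) * x| ≤ R → x ∈ Finset.Icc (-⌊R * n⌋) ⌊R * n⌋ := by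
    intro x hx
    rw [abs_mul, abs_of_pos (by positivity), one_div, inv_mul_le_iff₀ hn'] at hx
    rw [Finset.mem_Icc, ← abs_le, Int.le_floor]
    push_cast; linarith
  rw [bx, Finset.mem_product]
  exact ⟨key _ (by simpa using h.1), key _ (by simpa using h.2)⟩

theorem LPn_count (N : ℕ) {n : ℕ} (hn : 0 < n) {K : Set (ℝ × ℝ)} {R : ℝ} (hR : ∀ z ∈ K, |z.1| ≤ R ∧ |z.2| ≤ R) (X : ℕ)
    (hX : ∀ q q' : ℕ → ℤ × ℤ, GoodPair N K (sc n q) (sc n q') → 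
      (∏ i ∈ Finset.range (kf N), cnt (aN N q i) (bN N q i)) * (∏ i ∈ Finset.range (kf N), cnt (aN N q' i) (bN N q' i)) ≤ X) :
    (LPn n K).Finite ∧ (LPn n K).ncard ≤ (bx ⌊R * n⌋).card ^ (2 * (kf N + 1)) * X := by
  have hex : ∀ P : Set (ℝ × ℝ), ∃ x : (ℤ × ℤ) × (ℤ × ℤ →₀ ℕ) × (ℤ × ℤ) × (ℤ × ℤ →₀ ℕ), P ∈ LPn n K → 
      ∃ F : Finset (ℤ × ℤ), P = convexHull ℝ (cR '' (F : Set (ℤ × ℤ))) ∧ (∀ w ∈ F, (1 / n : ℝ) • cR w ∈ K) ∧ 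
       ChainOf F x.1 x.2.1 ∧ ChainOf (F.image rf) x.2.2.1 x.2.2.2 ∧ Chn x.2.1 ∧ Chn x.2.2.2 := by
    intro P
    by_cases hP : P ∈ LPn n K
    · obtain ⟨F, hF, h1, h2⟩ := hP
      obtain ⟨p, m, hm, hc⟩ := exists_chain F hF
      obtain ⟨p', m', hm', hc'⟩ := exists_chain (F.image rf) (hF.image _)
      exact ⟨(p, m, p', m'), fun _ => ⟨F, h1, h2, hc, hc', hm, hm'⟩⟩
    · exact ⟨(0,0,0,0), fun h => absurd h hP⟩
  choose x hx using hex
  let q : Set (ℝ × ℝ) → ℕ → ℤ × ℤ := fun P i => VV (x P).1 (x P).2.1 (cR (fan N i))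
  let q' : Set (ℝ × ℝ) → ℕ → ℤ × ℤ := fun P i => VV (x P).2.2.1 (x P).2.2.2 (cR (fan N i))
  let Φ : Set (ℝ × ℝ) → ((Fin (kf N + 1) → ℤ × ℤ) × (Fin (kf N + 1) → ℤ × ℤ)) × ((ℤ × ℤ →₀ ℕ) × (ℤ × ℤ →₀ ℕ)) :=
    fun P => ((fun j => q P j, fun j => q' P j), ((x P).2.1, (x P).2.2.2))
  let D0 : Finset (Fin (kf N + 1) → ℤ × ℤ) := Fintype.piFinset (fun _ => bx ⌊R * n⌋)
  let D := (D0 ×ˢ D0).filter (fun d => GoodPair N K (sc n (dx d.1)) (sc n (dx d.2)))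
  let T := D.biUnion (fun d => {d} ×ˢ ((CHd_count N (dx d.1)).1.toFinset ×ˢ (CHd_count N (dx d.2)).1.toFinset))
  have hmap : ∀ P ∈ LPn n K, Φ P ∈ (T : Set _) := by
    intro P hP
    obtain ⟨F, h1, h2, h3, h4, h5, h6⟩ := hx P hP
    obtain ⟨g1, g2, g3⟩ := chain_good N h3 h4 h5 h6 h2 (dx_mk (q P)) (dx_mk (q' P))
    obtain ⟨g1', g2', g3'⟩ := chain_good N (q := q P) (q' := q' P) h3 h4 h5 h6 h2 (fun _ _ => rfl) (fun _ _ => rfl)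
    rw [Finset.mem_coe, Finset.mem_biUnion]
    refine ⟨(Φ P).1, ?_, ?_⟩
    · rw [Finset.mem_filter, Finset.mem_product]
      refine ⟨⟨?_, ?_⟩, g3⟩
      · rw [Fintype.mem_piFinset]
        intro j
        exact mem_bx hn (hR _ (g3'.2.2.1 j (by omega)))
      · rw [Fintype.mem_piFinset]
        intro j
        have := hR _ (g3'.2.2.2.1 j (by omega))
        rw [rf_fst, rf_snd, abs_neg] at this
        exact mem_bx hn this
    · rw [Finset.mem_product, Finset.mem_product]
      refine ⟨Finset.mem_singleton_self _, ?_, ?_⟩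
      · rw [Set.Finite.mem_toFinset]; exact g1
      · rw [Set.Finite.mem_toFinset]; exact g2
  have hinj : Set.InjOn Φ (LPn n K) := by
    intro P hP P' hP' h
    obtain ⟨F, h1, h2, h3, h4, h5, h6⟩ := hx P hP
    obtain ⟨F', h1', h2', h3', h4', h5', h6'⟩ := hx P' hP'
    have e1 : (x P).2.1 = (x P').2.1 := congrArg (fun y => y.2.1) h
    have e2 : (x P).2.2.2 = (x P').2.2.2 := congrArg (fun y => y.2.2) h
    have e3 : (x P).1 = (x P').1 := by
      have : q P 0 = q P' 0 := congrArg (fun y => y.1.1 0) h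
      simp only [q] at this
      rwa [VV_start N _ h5, VV_start N _ h5'] at this
    have e4 : (x P).2.2.1 = (x P').2.2.1 := by
      have : q' P 0 = q' P' 0 := congrArg (fun y => y.1.2 0) h
      simp only [q'] at this
      rwa [VV_start N _ h6, VV_start N _ h6'] at this
    rw [← e1, ← e3] at h3'
    rw [← e2, ← e4] at h4'
    rw [h1, h1']
    exact Subset.antisymm (hull_sub h3' h4' h3 h4) (hull_sub h3 h4 h3' h4')
  refine ⟨Set.Finite.of_injOn hmap hinj T.finite_toSet, ?_⟩
  have h1 := Set.ncard_le_ncard_of_injOn _ hmap hinj T.finite_toSet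
  rw [Set.ncard_coe_finset] at h1
  refine h1.trans ?_
  have h2 : T.card ≤ D.card * X := by
    apply Finset.card_biUnion_le_card_mul
    intro d hd
    rw [Finset.card_product, Finset.card_singleton, one_mul, Finset.card_product]
    rw [← Set.ncard_eq_toFinset_card _ (CHd_count N (dx d.1)).1, ← Set.ncard_eq_toFinset_card _ (CHd_count N (dx d.2)).1]
    exact (Nat.mul_le_mul (CHd_count N (dx d.1)).2 (CHd_count N (dx d.2)).2).trans (hX _ _ (Finset.mem_filter.mp hd).2)
  refine h2.trans (Nat.mul_le_mul_right _ ?_)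
  refine (Finset.card_filter_le _ _).trans ?_
  rw [Finset.card_product, Fintype.card_piFinset, Finset.prod_const, Finset.card_univ, Fintype.card_fin, ← pow_add]
  exact le_of_eq (by congr 1; ring)

end BL

end Part7

section Part8
set_option linter.all false
open scoped Classical

namespace BL
open Topology

def fanW (N : ℕ) : ℝ := 1 + ∑ i ∈ Finset.range (kf N + 1), (|((fan N i).1 : ℝ)| + |((fan N i).2 : ℝ)|)
lemma fanW_ge (N : ℕ) {i : ℕ} (hi : i ≤ kf N) : |((fan N i).1 : ℝ)| + |((fan N i).2 : ℝ)| ≤ fanW N := by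
  have := Finset.single_le_sum (f := fun i => (|((fan N i).1 : ℝ)| + |((fan N i).2 : ℝ)|)) (s := Finset.range (kf N + 1)) (fun _ _ => by positivity) 
    (Finset.mem_range.mpr (Nat.lt_succ_of_le hi))
  rw [fanW]; linarith
lemma fanW_pos (N : ℕ) : 1 ≤ fanW N := by
  rw [fanW]; have : 0 ≤ ∑ i ∈ Finset.range (kf N + 1), (|((fan N i).1 : ℝ)| + |((fan N i).2 : ℝ)|) := Finset.sum_nonneg fun _ _ => by positivity
  linarith

lemma dt_le_bound {u v : ℝ × ℝ} {R W : ℝ} (h1 : |u.1| ≤ R) (h2 : |u.2| ≤ R) (hW : |v.1| + |v.2| ≤ W) : |dt u v| ≤ R * W := by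
  have hR : 0 ≤ R := (abs_nonneg _).trans h1
  calc |dt u v| ≤ |u.1 * v.2| + |u.2 * v.1| := by rw [dt]; exact abs_sub _ _
    _ = |u.1| * |v.2| + |u.2| * |v.1| := by rw [abs_mul, abs_mul]
    _ ≤ R * |v.2| + R * |v.1| := by gcongr
    _ = R * (|v.1| + |v.2|) := by ring
    _ ≤ R * W := by gcongr

lemma log_small (A C ε : ℝ) (hA : 0 < A) (hε : 0 < ε) : ∀ᶠ n : ℕ in atTop, C * Real.log (A * n) ≤ ε * cb n ^ 2 := by
  have h1 : Tendsto (fun n : ℕ => C * Real.log (A * n) / (n:ℝ) ^ ((2:ℝ)/3)) atTop (𝓝 0) := by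
    have h2 : Tendsto (fun n : ℕ => Real.log n / (n:ℝ) ^ ((2:ℝ)/3)) atTop (𝓝 0) := 
      ((isLittleO_log_rpow_atTop (by norm_num : (0:ℝ) < 2/3)).tendsto_div_nhds_zero).comp tendsto_natCast_atTop_atTop
    have h3 : Tendsto (fun n : ℕ => Real.log A / (n:ℝ) ^ ((2:ℝ)/3)) atTop (𝓝 0) := 
      tendsto_const_nhds.div_atTop ((tendsto_rpow_atTop (by norm_num)).comp tendsto_natCast_atTop_atTop)
    have := (h2.add h3).const_mul C
    rw [add_zero, mul_zero] at this
    refine this.congr' ?_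
    filter_upwards [eventually_gt_atTop 0] with n hn
    rw [Real.log_mul hA.ne' (by positivity)]
    ring
  filter_upwards [h1.eventually (gt_mem_nhds hε), eventually_gt_atTop 0] with n hn hn0
  have hp : (0:ℝ) < (n:ℝ) ^ ((2:ℝ)/3) := Real.rpow_pos_of_pos (by exact_mod_cast hn0) _
  rw [div_lt_iff₀ hp] at hn
  rw [← rpow23 (by positivity)]
  exact hn.le

theorem upper_U (N : ℕ) {K : Set (ℝ × ℝ)} {R : ℝ} (hR0 : 0 < R) (hR : ∀ z ∈ K, |z.1| ≤ R ∧ |z.2| ≤ R) {T : ℝ} (hT0 : 0 ≤ T)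
    (hT : ∀ p p', GoodPair N K p p' → TT N p + TT N p' ≤ T) {ε : ℝ} (hε : 0 < ε) :
    ∀ᶠ n : ℕ in atTop, (LPn n K).Finite ∧ Real.log ((LPn n K).ncard) ≤ (3 * cb (kap / 4) * T + ε) * cb n ^ 2 := by
  have hW := fanW_pos N
  have hk : (0:ℝ) < kf N := by exact_mod_cast kf_pos N
  obtain ⟨ε', hε'⟩ : ∃ ε', ε' = ε / 2 / (2 * kf N) := ⟨_, rfl⟩
  have hε'0 : 0 < ε' := by rw [hε']; positivity
  filter_upwards [eventually_gt_atTop 0, cnt_asymp_upper (2 * R * fanW N) ε' (by positivity) hε'0, 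
    log_small (2 * R + 1) (4 * (kf N + 1)) (ε / 2) (by positivity) (by positivity)] with n hn hcnt hlog
  have hn' : (0:ℝ) < n := by exact_mod_cast hn
  have hn1 : (1:ℝ) ≤ n := by exact_mod_cast hn
  have hcbn : cb n ^ 3 = n := cb_cube hn'.le
  -- one side
  have side : ∀ q : ℕ → ℤ × ℤ, Dat N (sc n q) → (∀ i ≤ kf N, |(sc n q i).1| ≤ R ∧ |(sc n q i).2| ≤ R) → 
      Real.log (∏ i ∈ Finset.range (kf N), (cnt (aN N q i) (bN N q i) : ℝ)) ≤ 3 * cb (kap / 4) * TT N (sc n q) * cb n ^ 2 + kf N * ε' * cb n ^ 2 := by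
    intro q hd hb
    rw [Real.log_prod (fun i _ => by have := cnt_pos (aN N q i) (bN N q i); positivity), TT, Finset.mul_sum, Finset.sum_mul]
    have : (kf N : ℝ) * ε' * cb n ^ 2 = ∑ i ∈ Finset.range (kf N), ε' * cb n ^ 2 := by
      rw [Finset.sum_const, Finset.card_range]; simp; ring
    rw [this, ← Finset.sum_add_distrib]
    apply Finset.sum_le_sum
    intro i hi
    rw [Finset.mem_range] at hi
    obtain ⟨d1, d2⟩ := hd i hi
    have a1 : (aN N q i : ℝ) = n * al N (sc n q) i := by
      rw [al_sc] at d1 ⊢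
      have h0 : (0:ℝ) ≤ (dt (q (i+1) - q i) (fan N (i+1)) : ℤ) := by
        by_contra hc; push_neg at hc
        have := mul_neg_of_pos_of_neg (show (0:ℝ) < 1 / n by positivity) hc
        linarith
      have h0' : (0:ℤ) ≤ dt (q (i+1) - q i) (fan N (i+1)) := by exact_mod_cast h0
      have : (aN N q i : ℤ) = dt (q (i+1) - q i) (fan N (i+1)) := by rw [aN, Int.toNat_of_nonneg h0']
      rw [← this]; push_cast; field_simp
    have b1 : (bN N q i : ℝ) = n * be N (sc n q) i := by
      rw [be_sc] at d2 ⊢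
      have h0 : (0:ℝ) ≤ (dt (fan N i) (q (i+1) - q i) : ℤ) := by
        by_contra hc; push_neg at hc
        have := mul_neg_of_pos_of_neg (show (0:ℝ) < 1 / n by positivity) hc
        linarith
      have h0' : (0:ℤ) ≤ dt (fan N i) (q (i+1) - q i) := by exact_mod_cast h0
      have : (bN N q i : ℤ) = dt (fan N i) (q (i+1) - q i) := by rw [bN, Int.toNat_of_nonneg h0']
      rw [← this]; push_cast; field_simp
    have hd1 : |(sc n q (i+1) - sc n q i).1| ≤ 2 * R := by
      rw [Prod.fst_sub]; refine (abs_sub _ _).trans ?_; linarith [(hb i hi.le).1, (hb (i+1) hi).1]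
    have hd2 : |(sc n q (i+1) - sc n q i).2| ≤ 2 * R := by
      rw [Prod.snd_sub]; refine (abs_sub _ _).trans ?_; linarith [(hb i hi.le).2, (hb (i+1) hi).2]
    have a2 : al N (sc n q) i ≤ 2 * R * fanW N := 
      (le_abs_self _).trans (dt_le_bound hd1 hd2 (fanW_ge N hi))
    have b2 : be N (sc n q) i ≤ 2 * R * fanW N := by
      rw [be, dt_swap]
      exact (neg_le_abs _).trans (dt_le_bound hd1 hd2 (fanW_ge N hi.le))
    have := hcnt (aN N q i) (bN N q i) (by rw [a1, mul_comm]; gcongr) (by rw [b1, mul_comm]; gcongr)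
    refine this.trans (le_of_eq ?_)
    rw [a1, b1]
    have e : kap * (n * al N (sc n q) i * (n * be N (sc n q) i)) = (kap / 4) * ((4 * (al N (sc n q) i * be N (sc n q) i)) * (n * n)) := by ring
    have hkp := kap_pos
    rw [e, cb_mul (by positivity) (by positivity), cb_mul (by positivity) (by positivity), cb_mul hn'.le hn'.le]
    ring
  obtain ⟨Y, hY⟩ : ∃ Y, Y = (3 * cb (kap / 4) * T + ε / 2) * cb n ^ 2 := ⟨_, rfl⟩
  have hc0 : 0 ≤ cb (kap / 4) := cb_nonneg (by have := kap_pos; positivity)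
  have hY0 : 0 ≤ Y := by rw [hY]; positivity
  have hX : ∀ q q' : ℕ → ℤ × ℤ, GoodPair N K (sc n q) (sc n q') → 
      (∏ i ∈ Finset.range (kf N), cnt (aN N q i) (bN N q i)) * (∏ i ∈ Finset.range (kf N), cnt (aN N q' i) (bN N q' i)) ≤ ⌊Real.exp Y⌋₊ := by
    intro q q' hg
    apply Nat.le_floor
    push_cast
    have p1 : (0:ℝ) < (∏ i ∈ Finset.range (kf N), (cnt (aN N q i) (bN N q i) : ℝ)) := Finset.prod_pos fun i _ => by have := cnt_pos (aN N q i) (bN N q i); positivity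
    have p2 : (0:ℝ) < (∏ i ∈ Finset.range (kf N), (cnt (aN N q' i) (bN N q' i) : ℝ)) := Finset.prod_pos fun i _ => by have := cnt_pos (aN N q' i) (bN N q' i); positivity
    rw [← Real.log_le_iff_le_exp (by positivity), Real.log_mul p1.ne' p2.ne']
    have s1 := side q hg.1 (fun i hi => hR _ (hg.2.2.1 i hi))
    have s2 := side q' hg.2.1 (fun i hi => by have := hR _ (hg.2.2.2.1 i hi); rwa [rf_fst, rf_snd, abs_neg] at this)
    have s3 := hT _ _ hg
    have s4 : kf N * ε' = ε / 4 := by rw [hε']; field_simp; ring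
    rw [s4] at s1 s2
    have s5 : 3 * cb (kap / 4) * (TT N (sc n q) + TT N (sc n q')) * cb n ^ 2 ≤ 3 * cb (kap / 4) * T * cb n ^ 2 := by gcongr
    rw [hY]; linarith
  obtain ⟨hfin, hle⟩ := LPn_count N hn hR _ hX
  refine ⟨hfin, ?_⟩
  have hfl : (0:ℤ) ≤ ⌊R * n⌋ := Int.floor_nonneg.mpr (by positivity)
  rcases Nat.eq_zero_or_pos (LPn n K).ncard with h0 | h0
  · rw [h0]; simp; positivity
  have h1 : ((LPn n K).ncard : ℝ) ≤ ((2 * R + 1) * n) ^ (4 * (kf N + 1)) * Real.exp Y := by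
    calc ((LPn n K).ncard : ℝ) ≤ ((bx ⌊R * n⌋).card : ℝ) ^ (2 * (kf N + 1)) * (⌊Real.exp Y⌋₊ : ℝ) := by exact_mod_cast hle
      _ ≤ (((2 * R + 1) * n) ^ 2) ^ (2 * (kf N + 1)) * Real.exp Y := by
        gcongr
        · rw [bx_card hfl]
          have : (⌊R * n⌋ : ℝ) ≤ R * n := Int.floor_le _
          have : (0:ℝ) ≤ (⌊R * n⌋ : ℝ) := by exact_mod_cast hfl
          gcongr
          linarith
        · exact Nat.floor_le (Real.exp_pos _).le
      _ = _ := by rw [← pow_mul]; congr 2; ring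
  have h2 := Real.log_le_log (by exact_mod_cast h0) h1
  rw [Real.log_mul (by positivity) (by positivity), Real.log_exp, Real.log_pow] at h2
  push_cast at h2
  rw [hY] at h2
  linarith

end BL

end Part8

section Part9
set_option linter.all false
open scoped Classical

/-! ## Part 2d: lower count, polygons from chains -/
namespace BL
open Topology

def HH (p : ℤ × ℤ) (m : ℤ × ℤ →₀ ℕ) (a : ℝ × ℝ) : ℝ := dt a (cR (VV p m a))

lemma HH_eq (p : ℤ × ℤ) (m : ℤ × ℤ →₀ ℕ) (a : ℝ × ℝ) : 
    HH p m a = dt a (cR p) + ∑ v ∈ m.support, (m v : ℝ) * min 0 (dt a (cR v)) := by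
  rw [HH, VV_eq, cR_add, cR_sum, dt_add_right, dt_sum_right, Finset.sum_filter]
  congr 1
  apply Finset.sum_congr rfl
  intro v _
  rw [cR_nsmul, dt_smul_right, dt_swap a (cR v)]
  split_ifs with h
  · rw [min_eq_right (by linarith)]
  · rw [min_eq_left (by linarith)]; simp

lemma prim_eq {u v : ℤ × ℤ} (hu : 0 < u.1) (hv : 0 < v.1) (cu : IsCoprime u.1 u.2) (cv : IsCoprime v.1 v.2) (h : dt u v = 0) : u = v := by
  have h' : u.1 * v.2 = u.2 * v.1 := by simp only [dt] at h; linarith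
  have d1 : u.1 ∣ v.1 := cu.dvd_of_dvd_mul_left ⟨v.2, by linarith⟩
  have d2 : v.1 ∣ u.1 := cv.dvd_of_dvd_mul_right ⟨u.2, by linarith⟩
  have e : u.1 = v.1 := Int.dvd_antisymm hu.le hv.le d1 d2
  ext
  · exact e
  · rw [e] at h'
    have : v.1 * v.2 = v.1 * u.2 := by linarith
    exact (mul_left_cancel₀ hv.ne' this).symm

lemma second_diff (p : ℤ × ℤ) {m : ℤ × ℤ →₀ ℕ} (hm : Chn m) {v0 : ℤ × ℤ} (h0 : 0 < v0.1) (c0 : IsCoprime v0.1 v0.2) {e : ℝ} (he : 0 < e)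
    (hb : ∀ v ∈ m.support, e * v.1 ≤ 1) : 
    HH p m (cR v0 + (0, e)) + HH p m (cR v0 - (0, e)) - 2 * HH p m (cR v0) = - (e * v0.1 * m v0) := by
  rw [HH_eq, HH_eq, HH_eq]
  have h1 : dt (cR v0 + (0, e)) (cR p) + dt (cR v0 - (0, e)) (cR p) - 2 * dt (cR v0) (cR p) = 0 := by
    rw [dt_add_left, dt_sub_left]; ring
  have h2 : (∑ v ∈ m.support, (m v : ℝ) * min 0 (dt (cR v0 + (0, e)) (cR v))) + (∑ v ∈ m.support, (m v : ℝ) * min 0 (dt (cR v0 - (0, e)) (cR v)))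
      - 2 * (∑ v ∈ m.support, (m v : ℝ) * min 0 (dt (cR v0) (cR v))) = - (e * v0.1 * m v0) := by
    rw [Finset.mul_sum, ← Finset.sum_add_distrib, ← Finset.sum_sub_distrib]
    have : ∀ v ∈ m.support, (m v : ℝ) * min 0 (dt (cR v0 + (0, e)) (cR v)) + (m v : ℝ) * min 0 (dt (cR v0 - (0, e)) (cR v)) - 
       2 * ((m v : ℝ) * min 0 (dt (cR v0) (cR v))) = if v = v0 then -(e * v0.1 * m v0) else 0 := by
      intro v hv
      have hv1 := (hm v hv).1
      have hv1' : (0:ℝ) < v.1 := by exact_mod_cast hv1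
      rw [dt_add_left, dt_sub_left]
      have ee : dt ((0:ℝ), e) (cR v) = - (e * v.1) := by simp [dt]
      have hev : 0 < e * v.1 := by positivity
      rw [ee]
      split_ifs with h
      · subst h
        rw [dt_self, zero_add, zero_sub, neg_neg, min_eq_right (by linarith), min_eq_left hev.le]; simp; ring
      · have hne : dt v0 v ≠ 0 := fun hh => h (prim_eq h0 hv1 c0 (hm v hv).2 hh).symm
        rw [dt_cR]
        have hb' := hb v hv
        rcases lt_or_gt_of_ne hne with hl | hl
        · have : ((dt v0 v : ℤ) : ℝ) ≤ -1 := by exact_mod_cast (by omega : dt v0 v ≤ -1)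
          rw [min_eq_right (by linarith), min_eq_right (by linarith), min_eq_right (by linarith)]; ring
        · have : (1:ℝ) ≤ ((dt v0 v : ℤ) : ℝ) := by exact_mod_cast (by omega : 1 ≤ dt v0 v)
          rw [min_eq_left (by linarith), min_eq_left (by linarith), min_eq_left (by linarith)]; ring
    rw [Finset.sum_congr rfl this, Finset.sum_ite_eq']
    split_ifs with h
    · rfl
    · rw [Finsupp.notMem_support_iff] at h; rw [h]; simp
  linarith

lemma chain_recover {p p' : ℤ × ℤ} {m m' : ℤ × ℤ →₀ ℕ} (hm : Chn m) (hm' : Chn m') (h : ∀ a : ℝ × ℝ, 0 < a.1 → HH p m a = HH p' m' a) : m = m' := by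
  have hs : ∀ (m : ℤ × ℤ →₀ ℕ), Chn m → 0 ≤ ∑ v ∈ m.support, (v.1 : ℝ) := fun m hm => Finset.sum_nonneg fun v hv => by
    have := (hm v hv).1; exact_mod_cast this.le
  have hs1 : ∀ (m : ℤ × ℤ →₀ ℕ), Chn m → ∀ v ∈ m.support, (v.1 : ℝ) ≤ ∑ v ∈ m.support, (v.1 : ℝ) := fun m hm v hv => 
    Finset.single_le_sum (f := fun v : ℤ × ℤ => (v.1:ℝ)) (fun v hv => by have := (hm v hv).1; exact_mod_cast this.le) hv
  obtain ⟨e, he⟩ : ∃ e, e = 1 / (1 + ∑ v ∈ m.support, (v.1 : ℝ) + ∑ v ∈ m'.support, (v.1 : ℝ)) := ⟨_, rfl⟩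
  have t1 := hs m hm
  have t2 := hs m' hm'
  have he0 : 0 < e := by rw [he]; positivity
  have key : ∀ v : ℤ × ℤ, 0 < v.1 → IsCoprime v.1 v.2 → m v = m' v := by
    intro v hv hc
    have hv' : (0:ℝ) < v.1 := by exact_mod_cast hv
    have e1 := second_diff p hm hv hc he0 (fun w hw => by
      rw [he, one_div, inv_mul_le_iff₀ (by positivity)]; linarith [hs1 m hm w hw])
    have e2 := second_diff p' hm' hv hc he0 (fun w hw => by
      rw [he, one_div, inv_mul_le_iff₀ (by positivity)]; linarith [hs1 m' hm' w hw])
    rw [h _ (by simpa using hv), h _ (by simpa using hv), h _ (by simpa using hv), e2] at e1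
    have : (m v : ℝ) = m' v := by
      have h3 : e * v.1 * (m' v : ℝ) = e * v.1 * m v := by linarith
      exact (mul_left_cancel₀ (by positivity) h3).symm
    exact_mod_cast this
  ext v
  by_cases hv : 0 < v.1 ∧ IsCoprime v.1 v.2
  · exact key v hv.1 hv.2
  · have e1 : m v = 0 := by
      by_contra h; exact hv (hm v (Finsupp.mem_support_iff.mpr h))
    have e2 : m' v = 0 := by
      by_contra h; exact hv (hm' v (Finsupp.mem_support_iff.mpr h))
    rw [e1, e2]

def LV (p : ℤ × ℤ) (m : ℤ × ℤ →₀ ℕ) : Finset (ℤ × ℤ) := 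
  (m.support.powerset.image (fun s => p + ∑ v ∈ s, m v • v)).filter (fun w => ∃ a : ℝ × ℝ, 0 < a.1 ∧ w = VV p m a)

lemma mem_LV {p m w} : w ∈ LV p m ↔ ∃ a : ℝ × ℝ, 0 < a.1 ∧ w = VV p m a := by
  rw [LV, Finset.mem_filter]
  constructor
  · exact fun h => h.2
  · rintro ⟨a, ha, rfl⟩
    refine ⟨?_, a, ha, rfl⟩
    rw [Finset.mem_image]
    exact ⟨_, Finset.mem_powerset.mpr (Finset.filter_subset _ _), (VV_eq p m a).symm⟩

def tot (m : ℤ × ℤ →₀ ℕ) : ℤ × ℤ := ∑ v ∈ m.support, m v • v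

/-- lower vertices lie below the chord -/
lemma VV_chord (p : ℤ × ℤ) {m : ℤ × ℤ →₀ ℕ} (hm : Chn m) {b : ℝ × ℝ} (hb : 0 < b.1) : 
    ∃ t : ℝ, ∃ h : ℝ, 0 ≤ t ∧ t ≤ 1 ∧ 0 ≤ h ∧ cR (VV p m b) = (1 - t) • cR p + t • cR (p + tot m) - (0, h) := by
  obtain ⟨s, hs⟩ : ∃ s, s = ∑ v ∈ m.support.filter (fun v => 0 < dt (cR v) b), m v • v := ⟨_, rfl⟩
  obtain ⟨r, hr⟩ : ∃ s, s = ∑ v ∈ m.support.filter (fun v => ¬ 0 < dt (cR v) b), m v • v := ⟨_, rfl⟩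
  have hsr : tot m = s + r := by rw [tot, hs, hr, Finset.sum_filter_add_sum_filter_not]
  have hV : VV p m b = p + s := by rw [VV_eq, hs]
  have hdt : 0 ≤ dt (cR s) (cR r) := by
    rw [hs, hr, cR_sum, cR_sum, dt_sum_left]
    apply Finset.sum_nonneg; intro v hv
    rw [dt_sum_right]
    apply Finset.sum_nonneg; intro w hw
    rw [Finset.mem_filter] at hv hw
    rw [cR_nsmul, cR_nsmul, dt_smul_left, dt_smul_right]
    refine mul_nonneg (by positivity) (mul_nonneg (by positivity) ?_)
    have h1 := plucker (cR v) b (cR w)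
    have h2 : 0 ≤ dt b (cR w) := by rw [dt_swap]; linarith [hw.2]
    have h3 : (0:ℝ) < (cR v).1 := by simp; exact (hm v hv.1).1
    have h4 : (0:ℝ) < (cR w).1 := by simp; exact (hm w hw.1).1
    have h5 : 0 ≤ dt (cR v) (cR w) * b.1 := by rw [h1]; exact add_nonneg (mul_nonneg hv.2.le h4.le) (mul_nonneg h2 h3.le)
    exact nonneg_of_mul_nonneg_left h5 hb
  have hs1 : 0 ≤ s.1 := by
    rw [hs, sum_fst]; apply Finset.sum_nonneg; intro v hv
    rw [Finset.mem_filter] at hv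
    have := (hm v hv.1).1
    simp; positivity
  have hr1 : 0 ≤ r.1 := by
    rw [hr, sum_fst]; apply Finset.sum_nonneg; intro v hv
    rw [Finset.mem_filter] at hv
    have := (hm v hv.1).1
    simp; positivity
  have hs1' : (0:ℝ) ≤ s.1 := by exact_mod_cast hs1
  have hr1' : (0:ℝ) ≤ r.1 := by exact_mod_cast hr1
  rw [hsr, hV]
  rcases (add_nonneg hs1' hr1').eq_or_lt with h0 | h0
  · have hm0 : m = 0 := by
      rw [← Finsupp.support_eq_empty, Finset.eq_empty_iff_forall_notMem]
      intro v hv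
      have h1 : (tot m).1 = 0 := by rw [hsr]; simp; exact_mod_cast h0.symm
      rw [tot, sum_fst, Finset.sum_eq_zero_iff_of_nonneg] at h1
      · have := h1 v hv
        simp at this
        rcases this with h | h
        · exact (Finsupp.mem_support_iff.mp hv) h
        · have := (hm v hv).1; omega
      · intro v hv; have := (hm v hv).1; simp; positivity
    subst hm0
    have e1 : s = 0 := by rw [hs]; simp
    have e2 : r = 0 := by rw [hr]; simp
    refine ⟨0, 0, le_rfl, zero_le_one, le_rfl, ?_⟩
    rw [e1, e2]; ext <;> simp
  · refine ⟨s.1 / (s.1 + r.1), dt (cR s) (cR r) / (s.1 + r.1), by positivity, by rw [div_le_one h0]; linarith, by positivity, ?_⟩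
    ext
    · simp; field_simp; ring
    · simp [dt]; field_simp; ring

def Ends (p : ℤ × ℤ) (m : ℤ × ℤ →₀ ℕ) (p' : ℤ × ℤ) (m' : ℤ × ℤ →₀ ℕ) : Prop :=
  p.1 = p'.1 ∧ p.2 ≤ -p'.2 ∧ (p + tot m).1 = (p' + tot m').1 ∧ (p + tot m).2 ≤ - (p' + tot m').2

lemma Ends.symm {p m p' m'} (h : Ends p m p' m') : Ends p' m' p m := ⟨h.1.symm, by linarith [h.2.1], h.2.2.1.symm, by linarith [h.2.2.2]⟩

lemma upper_ge {p m p' m'} (hE : Ends p m p' m') (hm : Chn m) (hm' : Chn m') {a b : ℝ × ℝ} (ha : 0 < a.1) (hb : 0 < b.1) :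
    HH p m a ≤ dt a (rf (cR (VV p' m' b))) := by
  obtain ⟨t, h, ht0, ht1, hh, e⟩ := VV_chord p' hm' hb
  obtain ⟨T, hT1, hT2⟩ := VV_inf p hm
  have k1 := VV_min p m a (1, -T)
  have k2 := VV_min p m a (1, T)
  rw [hT1, dt_sub_right] at k1
  rw [hT2, dt_sub_right] at k2
  change 0 ≤ dt a (cR (p + tot m)) - _ at k2
  obtain ⟨e1, e2, e3, e4⟩ := hE
  have e1' : ((p.1:ℤ):ℝ) = p'.1 := by exact_mod_cast e1
  have e2' : ((p.2:ℤ):ℝ) ≤ -p'.2 := by exact_mod_cast e2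
  have e3' : (((p + tot m).1:ℤ):ℝ) = (p' + tot m').1 := by exact_mod_cast e3
  have e4' : (((p + tot m).2:ℤ):ℝ) ≤ - (p' + tot m').2 := by exact_mod_cast e4
  obtain ⟨R, hR⟩ : ∃ R, R = p + tot m := ⟨_, rfl⟩
  obtain ⟨R', hR'⟩ : ∃ R, R = p' + tot m' := ⟨_, rfl⟩
  rw [← hR] at e3' e4' k2
  rw [← hR'] at e3' e4' e
  rw [e, HH]
  obtain ⟨Z, hZ⟩ : ∃ Z, Z = dt a (cR (VV p m a)) := ⟨_, rfl⟩
  rw [← hZ] at k1 k2 ⊢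
  simp only [dt, cR_fst, cR_snd, rf_fst, rf_snd, Prod.fst_sub, Prod.snd_sub, Prod.fst_add, Prod.snd_add, Prod.smul_fst, Prod.smul_snd, smul_eq_mul] at k1 k2 ⊢
  have q1 : Z ≤ a.1 * (-p'.2) - a.2 * p'.1 := by rw [← e1']; nlinarith
  have q2 : Z ≤ a.1 * (-R'.2) - a.2 * R'.1 := by rw [← e3']; nlinarith
  have := mul_le_mul_of_nonneg_left q1 (by linarith : 0 ≤ 1 - t)
  have := mul_le_mul_of_nonneg_left q2 ht0
  have := mul_nonneg ha.le hh
  nlinarith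

def poly (p : ℤ × ℤ) (m : ℤ × ℤ →₀ ℕ) (p' : ℤ × ℤ) (m' : ℤ × ℤ →₀ ℕ) : Finset (ℤ × ℤ) := LV p m ∪ (LV p' m').image rf

lemma dt_convex (a : ℝ × ℝ) (c : ℝ) : Convex ℝ {z : ℝ × ℝ | c ≤ dt a z} := by
  intro x hx y hy s t hs ht hst
  simp only [mem_setOf_eq] at hx hy ⊢
  rw [dt_add_right, dt_smul_right, dt_smul_right]
  calc c = s * c + t * c := by rw [← add_mul, hst, one_mul]
    _ ≤ _ := by gcongr

lemma dt_rf_convex (a : ℝ × ℝ) (c : ℝ) : Convex ℝ {z : ℝ × ℝ | c ≤ dt a (rf z)} := by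
  intro x hx y hy s t hs ht hst
  simp only [mem_setOf_eq] at hx hy ⊢
  have : rf (s • x + t • y) = s • rf x + t • rf y := by ext <;> simp; ring
  rw [this, dt_add_right, dt_smul_right, dt_smul_right]
  calc c = s * c + t * c := by rw [← add_mul, hst, one_mul]
    _ ≤ _ := by gcongr

lemma poly_lower {p m p' m'} (hE : Ends p m p' m') (hm : Chn m) (hm' : Chn m') {a : ℝ × ℝ} (ha : 0 < a.1) :
    cR (VV p m a) ∈ convexHull ℝ (cR '' (poly p m p' m' : Set (ℤ × ℤ))) ∧ 
    ∀ z ∈ convexHull ℝ (cR '' (poly p m p' m' : Set (ℤ × ℤ))), HH p m a ≤ dt a z := by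
  constructor
  · apply subset_convexHull
    exact ⟨_, by rw [poly, Finset.coe_union]; left; exact mem_LV.mpr ⟨a, ha, rfl⟩, rfl⟩
  · refine convexHull_min ?_ (dt_convex a _)
    rintro _ ⟨w, hw, rfl⟩
    rw [poly, Finset.coe_union] at hw
    rcases hw with hw | hw
    · obtain ⟨b, hb, rfl⟩ := mem_LV.mp hw
      have := VV_min p m a b
      rw [dt_sub_right] at this
      show HH p m a ≤ dt a (cR (VV p m b))
      rw [HH]; linarith
    · rw [Finset.mem_coe, Finset.mem_image] at hw
      obtain ⟨w', hw', rfl⟩ := hw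
      obtain ⟨b, hb, rfl⟩ := mem_LV.mp hw'
      have := upper_ge hE hm hm' ha hb
      rw [rf_cR] at this; exact this

lemma poly_upper {p m p' m'} (hE : Ends p m p' m') (hm : Chn m) (hm' : Chn m') {a : ℝ × ℝ} (ha : 0 < a.1) :
    rf (cR (VV p' m' a)) ∈ convexHull ℝ (cR '' (poly p m p' m' : Set (ℤ × ℤ))) ∧ 
    ∀ z ∈ convexHull ℝ (cR '' (poly p m p' m' : Set (ℤ × ℤ))), HH p' m' a ≤ dt a (rf z) := by
  constructor
  · apply subset_convexHull
    exact ⟨rf (VV p' m' a), by rw [poly, Finset.coe_union]; right; exact Finset.mem_coe.mpr (Finset.mem_image_of_mem _ (mem_LV.mpr ⟨a, ha, rfl⟩)), (rf_cR _).symm⟩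
  · refine convexHull_min ?_ (dt_rf_convex a _)
    rintro _ ⟨w, hw, rfl⟩
    rw [poly, Finset.coe_union] at hw
    rcases hw with hw | hw
    · obtain ⟨b, hb, rfl⟩ := mem_LV.mp hw
      exact upper_ge hE.symm hm' hm ha hb
    · rw [Finset.mem_coe, Finset.mem_image] at hw
      obtain ⟨w', hw', rfl⟩ := hw
      obtain ⟨b, hb, rfl⟩ := mem_LV.mp hw'
      have := VV_min p' m' a b
      rw [dt_sub_right] at this
      show HH p' m' a ≤ dt a (rf (cR (rf (VV p' m' b))))
      rw [← rf_cR, rf_rf, HH]; linarith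

lemma poly_inj {p m p' m'} (hE : Ends p m p' m') (hm : Chn m) (hm' : Chn m')
    {s n s' n'} (hE2 : Ends s n s' n') (hn : Chn n) (hn' : Chn n') 
    (h : convexHull ℝ (cR '' (poly p m p' m' : Set (ℤ × ℤ))) = convexHull ℝ (cR '' (poly s n s' n' : Set (ℤ × ℤ)))) :
    m = n ∧ m' = n' := by
  constructor
  · refine chain_recover (p := p) (p' := s) hm hn fun a ha => ?_
    obtain ⟨h1, h2⟩ := poly_lower hE hm hm' ha
    obtain ⟨h3, h4⟩ := poly_lower hE2 hn hn' ha
    rw [h] at h1 h2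
    exact le_antisymm (h2 _ h3) (h4 _ h1)
  · refine chain_recover (p := p') (p' := s') hm' hn' fun a ha => ?_
    obtain ⟨h1, h2⟩ := poly_upper hE hm hm' ha
    obtain ⟨h3, h4⟩ := poly_upper hE2 hn hn' ha
    rw [h] at h1 h2
    have e1 := h2 _ h3
    have e2 := h4 _ h1
    rw [rf_rf] at e1 e2
    exact le_antisymm e1 e2

end BL

end Part9

section Part10
set_option linter.all false
open scoped Classical

/-! ## Part 2e: building chains -/
namespace BL
open Topology

lemma mg_add (N i : ℕ) (m m' : ℤ × ℤ →₀ ℕ) : mg N i (m + m') = mg N i m + mg N i m' := by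
  rw [mg, Finsupp.filter_add, Finsupp.mapDomain_add]; rfl

lemma mg_zero (N i : ℕ) : mg N i 0 = 0 := by
  rw [mg, Finsupp.filter_zero, Finsupp.mapDomain_zero]

lemma mg_map {N i j : ℕ} (hi : i < kf N) (hj : j < kf N) {μ : ℕ × ℕ →₀ ℕ} (hμ : ↑μ.support ⊆ PV) : 
    mg N i (Finsupp.mapDomain (iI N j) μ) = if i = j then μ else 0 := by
  have hs : ∀ v ∈ (Finsupp.mapDomain (iI N j) μ).support, osec N j v := by
    intro v hv
    obtain ⟨x, hx, rfl⟩ := Finset.mem_image.mp (Finsupp.mapDomain_support hv)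
    exact osec_iI hj (hμ hx)
  split_ifs with h
  · subst h
    rw [mg, Finsupp.filter_eq_self_iff _ _ |>.mpr (fun v hv => hs v (Finsupp.mem_support_iff.mpr hv)), ← Finsupp.mapDomain_comp]
    conv_rhs => rw [← Finsupp.mapDomain_id (v := μ)]
    exact Finsupp.mapDomain_congr fun x hx => cI_iI hi x
  · rw [mg, Finsupp.filter_eq_zero_iff _ _ |>.mpr, Finsupp.mapDomain_zero]
    intro v hv
    by_contra hc
    have h1 := hs v (Finsupp.mem_support_iff.mpr hc)
    exact h (sec_unique hi hj (osec_fst_pos hi hv) ⟨hv.1.le, hv.2⟩ ⟨h1.1.le, h1.2⟩)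

lemma fan_insec {N j : ℕ} (hj : j < kf N) : insec N j (fan N j) := ⟨by rw [dt_self], by rw [(fan_props N j hj).1]; norm_num⟩

lemma fan_not_osec {N i j : ℕ} (hi : i < kf N) (hj : j < kf N) : ¬ osec N i (fan N j) := by
  intro h
  have h0 := osec_fst_pos hi h
  have := sec_unique hi hj h0 ⟨h.1.le, h.2⟩ (fan_insec hj)
  subst this
  have := h.1
  rw [dt_self] at this; exact lt_irrefl _ this

lemma mg_single {N i j : ℕ} (hi : i < kf N) (hj : j < kf N) (c : ℕ) : mg N i (Finsupp.single (fan N j) c) = 0 := by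
  rw [mg, Finsupp.filter_single_of_neg _ (fan_not_osec hi hj), Finsupp.mapDomain_zero]

lemma map_fan {N i j : ℕ} (hi : i < kf N) (hj : j < kf N) {μ : ℕ × ℕ →₀ ℕ} (hμ : ↑μ.support ⊆ PV) : 
    (Finsupp.mapDomain (iI N j) μ) (fan N i) = 0 := by
  by_contra hc
  obtain ⟨x, hx, h⟩ := Finset.mem_image.mp (Finsupp.mapDomain_support (Finsupp.mem_support_iff.mpr hc))
  exact fan_not_osec hj hi (h ▸ osec_iI hj (hμ hx))

lemma fan_coprime {N i : ℕ} (hi : i < kf N) : IsCoprime (fan N i).1 (fan N i).2 := 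
  ⟨(fan N (i+1)).2, -(fan N (i+1)).1, by have := (fan_props N i hi).1; simp only [dt] at this; linarith⟩

lemma Chn_add {m m' : ℤ × ℤ →₀ ℕ} (h : Chn m) (h' : Chn m') : Chn (m + m') := by
  intro v hv
  rcases Finset.mem_union.mp (Finsupp.support_add hv) with h1 | h1
  · exact h v h1
  · exact h' v h1

lemma build (N : ℕ) (μ : ℕ → (ℕ × ℕ →₀ ℕ)) (c : ℕ → ℕ) (hμ : ∀ i < kf N, ↑(μ i).support ⊆ PV) : 
    ∃ m, Chn m ∧ (∀ i < kf N, mg N i m = μ i) ∧ ∀ i < kf N, 0 < i → m (fan N i) = c i := by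
  have : ∀ s : ℕ, s ≤ kf N → ∃ m, Chn m ∧ (∀ i < kf N, mg N i m = if i < s then μ i else 0) ∧ 
      ∀ i < kf N, 0 < i → m (fan N i) = if i < s then c i else 0 := by
    intro s
    induction s with
    | zero => 
      intro _
      refine ⟨0, by simp [Chn], fun i hi => ?_, fun i _ _ => by simp⟩
      simp [mg_zero]
    | succ j ih =>
      intro hj
      obtain ⟨m, h1, h2, h3⟩ := ih (by omega)
      have hj' : j < kf N := hj
      have c1 : Chn (Finsupp.mapDomain (iI N j) (μ j)) := by
        intro v hv
        obtain ⟨x, hx, rfl⟩ := Finset.mem_image.mp (Finsupp.mapDomain_support hv)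
        exact ⟨osec_fst_pos hj' (osec_iI hj' (hμ j hj' hx)), coprime_iI hj' (hμ j hj' hx)⟩
      have c2 : Chn (if 0 < j then Finsupp.single (fan N j) (c j) else 0) := by
        split_ifs with h
        · intro v hv
          have := Finsupp.support_single_subset hv
          rw [Finset.mem_singleton] at this
          subst this
          exact ⟨(fan_props N j hj').2.2.2.2.2.2.2 h, fan_coprime hj'⟩
        · simp [Chn]
      refine ⟨m + Finsupp.mapDomain (iI N j) (μ j) + (if 0 < j then Finsupp.single (fan N j) (c j) else 0), Chn_add (Chn_add h1 c1) c2, ?_, ?_⟩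
      · intro i hi
        rw [mg_add, mg_add, h2 i hi, mg_map hi hj' (hμ j hj')]
        have : mg N i (if 0 < j then Finsupp.single (fan N j) (c j) else 0) = 0 := by
          split_ifs with h
          · exact mg_single hi hj' _
          · exact mg_zero N i
        rw [this, add_zero]
        by_cases hij : i = j
        · subst hij; simp
        · by_cases h : i < j
          · rw [if_pos h, if_neg hij, if_pos (by omega), add_zero]
          · rw [if_neg h, if_neg hij, if_neg (by omega), add_zero]
      · intro i hi hi0
        rw [Finsupp.add_apply, Finsupp.add_apply, h3 i hi hi0, map_fan hi hj' (hμ j hj'), add_zero]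
        by_cases hij : i = j
        · subst hij; simp [hi0]
        · have : (if 0 < j then Finsupp.single (fan N j) (c j) else 0) (fan N i) = 0 := by
            split_ifs with h
            · rw [Finsupp.single_apply, if_neg]
              intro he
              exact hij (sec_unique hi hj' ((fan_props N i hi).2.2.2.2.2.2.2 hi0) (fan_insec hi) (he ▸ fan_insec hj'))
            · simp
          rw [this, add_zero]
          by_cases h : i < j
          · rw [if_pos h, if_pos (by omega)]
          · rw [if_neg h, if_neg (by omega)]
  obtain ⟨m, h1, h2, h3⟩ := this (kf N) le_rfl
  exact ⟨m, h1, fun i hi => by rw [h2 i hi, if_pos hi], fun i hi h0 => by rw [h3 i hi h0, if_pos hi]⟩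

def PH (N : ℕ) (A B : ℕ → ℕ) (ph : ℤ × ℤ) (j : ℕ) : ℤ × ℤ := 
  ph + ∑ i ∈ Finset.range j, ((A i : ℤ) • fan N i + (B i : ℤ) • fan N (i+1))

lemma EE_eq {N i : ℕ} (hi : i < kf N) {m : ℤ × ℤ →₀ ℕ} (hm : Chn m) :
    EE N i m = ((m (fan N i) : ℤ) + (ms1 (mg N i m) : ℤ)) • fan N i + (ms2 (mg N i m) : ℤ) • fan N (i+1) := by
  conv_lhs => rw [sec_coord hi (EE N i m)]
  rw [EE_alpha hi hm, EE_beta hi hm]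

lemma build_side (N : ℕ) (A B : ℕ → ℕ) (ph : ℤ × ℤ) (d : ℕ) (μ : ℕ → (ℕ × ℕ →₀ ℕ)) (hμ : ∀ i < kf N, μ i ∈ CS (A i) (B i)) :
    ∃ m, ∃ L : ℤ × ℤ, Chn m ∧ (∀ i < kf N, mg N i m = μ i) ∧ (∃ x : ℤ, 0 ≤ x ∧ x ≤ A 0 ∧ L = ph + x • fan N 0) ∧ 
      ∀ j < kf N, ∃ y : ℤ, 0 ≤ y ∧ y ≤ B j ∧ VV L m (cR (fan N (j+1))) = PH N A B ph j + (A j : ℤ) • fan N j + y • fan N (j+1) 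
        + (if 2 ^ N ≤ j then (d : ℤ) else 0) • (1, 0) := by
  have hk := kf_pos N
  obtain ⟨m, h1, h2, h3⟩ := build N μ (fun i => (A i - ms1 (μ i)) + (B (i-1) - ms2 (μ (i-1))) + if i = 2 ^ N then d else 0) (fun i hi => (hμ i hi).1)
  obtain ⟨L, hL⟩ : ∃ L, L = ph + (((A 0 - ms1 (μ 0) : ℕ) : ℤ)) • fan N 0 := ⟨_, rfl⟩
  have m0 : m (fan N 0) = 0 := by
    by_contra h
    have := (h1 _ (Finsupp.mem_support_iff.mpr h)).1
    rw [fan_zero] at this; simp at this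
  have key : ∀ j < kf N, VV L m (cR (fan N (j+1))) = PH N A B ph j + (A j : ℤ) • fan N j + (ms2 (μ j) : ℤ) • fan N (j+1) 
        + (if 2 ^ N ≤ j then (d : ℤ) else 0) • (1, 0) := by
    intro j
    induction j with
    | zero => 
      intro hj
      have e := VV_succ hj L h1
      rw [EE_eq hj h1, VV_start N L h1, h2 0 hj, m0, sub_eq_iff_eq_add] at e
      rw [e, hL, if_neg (by have : 0 < 2 ^ N := by positivity
                            omega), PH, Finset.sum_range_zero]
      have := (hμ 0 hj).2.1
      rw [Nat.cast_sub this]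
      module
    | succ j ih =>
      intro hj
      have e := VV_succ hj L h1
      rw [EE_eq hj h1, ih (by omega), h2 _ hj, h3 _ hj (by omega), sub_eq_iff_eq_add] at e
      rw [e, PH, PH, Finset.sum_range_succ]
      have t1 := (hμ (j+1) hj).2.1
      have t2 := (hμ j (by omega)).2.2
      have t3 : (if 2 ^ N ≤ j + 1 then (d : ℤ) else 0) • ((1, 0) : ℤ × ℤ) = (if 2 ^ N ≤ j then (d : ℤ) else 0) • ((1, 0) : ℤ × ℤ)
          + (((if j + 1 = 2 ^ N then d else 0 : ℕ)) : ℤ) • fan N (j+1) := by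
        by_cases hh : j + 1 = 2 ^ N
        · rw [hh, fan_mid, if_pos le_rfl, if_neg (by omega), if_pos rfl]; simp
        · rw [if_neg hh]
          by_cases h4 : 2 ^ N ≤ j
          · rw [if_pos h4, if_pos (by omega)]; simp
          · rw [if_neg h4, if_neg (by omega)]; simp
      rw [t3]
      push_cast [Nat.cast_sub t1]
      rw [Nat.cast_sub t2]
      module
  refine ⟨m, L, h1, h2, ⟨_, by positivity, ?_, hL⟩, fun j hj => ⟨_, by positivity, ?_, key j hj⟩⟩
  · exact_mod_cast Nat.sub_le _ _
  · exact_mod_cast (hμ j hj).2.2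

end BL

end Part10

section Part11
set_option linter.all false
open scoped Classical

/-! ## Part 2f: lower count -/
namespace BL
open Topology

lemma fan_nonneg {N i : ℕ} (hi : i ≤ kf N) : 0 ≤ (fan N i).1 := by
  rcases hi.lt_or_eq with h | h
  · exact (fan_props N i h).2.1
  · rw [h, fan_last]

lemma close_real {a1 a2 b1 b2 x y α β M N : ℝ} (hN : 0 < N) (F1 : a1 * b2 - a2 * b1 = 1) (F2 : 0 ≤ a1) (F3 : 0 ≤ b1) (F4 : 0 ≤ a2 * b2) 
    (F5 : 1 ≤ a1 + |a2|) (F6 : 1 ≤ b1 + |b2|) (F7 : N ≤ (a1 + |a2|) * (b1 + |b2|))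
    (hx0 : 0 ≤ x) (hx : x ≤ α) (hy0 : 0 ≤ y) (hy : y ≤ β)
    (h1 : |α * a1 + β * b1| ≤ M) (h2 : |α * a2 + β * b2| ≤ M) : 
    ∃ τ : ℝ, 0 ≤ τ ∧ τ ≤ 1 ∧ |x * a1 + y * b1 - τ * (α * a1 + β * b1)| ≤ M / N ∧ |x * a2 + y * b2 - τ * (α * a2 + β * b2)| ≤ M / N := by
  have hα : 0 ≤ α := hx0.trans hx
  have hβ : 0 ≤ β := hy0.trans hy
  have hM0 : 0 ≤ M := (abs_nonneg _).trans h1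
  have h3 : α * |a2| + β * |b2| ≤ M := by
    refine le_trans ?_ h2
    rcases abs_cases a2 with ⟨e, q⟩ | ⟨e, q⟩ <;> rcases abs_cases b2 with ⟨e', q'⟩ | ⟨e', q'⟩ <;> rw [e, e']
    · exact le_abs_self _
    · have : a2 = 0 := by nlinarith only [F4, q, q']
      subst this; have := neg_le_abs (α * 0 + β * b2); linarith
    · have : b2 = 0 := by nlinarith only [F4, q, q']
      subst this; have := neg_le_abs (α * a2 + β * 0); linarith
    · exact le_trans (by linarith) (neg_le_abs _)
  have d2 : (b1 + |b2|) * a2 - (a1 + |a2|) * b2 = -1 := by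
    rcases abs_cases a2 with ⟨e, q⟩ | ⟨e, q⟩ <;> rcases abs_cases b2 with ⟨e', q'⟩ | ⟨e', q'⟩ <;> rw [e, e']
    · linarith
    · have : a2 = 0 := by nlinarith only [F4, q, q']
      subst this; linarith
    · have : b2 = 0 := by nlinarith only [F4, q, q']
      subst this; linarith
    · linarith
  have d1 : |(b1 + |b2|) * a1 - (a1 + |a2|) * b1| ≤ 1 := by
    rcases abs_cases a2 with ⟨e, q⟩ | ⟨e, q⟩ <;> rcases abs_cases b2 with ⟨e', q'⟩ | ⟨e', q'⟩ <;> rw [e, e']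
    · rw [show (b1 + b2) * a1 - (a1 + a2) * b1 = 1 by linarith]; simp
    · have : a2 = 0 := by nlinarith only [F4, q, q']
      subst this; nlinarith only [F1, F2, q']
    · have : b2 = 0 := by nlinarith only [F4, q, q']
      subst this; rw [show (b1 + 0) * a1 - (a1 + -a2) * b1 = -1 by linarith]; simp
    · rw [show (b1 + -b2) * a1 - (a1 + -a2) * b1 = -1 by linarith]; simp
  obtain ⟨la, hla⟩ : ∃ t, t = a1 + |a2| := ⟨_, rfl⟩
  obtain ⟨lb, hlb⟩ : ∃ t, t = b1 + |b2| := ⟨_, rfl⟩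
  have hsM : α * la + β * lb ≤ 2 * M := by
    have e1 : α * a1 + β * b1 ≤ M := (le_abs_self _).trans h1
    rw [hla, hlb]; linarith
  rw [← hla] at F5 F7 d1 d2
  rw [← hlb] at F6 F7 d1 d2
  clear hla hlb F1 F2 F3 F4 h1 h2 h3
  obtain ⟨s, hs⟩ : ∃ s, s = α * la + β * lb := ⟨_, rfl⟩
  rw [← hs] at hsM
  have hs0 : 0 ≤ s := by rw [hs]; positivity
  rcases hs0.eq_or_lt with h0 | h0
  · have hα0 : α = 0 := by nlinarith
    have hβ0 : β = 0 := by nlinarith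
    have hx' : x = 0 := by linarith
    have hy' : y = 0 := by linarith
    refine ⟨0, le_rfl, zero_le_one, ?_, ?_⟩ <;> rw [hx', hy'] <;> simp <;> positivity
  · obtain ⟨ρ, hρ⟩ : ∃ ρ, ρ = (x * β - α * y) / s := ⟨_, rfl⟩
    have hρM : |ρ| ≤ M / N := by
      rw [hρ, abs_div, abs_of_pos h0, div_le_div_iff₀ h0 hN]
      have t1 : |x * β - α * y| ≤ α * β := by
        have := mul_le_mul_of_nonneg_right hx hβ
        have := mul_le_mul_of_nonneg_left hy hα
        have := mul_nonneg hx0 hβ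
        have := mul_nonneg hα hy0
        rw [abs_le]; constructor <;> linarith
      have t2 : 4 * (α * β) * N ≤ s ^ 2 := by
        have := mul_le_mul_of_nonneg_left F7 (show 0 ≤ 4 * (α * β) by positivity)
        rw [hs]; nlinarith only [sq_nonneg (α * la - β * lb), this]
      have t3 := mul_le_mul_of_nonneg_right t1 hN.le
      nlinarith only [t2, t3, hsM, h0, hM0]
    refine ⟨(x * la + y * lb) / s, by positivity, ?_, ?_, ?_⟩
    · rw [div_le_one h0, hs]; gcongr
    · have : x * a1 + y * b1 - (x * la + y * lb) / s * (α * a1 + β * b1) = ρ * (lb * a1 - la * b1) := by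
        rw [hρ]; field_simp; rw [hs]; ring
      rw [this, abs_mul]
      exact (mul_le_of_le_one_right (abs_nonneg _) d1).trans hρM
    · have : x * a2 + y * b2 - (x * la + y * lb) / s * (α * a2 + β * b2) = ρ * (lb * a2 - la * b2) := by
        rw [hρ]; field_simp; rw [hs]; ring
      rw [this, d2, abs_mul]
      simpa using hρM

lemma fan_close {N i : ℕ} (hi : i < kf N) {x y α β M : ℝ} (hx0 : 0 ≤ x) (hx : x ≤ α) (hy0 : 0 ≤ y) (hy : y ≤ β)
    (h1 : |(α • cR (fan N i) + β • cR (fan N (i+1))).1| ≤ M) (h2 : |(α • cR (fan N i) + β • cR (fan N (i+1))).2| ≤ M) :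
    ∃ τ : ℝ, 0 ≤ τ ∧ τ ≤ 1 ∧ 
     |((x • cR (fan N i) + y • cR (fan N (i+1))) - τ • (α • cR (fan N i) + β • cR (fan N (i+1)))).1| ≤ M / (N+1) ∧
     |((x • cR (fan N i) + y • cR (fan N (i+1))) - τ • (α • cR (fan N i) + β • cR (fan N (i+1)))).2| ≤ M / (N+1) := by
  obtain ⟨f1, f2, f3, f4, f5, f6, f7, f8⟩ := fan_props N i hi
  simp only [dt, l1] at *
  rw [abs_of_nonneg f2] at f5 f7
  rw [abs_of_nonneg f3] at f6 f7
  simp only [Prod.fst_add, Prod.snd_add, Prod.smul_fst, Prod.smul_snd, smul_eq_mul, cR_fst, cR_snd, Prod.fst_sub, Prod.snd_sub] at *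
  exact close_real (by positivity) (by exact_mod_cast f1) (by exact_mod_cast f2) (by exact_mod_cast f3) (by exact_mod_cast f4) (by exact_mod_cast f5) 
    (by exact_mod_cast f6) (by exact_mod_cast f7) hx0 hx hy0 hy h1 h2

/-- nearness in both coordinates -/
def nr (e : ℝ) (z w : ℝ × ℝ) : Prop := |z.1 - w.1| ≤ e ∧ |z.2 - w.2| ≤ e

lemma nr_tri {e e' : ℝ} {x y z : ℝ × ℝ} (h : nr e x y) (h' : nr e' y z) : nr (e + e') x z := by
  constructor
  · calc |x.1 - z.1| = |(x.1 - y.1) + (y.1 - z.1)| := by ring_nf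
      _ ≤ _ := (abs_add_le _ _).trans (add_le_add h.1 h'.1)
  · calc |x.2 - z.2| = |(x.2 - y.2) + (y.2 - z.2)| := by ring_nf
      _ ≤ _ := (abs_add_le _ _).trans (add_le_add h.2 h'.2)

lemma nr_mono {e e' : ℝ} (he : e ≤ e') {x y : ℝ × ℝ} (h : nr e x y) : nr e' x y := ⟨h.1.trans he, h.2.trans he⟩

lemma nr_conv {e τ : ℝ} (h0 : 0 ≤ τ) (h1 : τ ≤ 1) {x y x' y' : ℝ × ℝ} (h : nr e x x') (h' : nr e y y') : 
    nr e (x + τ • (y - x)) (x' + τ • (y' - x')) := by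
  constructor
  · have : (x + τ • (y - x)).1 - (x' + τ • (y' - x')).1 = (1 - τ) * (x.1 - x'.1) + τ * (y.1 - y'.1) := by simp; ring
    rw [this]
    refine (abs_add_le _ _).trans ?_
    rw [abs_mul, abs_mul, abs_of_nonneg h0, abs_of_nonneg (by linarith : 0 ≤ 1 - τ)]
    nlinarith [mul_le_mul_of_nonneg_left h.1 (by linarith : 0 ≤ 1 - τ), mul_le_mul_of_nonneg_left h'.1 h0]
  · have : (x + τ • (y - x)).2 - (x' + τ • (y' - x')).2 = (1 - τ) * (x.2 - x'.2) + τ * (y.2 - y'.2) := by simp; ring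
    rw [this]
    refine (abs_add_le _ _).trans ?_
    rw [abs_mul, abs_mul, abs_of_nonneg h0, abs_of_nonneg (by linarith : 0 ≤ 1 - τ)]
    nlinarith [mul_le_mul_of_nonneg_left h.2 (by linarith : 0 ≤ 1 - τ), mul_le_mul_of_nonneg_left h'.2 h0]

lemma conv_pt {K : Set (ℝ × ℝ)} (hK : Convex ℝ K) {x y : ℝ × ℝ} (hx : x ∈ K) (hy : y ∈ K) {τ : ℝ} (h0 : 0 ≤ τ) (h1 : τ ≤ 1) : x + τ • (y - x) ∈ K := by
  have := hK hx hy (by linarith : 0 ≤ 1 - τ) h0 (by ring)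
  convert this using 1; module

/-- a piece of the sector path is near the segment -/
lemma seg_close {N i : ℕ} (hi : i < kf N) {p q : ℝ × ℝ} {x y M : ℝ} (hx0 : 0 ≤ x) (hx : x ≤ dt (q - p) (cR (fan N (i+1)))) 
    (hy0 : 0 ≤ y) (hy : y ≤ dt (cR (fan N i)) (q - p)) (h1 : |(q - p).1| ≤ M) (h2 : |(q - p).2| ≤ M) :
    ∃ τ : ℝ, 0 ≤ τ ∧ τ ≤ 1 ∧ nr (M / (N+1)) (p + (x • cR (fan N i) + y • cR (fan N (i+1)))) (p + τ • (q - p)) := by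
  have e := sec_coordR hi (q - p)
  rw [e] at h1 h2
  obtain ⟨τ, t0, t1, t2, t3⟩ := fan_close hi hx0 hx hy0 hy h1 h2
  rw [← e] at t2 t3
  refine ⟨τ, t0, t1, ?_, ?_⟩
  · rw [Prod.fst_add p, Prod.fst_add p, add_sub_add_left_eq_sub]; exact t2
  · rw [Prod.snd_add p, Prod.snd_add p, add_sub_add_left_eq_sub]; exact t3

lemma PH_close (N : ℕ) (q : ℕ → ℝ × ℝ) (hq : Dat N q) {n : ℕ} (ph : ℤ × ℤ) : ∀ j ≤ kf N, 
    ((PH N (fun i => ⌊n * al N q i⌋₊) (fun i => ⌊n * be N q i⌋₊) ph j).1 - ph.1 : ℝ) ≤ n * ((q j).1 - (q 0).1) ∧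
    nr (2 * j * fanW N) (cR (PH N (fun i => ⌊n * al N q i⌋₊) (fun i => ⌊n * be N q i⌋₊) ph j) - cR ph) ((n:ℝ) • (q j - q 0)) := by
  intro j
  induction j with
  | zero => intro _; simp [PH, nr]
  | succ j ih =>
    intro hj
    have hj' : j < kf N := hj
    obtain ⟨i1, i2⟩ := ih hj'.le
    obtain ⟨Q, hQ⟩ : ∃ Q, Q = PH N (fun i => ⌊n * al N q i⌋₊) (fun i => ⌊n * be N q i⌋₊) ph j := ⟨_, rfl⟩
    have e : PH N (fun i => ⌊n * al N q i⌋₊) (fun i => ⌊n * be N q i⌋₊) ph (j+1) = Q + ((⌊n * al N q j⌋₊ : ℤ) • fan N j + (⌊n * be N q j⌋₊ : ℤ) • fan N (j+1)) := by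
      rw [hQ, PH, Finset.sum_range_succ, ← add_assoc]; rfl
    rw [← hQ] at i1 i2
    rw [e]
    obtain ⟨hα, hβ⟩ := hq j hj'
    have hs := sec_coordR hj' (q (j+1) - q j)
    change _ = al N q j • _ + be N q j • _ at hs
    obtain ⟨a, ha⟩ : ∃ a, a = fan N j := ⟨_, rfl⟩
    obtain ⟨b, hb⟩ : ∃ a, a = fan N (j+1) := ⟨_, rfl⟩
    have w1 := fanW_ge N hj'.le
    have w2 := fanW_ge N hj
    have a0 : (0:ℝ) ≤ a.1 := by rw [ha]; exact_mod_cast fan_nonneg hj'.le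
    have b0 : (0:ℝ) ≤ b.1 := by rw [hb]; exact_mod_cast fan_nonneg hj
    rw [← ha] at hs w1 ⊢
    rw [← hb] at hs w2 ⊢
    have n0 : (0:ℝ) ≤ n := by positivity
    have A1 := Nat.floor_le (show 0 ≤ n * al N q j by positivity)
    have A2 := (Nat.lt_floor_add_one (n * al N q j)).le
    have B1 := Nat.floor_le (show 0 ≤ n * be N q j by positivity)
    have B2 := (Nat.lt_floor_add_one (n * be N q j)).le
    generalize ⌊n * al N q j⌋₊ = A at *
    generalize ⌊n * be N q j⌋₊ = B at *
    generalize al N q j = α at *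
    generalize be N q j = β at *
    have s1 := congrArg Prod.fst hs
    have s2 := congrArg Prod.snd hs
    simp only [Prod.fst_add, Prod.snd_add, Prod.smul_fst, Prod.smul_snd, smul_eq_mul, cR_fst, cR_snd, Prod.fst_sub, Prod.snd_sub, nr] at s1 s2 i2 ⊢
    obtain ⟨i2, i3⟩ := i2
    push_cast
    have g : ∀ c d : ℝ, |c| ≤ fanW N → |d| ≤ fanW N → |A * c + B * d - n * (α * c + β * d)| ≤ 2 * fanW N := by
      intro c d hc hd
      have : A * c + B * d - n * (α * c + β * d) = (A - n * α) * c + (B - n * β) * d := by ring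
      rw [this]
      refine (abs_add_le _ _).trans ?_
      rw [abs_mul, abs_mul]
      have h1 : |A - n * α| ≤ 1 := by rw [abs_le]; constructor <;> linarith
      have h2 : |B - n * β| ≤ 1 := by rw [abs_le]; constructor <;> linarith
      nlinarith [abs_nonneg c, abs_nonneg d, mul_le_of_le_one_left (abs_nonneg c) h1, mul_le_of_le_one_left (abs_nonneg d) h2]
    have pa1 := abs_nonneg (a.1 : ℝ)
    have pa2 := abs_nonneg (a.2 : ℝ)
    have pb1 := abs_nonneg (b.1 : ℝ)
    have pb2 := abs_nonneg (b.2 : ℝ)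
    refine ⟨?_, ?_, ?_⟩
    · have := mul_le_mul_of_nonneg_right A1 a0
      have := mul_le_mul_of_nonneg_right B1 b0
      have : n * ((q (j+1)).1 - (q 0).1) = n * ((q j).1 - (q 0).1) + n * (α * a.1 + β * b.1) := by rw [← s1]; ring
      rw [this]; linarith
    · have t := g a.1 b.1 (by linarith) (by linarith)
      have : (Q.1 : ℝ) + (A * a.1 + B * b.1) - ph.1 - n * ((q (j+1)).1 - (q 0).1) = (Q.1 - ph.1 - n * ((q j).1 - (q 0).1)) + (A * a.1 + B * b.1 - n * (α * a.1 + β * b.1)) := by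
        rw [← s1]; ring
      rw [this]
      refine (abs_add_le _ _).trans ?_
      linarith
    · have t := g a.2 b.2 (by linarith) (by linarith)
      have : (Q.2 : ℝ) + (A * a.2 + B * b.2) - ph.2 - n * ((q (j+1)).2 - (q 0).2) = (Q.2 - ph.2 - n * ((q j).2 - (q 0).2)) + (A * a.2 + B * b.2 - n * (α * a.2 + β * b.2)) := by
        rw [← s2]; ring
      rw [this]
      refine (abs_add_le _ _).trans ?_
      linarith

end BL

end Part11

section Part12
set_option linter.all false
open scoped Classical

/-! ## Part 2g: lower count -/
namespace BL
open Topology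

def cst (N : ℕ) : ℝ := 5 + 6 * (kf N * fanW N)

lemma dt_scale (n : ℝ) (u v : ℝ × ℝ) : dt (n • u) v = n * dt u v := dt_smul_left _ _ _

set_option maxHeartbeats 1600000 in
lemma side_chain (N : ℕ) {K0 : Set (ℝ × ℝ)} (hK0 : Convex ℝ K0) {M r : ℝ} (hM : ∀ z ∈ K0, |z.1| ≤ M ∧ |z.2| ≤ M) (hr : 0 < r) (hr1 : r ≤ 1)
    (hN : (8 * M + 4) / (N + 1) ≤ r / 2) {q : ℕ → ℝ × ℝ} (hq : Dat N q) (hqK : ∀ i ≤ kf N, q i ∈ K0) {n : ℕ} (hn : 0 < n) (hc : cst N / n ≤ r / 4)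
    (μ : ℕ → (ℕ × ℕ →₀ ℕ)) (hμ : ∀ i < kf N, μ i ∈ CS ⌊n * al N q i⌋₊ ⌊n * be N q i⌋₊) : 
    ∃ m, ∃ L : ℤ × ℤ, Chn m ∧ (∀ i < kf N, mg N i m = μ i) ∧ L.1 = ⌊n * (q 0).1⌋ ∧ (L.2 : ℝ) ≤ n * (q 0).2 ∧ 
      (L + tot m).1 = ⌈n * (q (kf N)).1⌉ ∧ ((L + tot m).2 : ℝ) ≤ n * (q (kf N)).2 ∧ 
      ∀ a : ℝ × ℝ, 0 < a.1 → ∃ z ∈ K0, nr r ((1 / n : ℝ) • cR (VV L m a)) z := by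
  have hk := kf_pos N
  have hk' : (0:ℝ) < kf N := by exact_mod_cast hk
  have hW := fanW_pos N
  have hn' : (0:ℝ) < n := by exact_mod_cast hn
  have hM0 : 0 ≤ M := (abs_nonneg _).trans (hM _ (hqK 0 (by omega))).1
  obtain ⟨A, hA⟩ : ∃ A : ℕ → ℕ, A = fun i => ⌊n * al N q i⌋₊ := ⟨_, rfl⟩
  obtain ⟨B, hB⟩ : ∃ B : ℕ → ℕ, B = fun i => ⌊n * be N q i⌋₊ := ⟨_, rfl⟩
  obtain ⟨C, hC⟩ : ∃ C : ℤ, C = ⌈2 * (kf N * fanW N)⌉ := ⟨_, rfl⟩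
  have hC1 : 2 * (kf N * fanW N) ≤ C := by rw [hC]; exact Int.le_ceil _
  have hC2 : C ≤ 2 * (kf N * fanW N) + 1 := by rw [hC]; exact (Int.ceil_lt_add_one _).le
  have f1 := Int.floor_le (n * (q 0).1)
  have f2 := (Int.lt_floor_add_one (n * (q 0).1)).le
  have f3 := Int.floor_le (n * (q 0).2)
  have f4 := (Int.lt_floor_add_one (n * (q 0).2)).le
  obtain ⟨ph, hph⟩ : ∃ ph : ℤ × ℤ, ph = (⌊n * (q 0).1⌋, ⌊n * (q 0).2⌋ - C) := ⟨_, rfl⟩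
  have hph1 : ph.1 = ⌊n * (q 0).1⌋ := by rw [hph]
  have hph2 : (ph.2 : ℝ) = ⌊n * (q 0).2⌋ - C := by rw [hph]; push_cast; ring
  have hPH := PH_close N q hq (n := n) ph
  rw [← hA, ← hB] at hPH
  have e1 := Int.le_ceil (n * (q (kf N)).1)
  have e2 := (Int.ceil_lt_add_one (n * (q (kf N)).1)).le
  obtain ⟨P1, P2⟩ := hPH (kf N) le_rfl
  have hd0 : 0 ≤ ⌈n * (q (kf N)).1⌉ - (PH N A B ph (kf N)).1 := by
    have : ((PH N A B ph (kf N)).1 : ℝ) ≤ ⌈n * (q (kf N)).1⌉ := by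
      rw [hph1] at P1; linarith
    have : (PH N A B ph (kf N)).1 ≤ ⌈n * (q (kf N)).1⌉ := by exact_mod_cast this
    linarith
  obtain ⟨d, hd⟩ := Int.eq_ofNat_of_zero_le hd0
  have hdR : (d : ℝ) = ⌈n * (q (kf N)).1⌉ - (PH N A B ph (kf N)).1 := by exact_mod_cast hd.symm
  have hd1 : (d:ℝ) ≤ 2 * (kf N * fanW N) + 2 := by
    rw [hdR]
    have := (abs_le.mp P2.1).1
    simp only [Prod.fst_sub, cR_fst, Prod.smul_fst, smul_eq_mul] at this
    rw [hph1] at this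
    linarith
  have hμ' : ∀ i < kf N, μ i ∈ CS (A i) (B i) := by rw [hA, hB]; exact hμ
  obtain ⟨m, L, m1, m2, ⟨x0, x0a, x0b, hL⟩, m4⟩ := build_side N A B ph d μ hμ'
  have A1 : ∀ i < kf N, (A i : ℝ) ≤ n * al N q i := fun i hi => by
    rw [hA]; exact Nat.floor_le (by have := (hq i hi).1; positivity)
  have B1 : ∀ i < kf N, (B i : ℝ) ≤ n * be N q i := fun i hi => by
    rw [hB]; exact Nat.floor_le (by have := (hq i hi).2; positivity)
  -- end point
  have hend : L + tot m = VV L m (cR (fan N (kf N))) := by rw [VV_end N L m1]; rfl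
  obtain ⟨k', hk'e⟩ : ∃ k', kf N = k' + 1 := ⟨kf N - 1, by omega⟩
  obtain ⟨y, y0, y1, hy⟩ := m4 k' (by omega)
  have h2N : 2 ^ N ≤ k' := by
    have : kf N = 2 * 2 ^ N := by rw [kf, pow_succ]; ring
    have : 0 < 2 ^ N := by positivity
    omega
  rw [← hk'e, ← hend, if_pos h2N] at hy
  have hPk : PH N A B ph (kf N) = PH N A B ph k' + ((A k' : ℤ) • fan N k' + (B k' : ℤ) • (0, 1)) := by
    rw [hk'e, PH, Finset.sum_range_succ, ← add_assoc, ← hk'e, fan_last]; rfl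
  rw [fan_last] at hy
  have yB : (y : ℝ) ≤ B k' := by exact_mod_cast y1
  have hpt' : ∀ i ≤ kf N, ∀ c : ℝ, 0 ≤ c → c ≤ d → ∀ w : ℝ × ℝ, nr (cst N) (cR (PH N A B ph i) + w + c • (1, 0)) ((n:ℝ) • q i + w) := by
    intro i hi c hc0 hcd w
    obtain ⟨_, h1, h2⟩ := hPH i hi
    have hi' : (i:ℝ) * fanW N ≤ kf N * fanW N := by gcongr
    simp only [Prod.fst_sub, Prod.snd_sub, Prod.fst_add, Prod.snd_add, cR_fst, cR_snd, Prod.smul_fst, Prod.smul_snd, smul_eq_mul, nr, cst] at h1 h2 ⊢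
    rw [abs_le] at h1 h2
    rw [hph1] at h1
    rw [hph2] at h2
    have hkW : 0 ≤ kf N * fanW N := by positivity
    constructor <;> rw [abs_le] <;> constructor <;> linarith
  -- fan vertices are close to K0
  have qd : ∀ i < kf N, |((n:ℝ) • q (i+1) - (n:ℝ) • q i).1| ≤ n * (2 * M) ∧ |((n:ℝ) • q (i+1) - (n:ℝ) • q i).2| ≤ n * (2 * M) := by
    intro i hi
    have t1 := hM _ (hqK i hi.le)
    have t2 := hM _ (hqK (i+1) hi)
    have : ∀ u v : ℝ, |u| ≤ M → |v| ≤ M → |n * u - n * v| ≤ n * (2 * M) := by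
      intro u v hu hv
      rw [← mul_sub, abs_mul, abs_of_pos hn']
      gcongr
      exact (abs_sub _ _).trans (by linarith)
    exact ⟨this _ _ t2.1 t1.1, this _ _ t2.2 t1.2⟩
  have hsub : ∀ i, (n:ℝ) • q (i+1) - (n:ℝ) • q i = (n:ℝ) • (q (i+1) - q i) := fun i => by rw [smul_sub]
  have base : ∀ i < kf N, ∀ x y : ℝ, 0 ≤ x → x ≤ n * al N q i → 0 ≤ y → y ≤ n * be N q i → ∃ z ∈ K0, 
      nr (n * (2 * M) / (N+1)) ((n:ℝ) • q i + (x • cR (fan N i) + y • cR (fan N (i+1)))) ((n:ℝ) • z) := by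
    intro i hi x y hx hx' hy hy'
    obtain ⟨τ, t0, t1, t2⟩ := seg_close (p := (n:ℝ) • q i) (q := (n:ℝ) • q (i+1)) hi hx (by rw [hsub, dt_smul_left]; exact hx') hy (by rw [hsub, dt_smul_right]; exact hy') (qd i hi).1 (qd i hi).2
    refine ⟨q i + τ • (q (i+1) - q i), conv_pt hK0 (hqK i hi.le) (hqK (i+1) hi) t0 t1, ?_⟩
    convert t2 using 1; module
  have hfan : ∀ i ≤ kf N, ∃ z ∈ K0, nr (n * (2 * M) / (N+1) + cst N) (cR (VV L m (cR (fan N i)))) ((n:ℝ) • z) := by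
    intro i hi
    rcases Nat.eq_zero_or_pos i with h | h
    · subst h
      rw [VV_start N L m1, hL]
      obtain ⟨z, hz, hz'⟩ := base 0 hk x0 0 (by exact_mod_cast x0a) ((by exact_mod_cast x0b : (x0:ℝ) ≤ A 0).trans (A1 0 hk)) le_rfl 
        (by have := (hq 0 hk).2; positivity)
      refine ⟨z, hz, ?_⟩
      have h1 := hpt' 0 (by omega) 0 le_rfl (by positivity) ((x0:ℝ) • cR (fan N 0) + (0:ℝ) • cR (fan N (0+1)))
      have h2 := nr_tri h1 hz'
      rw [add_comm]
      convert h2 using 1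
      have : PH N A B ph 0 = ph := by simp [PH]
      rw [this, cR_add]
      ext <;> simp
    · obtain ⟨j, rfl⟩ : ∃ j, i = j + 1 := ⟨i - 1, by omega⟩
      obtain ⟨y, y0, y1, hy⟩ := m4 j hi
      rw [hy]
      obtain ⟨z, hz, hz'⟩ := base j hi (A j) y (by positivity) (A1 j hi) (by exact_mod_cast y0) ((by exact_mod_cast y1 : (y:ℝ) ≤ B j).trans (B1 j hi))
      refine ⟨z, hz, ?_⟩
      have h1 := hpt' j (by omega) (if 2 ^ N ≤ j then d else 0) (by split_ifs <;> positivity) (by split_ifs <;> simp) ((A j:ℝ) • cR (fan N j) + (y:ℝ) • cR (fan N (j+1)))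
      have h2 := nr_tri h1 hz'
      rw [add_comm]
      convert h2 using 1
      rw [cR_add, cR_add, cR_add]
      split_ifs <;> ext <;> simp <;> ring
  refine ⟨m, L, m1, m2, ?_, ?_, ?_, ?_, ?_⟩
  · rw [hL, fan_zero, ← hph1]; simp
  · have : (L.2 : ℝ) = ph.2 - x0 := by rw [hL, fan_zero]; simp; ring
    rw [this, hph2]
    have : (0:ℝ) ≤ x0 := by exact_mod_cast x0a
    have : 0 ≤ kf N * fanW N := by positivity
    linarith
  · have t := congrArg Prod.fst hy
    have t' := congrArg Prod.fst hPk
    simp only [Prod.fst_add, Prod.smul_fst, smul_eq_mul, mul_zero, mul_one] at t t' ⊢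
    rw [t]; linarith
  · have t := congrArg Prod.snd hy
    have t' := congrArg Prod.snd hPk
    simp only [Prod.snd_add, Prod.smul_snd, smul_eq_mul, mul_zero, mul_one] at t t' ⊢
    have := (abs_le.mp P2.2).2
    simp only [Prod.snd_sub, cR_snd, Prod.smul_snd, smul_eq_mul] at this
    have t2 : (L + tot m).2 ≤ (PH N A B ph (kf N)).2 := by rw [Prod.snd_add, t, t']; linarith
    have t3 : ((L + tot m).2 : ℝ) ≤ (PH N A B ph (kf N)).2 := by exact_mod_cast t2
    rw [Prod.snd_add] at t3
    rw [hph2] at this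
    linarith
  · intro a ha
    obtain ⟨i, hi, s1, s2⟩ := exists_secR N ha
    obtain ⟨v1, v2, v3, v4⟩ := VV_sector hi L m1 ha s1 s2
    obtain ⟨z, hz, hz'⟩ := hfan i hi.le
    obtain ⟨w, hw, hw'⟩ := hfan (i+1) hi
    obtain ⟨U, hU⟩ : ∃ U, U = VV L m (cR (fan N i)) := ⟨_, rfl⟩
    obtain ⟨V, hV⟩ : ∃ U, U = VV L m (cR (fan N (i+1))) := ⟨_, rfl⟩
    rw [← hU] at v1 v2 hz'
    rw [← hV] at v3 v4 hw'
    obtain ⟨Y, hY⟩ : ∃ U, U = VV L m a := ⟨_, rfl⟩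
    rw [← hY] at v1 v2 v3 v4 ⊢
    obtain ⟨ee, hee⟩ : ∃ ee, ee = n * (2 * M) / (N+1) + cst N := ⟨_, rfl⟩
    rw [← hee] at hz' hw'
    have v5 : dt (Y - U) (fan N (i+1)) ≤ dt (V - U) (fan N (i+1)) := by
      have : V - U = (Y - U) + (V - Y) := by abel
      rw [this, dt_add_left]; linarith
    have v6 : dt (fan N i) (Y - U) ≤ dt (fan N i) (V - U) := by
      have : V - U = (Y - U) + (V - Y) := by abel
      rw [this, dt_add_right]; linarith
    have hN1 : (0:ℝ) < N + 1 := by positivity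
    have hMN : M / (N + 1) ≤ M := div_le_self hM0 (by linarith [(Nat.cast_nonneg N : (0:ℝ) ≤ N)])
    have hcn : cst N ≤ n * (r / 4) := by rw [div_le_iff₀ hn'] at hc; linarith
    have hee1 : ee ≤ n * (2 * (M / (N+1)) + r / 4) := by
      rw [hee]; have : n * (2 * M) / (N+1) = n * (2 * (M / (N+1))) := by ring
      rw [this]; linarith
    have hee2 : ee ≤ n * (2 * M + 1) := hee1.trans (by gcongr; linarith)
    have bd : ∀ u v s t : ℝ, |u - n * s| ≤ ee → |v - n * t| ≤ ee → |s| ≤ M → |t| ≤ M → |v - u| ≤ n * (6 * M + 2) := by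
      intro u v s t h1 h2 h3 h4
      have : v - u = (v - n * t) - (u - n * s) + n * (t - s) := by ring
      rw [this]
      have h5 : |n * (t - s)| ≤ n * (2 * M) := by
        rw [abs_mul, abs_of_pos hn']; gcongr; exact (abs_sub _ _).trans (by linarith)
      calc _ ≤ |v - n * t - (u - n * s)| + |n * (t - s)| := abs_add_le _ _
        _ ≤ (|v - n * t| + |u - n * s|) + |n * (t - s)| := by gcongr; exact abs_sub _ _
        _ ≤ _ := by linarith
    have b1 := bd _ _ _ _ hz'.1 hw'.1 (hM z hz).1 (hM w hw).1
    have b2 := bd _ _ _ _ hz'.2 hw'.2 (hM z hz).2 (hM w hw).2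
    obtain ⟨τ, t0, t1, t2⟩ := seg_close (p := cR U) (q := cR V) hi (x := ((dt (Y - U) (fan N (i+1)) : ℤ) : ℝ)) (y := ((dt (fan N i) (Y - U) : ℤ) : ℝ))
      (by exact_mod_cast v1) (by rw [← cR_sub, dt_cR]; exact_mod_cast v5) (by exact_mod_cast v2) (by rw [← cR_sub, dt_cR]; exact_mod_cast v6) b1 b2
    refine ⟨z + τ • (w - z), conv_pt hK0 hz hw t0 t1, ?_⟩
    have h7 := nr_tri t2 (nr_conv t0 t1 hz' hw')
    have e7 : cR U + (((dt (Y - U) (fan N (i+1)) : ℤ) : ℝ) • cR (fan N i) + ((dt (fan N i) (Y - U) : ℤ) : ℝ) • cR (fan N (i+1))) = cR Y := by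
      have := sec_coordR hi (cR (Y - U))
      rw [dt_cR, dt_cR] at this
      rw [← this, cR_sub]; abel
    have e8 : (n:ℝ) • z + τ • ((n:ℝ) • w - (n:ℝ) • z) = (n:ℝ) • (z + τ • (w - z)) := by module
    rw [e7, e8] at h7
    have h9 : n * (6 * M + 2) / (N + 1) + ee ≤ n * r := by
      have : n * (6 * M + 2) / (N + 1) = n * (6 * (M / (N+1)) + 2 / (N+1)) := by field_simp
      rw [this]
      have h10 : (8 * M + 4) / (N + 1) = 8 * (M / (N+1)) + 4 / (N+1) := by field_simp
      have h11 : 0 < 2 / ((N:ℝ)+1) := by positivity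
      have h12 : (4:ℝ) / (N+1) = 2 * (2 / (N+1)) := by ring
      rw [h10, h12] at hN
      have : n * (6 * (M / (N+1)) + 2 / (N+1)) + n * (2 * (M / (N+1)) + r / 4) ≤ n * r := by
        rw [← mul_add]; gcongr; linarith
      linarith
    have h13 := nr_mono h9 h7
    have fin : ∀ u s : ℝ, |u - n * s| ≤ n * r → |1 / n * u - s| ≤ r := by
      intro u s h
      have : 1 / n * u - s = (1 / n) * (u - n * s) := by field_simp
      rw [this, abs_mul, abs_of_pos (by positivity), one_div, inv_mul_le_iff₀ hn']; exact h
    exact ⟨fin _ _ h13.1, fin _ _ h13.2⟩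

end BL

end Part12

section Part13
set_option linter.all false
open scoped Classical

/-! ## Part 2h: lower count -/
namespace BL
open Topology

lemma cnt_floor (A B ε : ℝ) (hA : 0 ≤ A) (hB : 0 ≤ B) (hε : 0 < ε) : ∀ᶠ n : ℕ in atTop,
    3 * cb (kap / 4) * cb (4 * (A * B)) * cb n ^ 2 - ε * cb n ^ 2 ≤ Real.log (cnt ⌊n * A⌋₊ ⌊n * B⌋₊) := by
  have hk := kap_pos
  filter_upwards [cnt_asymp_lower (A + B + 1) (ε / 2) (by positivity) (by positivity), eventually_gt_atTop 0, 
    cb_large (6 * cb (kap * (A + B)) / ε)] with n h hn hl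
  have hn' : (0:ℝ) < n := by exact_mod_cast hn
  have hnA : (0:ℝ) ≤ n * A := by positivity
  have hnB : (0:ℝ) ≤ n * B := by positivity
  have f1 := Nat.floor_le hnA
  have f2 := Nat.floor_le hnB
  have g1 := (Nat.lt_floor_add_one (n * A : ℝ)).le
  have g2 := (Nat.lt_floor_add_one (n * B : ℝ)).le
  have h1 := h ⌊n * A⌋₊ ⌊n * B⌋₊ (by nlinarith) (by nlinarith)
  have h2 : cb (kap * (n * A * (n * B))) ≤ cb (kap * ((⌊n * A⌋₊ : ℝ) * ⌊n * B⌋₊)) + cb (kap * (A + B) * n) := by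
    refine le_trans (cb_mono (by positivity) ?_) (cb_add_le (by positivity) (by positivity))
    have : (n:ℝ) * A * (n * B) ≤ (⌊n * A⌋₊ : ℝ) * ⌊n * B⌋₊ + (A + B) * n := by
      obtain ⟨a, ha⟩ : ∃ a : ℝ, a = ⌊n * A⌋₊ := ⟨_, rfl⟩
      obtain ⟨b, hb⟩ : ∃ a : ℝ, a = ⌊n * B⌋₊ := ⟨_, rfl⟩
      have a0 : 0 ≤ a := by rw [ha]; positivity
      have b0 : 0 ≤ b := by rw [hb]; positivity
      rw [← ha] at f1 g1 ⊢; rw [← hb] at f2 g2 ⊢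
      nlinarith [mul_nonneg (show 0 ≤ 1 - (n*A - a) by linarith) hnB, mul_nonneg a0 (show 0 ≤ 1 - (n * B - b) by linarith)]
    calc _ ≤ kap * ((⌊n * A⌋₊ : ℝ) * ⌊n * B⌋₊ + (A + B) * n) := by gcongr
      _ = _ := by ring
  have e1 : cb (kap * (n * A * (n * B))) = cb (kap / 4) * cb (4 * (A * B)) * cb n ^ 2 := by
    rw [← cb_sq hn'.le, ← cb_mul (by positivity) (by positivity), ← cb_mul (by positivity) (by positivity)]
    congr 1; ring
  rw [e1, cb_mul (by positivity) hn'.le] at h2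
  have hc := cb_pos hn'
  rw [div_lt_iff₀ hε] at hl
  have := mul_le_mul_of_nonneg_right hl.le hc.le
  nlinarith

lemma prod_floor (N : ℕ) {q : ℕ → ℝ × ℝ} (hq : Dat N q) (ε : ℝ) (hε : 0 < ε) : ∀ᶠ n : ℕ in atTop,
    (3 * cb (kap / 4) * TT N q - ε) * cb n ^ 2 ≤ 
      Real.log (∏ i ∈ Finset.range (kf N), (cnt ⌊n * al N q i⌋₊ ⌊n * be N q i⌋₊ : ℝ)) := by
  have hk : (0:ℝ) < kf N := by exact_mod_cast kf_pos N
  have : ∀ᶠ n : ℕ in atTop, ∀ i ∈ Finset.range (kf N), 3 * cb (kap / 4) * cb (4 * (al N q i * be N q i)) * cb n ^ 2 - ε / kf N * cb n ^ 2 ≤ Real.log (cnt ⌊n * al N q i⌋₊ ⌊n * be N q i⌋₊) := by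
    rw [Filter.eventually_all_finset]
    intro i hi
    have := hq i (Finset.mem_range.mp hi)
    exact cnt_floor _ _ _ this.1 this.2 (by positivity)
  filter_upwards [this] with n h
  rw [Real.log_prod (fun i _ => by have := cnt_pos ⌊n * al N q i⌋₊ ⌊n * be N q i⌋₊; positivity)]
  refine le_trans (le_of_eq ?_) (Finset.sum_le_sum h)
  rw [Finset.sum_sub_distrib, ← Finset.sum_mul, ← Finset.mul_sum, Finset.sum_const, Finset.card_range, TT]
  simp; field_simp

lemma rf_convex {K : Set (ℝ × ℝ)} (hK : Convex ℝ K) : Convex ℝ {z | rf z ∈ K} := by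
  intro x hx y hy s t hs ht hst
  simp only [mem_setOf_eq] at hx hy ⊢
  have : rf (s • x + t • y) = s • rf x + t • rf y := by ext <;> simp; ring
  rw [this]; exact hK hx hy hs ht hst

def exF {N : ℕ} (μ : Fin (kf N) → (ℕ × ℕ →₀ ℕ)) (i : ℕ) : ℕ × ℕ →₀ ℕ := if h : i < kf N then μ ⟨i, h⟩ else 0

theorem lower_L (N : ℕ) {K K0 : Set (ℝ × ℝ)} (hK0 : Convex ℝ K0) {M r : ℝ} (hM : ∀ z ∈ K0, |z.1| ≤ M ∧ |z.2| ≤ M) (hr : 0 < r) (hr1 : r ≤ 1)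
    (hN : (8 * M + 4) / (N + 1) ≤ r / 2) (hKK : ∀ z ∈ K0, ∀ w, nr r w z → w ∈ K) {q q' : ℕ → ℝ × ℝ} (hg : GoodPair N K0 q q')
    {ε : ℝ} (hε : 0 < ε) : ∀ᶠ n : ℕ in atTop, (LPn n K).Finite → (3 * cb (kap / 4) * (TT N q + TT N q') - ε) * cb n ^ 2 ≤ Real.log ((LPn n K).ncard) := by
  obtain ⟨hq, hq', hqK, hqK', g1, g2, g3, g4⟩ := hg
  have hcs : ∀ᶠ n : ℕ in atTop, cst N / n ≤ r / 4 := by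
    have : Tendsto (fun n : ℕ => cst N / (n:ℝ)) atTop (𝓝 0) := tendsto_const_div_atTop_nhds_zero_nat _
    exact this.eventually (eventually_le_nhds (by positivity))
  filter_upwards [hcs, eventually_gt_atTop 0, prod_floor N hq (ε / 2) (by positivity), prod_floor N hq' (ε / 2) (by positivity)] with n hc hn h1 h2 hfin
  have hn' : (0:ℝ) < n := by exact_mod_cast hn
  obtain ⟨T, hT⟩ : ∃ T : (ℕ → ℝ × ℝ) → Finset (Fin (kf N) → (ℕ × ℕ →₀ ℕ)), T = fun q => Fintype.piFinset (fun i : Fin (kf N) => (CS_finite ⌊n * al N q i⌋₊ ⌊n * be N q i⌋₊).toFinset) := ⟨_, rfl⟩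
  have hTc : ∀ q, (T q).card = ∏ i ∈ Finset.range (kf N), cnt ⌊n * al N q i⌋₊ ⌊n * be N q i⌋₊ := by
    intro q
    rw [hT, Fintype.card_piFinset, Finset.prod_range]
    apply Finset.prod_congr rfl
    intro i _
    rw [cnt, Set.ncard_eq_toFinset_card _ (CS_finite _ _)]
  have hTm : ∀ q, ∀ μ ∈ T q, ∀ i < kf N, exF μ i ∈ CS ⌊n * al N q i⌋₊ ⌊n * be N q i⌋₊ := by
    intro q μ hμ i hi
    rw [hT, Fintype.mem_piFinset] at hμ
    have := hμ ⟨i, hi⟩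
    rw [Set.Finite.mem_toFinset] at this
    rw [exF, dif_pos hi]; exact this
  have S1 := fun μ (hμ : μ ∈ T q) => side_chain N hK0 hM hr hr1 hN hq hqK hn hc (exF μ) (hTm q μ hμ)
  have S2 := fun μ (hμ : μ ∈ T q') => side_chain N (rf_convex hK0) (M := M) (fun z hz => by have := hM _ hz; rwa [rf_fst, rf_snd, abs_neg] at this) 
    hr hr1 hN hq' hqK' hn hc (exF μ) (hTm q' μ hμ)
  choose! m L a1 a2 a3 a4 a5 a6 a7 using S1
  choose! m' L' b1 b2 b3 b4 b5 b6 b7 using S2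
  have key : (T q ×ˢ T q').card ≤ (LPn n K).ncard := by
    rw [← Set.ncard_coe_finset]
    refine Set.ncard_le_ncard_of_injOn (fun x => convexHull ℝ (cR '' (poly (L x.1) (m x.1) (L' x.2) (m' x.2) : Set (ℤ × ℤ)))) ?_ ?_ hfin
    · rintro ⟨μ, μ'⟩ hx
      rw [Finset.mem_coe, Finset.mem_product] at hx
      obtain ⟨x1, x2⟩ := hx
      refine ⟨_, ?_, rfl, ?_⟩
      · exact ⟨VV (L μ) (m μ) (1, 0), by rw [poly, Finset.mem_union]; left; exact mem_LV.mpr ⟨(1,0), by simp, rfl⟩⟩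
      · intro w hw
        dsimp only at hw
        rw [poly, Finset.mem_union] at hw
        rcases hw with hw | hw
        · obtain ⟨a, ha, rfl⟩ := mem_LV.mp hw
          obtain ⟨z, hz, hz'⟩ := a7 μ x1 a ha
          exact hKK z hz _ hz'
        · rw [Finset.mem_image] at hw
          obtain ⟨w', hw', rfl⟩ := hw
          obtain ⟨a, ha, rfl⟩ := mem_LV.mp hw'
          obtain ⟨z, hz, hz'⟩ := b7 μ' x2 a ha
          refine hKK _ hz _ ?_
          rw [← rf_cR, ← rf_smul]
          refine ⟨hz'.1, ?_⟩
          rw [rf_snd, rf_snd, ← abs_neg]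
          convert hz'.2 using 2; ring
    · have hE : ∀ x ∈ T q, ∀ y ∈ T q', Ends (L x) (m x) (L' y) (m' y) := by
        intro x hx y hy
        refine ⟨by rw [a3 x hx, b3 y hy, g1], ?_, by rw [a5 x hx, b5 y hy, g2], ?_⟩
        · have : ((L x).2 : ℝ) ≤ (-(L' y).2 : ℤ) := by 
            push_cast
            have := mul_le_mul_of_nonneg_left g3 hn'.le
            linarith [a4 x hx, b4 y hy]
          exact_mod_cast this
        · have : ((L x + tot (m x)).2 : ℝ) ≤ (-(L' y + tot (m' y)).2 : ℤ) := by 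
            have := mul_le_mul_of_nonneg_left g4 hn'.le
            have := a6 x hx
            have := b6 y hy
            push_cast at *
            linarith 
          exact_mod_cast this
      rintro ⟨μ, μ'⟩ hx ⟨ν, ν'⟩ hy hh
      rw [Finset.mem_coe, Finset.mem_product] at hx hy
      obtain ⟨e1, e2⟩ := poly_inj (hE _ hx.1 _ hx.2) (a1 _ hx.1) (b1 _ hx.2) (hE _ hy.1 _ hy.2) (a1 _ hy.1) (b1 _ hy.2) hh
      dsimp only at e1 e2 hx hy
      have : μ = ν := by
        funext i
        have t1 := a2 μ hx.1 i i.2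
        have t2 := a2 ν hy.1 i i.2
        rw [e1, t2] at t1
        rw [exF, exF, dif_pos i.2, dif_pos i.2] at t1
        exact t1.symm
      have : μ' = ν' := by
        funext i
        have t1 := b2 μ' hx.2 i i.2
        have t2 := b2 ν' hy.2 i i.2
        rw [e2, t2] at t1
        rw [exF, exF, dif_pos i.2, dif_pos i.2] at t1
        exact t1.symm
      simp [*]
  rw [Finset.card_product, hTc, hTc] at key
  have p1 : (0:ℝ) < (∏ i ∈ Finset.range (kf N), (cnt ⌊n * al N q i⌋₊ ⌊n * be N q i⌋₊ : ℝ)) := Finset.prod_pos fun i _ => by have := cnt_pos ⌊n * al N q i⌋₊ ⌊n * be N q i⌋₊; positivity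
  have p2 : (0:ℝ) < (∏ i ∈ Finset.range (kf N), (cnt ⌊n * al N q' i⌋₊ ⌊n * be N q' i⌋₊ : ℝ)) := Finset.prod_pos fun i _ => by have := cnt_pos ⌊n * al N q' i⌋₊ ⌊n * be N q' i⌋₊; positivity
  have key' : (∏ i ∈ Finset.range (kf N), (cnt ⌊n * al N q i⌋₊ ⌊n * be N q i⌋₊ : ℝ)) * (∏ i ∈ Finset.range (kf N), (cnt ⌊n * al N q' i⌋₊ ⌊n * be N q' i⌋₊ : ℝ)) ≤ ((LPn n K).ncard : ℝ) := by exact_mod_cast key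
  have := Real.log_le_log (mul_pos p1 p2) key'
  rw [Real.log_mul p1.ne' p2.ne'] at this
  linarith

end BL

end Part13

section Part14
set_option linter.all false
open scoped Classical

/-! ## Part 3a: floating bodies in the plane -/
namespace BL
open Topology

def FB (S : Set (ℝ × ℝ)) (δ : ℝ) : Set (ℝ × ℝ) :=
  {z ∈ S | ∀ u v c : ℝ, volume {y ∈ S | c < u * y.1 + v * y.2} ≤ ENNReal.ofReal δ → u * z.1 + v * z.2 ≤ c}

lemma FB_eq (S : Set (ℝ × ℝ)) (δ : ℝ) : FB S δ = S ∩ ⋂ u : ℝ, ⋂ v : ℝ, ⋂ c : ℝ, 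
    ⋂ (_ : volume {y ∈ S | c < u * y.1 + v * y.2} ≤ ENNReal.ofReal δ), {z : ℝ × ℝ | u * z.1 + v * z.2 ≤ c} := by
  ext z; simp [FB]

lemma hp_convex (u v c : ℝ) : Convex ℝ {z : ℝ × ℝ | u * z.1 + v * z.2 ≤ c} := by
  intro x hx y hy s t hs ht hst
  simp only [mem_setOf_eq, Prod.fst_add, Prod.snd_add, Prod.smul_fst, Prod.smul_snd, smul_eq_mul] at hx hy ⊢
  calc _ = s * (u * x.1 + v * x.2) + t * (u * y.1 + v * y.2) := by ring
    _ ≤ s * c + t * c := by gcongr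
    _ = c := by rw [← add_mul, hst, one_mul]

lemma FB_closed {S : Set (ℝ × ℝ)} (hS : IsClosed S) (δ : ℝ) : IsClosed (FB S δ) := by
  rw [FB_eq]
  refine hS.inter (isClosed_iInter fun u => isClosed_iInter fun v => isClosed_iInter fun c => isClosed_iInter fun _ => ?_)
  exact isClosed_le (by fun_prop) continuous_const

lemma FB_convex {S : Set (ℝ × ℝ)} (hS : Convex ℝ S) (δ : ℝ) : Convex ℝ (FB S δ) := by
  rw [FB_eq]
  exact hS.inter (convex_iInter fun u => convex_iInter fun v => convex_iInter fun c => convex_iInter fun _ => hp_convex u v c)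

lemma FB_sub (S : Set (ℝ × ℝ)) (δ : ℝ) : FB S δ ⊆ S := fun _ h => h.1

lemma rf_mp : MeasurePreserving (rf : ℝ × ℝ → ℝ × ℝ) volume volume := by
  have : (rf : ℝ × ℝ → ℝ × ℝ) = Prod.map id Neg.neg := by ext x <;> simp
  rw [this]
  exact (MeasurePreserving.id volume).prod (Measure.measurePreserving_neg volume)

def rfS (S : Set (ℝ × ℝ)) : Set (ℝ × ℝ) := {z | rf z ∈ S}

lemma rf_emb : MeasurableEmbedding (rf : ℝ × ℝ → ℝ × ℝ) := by
  have hc : Continuous (rf : ℝ × ℝ → ℝ × ℝ) := by unfold rf; fun_prop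
  exact (Homeomorph.mk (Equiv.mk (rf : ℝ × ℝ → ℝ × ℝ) rf rf_rf rf_rf) hc hc).measurableEmbedding

lemma FB_rf (S : Set (ℝ × ℝ)) (δ : ℝ) (z : ℝ × ℝ) : z ∈ FB (rfS S) δ ↔ rf z ∈ FB S δ := by
  have key : ∀ u v c : ℝ, volume {y ∈ rfS S | c < u * y.1 + v * y.2} = volume {y ∈ S | c < u * y.1 + -v * y.2} := by
    intro u v c
    rw [← rf_mp.measure_preimage_emb rf_emb]
    congr 1; ext y; simp [rfS]
  constructor
  · rintro ⟨h1, h2⟩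
    refine ⟨h1, fun u v c h => ?_⟩
    have := h2 u (-v) c (by rw [key, neg_neg]; exact h)
    rw [rf_fst, rf_snd]; linarith
  · rintro ⟨h1, h2⟩
    refine ⟨h1, fun u v c h => ?_⟩
    have := h2 u (-v) c (by rw [← key]; exact h)
    rw [rf_fst, rf_snd] at this; linarith

structure Rg (S : Set (ℝ × ℝ)) (a b : ℝ) (f g : ℝ → ℝ) : Prop where
  hab : a < b
  mem : ∀ x y, (x, y) ∈ S ↔ x ∈ Icc a b ∧ f x ≤ y ∧ y ≤ g x
  le : ∀ x ∈ Icc a b, f x ≤ g x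
  lt : ∀ x ∈ Ioo a b, f x < g x
  cv : Convex ℝ S
  cp : IsCompact S

namespace Rg
variable {S : Set (ℝ × ℝ)} {a b : ℝ} {f g : ℝ → ℝ}

lemma refl (R : Rg S a b f g) : Rg (rfS S) a b (fun x => -g x) (fun x => -f x) where
  hab := R.hab
  mem x y := by
    have := R.mem x (-y)
    simp only [rfS, mem_setOf_eq, rf] at this ⊢
    rw [this]
    constructor
    · rintro ⟨h1, h2, h3⟩; exact ⟨h1, by linarith, by linarith⟩
    · rintro ⟨h1, h2, h3⟩; exact ⟨h1, by linarith, by linarith⟩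
  le x hx := neg_le_neg (R.le x hx)
  lt x hx := neg_lt_neg (R.lt x hx)
  cv := rf_convex R.cv
  cp := by
    have : rfS S = rf '' S := by
      ext z; constructor
      · intro h; exact ⟨rf z, h, rf_rf z⟩
      · rintro ⟨w, hw, rfl⟩; simpa [rfS] using hw
    rw [this]
    exact R.cp.image (by unfold rf; fun_prop)

lemma cvx (R : Rg S a b f g) : ConvexOn ℝ (Icc a b) f := by
  refine ⟨convex_Icc a b, fun x hx y hy s t hs ht hst => ?_⟩
  have h1 := (R.mem x (f x)).mpr ⟨hx, le_rfl, R.le x hx⟩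
  have h2 := (R.mem y (f y)).mpr ⟨hy, le_rfl, R.le y hy⟩
  have := R.cv h1 h2 hs ht hst
  exact ((R.mem _ _).mp this).2.1

lemma ccv (R : Rg S a b f g) : ConvexOn ℝ (Icc a b) (fun x => -g x) := R.refl.cvx

lemma cont (R : Rg S a b f g) : ContinuousOn f (Ioo a b) :=
  (R.cvx.subset Ioo_subset_Icc_self (convex_Ioo a b)).continuousOn isOpen_Ioo

lemma mid (R : Rg S a b f g) {x s : ℝ} (h1 : x + s ∈ Icc a b) (h2 : x - s ∈ Icc a b) : 0 ≤ (f (x+s) + f (x-s)) / 2 - f x := by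
  have := R.cvx.2 h1 h2 (show (0:ℝ) ≤ 1/2 by norm_num) (show (0:ℝ) ≤ 1/2 by norm_num) (by norm_num)
  simp only [smul_eq_mul] at this
  rw [show 1/2 * (x + s) + 1/2 * (x - s) = x by ring] at this
  linarith

lemma width (R : Rg S a b f g) {x s : ℝ} (hx : x ∈ Ioo a b) (h1 : |s| ≤ (x - a) / 2) (h2 : |s| ≤ (b - x) / 2) : (g x - f x) / 2 ≤ g (x+s) - f (x+s) := by
  have hs := abs_le.mp h1
  have hs2 := abs_le.mp h2
  have m1 : x + s ∈ Icc a b := ⟨by linarith [hx.1], by linarith [hx.2]⟩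
  have m2 : x + 2 * s ∈ Icc a b := ⟨by linarith [hx.1], by linarith [hx.2]⟩
  have m0 : x ∈ Icc a b := Ioo_subset_Icc_self hx
  have A := R.cvx.2 m0 m2 (show (0:ℝ) ≤ 1/2 by norm_num) (show (0:ℝ) ≤ 1/2 by norm_num) (by norm_num)
  have B := R.ccv.2 m0 m2 (show (0:ℝ) ≤ 1/2 by norm_num) (show (0:ℝ) ≤ 1/2 by norm_num) (by norm_num)
  simp only [smul_eq_mul] at A B
  rw [show 1/2 * x + 1/2 * (x + 2 * s) = x + s by ring] at A B
  linarith [R.le _ m2]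

/-- points not cut off -/
lemma NC (R : Rg S a b f g) {x t h δ : ℝ} (q : ℝ → ℝ) (hx : x ∈ Ioo a b) (ht : 0 < t) (ht1 : t ≤ (x - a) / 2) (ht2 : t ≤ (b - x) / 2)
    (hh : h ≤ (g x - f x) / 4) (hq : Continuous q) (hev : ∀ s, q (-s) = q s) (hq0 : ∀ s, |s| < t → 0 ≤ q s)
    (hD : ∀ s, |s| < t → q s + ((f (x+s) + f (x-s)) / 2 - f x) ≤ h) (hδ : 0 ≤ δ) (hI : δ < ∫ s in (-t)..t, q s) : (x, f x + h) ∈ FB S δ := by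
  obtain ⟨c, hc⟩ : ∃ c : ℝ → ℝ, c = fun s => (f (x+s) - f (x-s)) / 2 := ⟨_, rfl⟩
  obtain ⟨U, hU⟩ : ∃ U, U = regionBetween (fun s => c s - q s) (fun s => c s + q s) (Ioo (-t) t) := ⟨_, rfl⟩
  have rng : ∀ s, |s| < t → x + s ∈ Icc a b ∧ x - s ∈ Icc a b := by
    intro s hs
    have := abs_lt.mp hs
    have := hx.1; have := hx.2
    exact ⟨⟨by linarith, by linarith⟩, by linarith, by linarith⟩
  have memU : ∀ z : ℝ × ℝ, z ∈ U ↔ |z.1| < t ∧ |z.2 - c z.1| < q z.1 := by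
    intro z
    rw [hU, regionBetween, mem_setOf_eq, mem_Ioo, mem_Ioo, abs_lt, abs_lt]
    constructor
    · rintro ⟨h1, h2, h3⟩; exact ⟨h1, by linarith, by linarith⟩
    · rintro ⟨h1, h2, h3⟩; exact ⟨h1, by linarith, by linarith⟩
  have sym : ∀ z, z ∈ U → -z ∈ U := by
    intro z hz
    rw [memU] at hz ⊢
    refine ⟨by simpa using hz.1, ?_⟩
    have : c (-z.1) = - c z.1 := by rw [hc]; simp only [sub_neg_eq_add, ← sub_eq_add_neg]; ring
    rw [Prod.fst_neg, Prod.snd_neg, this, hev, ← abs_neg]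
    convert hz.2 using 2; ring
  have sub : ∀ z, z ∈ U → (x, f x + h) + z ∈ S := by
    intro z hz
    rw [memU] at hz
    obtain ⟨h1, h23⟩ := hz
    obtain ⟨h2, h3⟩ := abs_lt.mp h23
    obtain ⟨r1, r2⟩ := rng _ h1
    have e1 := hD _ h1
    have e2 := R.mid r1 r2
    have e3 := R.width (s := z.1) hx (by linarith) (by linarith)
    have e4 : c z.1 = (f (x+z.1) - f (x-z.1)) / 2 := by rw [hc]
    show (x + z.1, f x + h + z.2) ∈ S
    rw [R.mem]
    exact ⟨r1, by linarith, by linarith⟩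
  have cc : ContinuousOn c (Icc (-t) t) := by
    rw [hc]
    have k1 : ContinuousOn (fun s => f (x + s)) (Icc (-t) t) := R.cont.comp (by fun_prop) (fun s hs => 
      ⟨by linarith [hs.1, hx.1], by linarith [hs.2, hx.2]⟩)
    have k2 : ContinuousOn (fun s => f (x - s)) (Icc (-t) t) := R.cont.comp (by fun_prop) (fun s hs => 
      ⟨by linarith [hs.2, hx.1], by linarith [hs.1, hx.2]⟩)
    exact (k1.sub k2).div_const _
  have i1 : IntegrableOn (fun s => c s - q s) (Ioo (-t) t) := ((cc.sub hq.continuousOn).integrableOn_compact isCompact_Icc).mono_set Ioo_subset_Icc_self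
  have i2 : IntegrableOn (fun s => c s + q s) (Ioo (-t) t) := ((cc.add hq.continuousOn).integrableOn_compact isCompact_Icc).mono_set Ioo_subset_Icc_self
  have vU : volume U = ENNReal.ofReal (2 * ∫ s in (-t)..t, q s) := by
    have := volume_regionBetween_eq_integral i1 i2 measurableSet_Ioo (fun s hs => by
      have := hq0 s (abs_lt.mpr hs); linarith)
    rw [hU, Measure.volume_eq_prod, this, intervalIntegral.integral_of_le (by linarith), integral_Ioc_eq_integral_Ioo, ← integral_const_mul]
    congr 2; ext s; simp; ring
  refine ⟨?_, fun u v k hk => ?_⟩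
  · have h0 := hD 0 (by simpa using ht)
    have h1 := hq0 0 (by simpa using ht)
    have h2 := R.lt x hx
    simp only [add_zero, sub_zero] at h0
    rw [R.mem]
    exact ⟨Ioo_subset_Icc_self hx, by linarith, by linarith⟩
  · by_contra hcon
    push_neg at hcon
    obtain ⟨V, hV⟩ : ∃ V, V = U ∩ {z : ℝ × ℝ | 0 ≤ u * z.1 + v * z.2} := ⟨_, rfl⟩
    have h1 : volume U ≤ volume V + volume V := by
      have : U ⊆ V ∪ (Neg.neg ⁻¹' V) := by
        intro z hz
        rcases le_total 0 (u * z.1 + v * z.2) with hs | hs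
        · left; rw [hV]; exact ⟨hz, hs⟩
        · right; rw [hV]; exact ⟨sym z hz, by simp only [mem_setOf_eq, Prod.fst_neg, Prod.snd_neg]; linarith⟩
      refine (measure_mono this).trans ((measure_union_le _ _).trans ?_)
      rw [Measure.measure_preimage_neg]
    have h2 : volume V ≤ volume {y ∈ S | k < u * y.1 + v * y.2} := by
      rw [← measure_preimage_add volume (x, f x + h) {y ∈ S | k < u * y.1 + v * y.2}]
      apply measure_mono
      intro z hz
      rw [hV] at hz
      have := hz.2
      refine ⟨sub z hz.1, ?_⟩
      simp only [mem_setOf_eq, Prod.fst_add, Prod.snd_add] at this hcon ⊢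
      linarith
    have h3 : ENNReal.ofReal (2 * ∫ s in (-t)..t, q s) ≤ ENNReal.ofReal (2 * δ) := by
      rw [← vU]
      refine h1.trans ((add_le_add (h2.trans hk) (h2.trans hk)).trans ?_)
      rw [← ENNReal.ofReal_add hδ hδ, two_mul]
    rw [ENNReal.ofReal_le_ofReal_iff (by positivity)] at h3
    linarith

end Rg
end BL

end Part14

section Part15
set_option linter.all false
open scoped Classical

/-! ## Part 3b: cut points and local asymptotics -/
namespace BL
open Topology

lemma int_par (m K x c : ℝ) : ∫ s in (x - c)..(x + c), (m - K * (s - x) ^ 2 / 2) = 2 * m * c - K * c ^ 3 / 3 := by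
  have h : ∀ s ∈ uIcc (x - c) (x + c), HasDerivAt (fun s => m * (s - x) - K * (s - x) ^ 3 / 6) (m - K * (s - x) ^ 2 / 2) s := by
    intro s _
    have h1 : HasDerivAt (fun s : ℝ => s - x) 1 s := (hasDerivAt_id s).sub_const x
    have h2 := ((h1.const_mul m).sub (((h1.pow 3).const_mul K).div_const 6))
    exact h2.congr_deriv (by norm_num; ring)
  rw [intervalIntegral.integral_eq_sub_of_hasDerivAt h (Continuous.intervalIntegrable (by fun_prop) _ _)]
  ring

namespace Rg
variable {S : Set (ℝ × ℝ)} {a b : ℝ} {f g : ℝ → ℝ}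

/-- points cut off -/
lemma cut (R : Rg S a b f g) {x p K u0 h δ : ℝ} (hx : x ∈ Ioo a b) (hK : 0 < K) (hu0 : 0 < u0)
    (hT : ∀ u, |u| ≤ u0 → x + u ∈ Icc a b ∧ f x + p * u + K * u ^ 2 / 2 ≤ f (x + u)) (h0 : 0 ≤ h) (hh : h < K * u0 ^ 2 / 2)
    (hδ : 32 * h ^ 3 < 9 * K * δ ^ 2) (hδ0 : 0 ≤ δ) : ∀ y < f x + h, (x, y) ∉ FB S δ := by
  intro y hy hmem
  obtain ⟨c, hc⟩ : ∃ c, c = Real.sqrt (2 * h / K) := ⟨_, rfl⟩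
  have hc0 : 0 ≤ c := by rw [hc]; positivity
  have hc2 : K * c ^ 2 = 2 * h := by rw [hc, Real.sq_sqrt (by positivity)]; field_simp
  have hcd : 4 / 3 * h * c < δ := by
    by_contra hcon; push_neg at hcon
    have h1 : δ ^ 2 ≤ (4 / 3 * h * c) ^ 2 := by gcongr
    have h2 : K * δ ^ 2 ≤ K * (4 / 3 * h * c) ^ 2 := by gcongr
    have h3 : K * (4 / 3 * h * c) ^ 2 = 16 / 9 * h ^ 2 * (K * c ^ 2) := by ring
    rw [h3, hc2] at h2
    linarith
  obtain ⟨η, hη⟩ : ∃ η, η = (δ - 4 / 3 * h * c) / (2 * c + 1) := ⟨_, rfl⟩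
  have hη0 : 0 < η := by rw [hη]; apply div_pos <;> linarith
  have hη1 : 2 * c * η ≤ δ - 4 / 3 * h * c := by
    have : (2 * c + 1) * η = δ - 4 / 3 * h * c := by rw [hη]; field_simp
    linarith
  have hcap : volume {z ∈ S | p * x - f x - h < p * z.1 + (-1) * z.2} ≤ ENNReal.ofReal δ := by
    have hsub : {z ∈ S | p * x - f x - h < p * z.1 + (-1) * z.2} ⊆ 
        regionBetween (fun s => f x + p * (s - x) + K * (s - x) ^ 2 / 2 - η) (fun s => f x + p * (s - x) + h) (Icc (x - c) (x + c)) := by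
      rintro ⟨s, y'⟩ ⟨hs1, hs2⟩
      simp only at hs2
      obtain ⟨m1, m2, m3⟩ := (R.mem _ _).mp hs1
      have hloc : |s - x| ≤ u0 := by
        by_contra hcon; push_neg at hcon
        have hpos : 0 < |s - x| := hu0.trans hcon
        obtain ⟨θ, hθ⟩ : ∃ θ, θ = u0 / |s - x| := ⟨_, rfl⟩
        have t0 : 0 ≤ θ := by rw [hθ]; positivity
        have t1 : θ ≤ 1 := by rw [hθ, div_le_one hpos]; exact hcon.le
        have tt : |θ * (s - x)| = u0 := by rw [abs_mul, abs_of_nonneg t0, hθ]; field_simp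
        obtain ⟨_, e⟩ := hT (θ * (s - x)) tt.le
        have cvx := R.cvx.2 (Ioo_subset_Icc_self hx) m1 (show 0 ≤ 1 - θ by linarith) t0 (by ring)
        simp only [smul_eq_mul] at cvx
        rw [show (1 - θ) * x + θ * s = x + θ * (s - x) by ring] at cvx
        have sq : (θ * (s - x)) ^ 2 = u0 ^ 2 := by rw [← sq_abs, tt]
        rw [sq] at e
        have : θ * (f s - f x - p * (s - x)) ≤ θ * h := by gcongr; linarith
        have : θ * h ≤ h := by nlinarith
        nlinarith
      obtain ⟨_, e⟩ := hT _ hloc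
      rw [add_sub_cancel] at e
      have hs : (s - x) ^ 2 ≤ c ^ 2 := by
        by_contra hcon; push_neg at hcon
        have := mul_lt_mul_of_pos_left hcon hK
        linarith
      have hs' := abs_le.mp (abs_le_of_sq_le_sq hs hc0)
      refine ⟨⟨by simp only; linarith [hs'.1], by simp only; linarith [hs'.2]⟩, ?_, ?_⟩
      · simp only; linarith
      · simp only; linarith
    refine (measure_mono hsub).trans ?_
    rw [Measure.volume_eq_prod, volume_regionBetween_eq_integral (Continuous.integrableOn_Icc (by fun_prop)) (Continuous.integrableOn_Icc (by fun_prop)) measurableSet_Icc]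
    · apply ENNReal.ofReal_le_ofReal
      rw [integral_Icc_eq_integral_Ioc, ← intervalIntegral.integral_of_le (by linarith)]
      have := int_par (h + η) K x c
      have e : ∫ s in (x - c)..(x + c), ((fun s : ℝ => f x + p * (s - x) + h) - (fun s : ℝ => f x + p * (s - x) + K * (s - x) ^ 2 / 2 - η) : ℝ → ℝ) s = ∫ s in (x - c)..(x + c), ((h + η) - K * (s - x) ^ 2 / 2) := by
        congr 1; ext s; simp; ring
      rw [e, this]
      have : K * c ^ 3 = 2 * h * c := by rw [← hc2]; ring
      rw [this]; linarith
    · intro s hs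
      have : (s - x) ^ 2 ≤ c ^ 2 := by
        apply sq_le_sq'; linarith [hs.1]; linarith [hs.2]
      have := mul_le_mul_of_nonneg_left this hK.le
      linarith
  have := hmem.2 p (-1) _ hcap
  simp only at this
  linarith

/-- second order expansion -/
def Tay (f : ℝ → ℝ) (x p k : ℝ) : Prop := ∀ ε > 0, ∃ u0 > 0, ∀ u, |u| ≤ u0 → |f (x + u) - f x - p * u - k * u ^ 2 / 2| ≤ ε * u ^ 2

lemma ev_small {A c : ℝ} (hc : 0 < c) : ∀ᶠ δ : ℝ in 𝓝[>] 0, A * cb δ ^ 2 < c := by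
  have : Tendsto (fun δ : ℝ => A * cb δ ^ 2) (𝓝[>] 0) (𝓝 (A * cb 0 ^ 2)) :=
    ((continuous_const.mul (cb_cont.pow 2)).tendsto 0).mono_left nhdsWithin_le_nhds
  rw [cb_zero] at this
  exact this.eventually (gt_mem_nhds (by simpa using hc))

lemma ev_small1 {A c : ℝ} (hc : 0 < c) : ∀ᶠ δ : ℝ in 𝓝[>] 0, A * cb δ < c := by
  have : Tendsto (fun δ : ℝ => A * cb δ) (𝓝[>] 0) (𝓝 (A * cb 0)) :=
    ((continuous_const.mul cb_cont).tendsto 0).mono_left nhdsWithin_le_nhds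
  rw [cb_zero] at this
  exact this.eventually (gt_mem_nhds (by simpa using hc))

lemma cut_lim (R : Rg S a b f g) {x p k A : ℝ} (hx : x ∈ Ioo a b) (hT : Tay f x p k) (hA : 0 ≤ A) (hAk : 32 * A ^ 3 < 9 * k) :
    ∀ᶠ δ : ℝ in 𝓝[>] 0, ∀ y < f x + A * cb δ ^ 2, (x, y) ∉ FB S δ := by
  have hA3 : 0 ≤ A ^ 3 := by positivity
  obtain ⟨K, hK1, hK2⟩ : ∃ K, 32 * A ^ 3 / 9 < K ∧ K < k := exists_between (by linarith)
  have hK : 0 < K := lt_of_le_of_lt (by positivity) hK1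
  obtain ⟨u1, hu1, hT⟩ := hT ((k - K) / 2) (by linarith)
  obtain ⟨u0, hu0⟩ : ∃ u0, u0 = min u1 (min (x - a) (b - x)) := ⟨_, rfl⟩
  have hu0' : 0 < u0 := by rw [hu0]; exact lt_min hu1 (lt_min (by linarith [hx.1]) (by linarith [hx.2]))
  have l1 : u0 ≤ u1 := by rw [hu0]; exact min_le_left _ _
  have l2 : u0 ≤ x - a := by rw [hu0]; exact (min_le_right _ _).trans (min_le_left _ _)
  have l3 : u0 ≤ b - x := by rw [hu0]; exact (min_le_right _ _).trans (min_le_right _ _)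
  filter_upwards [ev_small (A := A) (show 0 < K * u0 ^ 2 / 2 by positivity), self_mem_nhdsWithin] with δ h1 hδ
  have hδ : 0 < δ := hδ
  refine R.cut (p := p) hx hK hu0' ?_ (by positivity) h1 ?_ hδ.le
  · intro u hu
    have := abs_le.mp hu
    refine ⟨⟨by linarith, by linarith⟩, ?_⟩
    have := (abs_le.mp (hT u (hu.trans l1))).1
    nlinarith
  · have : (A * cb δ ^ 2) ^ 3 = A ^ 3 * δ ^ 2 := by
      rw [mul_pow, ← pow_mul, mul_comm 2 3, pow_mul, cb_cube hδ.le]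
    rw [this]
    have : 0 < δ ^ 2 := by positivity
    rw [div_lt_iff₀ (by norm_num)] at hK1
    nlinarith

lemma nc_lim (R : Rg S a b f g) {x p k A : ℝ} (hx : x ∈ Ioo a b) (hT : Tay f x p k) (hk : 0 ≤ k) (hAk : 9 * k < 32 * A ^ 3) (hA : 0 < A) :
    ∀ᶠ δ : ℝ in 𝓝[>] 0, (x, f x + A * cb δ ^ 2) ∈ FB S δ := by
  obtain ⟨K, hK1, hK2⟩ : ∃ K, k < K ∧ K < 32 * A ^ 3 / 9 := exists_between (by linarith)
  have hK : 0 < K := by linarith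
  obtain ⟨u1, hu1, hT⟩ := hT ((K - k) / 2) (by linarith)
  obtain ⟨u0, hu0⟩ : ∃ u0, u0 = min u1 (min ((x - a)/2) ((b - x)/2)) := ⟨_, rfl⟩
  have hu0' : 0 < u0 := by rw [hu0]; exact lt_min hu1 (lt_min (by linarith [hx.1]) (by linarith [hx.2]))
  have l1 : u0 ≤ u1 := by rw [hu0]; exact min_le_left _ _
  have l2 : u0 ≤ (x - a)/2 := by rw [hu0]; exact (min_le_right _ _).trans (min_le_left _ _)
  have l3 : u0 ≤ (b - x)/2 := by rw [hu0]; exact (min_le_right _ _).trans (min_le_right _ _)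
  have hw := R.lt x hx
  obtain ⟨B, hB⟩ : ∃ B, B = Real.sqrt (2 * A / K) := ⟨_, rfl⟩
  have hB0 : 0 < B := by rw [hB]; positivity
  have hB2 : K * B ^ 2 = 2 * A := by rw [hB, Real.sq_sqrt (by positivity)]; field_simp
  filter_upwards [ev_small (A := A) (show 0 < (g x - f x) / 4 by linarith), ev_small1 (A := B) hu0', self_mem_nhdsWithin] with δ h1 h2 hδ
  have hδ : 0 < δ := hδ
  have hσ := cb_pos hδ
  have hσ3 := cb_cube hδ.le
  refine R.NC (t := B * cb δ) (fun s => A * cb δ ^ 2 - K * s ^ 2 / 2) hx (by positivity) (by linarith) (by linarith) h1.le (by fun_prop) (fun s => by ring) ?_ ?_ hδ.le ?_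
  · intro s hs
    have : s ^ 2 ≤ (B * cb δ) ^ 2 := by rw [← sq_abs s]; gcongr
    have e : K * (B * cb δ) ^ 2 = 2 * (A * cb δ ^ 2) := by rw [mul_pow, ← mul_assoc, hB2]; ring
    have := mul_le_mul_of_nonneg_left this hK.le
    linarith
  · intro s hs
    have a1 := (abs_le.mp (hT s (by linarith))).2
    have a2 := (abs_le.mp (hT (-s) (by rw [abs_neg]; linarith))).2
    rw [← sub_eq_add_neg] at a2
    nlinarith
  · have e := int_par (A * cb δ ^ 2) K 0 (B * cb δ)
    simp only [sub_zero, zero_sub, zero_add] at e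
    rw [e]
    have : 2 * (A * cb δ ^ 2) * (B * cb δ) - K * (B * cb δ) ^ 3 / 3 = (4 / 3 * A * B) * δ := by
      have : K * (B * cb δ) ^ 3 = (K * B ^ 2) * B * cb δ ^ 3 := by ring
      rw [this, hB2, hσ3]
      have : 2 * (A * cb δ ^ 2) * (B * cb δ) = 2 * A * B * cb δ ^ 3 := by ring
      rw [this, hσ3]; ring
    rw [this]
    have key : 1 < 4 / 3 * A * B := by
      by_contra hcon; push_neg at hcon
      have h1 : (4 / 3 * A * B) ^ 2 ≤ 1 ^ 2 := by gcongr
      have h2 : K * (4 / 3 * A * B) ^ 2 = 16 / 9 * A ^ 2 * (K * B ^ 2) := by ring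
      rw [hB2] at h2
      nlinarith
    nlinarith

end Rg
end BL

end Part15

section Part16
set_option linter.all false
open scoped Classical

/-! ## Part 3c: fibre lengths -/
namespace BL
open Topology

def ell (S : Set (ℝ × ℝ)) (δ x : ℝ) : ℝ := (volume (Prod.mk x ⁻¹' (S \ FB S δ))).toReal

lemma ell_nonneg (S : Set (ℝ × ℝ)) (δ x : ℝ) : 0 ≤ ell S δ x := ENNReal.toReal_nonneg

namespace Rg
variable {S : Set (ℝ × ℝ)} {a b : ℝ} {f g : ℝ → ℝ}

lemma fib_sub (R : Rg S a b f g) (δ x : ℝ) : Prod.mk x ⁻¹' (S \ FB S δ) ⊆ Icc (f x) (g x) := by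
  intro y hy
  exact ((R.mem x y).mp hy.1).2

lemma fib_fin (R : Rg S a b f g) (δ x : ℝ) : volume (Prod.mk x ⁻¹' (S \ FB S δ)) < ⊤ :=
  (measure_mono (R.fib_sub δ x)).trans_lt (by rw [Real.volume_Icc]; exact ENNReal.ofReal_lt_top)

lemma ell_le_width (R : Rg S a b f g) {δ x : ℝ} (hx : x ∈ Icc a b) : ell S δ x ≤ g x - f x := by
  apply ENNReal.toReal_le_of_le_ofReal (by linarith [R.le x hx])
  rw [← Real.volume_Icc]
  exact measure_mono (R.fib_sub δ x)

lemma ell_out (R : Rg S a b f g) {δ x : ℝ} (hx : x ∉ Icc a b) : ell S δ x = 0 := by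
  have : Prod.mk x ⁻¹' (S \ FB S δ) = ∅ := by
    ext y; simp only [mem_preimage, mem_empty_iff_false, iff_false]
    intro h; exact hx ((R.mem x y).mp h.1).1
  rw [ell, this]; simp

lemma ell_le (R : Rg S a b f g) {δ x h h' : ℝ} (h0 : 0 ≤ h) (h0' : 0 ≤ h') (h1 : (x, f x + h) ∈ FB S δ) (h2 : (x, g x - h') ∈ FB S δ) :
    ell S δ x ≤ h + h' := by
  apply ENNReal.toReal_le_of_le_ofReal (by linarith)
  have : Prod.mk x ⁻¹' (S \ FB S δ) ⊆ Icc (f x) (f x + h) ∪ Icc (g x - h') (g x) := by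
    rintro y ⟨y1, y2⟩
    obtain ⟨m0, m1, m2⟩ := (R.mem x y).mp y1
    by_contra hcon
    simp only [mem_union, mem_Icc, not_or, not_and, not_le] at hcon
    have c1 := hcon.1 m1
    have c2 : y < g x - h' := by by_contra hc; push_neg at hc; linarith [hcon.2 hc]
    apply y2
    obtain ⟨w, hw⟩ : ∃ w, w = (g x - h') - (f x + h) := ⟨_, rfl⟩
    have hw0 : 0 < w := by linarith
    have := FB_convex R.cv δ h1 h2 (show 0 ≤ (g x - h' - y) / w by apply div_nonneg <;> linarith) (show 0 ≤ (y - (f x + h)) / w by apply div_nonneg <;> linarith) 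
      (by rw [← add_div, div_eq_one_iff_eq hw0.ne']; linarith)
    convert this using 1
    ext
    · simp only [Prod.fst_add, Prod.smul_fst, smul_eq_mul]; field_simp; rw [hw]; ring
    · simp only [Prod.snd_add, Prod.smul_snd, smul_eq_mul]; field_simp; rw [hw]; ring
  refine (measure_mono this).trans ((measure_union_le _ _).trans ?_)
  rw [Real.volume_Icc, Real.volume_Icc, ← ENNReal.ofReal_add (by linarith) (by linarith)]
  apply ENNReal.ofReal_le_ofReal; linarith

lemma ell_ge (R : Rg S a b f g) {δ x h h' : ℝ} (hx : x ∈ Icc a b) (h0 : 0 ≤ h) (h0' : 0 ≤ h') (hw : h + h' ≤ g x - f x) (h1 : ∀ y < f x + h, (x, y) ∉ FB S δ) 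
    (h2 : ∀ y > g x - h', (x, y) ∉ FB S δ) : h + h' ≤ ell S δ x := by
  have : Ico (f x) (f x + h) ∪ Ioc (g x - h') (g x) ⊆ Prod.mk x ⁻¹' (S \ FB S δ) := by
    rintro y (hy | hy)
    · exact ⟨(R.mem x y).mpr ⟨hx, hy.1, by linarith [hy.2]⟩, h1 y hy.2⟩
    · exact ⟨(R.mem x y).mpr ⟨hx, by linarith [hy.1], hy.2⟩, h2 y hy.1⟩
  have hm := measure_mono (μ := volume) this
  rw [measure_union (Set.disjoint_left.mpr fun y hy hy' => by linarith [hy.2, hy'.1]) measurableSet_Ioc, Real.volume_Ico, Real.volume_Ioc, 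
    ← ENNReal.ofReal_add (by linarith) (by linarith)] at hm
  rw [ell, ← ENNReal.ofReal_le_iff_le_toReal (R.fib_fin δ x).ne]
  refine le_trans (ENNReal.ofReal_le_ofReal (by linarith)) hm

lemma D_mono (R : Rg S a b f g) {x s t : ℝ} (ht : 0 < t) (h1 : x + t ∈ Icc a b) (h2 : x - t ∈ Icc a b) (hs : |s| ≤ t) : 
    f (x + s) + f (x - s) ≤ f (x + t) + f (x - t) := by
  have hs' := abs_le.mp hs
  have A := R.cvx.2 h1 h2 (show 0 ≤ (t + s) / (2 * t) by apply div_nonneg <;> linarith) (show 0 ≤ (t - s) / (2 * t) by apply div_nonneg <;> linarith) (by field_simp; ring)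
  have B := R.cvx.2 h1 h2 (show 0 ≤ (t - s) / (2 * t) by apply div_nonneg <;> linarith) (show 0 ≤ (t + s) / (2 * t) by apply div_nonneg <;> linarith) (by field_simp; ring)
  simp only [smul_eq_mul] at A B
  rw [show (t + s) / (2 * t) * (x + t) + (t - s) / (2 * t) * (x - t) = x + s by field_simp; ring] at A
  rw [show (t - s) / (2 * t) * (x + t) + (t + s) / (2 * t) * (x - t) = x - s by field_simp; ring] at B
  have : (t + s) / (2 * t) + (t - s) / (2 * t) = 1 := by field_simp; ring
  have e : (t - s) / (2 * t) = 1 - (t + s) / (2 * t) := by linarith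
  rw [e] at A B
  linarith

def DD (f : ℝ → ℝ) (x t : ℝ) : ℝ := (f (x + t) + f (x - t)) / 2 - f x

lemma one_side (R : Rg S a b f g) {x t δ h : ℝ} (hx : x ∈ Ioo a b) (ht : 0 < t) (ht1 : t ≤ (x - a) / 2) (ht2 : t ≤ (b - x) / 2) (hδ : 0 < δ)
    (h1 : 2 * (δ / t) ≤ h) (h2 : 2 * DD f x t ≤ h) (h3 : h ≤ (g x - f x) / 4) : (x, f x + h) ∈ FB S δ := by
  have hd : 0 < δ / t := by positivity
  have hx1 := hx.1
  have hx2 := hx.2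
  refine R.NC (fun _ => h / 2) hx ht ht1 ht2 h3 continuous_const (fun _ => rfl) (fun _ _ => by linarith) ?_ hδ.le ?_
  · intro s hs
    have := R.D_mono ht (x := x) (s := s) ⟨by linarith, by linarith⟩ ⟨by linarith, by linarith⟩ hs.le
    rw [DD] at h2
    linarith
  · rw [intervalIntegral.integral_const, smul_eq_mul]
    have : δ = δ / t * t := by field_simp
    nlinarith

lemma ell_bound (R : Rg S a b f g) {x t δ : ℝ} (hx : x ∈ Ioo a b) (ht : 0 < t) (ht1 : t ≤ (x - a) / 2) (ht2 : t ≤ (b - x) / 2) (hδ : 0 < δ) :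
    ell S δ x ≤ 8 * (δ / t) + 8 * DD f x t + 8 * DD (fun x => - g x) x t := by
  have hx1 := hx.1
  have hx2 := hx.2
  have d1 : 0 ≤ DD f x t := R.mid ⟨by linarith, by linarith⟩ ⟨by linarith, by linarith⟩
  have d2 : 0 ≤ DD (fun x => - g x) x t := R.refl.mid ⟨by linarith, by linarith⟩ ⟨by linarith, by linarith⟩
  have d3 : 0 < δ / t := by positivity
  obtain ⟨h, hh⟩ : ∃ h, h = 2 * (δ / t) + 2 * DD f x t + 2 * DD (fun x => - g x) x t := ⟨_, rfl⟩
  by_cases hw : h ≤ (g x - f x) / 4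
  · have e1 := R.one_side (h := h) hx ht ht1 ht2 hδ (by linarith) (by linarith) hw
    have e2 := R.refl.one_side (h := h) hx ht ht1 ht2 hδ (by linarith) (by linarith) (by linarith)
    rw [FB_rf] at e2
    have e3 : rf (x, -g x + h) = (x, g x - h) := by ext <;> simp; ring
    rw [e3] at e2
    linarith [R.ell_le (by linarith) (by linarith) e1 e2]
  · linarith [R.ell_le_width (δ := δ) (Ioo_subset_Icc_self hx)]

lemma ell_lim (R : Rg S a b f g) {x p k p' k' : ℝ} (hx : x ∈ Ioo a b) (hT : Tay f x p k) (hT' : Tay (fun x => - g x) x p' k') (hk : 0 ≤ k) (hk' : 0 ≤ k') :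
    Tendsto (fun δ => ell S δ x / cb δ ^ 2) (𝓝[>] 0) (𝓝 (cb (9/32) * (cb k + cb k'))) := by
  have hw := R.lt x hx
  obtain ⟨c, hc⟩ : ∃ c, c = cb (9 / 32 * k) := ⟨_, rfl⟩
  obtain ⟨c', hc'⟩ : ∃ c, c = cb (9 / 32 * k') := ⟨_, rfl⟩
  have e : cb (9/32) * (cb k + cb k') = c + c' := by rw [hc, hc', cb_mul (by norm_num) hk, cb_mul (by norm_num) hk']; ring
  have c0 : 0 ≤ c := by rw [hc]; exact cb_nonneg (by positivity)
  have c0' : 0 ≤ c' := by rw [hc']; exact cb_nonneg (by positivity)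
  have c3 : c ^ 3 = 9 / 32 * k := by rw [hc, cb_cube (by positivity)]
  have c3' : c' ^ 3 = 9 / 32 * k' := by rw [hc', cb_cube (by positivity)]
  rw [e, tendsto_order]
  -- lower one-sided
  have low : ∀ (S : Set (ℝ × ℝ)) (f g : ℝ → ℝ), Rg S a b f g → ∀ p k c, Tay f x p k → 0 ≤ c → c ^ 3 = 9 / 32 * k → ∀ η > 0, ∃ A, 0 ≤ A ∧ c - η ≤ A ∧ A ≤ c ∧ 
      ∀ᶠ δ : ℝ in 𝓝[>] 0, ∀ y < f x + A * cb δ ^ 2, (x, y) ∉ FB S δ := by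
    intro S f g R p k c hT c0 c3 η hη
    rcases le_or_gt c η with h | h
    · refine ⟨0, le_rfl, by linarith, c0, ?_⟩
      filter_upwards with δ y hy hm
      have := ((R.mem x y).mp hm.1).2.1
      linarith
    · refine ⟨c - η, by linarith, le_rfl, by linarith, R.cut_lim hx hT (by linarith) ?_⟩
      have : (c - η) ^ 3 < c ^ 3 := pow_lt_pow_left₀ (by linarith) (by linarith) (by norm_num)
      linarith
  have upp : ∀ (S : Set (ℝ × ℝ)) (f g : ℝ → ℝ), Rg S a b f g → ∀ p k c, Tay f x p k → 0 ≤ k → 0 ≤ c → c ^ 3 = 9 / 32 * k → ∀ η > 0, 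
      ∀ᶠ δ : ℝ in 𝓝[>] 0, (x, f x + (c + η) * cb δ ^ 2) ∈ FB S δ := by
    intro S f g R p k c hT hk c0 c3 η hη
    refine R.nc_lim hx hT hk ?_ (by linarith)
    have : c ^ 3 < (c + η) ^ 3 := pow_lt_pow_left₀ (by linarith) c0 (by norm_num)
    linarith
  constructor
  · intro m hm
    obtain ⟨η, hη⟩ : ∃ η, η = (c + c' - m) / 4 := ⟨_, rfl⟩
    obtain ⟨A, a1, a2, a2', a3⟩ := low S f g R p k c hT c0 c3 η (by linarith)
    obtain ⟨A', b1, b2, b2', b3⟩ := low _ _ _ R.refl p' k' c' hT' c0' c3' η (by linarith)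
    filter_upwards [a3, b3, ev_small (A := A + A') (show 0 < g x - f x by linarith), self_mem_nhdsWithin] with δ h1 h2 h3 hδ
    have hσ : 0 < cb δ ^ 2 := pow_pos (cb_pos hδ) 2
    rw [lt_div_iff₀ hσ]
    have := R.ell_ge (δ := δ) (h := A * cb δ ^ 2) (h' := A' * cb δ ^ 2) (Ioo_subset_Icc_self hx) (by positivity) (by positivity) (by linarith) h1 ?_
    · nlinarith
    · intro y hy hm
      refine h2 (-y) (by linarith) ?_
      rw [FB_rf]
      convert hm using 1
      ext <;> simp
  · intro m hm
    obtain ⟨η, hη⟩ : ∃ η, η = (m - (c + c')) / 4 := ⟨_, rfl⟩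
    filter_upwards [upp S f g R p k c hT hk c0 c3 η (by linarith), upp _ _ _ R.refl p' k' c' hT' hk' c0' c3' η (by linarith), self_mem_nhdsWithin] with δ h1 h2 hδ
    have hσ : 0 < cb δ ^ 2 := pow_pos (cb_pos hδ) 2
    rw [div_lt_iff₀ hσ]
    rw [FB_rf] at h2
    have e3 : rf (x, -g x + (c' + η) * cb δ ^ 2) = (x, g x - (c' + η) * cb δ ^ 2) := by ext <;> simp; ring
    rw [e3] at h2
    have := R.ell_le (mul_nonneg (by linarith) hσ.le) (mul_nonneg (by linarith) hσ.le) h1 h2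
    nlinarith

end Rg
end BL

end Part16

section Part17
set_option linter.all false
open scoped Classical

/-! ## Part 3d: integral bounds -/
namespace BL
open Topology

lemma ell_meas {S : Set (ℝ × ℝ)} (hS : IsCompact S) (δ : ℝ) : Measurable (ell S δ) :=
  (measurable_measure_prodMk_left (hS.isClosed.measurableSet.diff (FB_closed hS.isClosed δ).measurableSet)).ennreal_toReal

lemma dyadic {F : ℝ → ℝ} {E H d M : ℝ} (hd : 0 < d) (hE : 0 ≤ E) (hH : 0 ≤ H) (h1 : ∀ μ, 0 < μ → μ ≤ M → F μ ≤ H * μ)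
    (h2 : ∀ μ, d ^ 3 ≤ μ → 2 * μ ≤ M → F (2 * μ) ≤ F μ + E * d ^ 2 * cb μ) (μ : ℝ) (hμ : d ^ 3 ≤ μ) (hM : μ ≤ M) :
    F μ ≤ (4 * H + 4 * E) * d ^ 2 * cb μ := by
  have hd3 : 0 < d ^ 3 := by positivity
  have key : ∀ n : ℕ, ∀ μ, d ^ 3 ≤ μ → μ ≤ M → μ ≤ 2 * (2 ^ n * d ^ 3) → F μ ≤ (4 * H + 4 * E) * d ^ 2 * cb μ := by
    intro n
    have base : ∀ μ, d ^ 3 ≤ μ → μ ≤ M → μ ≤ 2 * d ^ 3 → F μ ≤ (4 * H + 4 * E) * d ^ 2 * cb μ := by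
      intro μ a1 a2 a3
      have m0 : 0 < μ := by linarith
      have c0 : 0 < cb μ := cb_pos m0
      have c1 : cb μ ≤ 2 * d := by
        rw [← cb_of_cube (show 0 ≤ 2 * d by positivity)]
        apply cb_mono m0.le; nlinarith
      calc F μ ≤ H * μ := h1 μ m0 a2
        _ = H * cb μ * cb μ ^ 2 := by rw [← cb_cube m0.le]; simp only [cb_cube m0.le]; rw [← cb_cube m0.le, cb_of_cube c0.le]; ring
        _ ≤ H * cb μ * (2 * d) ^ 2 := by gcongr
        _ ≤ _ := by nlinarith [mul_nonneg (mul_nonneg hE c0.le) (sq_nonneg d)]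
    induction n with
    | zero => intro μ a1 a2 a3; exact base μ a1 a2 (by simpa using a3)
    | succ n ih =>
      intro μ a1 a2 a3
      by_cases hc : μ ≤ 2 * d ^ 3
      · exact base μ a1 a2 hc
      push Not at hc
      have hm : 0 < μ / 2 := by linarith
      have i1 := ih (μ / 2) (by linarith) (by linarith) (by rw [pow_succ] at a3; linarith)
      have i2 := h2 (μ / 2) (by linarith) (by linarith)
      rw [show 2 * (μ / 2) = μ by ring] at i2
      have c0 := cb_pos hm
      have c1 : 5 / 4 * cb (μ / 2) ≤ cb μ := by
        have : cb (5 / 4 * cb (μ / 2)) ≤ cb (5 / 4 * cb (μ / 2)) := le_rfl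
        rw [← cb_of_cube (show 0 ≤ 5 / 4 * cb (μ / 2) by positivity)]
        apply cb_mono (by positivity)
        rw [mul_pow, cb_cube hm.le]; linarith
      calc F μ ≤ _ := i2
        _ ≤ (4 * H + 4 * E) * d ^ 2 * cb (μ / 2) + E * d ^ 2 * cb (μ / 2) := by linarith
        _ ≤ (4 * H + 4 * E) * d ^ 2 * (5 / 4 * cb (μ / 2)) := by
          nlinarith [mul_nonneg (mul_nonneg hH (sq_nonneg d)) c0.le]
        _ ≤ _ := by gcongr
  obtain ⟨n, hn⟩ := pow_unbounded_of_one_lt (μ / d ^ 3) (show (1:ℝ) < 2 by norm_num)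
  refine key n μ hμ hM ?_
  rw [div_lt_iff₀ hd3] at hn
  nlinarith

namespace Rg
variable {S : Set (ℝ × ℝ)} {a b : ℝ} {f g : ℝ → ℝ}

lemma bdd (R : Rg S a b f g) : ∃ H > 0, ∀ x ∈ Icc a b, |f x| ≤ H ∧ |g x| ≤ H := by
  obtain ⟨H, hH⟩ := R.cp.isBounded.subset_closedBall (0 : ℝ × ℝ)
  have key : ∀ x y, (x, y) ∈ S → |y| ≤ max H 1 := by
    intro x y h
    have := hH h
    rw [mem_closedBall_zero_iff, Prod.norm_mk] at this
    exact le_max_of_le_left ((le_max_right _ _).trans this)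
  exact ⟨max H 1, by positivity, fun x hx => ⟨key x _ ((R.mem x _).mpr ⟨hx, le_rfl, R.le x hx⟩), key x _ ((R.mem x _).mpr ⟨hx, R.le x hx, le_rfl⟩)⟩⟩

lemma lip (R : Rg S a b f g) {H t l x : ℝ} (hH : ∀ x ∈ Icc a b, |f x| ≤ H) (ht : 0 < t) (hl : 0 < l) (h1 : a ≤ x - l / 2) (h2 : x + t + l / 2 ≤ b) :
    |f (x + t) - f x| ≤ 4 * H / l * t := by
  have e1 := R.cvx.slope_mono_adjacent (x := x) (y := x + t) (z := x + t + l / 2) ⟨by linarith, by linarith⟩ ⟨by linarith, by linarith⟩ (by linarith) (by linarith)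
  have e2 := R.cvx.slope_mono_adjacent (x := x - l / 2) (y := x) (z := x + t) ⟨by linarith, by linarith⟩ ⟨by linarith, by linarith⟩ (by linarith) (by linarith)
  have b1 := abs_le.mp (hH (x + t + l / 2) ⟨by linarith, by linarith⟩)
  have b2 := abs_le.mp (hH (x + t) ⟨by linarith, by linarith⟩)
  have b3 := abs_le.mp (hH x ⟨by linarith, by linarith⟩)
  have b4 := abs_le.mp (hH (x - l / 2) ⟨by linarith, by linarith⟩)
  have i1 : (f (x + t + l / 2) - f (x + t)) / (x + t + l / 2 - (x + t)) ≤ 4 * H / l := by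
    rw [show x + t + l / 2 - (x + t) = l / 2 by ring, div_le_div_iff₀ (by positivity) hl]; nlinarith
  have i2 : -(4 * H / l) ≤ (f x - f (x - l / 2)) / (x - (x - l / 2)) := by
    rw [show x - (x - l / 2) = l / 2 by ring, ← neg_div, div_le_div_iff₀ hl (by positivity)]; nlinarith
  rw [show x + t - x = t by ring] at e1 e2
  have j1 := e1.trans i1
  have j2 := i2.trans e2
  rw [div_le_iff₀ ht] at j1
  rw [le_div_iff₀ ht] at j2
  rw [abs_le]; constructor <;> linarith

lemma ii (R : Rg S a b f g) {p q : ℝ} (hp : a < p) (hq : p ≤ q) (hb : q < b) : IntervalIntegrable f volume p q :=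
  (R.cont.mono (by rw [uIcc_of_le hq]; exact fun x hx => ⟨by linarith [hx.1], by linarith [hx.2]⟩)).intervalIntegrable

lemma DD_ii (R : Rg S a b f g) {t p q : ℝ} (ht : 0 < t) (hpq : p ≤ q) (h1 : a < p - t) (h2 : q + t < b) : IntervalIntegrable (fun x => DD f x t) volume p q := by
  have a1 := (R.ii (p := p + t) (q := q + t) (by linarith) (by linarith) h2).comp_add_right (c := t)
  have a2 := (R.ii (p := p - t) (q := q - t) (by linarith) (by linarith) (by linarith)).comp_add_right (c := -t)
  simp only [add_sub_cancel_right, sub_neg_eq_add, sub_add_cancel] at a1 a2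
  exact ((a1.add a2).div_const 2).sub (R.ii (by linarith) hpq (by linarith))

lemma DD_int (R : Rg S a b f g) {H t l p q : ℝ} (hH : ∀ x ∈ Icc a b, |f x| ≤ H) (ht : 0 < t) (htl : t < l / 2) (hpq : p ≤ q) (h1 : a ≤ p - l) (h2 : q + l ≤ b) :
    ∫ x in p..q, DD f x t ≤ 4 * H / l * t ^ 2 := by
  have I := @ii S a b f g R
  have a1 := (R.ii (p := p + t) (q := q + t) (by linarith) (by linarith) (by linarith)).comp_add_right (c := t)
  have a2 := (R.ii (p := p - t) (q := q - t) (by linarith) (by linarith) (by linarith)).comp_add_right (c := -t)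
  simp only [add_sub_cancel_right, sub_neg_eq_add, sub_add_cancel] at a1 a2
  have e : ∫ x in p..q, DD f x t = ((∫ x in (p + t)..(q + t), f x) + ∫ x in (p - t)..(q - t), f x) / 2 - ∫ x in p..q, f x := by
    unfold DD
    simp only [← sub_eq_add_neg] at a2
    rw [intervalIntegral.integral_sub ((a1.add a2).div_const 2) (I (by linarith) hpq (by linarith)), intervalIntegral.integral_div, intervalIntegral.integral_add a1 a2]
    rw [intervalIntegral.integral_comp_add_right, intervalIntegral.integral_comp_sub_right]
  have s : ∀ c, a + l ≤ c → c + l ≤ b → |(∫ x in c..(c + t), f x) - ∫ x in (c - t)..c, f x| ≤ 4 * H / l * t * t := by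
    intro c c1 c2
    have := intervalIntegral.integral_comp_add_right (a := c - t) (b := c) f t
    rw [sub_add_cancel] at this
    have b1 := (R.ii (p := c) (q := c + t) (by linarith) (by linarith) (by linarith)).comp_add_right (c := t)
    simp only [add_sub_cancel_right] at b1
    rw [← this, ← intervalIntegral.integral_sub b1 (I (by linarith) (by linarith) (by linarith))]
    have := intervalIntegral.norm_integral_le_of_norm_le_const (a := c - t) (b := c) (f := fun x => f (x + t) - f x) (C := 4 * H / l * t) ?_
    · rw [Real.norm_eq_abs, sub_sub_cancel, abs_of_pos ht] at this; exact this
    · intro x hx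
      rw [uIoc_of_le (by linarith)] at hx
      exact R.lip hH ht (by linarith) (by linarith [hx.1]) (by linarith [hx.2])
  have s1 := abs_le.mp (s q (by linarith) (by linarith))
  have s2 := abs_le.mp (s p (by linarith) (by linarith))
  have k1 := intervalIntegral.integral_add_adjacent_intervals (I (p := p - t) (q := p) (by linarith) (by linarith) (by linarith)) (I (p := p) (q := q) (by linarith) hpq (by linarith))
  have k2 := intervalIntegral.integral_add_adjacent_intervals (I (p := p - t) (q := q - t) (by linarith) (by linarith) (by linarith)) (I (p := q - t) (q := q) (by linarith) (by linarith) (by linarith))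
  have k3 := intervalIntegral.integral_add_adjacent_intervals (I (p := p) (q := q) (by linarith) hpq (by linarith)) (I (p := q) (q := q + t) (by linarith) (by linarith) (by linarith))
  have k4 := intervalIntegral.integral_add_adjacent_intervals (I (p := p) (q := p + t) (by linarith) (by linarith) (by linarith)) (I (p := p + t) (q := q + t) (by linarith) (by linarith) (by linarith))
  rw [e]; nlinarith

lemma ell_ii (R : Rg S a b f g) (δ p q : ℝ) : IntervalIntegrable (ell S δ) volume p q := by
  obtain ⟨H, hH, hb⟩ := R.bdd
  refine (intervalIntegrable_const (c := 2 * H)).mono_fun (ell_meas R.cp δ).aestronglyMeasurable (ae_of_all _ fun x => ?_)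
  show ‖ell S δ x‖ ≤ ‖2 * H‖
  rw [Real.norm_eq_abs, Real.norm_eq_abs, abs_of_nonneg (ell_nonneg S δ x), abs_of_pos (by positivity)]
  by_cases hx : x ∈ Icc a b
  · have := R.ell_le_width (δ := δ) hx
    have h1 := abs_le.mp (hb x hx).1
    have h2 := abs_le.mp (hb x hx).2
    linarith
  · rw [R.ell_out hx]; positivity

lemma ell_int1 (R : Rg S a b f g) {H δ p q : ℝ} (hH : ∀ x ∈ Icc a b, |f x| ≤ H ∧ |g x| ≤ H) (h1 : a ≤ p) (hpq : p ≤ q) (h2 : q ≤ b) :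
    ∫ x in p..q, ell S δ x ≤ 2 * H * (q - p) := by
  have := intervalIntegral.integral_mono_on hpq (R.ell_ii δ p q) (intervalIntegrable_const (c := 2 * H)) (fun x hx => ?_)
  · rw [intervalIntegral.integral_const, smul_eq_mul] at this; linarith
  · have hx' : x ∈ Icc a b := ⟨by linarith [hx.1], by linarith [hx.2]⟩
    have := R.ell_le_width (δ := δ) hx'
    have h1 := abs_le.mp (hH x hx').1
    have h2 := abs_le.mp (hH x hx').2
    linarith

lemma psi_int (R : Rg S a b f g) {H t l p q : ℝ} (hH : ∀ x ∈ Icc a b, |f x| ≤ H ∧ |g x| ≤ H) (ht : 0 < t) (htl : t < l / 2) (hpq : p ≤ q) (h1 : a ≤ p - l) (h2 : q + l ≤ b) :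
    ∫ x in p..q, (8 * DD f x t + 8 * DD (fun x => - g x) x t) ≤ 64 * H / l * t ^ 2 := by
  have i1 := R.DD_ii ht hpq (by linarith) (by linarith)
  have i2 := R.refl.DD_ii ht hpq (by linarith) (by linarith)
  rw [intervalIntegral.integral_add (i1.const_mul 8) (i2.const_mul 8), intervalIntegral.integral_const_mul, intervalIntegral.integral_const_mul]
  have a1 := R.DD_int (fun x hx => (hH x hx).1) ht htl hpq h1 h2
  have a2 := R.refl.DD_int (fun x hx => by rw [abs_neg]; exact (hH x hx).2) ht htl hpq h1 h2
  have : 64 * H / l * t ^ 2 = 8 * (4 * H / l * t ^ 2) + 8 * (4 * H / l * t ^ 2) := by ring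
  linarith

lemma ell_int2 (R : Rg S a b f g) {H δ t l p q : ℝ} (hH : ∀ x ∈ Icc a b, |f x| ≤ H ∧ |g x| ≤ H) (ht : 0 < t) (htl : t < l / 2) (hpq : p ≤ q) (h1 : a ≤ p - l) (h2 : q + l ≤ b) (hδ : 0 < δ) :
    ∫ x in p..q, ell S δ x ≤ 8 * (δ / t) * (q - p) + 64 * H / l * t ^ 2 := by
  have i1 := R.DD_ii ht hpq (by linarith) (by linarith)
  have i2 := R.refl.DD_ii ht hpq (by linarith) (by linarith)
  have i3 := (i1.const_mul 8).add (i2.const_mul 8)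
  have := intervalIntegral.integral_mono_on hpq (R.ell_ii δ p q) ((intervalIntegrable_const (c := 8 * (δ / t))).add i3) (fun x hx => ?_)
  · rw [intervalIntegral.integral_add intervalIntegrable_const i3, intervalIntegral.integral_const, smul_eq_mul] at this
    have h := R.psi_int hH ht htl hpq h1 h2
    linarith
  · have := R.ell_bound (x := x) ⟨by linarith [hx.1], by linarith [hx.2]⟩ ht (by linarith [hx.1]) (by linarith [hx.2]) hδ
    linarith

/-- generic strip bound used at both ends -/
lemma strip (R : Rg S a b f g) {H d p μ : ℝ} (hH : ∀ x ∈ Icc a b, |f x| ≤ H ∧ |g x| ≤ H) (hd : 0 < d) (hdm : d ^ 3 ≤ μ) (h1 : a ≤ p - μ) (h2 : p + μ + μ ≤ b) :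
    ∫ x in p..(p + μ), ell S (d ^ 3) x ≤ (24 + 8 * H) * d ^ 2 * cb μ := by
  have hμ : 0 < μ := lt_of_lt_of_le (by positivity) hdm
  obtain ⟨u, hu⟩ : ∃ u, u = cb μ := ⟨_, rfl⟩
  have u0 : 0 < u := by rw [hu]; exact cb_pos hμ
  have hu3 : μ = u ^ 3 := by rw [hu, cb_cube hμ.le]
  have hdu : d ≤ u := by rw [hu3] at hdm; exact le_of_pow_le_pow_left₀ (by norm_num) u0.le hdm
  have hH0 : 0 ≤ H := (abs_nonneg _).trans (hH a ⟨le_rfl, R.hab.le⟩).1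
  have := R.ell_int2 (t := d * u ^ 2 / 3) (l := μ) (p := p) (q := p + μ) (δ := d ^ 3) hH (by positivity) (by rw [hu3]; nlinarith [pow_pos u0 2, pow_pos u0 3]) (by linarith) h1 (by linarith) (by positivity)
  rw [← hu]
  refine this.trans ?_
  have e : 8 * (d ^ 3 / (d * u ^ 2 / 3)) * (p + μ - p) + 64 * H / μ * (d * u ^ 2 / 3) ^ 2 = (24 + 64 / 9 * H) * d ^ 2 * u := by
    rw [hu3]; field_simp; ring
  rw [e]
  have : 0 ≤ H * d ^ 2 * u := by positivity
  nlinarith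

lemma left_end (R : Rg S a b f g) {H d μ : ℝ} (hH : ∀ x ∈ Icc a b, |f x| ≤ H ∧ |g x| ≤ H) (hd : 0 < d) (hdm : d ^ 3 ≤ μ) (h2 : μ ≤ (b - a) / 2) :
    ∫ x in a..(a + μ), ell S (d ^ 3) x ≤ (96 + 40 * H) * d ^ 2 * cb μ := by
  have hH0 : 0 ≤ H := (abs_nonneg _).trans (hH a ⟨le_rfl, R.hab.le⟩).1
  have hab := R.hab
  have := dyadic (F := fun μ => ∫ x in a..(a + μ), ell S (d ^ 3) x) (E := 24 + 8 * H) (H := 2 * H) (M := (b - a) / 2) hd (by positivity) (by positivity)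
    (fun μ h0 h1 => (R.ell_int1 hH le_rfl (by linarith) (by linarith)).trans (by linarith))
    (fun μ h0 h1 => by
      have := R.strip (p := a + μ) hH hd h0 (by linarith) (by linarith)
      have e := intervalIntegral.integral_add_adjacent_intervals (R.ell_ii (d ^ 3) a (a + μ)) (R.ell_ii (d ^ 3) (a + μ) (a + μ + μ))
      rw [show a + 2 * μ = a + μ + μ by ring, ← e]; linarith) μ hdm h2
  exact this.trans (le_of_eq (by ring))

lemma right_end (R : Rg S a b f g) {H d μ : ℝ} (hH : ∀ x ∈ Icc a b, |f x| ≤ H ∧ |g x| ≤ H) (hd : 0 < d) (hdm : d ^ 3 ≤ μ) (h2 : μ ≤ (b - a) / 2) :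
    ∫ x in (b - μ)..b, ell S (d ^ 3) x ≤ (96 + 40 * H) * d ^ 2 * cb μ := by
  have hH0 : 0 ≤ H := (abs_nonneg _).trans (hH a ⟨le_rfl, R.hab.le⟩).1
  have hab := R.hab
  have := dyadic (F := fun μ => ∫ x in (b - μ)..b, ell S (d ^ 3) x) (E := 24 + 8 * H) (H := 2 * H) (M := (b - a) / 2) hd (by positivity) (by positivity)
    (fun μ h0 h1 => (R.ell_int1 hH (by linarith) (by linarith) le_rfl).trans (by linarith))
    (fun μ h0 h1 => by
      have := R.strip (p := b - 2 * μ) hH hd h0 (by linarith) (by linarith)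
      have e := intervalIntegral.integral_add_adjacent_intervals (R.ell_ii (d ^ 3) (b - 2 * μ) (b - μ)) (R.ell_ii (d ^ 3) (b - μ) b)
      rw [show b - 2 * μ + μ = b - μ by ring] at this
      rw [← e]; linarith) μ hdm h2
  exact this.trans (le_of_eq (by ring))

end Rg
end BL

end Part17

section Part18
set_option linter.all false
open scoped Classical

/-! ## Part 3e: convergence of integrals -/
namespace BL
open Topology

lemma vit {μ : Measure ℝ} [IsFiniteMeasure μ] {φ : ℝ → ℝ → ℝ} {Φ : ℝ → ℝ} (h0 : ∀ δ x, 0 ≤ φ δ x) (hi : ∀ δ, Integrable (φ δ) μ)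
    (hae : ∀ᵐ x ∂μ, Tendsto (fun δ => φ δ x) (𝓝[>] 0) (𝓝 (Φ x)))
    (hu : ∀ ε > 0, ∃ m, ∀ᶠ δ in 𝓝[>] (0:ℝ), ∫ x, φ δ x ∂μ ≤ (∫ x, min (φ δ x) m ∂μ) + ε) :
    Integrable Φ μ ∧ Tendsto (fun δ => ∫ x, φ δ x ∂μ) (𝓝[>] 0) (𝓝 (∫ x, Φ x ∂μ)) := by
  have hmi : ∀ δ m, Integrable (fun x => min (φ δ x) m) μ := fun δ m => (hi δ).inf (integrable_const m)
  have hΦ0 : ∀ᵐ x ∂μ, 0 ≤ Φ x := by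
    filter_upwards [hae] with x hx
    exact ge_of_tendsto' hx (fun δ => h0 δ x)
  have hseq : Tendsto (fun n : ℕ => (1 / ((n:ℝ) + 1))) atTop (𝓝[>] 0) :=
    tendsto_nhdsWithin_iff.mpr ⟨tendsto_one_div_add_atTop_nhds_zero_nat, Eventually.of_forall fun n => by simp only [mem_Ioi]; positivity⟩
  have hInt0 : Integrable Φ μ := by
    refine integrable_of_tendsto (G := fun n x => φ (1 / ((n:ℝ) + 1)) x) ?_ (fun n => (hi _).aestronglyMeasurable) ?_
    · filter_upwards [hae] with x hx
      exact hx.comp hseq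
    · obtain ⟨m, hm⟩ := hu 1 one_pos
      have hB : ∀ᶠ n : ℕ in atTop, ∫⁻ x, ‖φ (1 / ((n:ℝ) + 1)) x‖ₑ ∂μ ≤ ENNReal.ofReal (m * μ.real univ + 1) := by
        filter_upwards [hseq.eventually hm] with n hn
        rw [← ofReal_integral_norm_eq_lintegral_enorm (hi _)]
        apply ENNReal.ofReal_le_ofReal
        have e : ∫ x, ‖φ (1 / ((n:ℝ) + 1)) x‖ ∂μ = ∫ x, φ (1 / ((n:ℝ) + 1)) x ∂μ := by
          congr 1; ext x; rw [Real.norm_eq_abs, abs_of_nonneg (h0 _ _)]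
        rw [e]
        have : ∫ x, min (φ (1 / ((n:ℝ) + 1)) x) m ∂μ ≤ ∫ x, m ∂μ := integral_mono (hmi _ _) (integrable_const m) (fun x => min_le_right _ _)
        rw [integral_const, smul_eq_mul] at this
        linarith
      refine ne_top_of_le_ne_top ENNReal.ofReal_ne_top (liminf_le_of_frequently_le' hB.frequently)
  have hmiΦ : ∀ m, Integrable (fun x => min (Φ x) m) μ := fun m => hInt0.inf (integrable_const m)
  have hmc : ∀ m, 0 ≤ m → Tendsto (fun δ => ∫ x, min (φ δ x) m ∂μ) (𝓝[>] 0) (𝓝 (∫ x, min (Φ x) m ∂μ)) := by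
    intro m hm
    refine tendsto_integral_filter_of_dominated_convergence (fun _ => m) (Eventually.of_forall fun δ => (hmi δ m).aestronglyMeasurable) (Eventually.of_forall fun δ => ae_of_all _ fun x => ?_)
      (integrable_const m) ?_
    · rw [Real.norm_eq_abs, abs_of_nonneg (le_min (h0 δ x) hm)]; exact min_le_right _ _
    · filter_upwards [hae] with x hx
      exact hx.min tendsto_const_nhds
  have hMc : Tendsto (fun n : ℕ => ∫ x, min (Φ x) (n:ℝ) ∂μ) atTop (𝓝 (∫ x, Φ x ∂μ)) := by
    refine tendsto_integral_of_dominated_convergence (fun x => Φ x) (fun n => (hmiΦ n).aestronglyMeasurable) hInt0 (fun n => ?_) ?_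
    · filter_upwards [hΦ0] with x hx
      rw [Real.norm_eq_abs, abs_of_nonneg (le_min hx n.cast_nonneg)]; exact min_le_left _ _
    · refine ae_of_all _ fun x => ?_
      refine tendsto_const_nhds.congr' ?_
      obtain ⟨N, hN⟩ := exists_nat_ge (Φ x)
      filter_upwards [eventually_ge_atTop N] with n hn
      rw [min_eq_left (hN.trans (by exact_mod_cast hn))]
  refine ⟨hInt0, ?_⟩
  rw [Metric.tendsto_nhds]
  intro ε hε
  obtain ⟨m, hm⟩ := hu (ε / 3) (by positivity)
  obtain ⟨M, hM⟩ := (hMc.eventually (lt_mem_nhds (show (∫ x, Φ x ∂μ) - ε / 3 < _ by linarith))).exists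
  filter_upwards [hm, (hmc (max m 0) (le_max_right _ _)).eventually (gt_mem_nhds (show _ < (∫ x, min (Φ x) (max m 0) ∂μ) + ε / 3 by linarith)),
    (hmc M M.cast_nonneg).eventually (lt_mem_nhds (show (∫ x, min (Φ x) M ∂μ) - ε / 3 < _ by linarith))] with δ h1 h2 h3
  have a1 : ∫ x, min (φ δ x) m ∂μ ≤ ∫ x, min (φ δ x) (max m 0) ∂μ := integral_mono (hmi _ _) (hmi _ _) (fun x => min_le_min_left _ (le_max_left _ _))
  have a2 : ∫ x, min (φ δ x) M ∂μ ≤ ∫ x, φ δ x ∂μ := integral_mono (hmi _ _) (hi _) (fun x => min_le_left _ _)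
  have a3 : ∫ x, min (Φ x) (max m 0) ∂μ ≤ ∫ x, Φ x ∂μ := integral_mono (hmiΦ _) hInt0 (fun x => min_le_left _ _)
  rw [Real.dist_eq, abs_lt]
  constructor <;> linarith

namespace Rg
variable {S : Set (ℝ × ℝ)} {a b : ℝ} {f g : ℝ → ℝ}

lemma min_ii (R : Rg S a b f g) (δ c m p q : ℝ) : IntervalIntegrable (fun x => min (ell S δ x / c) m) volume p q := by
  have h1 := (R.ell_ii δ p q).div_const c
  rw [intervalIntegrable_iff] at h1 ⊢
  exact h1.inf (intervalIntegrable_iff.mp (intervalIntegrable_const (c := m)))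

lemma unif (R : Rg S a b f g) {ε : ℝ} (hε : 0 < ε) : ∃ m, ∀ᶠ δ in 𝓝[>] (0:ℝ),
    ∫ x in a..b, ell S δ x / cb δ ^ 2 ≤ (∫ x in a..b, min (ell S δ x / cb δ ^ 2) m) + ε := by
  obtain ⟨H, hH0, hH⟩ := R.bdd
  have hab := R.hab
  obtain ⟨c, hc⟩ : ∃ c, c = ε / (4 * (96 + 40 * H)) := ⟨_, rfl⟩
  have hc0 : 0 < c := by rw [hc]; positivity
  obtain ⟨l, hl⟩ : ∃ l, l = min (c ^ 3) ((b - a) / 2) := ⟨_, rfl⟩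
  have hl0 : 0 < l := by rw [hl]; exact lt_min (by positivity) (by linarith)
  have hlb : l ≤ (b - a) / 2 := by rw [hl]; exact min_le_right _ _
  have hlc : (96 + 40 * H) * cb l ≤ ε / 4 := by
    have : cb l ≤ c := by
      rw [← cb_of_cube hc0.le]; exact cb_mono hl0.le (by rw [hl]; exact min_le_left _ _)
    calc _ ≤ (96 + 40 * H) * c := by gcongr
      _ = ε / 4 := by rw [hc]; field_simp
  obtain ⟨X, hX⟩ : ∃ X, X = 128 * H / (l * ε) := ⟨_, rfl⟩
  have hX0 : 0 < X := by rw [hX]; positivity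
  obtain ⟨r, hr⟩ : ∃ r, r = 1 / (1 + X) := ⟨_, rfl⟩
  have hr0 : 0 < r := by rw [hr]; positivity
  have hr1 : X * r ^ 2 ≤ 1 := by
    have e : (1 + X) * r = 1 := by rw [hr]; field_simp
    have : r ≤ 1 := by nlinarith
    nlinarith
  have hr2 : 64 * H / l * r ^ 2 ≤ ε / 2 := by
    have : 64 * H / l * r ^ 2 = ε / 2 * (X * r ^ 2) := by rw [hX]; field_simp; ring
    rw [this]; nlinarith
  refine ⟨8 / r, ?_⟩
  filter_upwards [ev_small1 (A := r) (c := l / 2) (by positivity), ev_small1 (A := 1) (c := cb l) (cb_pos hl0), self_mem_nhdsWithin] with δ h1 h2 h3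
  simp only [mem_Ioi] at h3
  obtain ⟨d, hd⟩ : ∃ d, d = cb δ := ⟨_, rfl⟩
  have hd0 : 0 < d := by rw [hd]; exact cb_pos h3
  have hδ : δ = d ^ 3 := by rw [hd, cb_cube h3.le]
  rw [← hd] at h1 h2 ⊢
  have hdl : d ^ 3 ≤ l := by rw [← cb_cube hl0.le]; exact pow_le_pow_left₀ hd0.le (by linarith) 3
  have E1 := R.left_end hH hd0 hdl hlb
  have E2 := R.right_end hH hd0 hdl hlb
  rw [← hδ] at E1 E2
  have i := fun p q => (R.ell_ii δ p q).div_const (d ^ 2)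
  have j := R.min_ii δ (d ^ 2) (8 / r)
  have s1 := intervalIntegral.integral_add_adjacent_intervals (i a (a + l)) (i (a + l) (b - l))
  have s2 := intervalIntegral.integral_add_adjacent_intervals (i a (b - l)) (i (b - l) b)
  have t1 := intervalIntegral.integral_add_adjacent_intervals (j a (a + l)) (j (a + l) (b - l))
  have t2 := intervalIntegral.integral_add_adjacent_intervals (j a (b - l)) (j (b - l) b)
  have mp : ∀ p q, p ≤ q → 0 ≤ ∫ x in p..q, min (ell S δ x / d ^ 2) (8 / r) := fun p q hpq =>
    intervalIntegral.integral_nonneg hpq fun x _ => le_min (div_nonneg (ell_nonneg _ _ _) (by positivity)) (by positivity)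
  have m1 := mp a (a + l) (by linarith)
  have m2 := mp (b - l) b (by linarith)
  have F1 : ∫ x in a..(a + l), ell S δ x / d ^ 2 ≤ ε / 4 := by
    rw [intervalIntegral.integral_div, div_le_iff₀ (by positivity)]; nlinarith [pow_pos hd0 2]
  have F2 : ∫ x in (b - l)..b, ell S δ x / d ^ 2 ≤ ε / 4 := by
    rw [intervalIntegral.integral_div, div_le_iff₀ (by positivity)]; nlinarith [pow_pos hd0 2]
  have ht : 0 < r * d := by positivity
  have P := R.psi_int (t := r * d) (l := l) (p := a + l) (q := b - l) hH ht h1 (by linarith) (by linarith) (by linarith)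
  have i1 := R.DD_ii (t := r * d) (p := a + l) (q := b - l) ht (by linarith) (by linarith) (by linarith)
  have i2 := R.refl.DD_ii (t := r * d) (p := a + l) (q := b - l) ht (by linarith) (by linarith) (by linarith)
  have i3 := ((i1.const_mul 8).add (i2.const_mul 8)).div_const (d ^ 2)
  have Q := intervalIntegral.integral_mono_on (show a + l ≤ b - l by linarith) (i _ _) ((j (a + l) (b - l)).add i3) (fun x hx => by
    have hx1 := hx.1
    have hx2 := hx.2
    have B := R.ell_bound (x := x) (t := r * d) ⟨by linarith, by linarith⟩ ht (by linarith) (by linarith) h3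
    have d1 : 0 ≤ DD f x (r * d) := R.mid ⟨by linarith, by linarith⟩ ⟨by linarith, by linarith⟩
    have d2 : 0 ≤ DD (fun x => - g x) x (r * d) := R.refl.mid ⟨by linarith, by linarith⟩ ⟨by linarith, by linarith⟩
    show ell S δ x / d ^ 2 ≤ min (ell S δ x / d ^ 2) (8 / r) + (8 * DD f x (r * d) + 8 * DD (fun x => - g x) x (r * d)) / d ^ 2
    have d3 : 0 ≤ (8 * DD f x (r * d) + 8 * DD (fun x => - g x) x (r * d)) / d ^ 2 := by positivity
    rcases min_cases (ell S δ x / d ^ 2) (8 / r) with ⟨hm, _⟩ | ⟨hm, _⟩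
    · rw [hm]; linarith
    · rw [hm]
      calc ell S δ x / d ^ 2 ≤ (8 * (δ / (r * d)) + 8 * DD f x (r * d) + 8 * DD (fun x => - g x) x (r * d)) / d ^ 2 := by gcongr
        _ = _ := by rw [hδ]; field_simp; ring)
  rw [intervalIntegral.integral_add (j _ _) i3] at Q
  have P2 : (∫ x in (a + l)..(b - l), (8 * DD f x (r * d) + 8 * DD (fun x => - g x) x (r * d)) / d ^ 2) ≤ ε / 2 := by
    rw [intervalIntegral.integral_div, div_le_iff₀ (by positivity)]
    refine P.trans ?_
    rw [mul_pow, ← mul_assoc]; gcongr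
  linarith

lemma vol_eq (R : Rg S a b f g) (δ : ℝ) : (volume S).toReal - (volume (FB S δ)).toReal = ∫ x in a..b, ell S δ x := by
  have hfin : volume S ≠ ⊤ := R.cp.measure_lt_top.ne
  have hm := (FB_closed R.cp.isClosed δ).measurableSet
  have h1 : volume (S \ FB S δ) = volume S - volume (FB S δ) :=
    measure_diff (FB_sub S δ) hm.nullMeasurableSet (ne_top_of_le_ne_top hfin (measure_mono (FB_sub S δ)))
  rw [← ENNReal.toReal_sub_of_le (measure_mono (FB_sub S δ)) hfin, ← h1]
  have hmd := R.cp.isClosed.measurableSet.diff hm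
  have h2 : volume (S \ FB S δ) = ∫⁻ x, volume (Prod.mk x ⁻¹' (S \ FB S δ)) := by
    rw [Measure.volume_eq_prod, Measure.prod_apply hmd]
  rw [h2]
  have h3 := integral_toReal (μ := (volume : Measure ℝ)) (measurable_measure_prodMk_left hmd).aemeasurable (ae_of_all _ fun x => R.fib_fin δ x)
  rw [← h3, intervalIntegral.integral_of_le R.hab.le, ← integral_Icc_eq_integral_Ioc]
  symm
  apply setIntegral_eq_integral_of_forall_compl_eq_zero
  intro x hx
  exact R.ell_out hx

lemma lim_of_tay (R : Rg S a b f g) {k k' : ℝ → ℝ} (hT : ∀ᵐ x, x ∈ Ioo a b → 0 ≤ k x ∧ 0 ≤ k' x ∧ ∃ p p', Tay f x p (k x) ∧ Tay (fun x => - g x) x p' (k' x)) :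
    Tendsto (fun δ => ((volume S).toReal - (volume (FB S δ)).toReal) / δ ^ ((2:ℝ)/3)) (𝓝[>] 0) (𝓝 (cb (9/32) * ∫ x in a..b, (cb (k x) + cb (k' x)))) := by
  have V := vit (μ := volume.restrict (Ioc a b)) (φ := fun δ x => ell S δ x / cb δ ^ 2) (Φ := fun x => cb (9/32) * (cb (k x) + cb (k' x)))
    (fun δ x => div_nonneg (ell_nonneg _ _ _) (by positivity)) (fun δ => by
      have := (R.ell_ii δ a b).div_const (cb δ ^ 2)
      rwa [intervalIntegrable_iff_integrableOn_Ioc_of_le R.hab.le] at this) ?_ ?_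
  · have := V.2
    rw [integral_const_mul, ← intervalIntegral.integral_of_le R.hab.le] at this
    refine this.congr' ?_
    filter_upwards [self_mem_nhdsWithin] with δ hδ
    simp only [mem_Ioi] at hδ
    rw [rpow23, R.vol_eq, ← intervalIntegral.integral_of_le R.hab.le, intervalIntegral.integral_div]
    · try exact hδ.le
  · rw [ae_restrict_iff' measurableSet_Ioc]
    have hb : ∀ᵐ x : ℝ, x ≠ b := by simp [ae_iff]
    filter_upwards [hT, hb] with x hx hxb hx'
    obtain ⟨k0, k0', p, p', t, t'⟩ := hx ⟨hx'.1, lt_of_le_of_ne hx'.2 hxb⟩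
    exact R.ell_lim ⟨hx'.1, lt_of_le_of_ne hx'.2 hxb⟩ t t' k0 k0'
  · intro ε hε
    obtain ⟨m, hm⟩ := R.unif hε
    refine ⟨m, ?_⟩
    simpa only [intervalIntegral.integral_of_le R.hab.le] using hm

end Rg
end BL

end Part18

section Part19
set_option linter.all false
open scoped Classical

/-! ## Part 4a: second derivatives of convex functions, arc bound -/
namespace BL
open Topology

def rd (f : ℝ → ℝ) (x : ℝ) : ℝ := derivWithin f (Ioi x) x
def kk (f : ℝ → ℝ) (x : ℝ) : ℝ := deriv (rd f) x

section cx
variable {a b : ℝ} {f : ℝ → ℝ}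

lemma rd_has (hf : ConvexOn ℝ (Icc a b) f) {x : ℝ} (hx : x ∈ Ioo a b) : HasDerivWithinAt f (rd f x) (Ioi x) x :=
  hf.hasDerivWithinAt_rightDeriv_of_mem_interior (by rwa [interior_Icc])

lemma rd_mono (hf : ConvexOn ℝ (Icc a b) f) : MonotoneOn (rd f) (Ioo a b) := by
  have := hf.monotoneOn_rightDeriv
  rwa [interior_Icc] at this

lemma rd_sub (hf : ConvexOn ℝ (Icc a b) f) {x y : ℝ} (hx : x ∈ Ioo a b) (hy : y ∈ Icc a b) : f x + rd f x * (y - x) ≤ f y := by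
  have hx' : x ∈ interior (Icc a b) := by rwa [interior_Icc]
  rcases lt_trichotomy x y with h | h | h
  · have := hf.rightDeriv_le_slope_of_mem_interior hx' hy h
    rw [slope_def_field, le_div_iff₀ (by linarith)] at this
    show f x + derivWithin f (Ioi x) x * _ ≤ _
    linarith
  · rw [h]; simp
  · have h1 := hf.slope_le_leftDeriv_of_mem_interior hy hx' h
    have h2 := h1.trans (hf.leftDeriv_le_rightDeriv_of_mem_interior hx')
    rw [slope_def_field, div_le_iff₀ (by linarith)] at h2
    show f x + derivWithin f (Ioi x) x * _ ≤ _
    linarith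

lemma rd_ae (hf : ConvexOn ℝ (Icc a b) f) : ∀ᵐ x, x ∈ Ioo a b → HasDerivAt (rd f) (kk f x) x := by
  filter_upwards [(rd_mono hf).ae_differentiableWithinAt_of_mem] with x h hx
  exact ((h hx).differentiableAt (isOpen_Ioo.mem_nhds hx)).hasDerivAt

lemma kk_nonneg (hf : ConvexOn ℝ (Icc a b) f) {x : ℝ} (hx : x ∈ Ioo a b) : 0 ≤ kk f x := by
  have h1 : kk f x = derivWithin (rd f) (Ioo a b) x := (derivWithin_of_isOpen isOpen_Ioo hx).symm
  rw [h1]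
  exact (rd_mono hf).derivWithin_nonneg

lemma tay_of (hf : ConvexOn ℝ (Icc a b) f) {x k : ℝ} (hx : x ∈ Ioo a b) (hk : HasDerivAt (rd f) k x) : Rg.Tay f x (rd f x) k := by
  intro ε hε
  have hc : ContinuousOn f (Ioo a b) := (hf.subset Ioo_subset_Icc_self (convex_Ioo a b)).continuousOn isOpen_Ioo
  have h1 := (hasDerivAt_iff_isLittleO.mp hk).def hε
  obtain ⟨η, hη, hball⟩ := Metric.eventually_nhds_iff.mp h1
  obtain ⟨w, hw⟩ : ∃ w, w = min (η / 2) (min ((x - a) / 2) ((b - x) / 2)) := ⟨_, rfl⟩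
  have hw0 : 0 < w := by rw [hw]; exact lt_min (by linarith) (lt_min (by linarith [hx.1]) (by linarith [hx.2]))
  have hw1 : w ≤ η / 2 := by rw [hw]; exact min_le_left _ _
  have hw2 : w ≤ (x - a) / 2 := by rw [hw]; exact (min_le_right _ _).trans (min_le_left _ _)
  have hw3 : w ≤ (b - x) / 2 := by rw [hw]; exact (min_le_right _ _).trans (min_le_right _ _)
  have key : ∀ c e m, x - w ≤ c → e ≤ x + w → c ≤ e → (∀ y ∈ Icc c e, |y - x| ≤ m) → 
      |(f e - rd f x * (e - x) - k * (e - x) ^ 2 / 2) - (f c - rd f x * (c - x) - k * (c - x) ^ 2 / 2)| ≤ ε * m * (e - c) := by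
    intro c e m h1 h2 h3 hm
    have := norm_image_sub_le_of_norm_deriv_right_le_segment (f := fun y => f y - rd f x * (y - x) - k * (y - x) ^ 2 / 2) (f' := fun y => rd f y - rd f x - k * (y - x))
      (a := c) (b := e) (C := ε * m) ?_ ?_ ?_ e ⟨h3, le_rfl⟩
    · simpa using this
    · refine ContinuousOn.sub (ContinuousOn.sub (hc.mono fun y hy => ⟨by linarith [hy.1, hx.1], by linarith [hy.2, hx.2]⟩) (by fun_prop)) (by fun_prop)
    · intro y hy
      have hd := (rd_has hf (x := y) ⟨by linarith [hy.1, hx.1], by linarith [hy.2, hx.2]⟩).Ici_of_Ioi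
      have h1 : HasDerivAt (fun y : ℝ => y - x) 1 y := (hasDerivAt_id y).sub_const x
      have h2 := ((h1.const_mul (rd f x))).hasDerivWithinAt (s := Ici y)
      have h3 := (((h1.pow 2).const_mul k).div_const 2).hasDerivWithinAt (s := Ici y)
      exact ((hd.sub h2).sub h3).congr_deriv (by norm_num; ring)
    · intro y hy
      have hym := hm y (Ico_subset_Icc_self hy)
      have : dist y x < η := by
        rw [Real.dist_eq, abs_lt]; constructor <;> linarith [hy.1, hy.2]
      have := hball this
      simp only [smul_eq_mul] at this
      calc ‖rd f y - rd f x - k * (y - x)‖ = ‖rd f y - rd f x - (y - x) * k‖ := by rw [mul_comm k]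
        _ ≤ ε * ‖y - x‖ := this
        _ ≤ ε * m := by rw [Real.norm_eq_abs]; gcongr
  refine ⟨w, hw0, fun u hu => ?_⟩
  obtain ⟨u1, u2⟩ := abs_le.mp hu
  rcases le_total 0 u with h | h
  · have := key x (x + u) u (by linarith) (by linarith) (by linarith) (fun y hy => by rw [abs_of_nonneg] <;> linarith [hy.1, hy.2])
    rw [show ε * u ^ 2 = ε * u * (x + u - x) by ring]
    convert this using 2; ring
  · have := key (x + u) x (-u) (by linarith) (by linarith) (by linarith) (fun y hy => by rw [abs_of_nonpos] <;> linarith [hy.1, hy.2])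
    rw [show ε * u ^ 2 = ε * (-u) * (x - (x + u)) by ring]
    rw [abs_sub_comm] at this
    convert this using 2
    ring

lemma has_of_tay {x p k : ℝ} (h : Rg.Tay f x p k) : HasDerivAt f p x := by
  rw [hasDerivAt_iff_isLittleO, Asymptotics.isLittleO_iff]
  intro c hc
  obtain ⟨u0, hu0, hT⟩ := h 1 one_pos
  have hk : 0 < |k| + 1 := by positivity
  rw [Metric.eventually_nhds_iff]
  refine ⟨min u0 (c / (|k| + 1)), lt_min hu0 (by positivity), fun y hy => ?_⟩
  rw [Real.dist_eq] at hy
  have h1 := hT (y - x) ((hy.trans_le (min_le_left _ _)).le)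
  have h2 := hy.trans_le (min_le_right _ _)
  rw [lt_div_iff₀ hk] at h2
  rw [add_sub_cancel, ] at h1
  simp only [smul_eq_mul, Real.norm_eq_abs]
  have e : f y - f x - (y - x) * p = (f y - f x - p * (y - x) - k * (y - x) ^ 2 / 2) + k * (y - x) ^ 2 / 2 := by ring
  rw [e]
  refine (abs_add_le _ _).trans ?_
  rw [abs_div, abs_mul, abs_pow, abs_two]
  have h3 : 1 * (y - x) ^ 2 = |y - x| ^ 2 := by rw [sq_abs, one_mul]
  rw [h3] at h1
  nlinarith [abs_nonneg (y - x), abs_nonneg k, mul_nonneg (abs_nonneg k) (sq_nonneg |y - x|)]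

end cx
end BL

end Part19

section Part20
set_option linter.all false
open scoped Classical

/-! ## Part 4b: the bound for one piece -/
namespace BL
open Topology

/-- `r` for one piece. -/
def rr (u v s : ℝ) : ℝ := Real.sqrt (u ^ 2 + (v - u) * s)
def ta (u v s : ℝ) : ℝ := s / (u + rr u v s)

section rta
variable {u v s : ℝ}

lemma rr_arg (hu : 0 ≤ u) (hv : 0 ≤ v) (h0 : 0 < s) (h1 : s < u + v) : 0 < u ^ 2 + (v - u) * s := by
  have e : (u + v) * (u ^ 2 + (v - u) * s) = u ^ 2 * (u + v - s) + v ^ 2 * s := by ring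
  have hX : 0 < u + v := by linarith
  by_contra hc
  push Not at hc
  have h3 : u ^ 2 * (u + v - s) + v ^ 2 * s ≤ 0 := by rw [← e]; exact mul_nonpos_of_nonneg_of_nonpos hX.le hc
  have h4 : 0 ≤ u ^ 2 * (u + v - s) := mul_nonneg (sq_nonneg u) (by linarith)
  have h5 : 0 ≤ v ^ 2 * s := by positivity
  have h6 : u ^ 2 = 0 := by
    rcases mul_eq_zero.mp (show u ^ 2 * (u + v - s) = 0 by linarith) with h | h
    · exact h
    · linarith
  have h7 : v ^ 2 = 0 := by
    rcases mul_eq_zero.mp (show v ^ 2 * s = 0 by linarith) with h | h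
    · exact h
    · linarith
  have := pow_eq_zero_iff (n := 2) (by norm_num) |>.mp h6
  have := pow_eq_zero_iff (n := 2) (by norm_num) |>.mp h7
  linarith

lemma rr_pos (hu : 0 ≤ u) (hv : 0 ≤ v) (h0 : 0 < s) (h1 : s < u + v) : 0 < rr u v s := Real.sqrt_pos.mpr (rr_arg hu hv h0 h1)

lemma rr_sq (hu : 0 ≤ u) (hv : 0 ≤ v) (h0 : 0 < s) (h1 : s < u + v) : rr u v s ^ 2 = u ^ 2 + (v - u) * s := Real.sq_sqrt (rr_arg hu hv h0 h1).le

lemma ta_nonneg (hu : 0 ≤ u) (hs : 0 ≤ s) : 0 ≤ ta u v s := div_nonneg hs (add_nonneg hu (Real.sqrt_nonneg _))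

lemma ta_le (hu : 0 ≤ u) (hv : 0 ≤ v) (h0 : 0 < s) (h1 : s < u + v) : ta u v s ≤ 1 := by
  have hr := rr_pos hu hv h0 h1
  rw [ta, div_le_one (by linarith)]
  have : s - u ≤ rr u v s := by
    apply Real.le_sqrt_of_sq_le; nlinarith
  linarith

lemma rr_has (hu : 0 ≤ u) (hv : 0 ≤ v) (h0 : 0 < s) (h1 : s < u + v) : HasDerivAt (rr u v) ((v - u) / (2 * rr u v s)) s := by
  have h : HasDerivAt (fun s : ℝ => u ^ 2 + (v - u) * s) (v - u) s := 
    (((hasDerivAt_id s).const_mul (v - u)).const_add (u ^ 2)).congr_deriv (by simp)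
  exact h.sqrt (rr_arg hu hv h0 h1).ne'

lemma ta_has (hu : 0 ≤ u) (hv : 0 ≤ v) (h0 : 0 < s) (h1 : s < u + v) : HasDerivAt (ta u v) (1 / (2 * rr u v s)) s := by
  have hr := rr_pos hu hv h0 h1
  have h2 := rr_sq hu hv h0 h1
  have h := (hasDerivAt_id s).div ((rr_has hu hv h0 h1).const_add u) (by linarith [rr_pos hu hv h0 h1])
  refine h.congr_deriv ?_
  have hne : u + rr u v s ≠ 0 := by positivity
  simp only [id]
  rw [div_eq_div_iff (by positivity) (by positivity)]
  have e : (v - u) / (2 * rr u v s) * (2 * rr u v s) = v - u := by field_simp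
  linear_combination (-s) * e + h2
 
lemma ta_mono (hu : 0 ≤ u) (hv : 0 ≤ v) : MonotoneOn (ta u v) (Ioo 0 (u + v)) := by
  apply monotoneOn_of_deriv_nonneg (convex_Ioo _ _)
  · intro s hs; exact (ta_has hu hv hs.1 hs.2).continuousAt.continuousWithinAt
  · rw [interior_Ioo]; intro s hs; exact (ta_has hu hv hs.1 hs.2).differentiableAt.differentiableWithinAt
  · rw [interior_Ioo]; intro s hs; rw [(ta_has hu hv hs.1 hs.2).deriv]
    have := rr_pos hu hv hs.1 hs.2
    positivity

end rta

/-- AM-GM -/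
lemma amgm3 {k r l : ℝ} (hk : 0 ≤ k) (hr : 0 < r) (hl : 0 < l) : cb k ≤ (l ^ 2 * (k * r ^ 2) + 4 / l * (1 / (2 * r))) / 3 := by
  obtain ⟨c, hc⟩ : ∃ c, c = cb k := ⟨_, rfl⟩
  have hc0 : 0 ≤ c := by rw [hc]; exact cb_nonneg hk
  have hk' : k = c ^ 3 := by rw [hc, cb_cube hk]
  rw [← hc, hk']
  have e : (l ^ 2 * (c ^ 3 * r ^ 2) + 4 / l * (1 / (2 * r))) / 3 = ((l * r * c) ^ 3 + 2) / (3 * (l * r)) := by field_simp; ring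
  rw [e, le_div_iff₀ (by positivity)]
  have : 0 ≤ l * r * c := by positivity
  nlinarith [mul_nonneg (by linarith : 0 ≤ l * r * c + 2) (sq_nonneg (l * r * c - 1))]

section piece
variable {a b : ℝ} {f : ℝ → ℝ}

def Th (f : ℝ → ℝ) (u v c x : ℝ) : ℝ :=
  (u ^ 2 * (rd f x * (c + (u + v) - x) + f x - f (c + (u + v))) + v ^ 2 * (rd f x * (x - c) - (f x - f c))) / (u + v)

lemma piece1 (hf : ConvexOn ℝ (Icc a b) f) {c u v P l : ℝ} (hu : 0 ≤ u) (hv : 0 ≤ v) (hX : 0 < u + v) (hc : a ≤ c) (hb : c + (u + v) ≤ b) (hP : 0 ≤ P)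
    (h1 : ∀ x ∈ Ioo c (c + (u + v)), v ^ 2 * (rd f x * (x - c) - (f x - f c)) ≤ P * v) 
    (h2 : ∀ x ∈ Ioo c (c + (u + v)), -(P * u) ≤ u ^ 2 * (rd f x * (c + (u + v) - x) + f x - f (c + (u + v)))) (hl : 0 < l) :
    IntervalIntegrable (fun x => cb (kk f x)) volume c (c + (u + v)) ∧ ∫ x in c..(c + (u + v)), cb (kk f x) ≤ (l ^ 2 * P + 4 / l) / 3 := by
  obtain ⟨X, hXd⟩ : ∃ X, X = u + v := ⟨_, rfl⟩
  have hX' : 0 < X := by linarith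
  have hsub : Ioo c (c + X) ⊆ Ioo a b := fun x hx => ⟨by linarith [hx.1], by linarith [hx.2]⟩
  have hmemI : ∀ x ∈ Ioo c (c + X), c ∈ Icc a b ∧ c + X ∈ Icc a b ∧ x ∈ Icc a b := fun x hx => 
    ⟨⟨by linarith, by linarith⟩, ⟨by linarith, by linarith⟩, Ioo_subset_Icc_self (hsub hx)⟩
  -- Θ bounds
  have hlo : ∀ x ∈ Ioo c (c + X), -(P * u / X) ≤ Th f u v c x := by
    intro x hx
    have s := rd_sub hf (hsub hx) (hmemI x hx).1
    have i2 := h2 x (by rwa [← hXd])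
    rw [Th, ← hXd, ← neg_div]
    rw [← hXd] at i2
    have : 0 ≤ v ^ 2 * (rd f x * (x - c) - (f x - f c)) := mul_nonneg (sq_nonneg v) (by linarith)
    gcongr; linarith
  have hhi : ∀ x ∈ Ioo c (c + X), Th f u v c x ≤ P * v / X := by
    intro x hx
    have s := rd_sub hf (hsub hx) (hmemI x hx).2.1
    have i1 := h1 x (by rwa [← hXd])
    rw [Th, ← hXd]
    have : u ^ 2 * (rd f x * (c + X - x) + f x - f (c + X)) ≤ 0 := mul_nonpos_of_nonneg_of_nonpos (sq_nonneg u) (by linarith)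
    gcongr; linarith
  have hmon : MonotoneOn (Th f u v c) (Ioo c (c + X)) := by
    intro x hx y hy hxy
    have hd := rd_mono hf (hsub hx) (hsub hy) hxy
    have s1 := rd_sub hf (hsub hx) (hmemI y hy).2.2
    have s2 := rd_sub hf (hsub hy) (hmemI x hx).2.2
    have k1 : rd f x * (c + X - x) + f x - f (c + X) ≤ rd f y * (c + X - y) + f y - f (c + X) := by nlinarith [hy.2]
    have k2 : rd f x * (x - c) - (f x - f c) ≤ rd f y * (y - c) - (f y - f c) := by nlinarith [hx.1]
    rw [Th, Th, ← hXd]; gcongr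
  obtain ⟨G, hG⟩ : ∃ G : ℝ → ℝ, G = fun x => if x ≤ c then (l ^ 2 * (-(P * u / X))) / 3 else if c + X ≤ x then (l ^ 2 * (P * v / X) + 4 / l) / 3 else 
      (l ^ 2 * Th f u v c x + 4 / l * ta u v (x - c)) / 3 := ⟨_, rfl⟩
  have G0 : G c = (l ^ 2 * (-(P * u / X))) / 3 := by rw [hG]; simp
  have G1 : G (c + X) = (l ^ 2 * (P * v / X) + 4 / l) / 3 := by rw [hG]; simp [show ¬ (X ≤ 0) by linarith]
  have Gm : ∀ x ∈ Ioo c (c + X), G x = (l ^ 2 * Th f u v c x + 4 / l * ta u v (x - c)) / 3 := by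
    intro x hx; rw [hG]; simp only [not_le.mpr hx.1, not_le.mpr hx.2, if_false]
  have hl4 : 0 < 4 / l := by positivity
  have Gmono : MonotoneOn G (Icc c (c + X)) := by
    intro x hx y hy hxy
    rcases eq_or_lt_of_le hxy with h | hlt
    · rw [h]
    have A : ∀ z ∈ Ioo c (c + X), G c ≤ G z := by
      intro z hz
      rw [Gm z hz, G0]
      have t0 := ta_nonneg (v := v) hu (show 0 ≤ z - c by linarith [hz.1])
      have := mul_le_mul_of_nonneg_left (hlo z hz) (sq_nonneg l)
      nlinarith
    have B : ∀ z ∈ Ioo c (c + X), G z ≤ G (c + X) := by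
      intro z hz
      rw [Gm z hz, G1]
      have t0 := ta_le hu hv (show 0 < z - c by linarith [hz.1]) (by linarith [hz.2])
      have := mul_le_mul_of_nonneg_left (hhi z hz) (sq_nonneg l)
      nlinarith
    rcases eq_or_lt_of_le hx.1 with h1 | h1
    · rw [← h1]
      rcases eq_or_lt_of_le hy.2 with h2 | h2
      · rw [h2]; exact (A (c + X / 2) ⟨by linarith, by linarith⟩).trans (B _ ⟨by linarith, by linarith⟩)
      · exact A y ⟨by linarith, h2⟩
    · rcases eq_or_lt_of_le hy.2 with h2 | h2
      · rw [h2]; exact B x ⟨h1, by linarith⟩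
      · have hx' : x ∈ Ioo c (c + X) := ⟨h1, by linarith⟩
        have hy' : y ∈ Ioo c (c + X) := ⟨by linarith, h2⟩
        rw [Gm x hx', Gm y hy']
        have t := ta_mono hu hv (show x - c ∈ Ioo 0 (u + v) from ⟨by linarith, by linarith⟩) (show y - c ∈ Ioo 0 (u + v) from ⟨by linarith, by linarith⟩) (by linarith)
        have := hmon hx' hy' hxy
        gcongr
  have hle : c ≤ c + X := by linarith
  have hii : IntervalIntegrable (deriv G) volume c (c + X) := MonotoneOn.intervalIntegrable_deriv (by rwa [uIcc_of_le hle])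
  have hInt0 := MonotoneOn.intervalIntegral_deriv_mem_uIcc (f := G) (a := c) (b := c + X) (by rwa [uIcc_of_le hle])
  have hG01 : G (c + X) - G c = (l ^ 2 * P + 4 / l) / 3 := by
    rw [G0, G1, hXd]; field_simp; ring
  rw [hG01, uIcc_of_le (by positivity)] at hInt0
  have hae : ∀ᵐ x, x ∈ Ioc c (c + X) → 0 ≤ cb (kk f x) ∧ cb (kk f x) ≤ deriv G x := by
    have hne : ∀ᵐ x : ℝ, x ≠ c + X := by simp [ae_iff]
    filter_upwards [rd_ae hf, hne] with x hx hxne hx'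
    have hxo : x ∈ Ioo c (c + X) := ⟨hx'.1, lt_of_le_of_ne hx'.2 hxne⟩
    have hk := hx (hsub hxo)
    have hk0 := kk_nonneg hf (hsub hxo)
    refine ⟨cb_nonneg hk0, ?_⟩
    have hfd := has_of_tay (tay_of hf (hsub hxo) hk)
    have s0 : 0 < x - c := by linarith [hxo.1]
    have s1 : x - c < u + v := by linarith [hxo.2]
    have hr := rr_pos hu hv s0 s1
    have hT : HasDerivAt (Th f u v c) (kk f x * rr u v (x - c) ^ 2) x := by
      have e1 : HasDerivAt (fun x : ℝ => c + (u + v) - x) (-1) x := (hasDerivAt_id x).const_sub _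
      have e2 : HasDerivAt (fun x : ℝ => x - c) 1 x := (hasDerivAt_id x).sub_const _
      have := ((((((hk.mul e1).add hfd).sub_const (f (c + (u + v)))).const_mul (u ^ 2)).add (((hk.mul e2).sub (hfd.sub_const (f c))).const_mul (v ^ 2))).div_const (u + v))
      refine this.congr_deriv ?_
      rw [rr_sq hu hv s0 s1]; field_simp; ring
    have hta : HasDerivAt (fun x => ta u v (x - c)) (1 / (2 * rr u v (x - c))) x := by
      have := (ta_has hu hv s0 s1).comp x ((hasDerivAt_id x).sub_const c)
      exact this.congr_deriv (by simp)
    have hGd : HasDerivAt G ((l ^ 2 * (kk f x * rr u v (x - c) ^ 2) + 4 / l * (1 / (2 * rr u v (x - c)))) / 3) x := by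
      refine (((hT.const_mul (l ^ 2)).add (hta.const_mul (4 / l))).div_const 3).congr_of_eventuallyEq ?_
      filter_upwards [isOpen_Ioo.mem_nhds hxo] with y hy
      exact Gm y hy
    rw [hGd.deriv]
    exact amgm3 hk0 hr hl
  rw [← hXd]
  have hii2 : IntervalIntegrable (fun x => cb (kk f x)) volume c (c + X) := by
    refine hii.mono_fun ((cb_cont.measurable.comp (measurable_deriv _)).aestronglyMeasurable) ?_
    rw [uIoc_of_le hle]
    refine (ae_restrict_iff' measurableSet_Ioc).mpr ?_
    filter_upwards [hae] with x hx hx'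
    obtain ⟨a0, a1⟩ := hx hx'
    rw [Real.norm_eq_abs, Real.norm_eq_abs, abs_of_nonneg a0, abs_of_nonneg (a0.trans a1)]; exact a1
  refine ⟨hii2, ?_⟩
  refine le_trans ?_ hInt0.2
  refine intervalIntegral.integral_mono_ae_restrict hle hii2 hii ?_
  rw [← restrict_Ioc_eq_restrict_Icc]
  refine (ae_restrict_iff' measurableSet_Ioc).mpr ?_
  filter_upwards [hae] with x hx hx'
  exact (hx hx').2

lemma piece2 (hf : ConvexOn ℝ (Icc a b) f) {c u v P : ℝ} (hu : 0 ≤ u) (hv : 0 ≤ v) (hX : 0 < u + v) (hc : a ≤ c) (hb : c + (u + v) ≤ b) (hP : 0 ≤ P)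
    (h1 : ∀ x ∈ Ioo c (c + (u + v)), v ^ 2 * (rd f x * (x - c) - (f x - f c)) ≤ P * v) 
    (h2 : ∀ x ∈ Ioo c (c + (u + v)), -(P * u) ≤ u ^ 2 * (rd f x * (c + (u + v) - x) + f x - f (c + (u + v)))) :
    IntervalIntegrable (fun x => cb (kk f x)) volume c (c + (u + v)) ∧ ∫ x in c..(c + (u + v)), cb (kk f x) ≤ cb (4 * P) := by
  have key := fun l hl => piece1 hf hu hv hX hc hb hP h1 h2 (l := l) hl
  refine ⟨(key 1 one_pos).1, ?_⟩
  rcases eq_or_lt_of_le hP with h | h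
  · rw [← h, mul_zero, cb_zero]
    apply le_of_forall_pos_le_add
    intro ε hε
    have := (key (2 / ε) (by positivity)).2
    rw [← h] at this
    refine this.trans ?_
    have : (((2 / ε) ^ 2 * 0 + 4 / (2 / ε)) / 3) = 2 / 3 * ε := by field_simp; ring
    linarith
  · obtain ⟨m, hm⟩ : ∃ m, m = cb (4 * P) := ⟨_, rfl⟩
    have m0 : 0 < m := by rw [hm]; exact cb_pos (by positivity)
    have m3 : m ^ 3 = 4 * P := by rw [hm, cb_cube (by positivity)]
    have := (key (2 / m) (by positivity)).2
    rw [← hm]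
    refine this.trans (le_of_eq ?_)
    have : P = m ^ 3 / 4 := by linarith
    rw [this]; field_simp; ring

end piece
end BL

end Part20

section Part21
set_option linter.all false
open scoped Classical

/-! ## Part 4c: affine length is at most the sum over a fan -/
namespace BL
open Topology

lemma piece3 {a b c c' : ℝ} {f : ℝ → ℝ} (hf : ConvexOn ℝ (Icc a b) f) {α β a1 a2 b1 b2 : ℝ} (hα : 0 ≤ α) (hβ : 0 ≤ β)
    (ha1 : 0 ≤ a1) (hb1 : 0 ≤ b1) (hd : a1 * b2 - a2 * b1 = 1) (hc : a ≤ c) (hb : c' ≤ b)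
    (e1 : c' - c = α * a1 + β * b1) (e2 : f c' - f c = α * a2 + β * b2)
    (s1 : ∀ x ∈ Icc a b, a1 * f c - a2 * c ≤ a1 * f x - a2 * x)
    (s2 : ∀ x ∈ Icc a b, b1 * f c' - b2 * c' ≤ b1 * f x - b2 * x) :
    IntervalIntegrable (fun x => cb (kk f x)) volume c c' ∧ ∫ x in c..c', cb (kk f x) ≤ cb (4 * (α * β)) := by
  have hu : 0 ≤ α * a1 := by positivity
  have hv : 0 ≤ β * b1 := by positivity
  rcases (add_nonneg hu hv).eq_or_lt with h0 | h0
  · have : c' = c := by linarith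
    subst this
    simp only [IntervalIntegrable.refl, intervalIntegral.integral_same, true_and]
    exact cb_nonneg (by positivity)
  have hc' : c' = c + (α * a1 + β * b1) := by linarith
  have mc : c ∈ Icc a b := ⟨hc, by linarith⟩
  have mc' : c' ∈ Icc a b := ⟨by linarith, by linarith⟩
  have P2 := piece2 (P := α * β) hf hu hv h0 hc (by rw [← hc']; exact hb) (by positivity)
  rw [← hc'] at P2
  refine P2 (fun x hx => ?_) (fun x hx => ?_)
  · have mx : x ∈ Icc a b := ⟨by linarith [hx.1], by linarith [hx.2]⟩
    have mx' : x ∈ Ioo a b := ⟨by linarith [hx.1], by linarith [hx.2]⟩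
    have r := rd_sub hf mx' mc'
    have h3 : b1 * (rd f x * (x - c) - (f x - f c)) ≤ α := by
      have t1 := s2 x mx
      have t2 : b1 * rd f x ≤ b2 := by
        have : b1 * rd f x * (c' - x) ≤ b2 * (c' - x) := by
          have := mul_le_mul_of_nonneg_left r hb1
          nlinarith
        exact le_of_mul_le_mul_right this (by linarith [hx.2])
      have t3 : b1 * rd f x * (x - c) ≤ b2 * (x - c) := mul_le_mul_of_nonneg_right t2 (by linarith [hx.1])
      have t4 : b2 * (c' - c) - b1 * (f c' - f c) = α := by rw [e1, e2]; linear_combination α * hd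
      linarith
    have h4 : β * (b1 * (rd f x * (x - c) - (f x - f c))) ≤ β * α := mul_le_mul_of_nonneg_left h3 hβ
    have h5 := mul_le_mul_of_nonneg_left h4 hv
    linarith
  · have mx : x ∈ Icc a b := ⟨by linarith [hx.1], by linarith [hx.2]⟩
    have mx' : x ∈ Ioo a b := ⟨by linarith [hx.1], by linarith [hx.2]⟩
    have r := rd_sub hf mx' mc
    have h3 : -β ≤ a1 * (rd f x * (c' - x) + f x - f c') := by
      have t1 := s1 x mx
      have t2 : a2 ≤ a1 * rd f x := by
        have : a2 * (x - c) ≤ a1 * rd f x * (x - c) := by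
          have := mul_le_mul_of_nonneg_left r ha1
          nlinarith
        exact le_of_mul_le_mul_right this (by linarith [hx.1])
      have t3 : a2 * (c' - x) ≤ a1 * rd f x * (c' - x) := mul_le_mul_of_nonneg_right t2 (by linarith [hx.2])
      have t4 : a2 * (c' - c) - a1 * (f c' - f c) = -β := by rw [e1, e2]; linear_combination (-β) * hd
      linarith
    have h4 : α * (-β) ≤ α * (a1 * (rd f x * (c' - x) + f x - f c')) := mul_le_mul_of_nonneg_left h3 hα
    have h5 := mul_le_mul_of_nonneg_left h4 hu
    linarith

lemma Rg.exists_dat {S : Set (ℝ × ℝ)} {a b : ℝ} {f g : ℝ → ℝ} (R : Rg S a b f g) (N : ℕ) : ∃ p : ℕ → ℝ × ℝ,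
    p 0 = (a, f a) ∧ p (kf N) = (b, f b) ∧ ∀ i ≤ kf N, p i ∈ S ∧ (p i).2 = f (p i).1 ∧
      ∀ z ∈ S, dt (cR (fan N i)) (p i) ≤ dt (cR (fan N i)) z := by
  have ma : (a, f a) ∈ S := (R.mem _ _).mpr ⟨⟨le_rfl, R.hab.le⟩, le_rfl, R.le _ ⟨le_rfl, R.hab.le⟩⟩
  have mb : (b, f b) ∈ S := (R.mem _ _).mpr ⟨⟨R.hab.le, le_rfl⟩, le_rfl, R.le _ ⟨R.hab.le, le_rfl⟩⟩
  have key : ∀ i, ∃ q : ℝ × ℝ, (i = 0 → q = (a, f a)) ∧ (i = kf N → q = (b, f b)) ∧ (i ≤ kf N → q ∈ S ∧ q.2 = f q.1 ∧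
      ∀ z ∈ S, dt (cR (fan N i)) q ≤ dt (cR (fan N i)) z) := by
    intro i
    have hk := kf_pos N
    rcases Nat.eq_zero_or_pos i with rfl | h0
    · refine ⟨(a, f a), fun _ => rfl, fun h => by omega, fun _ => ⟨ma, rfl, fun z hz => ?_⟩⟩
      rw [fan_zero]; simp [dt]
      exact ((R.mem z.1 z.2).mp hz).1.1
    rcases lt_trichotomy i (kf N) with h1 | rfl | h1
    · obtain ⟨q, hq, hm⟩ := R.cp.exists_isMinOn ⟨_, ma⟩ (f := fun z => dt (cR (fan N i)) z) (by unfold dt; fun_prop)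
      refine ⟨q, fun h => by omega, fun h => by omega, fun _ => ⟨hq, ?_, fun z hz => hm hz⟩⟩
      have h2 := (R.mem q.1 q.2).mp hq
      have h3 : (q.1, f q.1) ∈ S := (R.mem _ _).mpr ⟨h2.1, le_rfl, R.le _ h2.1⟩
      have h4 := hm h3
      have h5 : (0:ℝ) < (fan N i).1 := by exact_mod_cast (fan_props N i h1).2.2.2.2.2.2.2 h0
      simp only [mem_setOf_eq, dt, cR_fst, cR_snd] at h4
      have h6 : ((fan N i).1 : ℝ) * q.2 ≤ (fan N i).1 * f q.1 := by linarith
      exact le_antisymm (le_of_mul_le_mul_left h6 h5) h2.2.1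
    · refine ⟨(b, f b), fun h => by omega, fun _ => rfl, fun _ => ⟨mb, rfl, fun z hz => ?_⟩⟩
      rw [fan_last]; simp [dt]
      exact ((R.mem z.1 z.2).mp hz).1.2
    · exact ⟨0, fun h => by omega, fun h => by omega, fun h => by omega⟩
  choose p hp using key
  exact ⟨p, (hp 0).1 rfl, (hp _).2.1 rfl, fun i hi => (hp i).2.2 hi⟩

lemma Rg.low_le {S : Set (ℝ × ℝ)} {a b : ℝ} {f g : ℝ → ℝ} (R : Rg S a b f g) (N : ℕ) {p : ℕ → ℝ × ℝ}
    (h0 : p 0 = (a, f a)) (hk : p (kf N) = (b, f b)) (hp : ∀ i ≤ kf N, p i ∈ S ∧ (p i).2 = f (p i).1 ∧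
      ∀ z ∈ S, dt (cR (fan N i)) (p i) ≤ dt (cR (fan N i)) z) :
    Dat N p ∧ IntervalIntegrable (fun x => cb (kk f x)) volume a b ∧ ∫ x in a..b, cb (kk f x) ≤ TT N p := by
  have hD : Dat N p := by
    intro i hi
    have h1 := (hp (i+1) hi).2.2 _ (hp i hi.le).1
    have h2 := (hp i hi.le).2.2 _ (hp (i+1) hi).1
    constructor
    · unfold al; rw [dt_swap, dt_sub_right]; linarith
    · unfold be; rw [dt_sub_right]; linarith
  have key : ∀ i < kf N, IntervalIntegrable (fun x => cb (kk f x)) volume (p i).1 (p (i+1)).1 ∧ 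
      ∫ x in (p i).1..(p (i+1)).1, cb (kk f x) ≤ cb (4 * (al N p i * be N p i)) := by
    intro i hi
    have hF := fan_props N i hi
    obtain ⟨m1, y1, s1⟩ := hp i hi.le
    obtain ⟨m2, y2, s2⟩ := hp (i+1) hi
    have e := sec_coordR hi (p (i+1) - p i)
    have hd : dt (cR (fan N i)) (cR (fan N (i+1))) = 1 := by rw [dt_cR, hF.1]; simp
    refine piece3 R.cvx (a1 := (cR (fan N i)).1) (a2 := (cR (fan N i)).2) (b1 := (cR (fan N (i+1))).1) (b2 := (cR (fan N (i+1))).2)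
      (hD i hi).1 (hD i hi).2 (by simpa using hF.2.1) (by simpa using hF.2.2.1) hd ((R.mem (p i).1 (p i).2).mp m1).1.1 ((R.mem (p (i+1)).1 (p (i+1)).2).mp m2).1.2 ?_ ?_ ?_ ?_
    · have := congrArg Prod.fst e
      exact this
    · have := congrArg Prod.snd e
      rw [← y1, ← y2]; exact this
    · intro x hx
      have := s1 _ ((R.mem x (f x)).mpr ⟨hx, le_rfl, R.le x hx⟩)
      unfold dt at this; rw [y1] at this; exact this
    · intro x hx
      have := s2 _ ((R.mem x (f x)).mpr ⟨hx, le_rfl, R.le x hx⟩)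
      unfold dt at this; rw [y2] at this; exact this
  have A := IntervalIntegrable.trans_iterate (a := fun i => (p i).1) (n := kf N) (fun i hi => (key i hi).1)
  have B := intervalIntegral.sum_integral_adjacent_intervals (a := fun i => (p i).1) (n := kf N) (fun i hi => (key i hi).1)
  simp only [h0, hk] at A B
  refine ⟨hD, A, ?_⟩
  rw [← B]
  exact Finset.sum_le_sum fun i hi => (key i (Finset.mem_range.mp hi)).2

/-- affine length of the lower and upper boundary -/
def AL (a b : ℝ) (f g : ℝ → ℝ) : ℝ := ∫ x in a..b, (cb (kk f x) + cb (kk (fun x => - g x) x))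

theorem Rg.lim_FB {S : Set (ℝ × ℝ)} {a b : ℝ} {f g : ℝ → ℝ} (R : Rg S a b f g) : 
    Tendsto (fun δ => ((volume S).toReal - (volume (FB S δ)).toReal) / δ ^ ((2:ℝ)/3)) (𝓝[>] 0) (𝓝 (cb (9/32) * AL a b f g)) := by
  refine R.lim_of_tay ?_
  filter_upwards [rd_ae R.cvx, rd_ae R.ccv] with x h1 h2 hx
  exact ⟨kk_nonneg R.cvx hx, kk_nonneg R.ccv hx, _, _, tay_of R.cvx hx (h1 hx), tay_of R.ccv hx (h2 hx)⟩

/-- Part (b): a good pair of data inside `S` whose value dominates the affine length. -/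
theorem Rg.good {S : Set (ℝ × ℝ)} {a b : ℝ} {f g : ℝ → ℝ} (R : Rg S a b f g) (N : ℕ) : ∃ p p', GoodPair N S p p' ∧ AL a b f g ≤ TT N p + TT N p' := by
  obtain ⟨p, h0, hk, hp⟩ := R.exists_dat N
  obtain ⟨p', h0', hk', hp'⟩ := R.refl.exists_dat N
  obtain ⟨D, I, B⟩ := R.low_le N h0 hk hp
  obtain ⟨D', I', B'⟩ := R.refl.low_le N h0' hk' hp'
  refine ⟨p, p', ⟨D, D', fun i hi => (hp i hi).1, fun i hi => (hp' i hi).1, by rw [h0, h0'], by rw [hk, hk'], ?_, ?_⟩, ?_⟩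
  · rw [h0, h0']; simpa using R.le a ⟨le_rfl, R.hab.le⟩
  · rw [hk, hk']; simpa using R.le b ⟨R.hab.le, le_rfl⟩
  · unfold AL; rw [intervalIntegral.integral_add I I']; linarith

end BL

end Part21

section Part22
set_option linter.all false
open scoped Classical

/-! ## Part 5a: parabolic arcs -/
namespace BL
open Topology

section rta
variable {u v s : ℝ}

lemma ta_lt (hu : 0 ≤ u) (hv : 0 ≤ v) (h0 : 0 < s) (h1 : s < u + v) : ta u v s < 1 := by
  have hr := rr_pos hu hv h0 h1
  rw [ta, div_lt_one (by linarith)]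
  have : s - u < rr u v s := by
    apply Real.lt_sqrt_of_sq_lt; nlinarith
  linarith

lemma rr_ta (hu : 0 ≤ u) (hv : 0 ≤ v) (h0 : 0 < s) (h1 : s < u + v) : rr u v s = u + (v - u) * ta u v s := by
  have hr := rr_pos hu hv h0 h1
  have h2 := rr_sq hu hv h0 h1
  have hne : u + rr u v s ≠ 0 := by positivity
  rw [ta]; field_simp; linarith

lemma ta_eq (hu : 0 ≤ u) (hv : 0 ≤ v) (h0 : 0 < s) (h1 : s < u + v) : u * (2 * ta u v s - ta u v s ^ 2) + v * ta u v s ^ 2 = s := by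
  have hr := rr_pos hu hv h0 h1
  have h2 := rr_ta hu hv h0 h1
  have hne : u + rr u v s ≠ 0 := by positivity
  have h3 : ta u v s * (u + rr u v s) = s := by rw [ta]; field_simp
  rw [h2] at h3
  linarith

lemma ta_pos (hu : 0 ≤ u) (hv : 0 ≤ v) (h0 : 0 < s) (h1 : s < u + v) : 0 < ta u v s := 
  div_pos h0 (by linarith [rr_pos hu hv h0 h1])

lemma ta_low (hu : 0 ≤ u) (hv : 0 ≤ v) (h0 : 0 < s) (h1 : s < u + v) : ta u v s ≤ Real.sqrt (s / (u + v)) := by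
  have e := ta_eq hu hv h0 h1
  have p := ta_pos hu hv h0 h1
  have q := ta_lt hu hv h0 h1
  apply Real.le_sqrt_of_sq_le
  rw [le_div_iff₀ (by linarith)]
  nlinarith [mul_nonneg hu (mul_nonneg p.le (sub_nonneg.mpr q.le))]

lemma ta_high (hu : 0 ≤ u) (hv : 0 ≤ v) (h0 : 0 < s) (h1 : s < u + v) : 1 - Real.sqrt ((u + v - s) / (u + v)) ≤ ta u v s := by
  have e := ta_eq hu hv h0 h1
  have p := ta_pos hu hv h0 h1
  have q := ta_lt hu hv h0 h1
  have : 1 - ta u v s ≤ Real.sqrt ((u + v - s) / (u + v)) := by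
    apply Real.le_sqrt_of_sq_le
    rw [le_div_iff₀ (by linarith)]
    nlinarith [mul_nonneg hv (mul_nonneg p.le (sub_nonneg.mpr q.le))]
  linarith

end rta

lemma arc_piece {f : ℝ → ℝ} {α β a1 a2 b1 b2 c c' y0 : ℝ} (hα : 0 ≤ α) (hβ : 0 ≤ β) (ha1 : 0 ≤ a1) (hb1 : 0 ≤ b1)
    (hd : a1 * b2 - a2 * b1 = 1) (hc' : c' = c + (α * a1 + β * b1)) (hX : c < c')
    (hF : ∀ x ∈ Ioo c c', f x = y0 + (α * (2 * ta (α * a1) (β * b1) (x - c) - ta (α * a1) (β * b1) (x - c) ^ 2) * a2 + β * ta (α * a1) (β * b1) (x - c) ^ 2 * b2))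
    (hI : IntervalIntegrable (fun x => cb (kk f x)) volume c c') : ∫ x in c..c', cb (kk f x) = cb (4 * (α * β)) := by
  obtain ⟨u, hu'⟩ : ∃ u, u = α * a1 := ⟨_, rfl⟩
  obtain ⟨v, hv'⟩ : ∃ v, v = β * b1 := ⟨_, rfl⟩
  have hu : 0 ≤ u := by rw [hu']; positivity
  have hv : 0 ≤ v := by rw [hv']; positivity
  rw [← hu', ← hv'] at hc' hF
  have hs : ∀ x ∈ Ioo c c', 0 < x - c ∧ x - c < u + v := fun x hx => ⟨by linarith [hx.1], by linarith [hx.2]⟩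
  have hta : ∀ x ∈ Ioo c c', HasDerivAt (fun x => ta u v (x - c)) (1 / (2 * rr u v (x - c))) x := by
    intro x hx
    have := (ta_has hu hv (hs x hx).1 (hs x hx).2).comp x ((hasDerivAt_id x).sub_const c)
    exact this.congr_deriv (by simp)
  have hrd : ∀ x ∈ Ioo c c', rd f x = (α * (1 - ta u v (x - c)) * a2 + β * ta u v (x - c) * b2) / (u + (v - u) * ta u v (x - c)) := by
    intro x hx
    have t := hta x hx
    have hr := rr_pos hu hv (hs x hx).1 (hs x hx).2
    have h1 : HasDerivAt f ((α * (1 - ta u v (x - c)) * a2 + β * ta u v (x - c) * b2) / (u + (v - u) * ta u v (x - c))) x := by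
      have h2 := ((((((t.const_mul 2).sub (t.pow 2)).const_mul α).mul_const a2).add (((t.pow 2).const_mul β).mul_const b2)).const_add y0)
      refine (h2.congr_of_eventuallyEq ?_).congr_deriv ?_
      · filter_upwards [isOpen_Ioo.mem_nhds hx] with y hy
        rw [hF y hy]; rfl
      · rw [← rr_ta hu hv (hs x hx).1 (hs x hx).2]; field_simp; push_cast; ring
    exact h1.hasDerivWithinAt.derivWithin (uniqueDiffWithinAt_Ioi x)
  have hkk : ∀ x ∈ Ioo c c', cb (kk f x) = cb (4 * (α * β)) * (1 / (2 * rr u v (x - c))) := by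
    intro x hx
    have t := hta x hx
    have hr := rr_pos hu hv (hs x hx).1 (hs x hx).2
    have e := rr_ta hu hv (hs x hx).1 (hs x hx).2
    have h1 : HasDerivAt (rd f) (4 * (α * β) * (1 / (2 * rr u v (x - c))) ^ 3) x := by
      have h2 := (((((t.const_sub 1).const_mul α).mul_const a2).add ((t.const_mul β).mul_const b2))).div ((t.const_mul (v - u)).const_add u) (by rw [← e]; exact hr.ne')
      refine (h2.congr_of_eventuallyEq ?_).congr_deriv ?_
      · filter_upwards [isOpen_Ioo.mem_nhds hx] with y hy
        rw [hrd y hy]; rfl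
      · obtain ⟨r, hr'⟩ : ∃ r, r = rr u v (x - c) := ⟨_, rfl⟩
        obtain ⟨τ, hτ⟩ : ∃ τ, τ = ta u v (x - c) := ⟨_, rfl⟩
        simp only [Pi.add_apply] at *
        rw [← e, ← hr', ← hτ] 
        rw [← hr', ← hτ] at e
        rw [← hr'] at hr
        have : (α * -(1 / (2 * r)) * a2 + β * (1 / (2 * r)) * b2) * r - (α * (1 - τ) * a2 + β * τ * b2) * ((v - u) * (1 / (2 * r))) = α * β / (2 * r) := by
          have : (β * b2 - α * a2) * r - (α * (1 - τ) * a2 + β * τ * b2) * (v - u) = α * β := by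
            rw [e, hu', hv']; linear_combination α * β * hd
          rw [← this]; field_simp; ring
        rw [this]; field_simp; ring
    rw [kk, h1.deriv, cb_mul (by positivity) (by positivity), cb_of_cube (by positivity)]
  have hI2 : IntervalIntegrable (fun x => cb (4 * (α * β)) * (1 / (2 * rr u v (x - c)))) volume c c' := by
    refine hI.congr_ae ?_
    rw [uIoc_of_le hX.le, ← restrict_Ioo_eq_restrict_Ioc]
    exact (ae_restrict_mem measurableSet_Ioo).mono hkk
  have hle := intervalIntegral.integral_eq_sub_of_hasDerivAt_of_tendsto (f := fun x => cb (4 * (α * β)) * ta u v (x - c)) (fa := cb (4 * (α * β)) * 0)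
    (fb := cb (4 * (α * β)) * 1) hX (fun x hx => (hta x hx).const_mul _) hI2 ?_ ?_
  · rw [mul_one, mul_zero, sub_zero] at hle
    rw [← hle]
    refine intervalIntegral.integral_congr_ae' ?_ ?_
    · have hne : ∀ᵐ x : ℝ, x ≠ c' := by simp [ae_iff]
      filter_upwards [hne] with x hx hx'
      exact hkk x ⟨hx'.1, lt_of_le_of_ne hx'.2 hx⟩
    · exact Eventually.of_forall fun x hx => absurd (hx.1.trans_le hx.2) (by linarith)
  · refine Tendsto.const_mul _ ?_
    have h1 : Tendsto (fun x => Real.sqrt ((x - c) / (u + v))) (𝓝[>] c) (𝓝 0) := by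
      have : Continuous (fun x => Real.sqrt ((x - c) / (u + v))) := by fun_prop
      have := (this.tendsto c).mono_left (nhdsWithin_le_nhds (s := Ioi c))
      simpa using this
    refine tendsto_of_tendsto_of_tendsto_of_le_of_le' tendsto_const_nhds h1 ?_ ?_
    · filter_upwards [Ioo_mem_nhdsGT hX] with x hx; exact (ta_pos hu hv (hs x hx).1 (hs x hx).2).le
    · filter_upwards [Ioo_mem_nhdsGT hX] with x hx; exact ta_low hu hv (hs x hx).1 (hs x hx).2
  · refine Tendsto.const_mul _ ?_
    have h1 : Tendsto (fun x => 1 - Real.sqrt ((u + v - (x - c)) / (u + v))) (𝓝[<] c') (𝓝 1) := by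
      have : Continuous (fun x => 1 - Real.sqrt ((u + v - (x - c)) / (u + v))) := by fun_prop
      have := (this.tendsto c').mono_left (nhdsWithin_le_nhds (s := Iio c'))
      simpa [hc'] using this
    refine tendsto_of_tendsto_of_tendsto_of_le_of_le' h1 tendsto_const_nhds ?_ ?_
    · filter_upwards [Ioo_mem_nhdsLT hX] with x hx; exact ta_high hu hv (hs x hx).1 (hs x hx).2
    · filter_upwards [Ioo_mem_nhdsLT hX] with x hx; exact (ta_lt hu hv (hs x hx).1 (hs x hx).2).le

end BL

end Part22

section Part23
set_option linter.all false
open scoped Classical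

/-! ## Part 5b: the convex set bounded by parabolic arcs -/
namespace BL
open Topology

lemma fan_ord {N i j : ℕ} (hij : i ≤ j) (hj : j ≤ kf N) : 0 ≤ dt (cR (fan N i)) (cR (fan N j)) := by
  rcases hij.eq_or_lt with rfl | h
  · rw [dt_self]
  rcases Nat.eq_zero_or_pos i with rfl | h0
  · obtain ⟨m, rfl⟩ : ∃ m, j = m + 1 := ⟨j - 1, by omega⟩
    have := (fan_props N m hj).2.2.1
    rw [fan_zero, dt_cR]; simp [dt]; exact this
  · have h1 := fan_props N i (by omega)
    have := fan_mono (N := N) (i := i+1) h hj (v := fan N i) (h1.2.2.2.2.2.2.2 h0) (by rw [h1.1]; norm_num)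
    rw [dt_cR]; exact_mod_cast this.le

section dat
variable {N : ℕ} {p p' : ℕ → ℝ × ℝ}

lemma step_eq {i : ℕ} (hi : i < kf N) (p : ℕ → ℝ × ℝ) : p (i+1) = p i + (al N p i • cR (fan N i) + be N p i • cR (fan N (i+1))) := by
  have := sec_coordR hi (p (i+1) - p i)
  rw [al, be, ← this]; abel

lemma fan_dt1 {i : ℕ} (hi : i < kf N) : dt (cR (fan N i)) (cR (fan N (i+1))) = 1 := by rw [dt_cR, (fan_props N i hi).1]; simp

lemma fan_fst (i : ℕ) (hi : i ≤ kf N) : 0 ≤ (cR (fan N i)).1 := by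
  have := fan_ord (Nat.zero_le i) hi
  rw [fan_zero] at this; simpa [dt] using this

lemma p_mono (hD : Dat N p) {i j : ℕ} (hij : i ≤ j) (hj : j ≤ kf N) : (p i).1 ≤ (p j).1 := by
  induction j, hij using Nat.le_induction with
  | base => exact le_rfl
  | succ m hm ih =>
    refine (ih (by omega)).trans ?_
    rw [step_eq (show m < kf N from hj) p, Prod.fst_add, Prod.fst_add, Prod.smul_fst, Prod.smul_fst, smul_eq_mul, smul_eq_mul]
    have := mul_nonneg (hD m hj).1 (fan_fst (N := N) m (by omega))
    have := mul_nonneg (hD m hj).2 (fan_fst (m+1) hj)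
    linarith

def ga (N : ℕ) (p : ℕ → ℝ × ℝ) (i : ℕ) (τ : ℝ) : ℝ × ℝ := 
  p i + ((al N p i * (2 * τ - τ ^ 2)) • cR (fan N i) + (be N p i * τ ^ 2) • cR (fan N (i+1)))
def tg (N : ℕ) (p : ℕ → ℝ × ℝ) (i : ℕ) (τ : ℝ) : ℝ × ℝ := 
  (al N p i * (1 - τ)) • cR (fan N i) + (be N p i * τ) • cR (fan N (i+1))

lemma ga_end {i : ℕ} (hi : i < kf N) (p : ℕ → ℝ × ℝ) (τ : ℝ) : ga N p i τ = p (i+1) - ((al N p i * (1 - τ) ^ 2) • cR (fan N i) + (be N p i * (1 - τ ^ 2)) • cR (fan N (i+1))) := by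
  rw [step_eq hi p, ga]; module

variable {i : ℕ} {τ σ : ℝ}

lemma tg_up (hD : Dat N p) (hi : i < kf N) (h0 : 0 ≤ τ) (h1 : τ ≤ 1) {j : ℕ} (hj : i < j) (hj' : j ≤ kf N) : 0 ≤ dt (tg N p i τ) (cR (fan N j)) := by
  rw [tg, dt_add_left, dt_smul_left, dt_smul_left]
  have := mul_nonneg (mul_nonneg (hD i hi).1 (sub_nonneg.mpr h1)) (fan_ord (N := N) (i := i) hj.le hj')
  have := mul_nonneg (mul_nonneg (hD i hi).2 h0) (fan_ord (N := N) (i := i + 1) hj hj')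
  linarith

lemma tg_dn (hD : Dat N p) (hi : i < kf N) (h0 : 0 ≤ τ) (h1 : τ ≤ 1) {j : ℕ} (hj : j ≤ i) : dt (tg N p i τ) (cR (fan N j)) ≤ 0 := by
  rw [tg, dt_add_left, dt_smul_left, dt_smul_left, dt_swap (cR (fan N i)), dt_swap (cR (fan N (i+1)))]
  have := mul_nonneg (mul_nonneg (hD i hi).1 (sub_nonneg.mpr h1)) (fan_ord (N := N) (i := j) hj hi.le)
  have := mul_nonneg (mul_nonneg (hD i hi).2 h0) (fan_ord (N := N) (i := j) (show j ≤ i + 1 by omega) hi)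
  linarith

lemma H_up (hD : Dat N p) (hi : i < kf N) (h0 : 0 ≤ τ) (h1 : τ ≤ 1) {m : ℕ} (hm : i + 1 ≤ m) (hm' : m ≤ kf N) : 0 ≤ dt (tg N p i τ) (p m - ga N p i τ) := by
  induction m, hm using Nat.le_induction with
  | base =>
    rw [ga_end hi, sub_sub_cancel, tg]
    have hd := fan_dt1 hi
    have e : dt ((al N p i * (1 - τ)) • cR (fan N i) + (be N p i * τ) • cR (fan N (i+1))) ((al N p i * (1 - τ) ^ 2) • cR (fan N i) + (be N p i * (1 - τ ^ 2)) • cR (fan N (i+1)))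
        = al N p i * be N p i * (1 - τ) ^ 2 * dt (cR (fan N i)) (cR (fan N (i+1))) := by
      simp only [dt, Prod.fst_add, Prod.snd_add, Prod.smul_fst, Prod.smul_snd, smul_eq_mul]; ring
    rw [e, hd]
    have := mul_nonneg (hD i hi).1 (hD i hi).2
    positivity
  | succ m hm ih =>
    have := ih (by omega)
    rw [step_eq (show m < kf N from hm') p, add_sub_right_comm, dt_add_right, dt_add_right, dt_smul_right, dt_smul_right]
    have := mul_nonneg (hD m hm').1 (tg_up hD hi h0 h1 (j := m) (by omega) (by omega))
    have := mul_nonneg (hD m hm').2 (tg_up hD hi h0 h1 (j := m + 1) (by omega) (by omega))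
    linarith

lemma H_dn (hD : Dat N p) (hi : i < kf N) (h0 : 0 ≤ τ) (h1 : τ ≤ 1) {m : ℕ} (hm : m ≤ i) : 0 ≤ dt (tg N p i τ) (p m - ga N p i τ) := by
  have key : ∀ d, d ≤ i → 0 ≤ dt (tg N p i τ) (p (i - d) - ga N p i τ) := by
    intro d
    induction d with
    | zero =>
      intro _
      rw [Nat.sub_zero, ga, tg]
      have hd := fan_dt1 hi
      have e : dt ((al N p i * (1 - τ)) • cR (fan N i) + (be N p i * τ) • cR (fan N (i+1))) (p i - (p i + ((al N p i * (2 * τ - τ ^ 2)) • cR (fan N i) + (be N p i * τ ^ 2) • cR (fan N (i+1)))))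
          = al N p i * be N p i * τ ^ 2 * dt (cR (fan N i)) (cR (fan N (i+1))) := by
        simp only [dt, Prod.fst_add, Prod.snd_add, Prod.fst_sub, Prod.snd_sub, Prod.smul_fst, Prod.smul_snd, smul_eq_mul]; ring
      rw [e, hd]
      have := mul_nonneg (hD i hi).1 (hD i hi).2
      positivity
    | succ d ih =>
      intro hd
      have := ih (by omega)
      obtain ⟨m, hm⟩ : ∃ m, m = i - (d + 1) := ⟨_, rfl⟩
      rw [show i - d = m + 1 by omega, step_eq (show m < kf N by omega) p, add_sub_right_comm, dt_add_right, dt_add_right, dt_smul_right, dt_smul_right] at this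
      rw [← hm]
      have := mul_nonpos_of_nonneg_of_nonpos (hD m (by omega)).1 (tg_dn hD hi h0 h1 (j := m) (by omega))
      have := mul_nonpos_of_nonneg_of_nonpos (hD m (by omega)).2 (tg_dn hD hi h0 h1 (j := m + 1) (by omega))
      linarith
  have := key (i - m) (by omega)
  rwa [show i - (i - m) = m by omega] at this

lemma H_p (hD : Dat N p) (hi : i < kf N) (h0 : 0 ≤ τ) (h1 : τ ≤ 1) {m : ℕ} (hm : m ≤ kf N) : 0 ≤ dt (tg N p i τ) (p m - ga N p i τ) := by
  rcases Nat.lt_or_ge i m with h | h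
  · exact H_up hD hi h0 h1 h hm
  · exact H_dn hD hi h0 h1 h

lemma H_ga (hD : Dat N p) (hi : i < kf N) (h0 : 0 ≤ τ) (h1 : τ ≤ 1) {j : ℕ} (hj : j < kf N) (s0 : 0 ≤ σ) (s1 : σ ≤ 1) : 
    0 ≤ dt (tg N p i τ) (ga N p j σ - ga N p i τ) := by
  have q1 : 0 ≤ 2 * σ - σ ^ 2 := by nlinarith
  have q2 : 0 ≤ 1 - σ ^ 2 := by nlinarith
  rcases lt_trichotomy i j with h | h | h
  · have e : ga N p j σ - ga N p i τ = (p j - ga N p i τ) + ((al N p j * (2 * σ - σ ^ 2)) • cR (fan N j) + (be N p j * σ ^ 2) • cR (fan N (j+1))) := by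
      nth_rewrite 1 [ga]; abel
    rw [e, dt_add_right, dt_add_right, dt_smul_right, dt_smul_right]
    have := H_p hD hi h0 h1 hj.le
    have := mul_nonneg (mul_nonneg (hD j hj).1 q1) (tg_up hD hi h0 h1 (j := j) h hj.le)
    have := mul_nonneg (mul_nonneg (hD j hj).2 (sq_nonneg σ)) (tg_up hD hi h0 h1 (j := j + 1) (by omega) (by omega))
    linarith
  · subst h
    have e : dt (tg N p i τ) (ga N p i σ - ga N p i τ) = al N p i * be N p i * (σ - τ) ^ 2 * dt (cR (fan N i)) (cR (fan N (i+1))) := by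
      simp only [tg, ga, dt, Prod.fst_add, Prod.snd_add, Prod.fst_sub, Prod.snd_sub, Prod.smul_fst, Prod.smul_snd, smul_eq_mul]; ring
    rw [e, fan_dt1 hi]
    have := mul_nonneg (hD i hi).1 (hD i hi).2
    positivity
  · have e : ga N p j σ - ga N p i τ = (p (j+1) - ga N p i τ) - ((al N p j * (1 - σ) ^ 2) • cR (fan N j) + (be N p j * (1 - σ ^ 2)) • cR (fan N (j+1))) := by
      rw [ga_end hj]; abel
    rw [e, dt_sub_right, dt_add_right, dt_smul_right, dt_smul_right]
    have := H_p hD hi h0 h1 (show j + 1 ≤ kf N by omega)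
    have := mul_nonpos_of_nonneg_of_nonpos (mul_nonneg (hD j hj).1 (sq_nonneg (1 - σ))) (tg_dn hD hi h0 h1 (j := j) h.le)
    have := mul_nonpos_of_nonneg_of_nonpos (mul_nonneg (hD j hj).2 q2) (tg_dn hD hi h0 h1 (j := j + 1) h)
    linarith

/-- validity of an arc parameter -/
def Va (N : ℕ) (p : ℕ → ℝ × ℝ) (i : ℕ) (τ : ℝ) : Prop := i < kf N ∧ 0 < τ ∧ τ < 1 ∧ (p i).1 < (p (i+1)).1
def Gen (N : ℕ) (p : ℕ → ℝ × ℝ) : Set (ℝ × ℝ) := {w | w = p 0 ∨ w = p (kf N) ∨ ∃ i τ, Va N p i τ ∧ w = ga N p i τ}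

lemma x_step (hi : i < kf N) : (p (i+1)).1 = (p i).1 + (al N p i * (cR (fan N i)).1 + be N p i * (cR (fan N (i+1))).1) := congrArg Prod.fst (step_eq hi p)

lemma tg_pos (hD : Dat N p) (h : Va N p i τ) : 0 < (tg N p i τ).1 := by
  obtain ⟨hi, h0, h1, h2⟩ := h
  rw [x_step hi] at h2
  have e1 := mul_nonneg (hD i hi).1 (fan_fst i hi.le)
  have e2 := mul_nonneg (hD i hi).2 (fan_fst (i+1) hi)
  have e : (tg N p i τ).1 = (1 - τ) * (al N p i * (cR (fan N i)).1) + τ * (be N p i * (cR (fan N (i+1))).1) := by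
    simp only [tg, Prod.fst_add, Prod.smul_fst, smul_eq_mul]; ring
  rw [e]
  rcases e1.eq_or_lt with q | q
  · rw [← q]; have := mul_pos h0 (show 0 < be N p i * (cR (fan N (i+1))).1 by linarith); linarith
  · have := mul_pos (sub_pos.mpr h1) q; have := mul_nonneg h0.le e2; linarith

lemma Gen_H (hD : Dat N p) (h : Va N p i τ) {w : ℝ × ℝ} (hw : w ∈ Gen N p) : 0 ≤ dt (tg N p i τ) (w - ga N p i τ) := by
  rcases hw with rfl | rfl | ⟨j, σ, hj, rfl⟩
  · exact H_p hD h.1 h.2.1.le h.2.2.1.le (Nat.zero_le _)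
  · exact H_p hD h.1 h.2.1.le h.2.2.1.le le_rfl
  · exact H_ga hD h.1 h.2.1.le h.2.2.1.le hj.1 hj.2.1.le hj.2.2.1.le

lemma ga_x (hD : Dat N p) (h : Va N p i τ) : (p i).1 ≤ (ga N p i τ).1 ∧ (ga N p i τ).1 ≤ (p (i+1)).1 := by
  obtain ⟨hi, h0, h1, h2⟩ := h
  have e1 := mul_nonneg (hD i hi).1 (fan_fst i hi.le)
  have e2 := mul_nonneg (hD i hi).2 (fan_fst (i+1) hi)
  constructor
  · rw [ga]; simp only [Prod.fst_add, Prod.smul_fst, smul_eq_mul]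
    have := mul_nonneg e1 (show 0 ≤ 2 * τ - τ ^ 2 by nlinarith)
    have := mul_nonneg e2 (sq_nonneg τ)
    linarith
  · rw [ga_end hi]; simp only [Prod.fst_add, Prod.fst_sub, Prod.smul_fst, smul_eq_mul]
    have := mul_nonneg e1 (sq_nonneg (1 - τ))
    have := mul_nonneg e2 (show 0 ≤ 1 - τ ^ 2 by nlinarith)
    linarith

lemma Gen_chord (hD : Dat N p) {w : ℝ × ℝ} (hw : w ∈ Gen N p) : ∃ s, 0 ≤ s ∧ s ≤ 1 ∧ w.1 = (1 - s) * (p 0).1 + s * (p (kf N)).1 ∧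
    w.2 ≤ (1 - s) * (p 0).2 + s * (p (kf N)).2 := by
  rcases hw with rfl | rfl | ⟨i, τ, h, rfl⟩
  · exact ⟨0, by norm_num, by norm_num, by ring, by linarith⟩
  · exact ⟨1, by norm_num, by norm_num, by ring, by linarith⟩
  have hx := ga_x hD h
  have A := p_mono hD (Nat.zero_le i) h.1.le
  have B := p_mono hD (show i + 1 ≤ kf N from h.1) le_rfl
  have hAB : (p 0).1 < (p (kf N)).1 := by linarith [h.2.2.2]
  have hne : (p (kf N)).1 - (p 0).1 ≠ 0 := by linarith
  obtain ⟨s, hs⟩ : ∃ s, s = ((ga N p i τ).1 - (p 0).1) / ((p (kf N)).1 - (p 0).1) := ⟨_, rfl⟩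
  have e : (ga N p i τ).1 = (1 - s) * (p 0).1 + s * (p (kf N)).1 := by rw [hs]; field_simp; ring
  have s0 : 0 ≤ s := by rw [hs]; apply div_nonneg <;> linarith
  have s1 : s ≤ 1 := by rw [hs, div_le_one (by linarith)]; linarith
  refine ⟨s, s0, s1, e, ?_⟩
  have t := tg_pos hD h
  have q1 := mul_nonneg (sub_nonneg.mpr s1) (H_p hD h.1 h.2.1.le h.2.2.1.le (Nat.zero_le (kf N)))
  have q2 := mul_nonneg s0 (H_p hD h.1 h.2.1.le h.2.2.1.le (le_refl (kf N)))
  simp only [dt, Prod.fst_sub, Prod.snd_sub] at q1 q2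
  have : 0 ≤ (tg N p i τ).1 * ((1 - s) * (p 0).2 + s * (p (kf N)).2 - (ga N p i τ).2) := by
    have e' : (tg N p i τ).2 * ((1 - s) * (p 0).1 + s * (p (kf N)).1 - (ga N p i τ).1) = 0 := by rw [e]; ring
    linarith
  have := nonneg_of_mul_nonneg_right this t
  linarith

lemma Gen_H' {K : Set (ℝ × ℝ)} (hg : GoodPair N K p p') (h : Va N p i τ) {w : ℝ × ℝ} (hw : w ∈ Gen N p') : 0 ≤ dt (tg N p i τ) (rf w - ga N p i τ) := by
  obtain ⟨hD, hD', -, -, x0, xk, y0, yk⟩ := hg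
  obtain ⟨s, s0, s1, e1, e2⟩ := Gen_chord hD' hw
  have t := tg_pos hD h
  have q1 := mul_nonneg (sub_nonneg.mpr s1) (H_p hD h.1 h.2.1.le h.2.2.1.le (Nat.zero_le (kf N)))
  have q2 := mul_nonneg s0 (H_p hD h.1 h.2.1.le h.2.2.1.le (le_refl (kf N)))
  simp only [dt, Prod.fst_sub, Prod.snd_sub, rf_fst, rf_snd] at q1 q2 ⊢
  rw [e1, ← x0, ← xk]
  have r1 := mul_le_mul_of_nonneg_left y0 (sub_nonneg.mpr s1)
  have r2 := mul_le_mul_of_nonneg_left yk s0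
  have : 0 ≤ (tg N p i τ).1 * (-w.2 - ((1 - s) * (p 0).2 + s * (p (kf N)).2)) := mul_nonneg t.le (by linarith)
  linarith

lemma GoodPair.swap {K : Set (ℝ × ℝ)} (hg : GoodPair N K p p') : GoodPair N (rfS K) p' p := by
  obtain ⟨hD, hD', k1, k2, x0, xk, y0, yk⟩ := hg
  exact ⟨hD', hD, k2, fun i hi => by simpa [rfS] using k1 i hi, x0.symm, xk.symm, by linarith, by linarith⟩

lemma Rg.arc_side {S : Set (ℝ × ℝ)} {a b : ℝ} {f g : ℝ → ℝ} (R : Rg S a b f g) (hD : Dat N p) (hG : Gen N p ⊆ S)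
    (hH : ∀ i τ, Va N p i τ → ∀ w ∈ S, 0 ≤ dt (tg N p i τ) (w - ga N p i τ)) (hI : IntervalIntegrable (fun x => cb (kk f x)) volume a b) :
    TT N p ≤ ∫ x in a..b, cb (kk f x) := by
  have memS : ∀ w ∈ S, w.1 ∈ Icc a b := fun w hw => ((R.mem w.1 w.2).mp hw).1
  have e0 : (p 0).1 ∈ Icc a b := memS _ (hG (Or.inl rfl))
  have ek : (p (kf N)).1 ∈ Icc a b := memS _ (hG (Or.inr (Or.inl rfl)))
  have sub : ∀ i ≤ kf N, (p i).1 ∈ Icc a b := fun i hi => ⟨e0.1.trans (p_mono hD (Nat.zero_le i) hi), (p_mono hD hi le_rfl).trans ek.2⟩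
  have hIs : ∀ i < kf N, IntervalIntegrable (fun x => cb (kk f x)) volume (p i).1 (p (i+1)).1 := by
    intro i hi
    refine hI.mono_set ?_
    rw [uIcc_of_le R.hab.le, uIcc_of_le (p_mono hD (Nat.le_succ i) hi)]
    exact Icc_subset_Icc (sub i hi.le).1 (sub (i+1) hi).2
  have key : ∀ i < kf N, cb (4 * (al N p i * be N p i)) ≤ ∫ x in (p i).1..(p (i+1)).1, cb (kk f x) := by
    intro i hi
    have hα := (hD i hi).1
    have hβ := (hD i hi).2
    have ha := fan_fst i hi.le
    have hb := fan_fst (i+1) hi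
    have hd := fan_dt1 hi
    have hx := x_step (p := p) hi
    have e1 := mul_nonneg hα ha
    have e2 := mul_nonneg hβ hb
    rcases (p_mono hD (Nat.le_succ i) hi).eq_or_lt with h | h
    · rw [Nat.succ_eq_add_one] at h
      rw [← h, intervalIntegral.integral_same]
      have z1 : al N p i * (cR (fan N i)).1 = 0 := by linarith
      have z2 : be N p i * (cR (fan N (i+1))).1 = 0 := by linarith
      have : al N p i * be N p i = 0 := by
        unfold dt at hd
        linear_combination (-(al N p i * be N p i)) * hd + be N p i * (cR (fan N (i+1))).2 * z1 - al N p i * (cR (fan N i)).2 * z2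
      rw [this, mul_zero, cb_zero]
    · refine (arc_piece (y0 := (p i).2) hα hβ ha hb hd hx h (fun x hx' => ?_) (hIs i hi)).ge
      have s0 : 0 < x - (p i).1 := by linarith [hx'.1]
      have s1 : x - (p i).1 < al N p i * (cR (fan N i)).1 + be N p i * (cR (fan N (i+1))).1 := by linarith [hx'.2, Nat.succ_eq_add_one i]
      have t0 := ta_pos e1 e2 s0 s1
      have t1 := ta_lt e1 e2 s0 s1
      have te := ta_eq e1 e2 s0 s1
      obtain ⟨τ, hτ⟩ : ∃ τ, τ = ta (al N p i * (cR (fan N i)).1) (be N p i * (cR (fan N (i+1))).1) (x - (p i).1) := ⟨_, rfl⟩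
      rw [← hτ] at t0 t1 te ⊢
      have V : Va N p i τ := ⟨hi, t0, t1, h⟩
      have gx : (ga N p i τ).1 = x := by
        simp only [ga, Prod.fst_add, Prod.smul_fst, smul_eq_mul]; linarith
      have gy : (ga N p i τ).2 = (p i).2 + (al N p i * (2 * τ - τ ^ 2) * (cR (fan N i)).2 + be N p i * τ ^ 2 * (cR (fan N (i+1))).2) := rfl
      rw [← gy]
      have gS : ga N p i τ ∈ S := hG (Or.inr (Or.inr ⟨i, τ, V, rfl⟩))
      have m1 := (R.mem (ga N p i τ).1 (ga N p i τ).2).mp gS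
      rw [gx] at m1
      have m2 := hH i τ V (x, f x) ((R.mem _ _).mpr ⟨m1.1, le_rfl, R.le x m1.1⟩)
      simp only [dt, Prod.fst_sub, Prod.snd_sub, gx, sub_self, mul_zero, sub_zero] at m2
      have m3 := nonneg_of_mul_nonneg_right m2 (tg_pos hD V)
      exact le_antisymm m1.2.1 (by linarith)
  have B := intervalIntegral.sum_integral_adjacent_intervals (a := fun i => (p i).1) (n := kf N) (fun i hi => hIs i hi)
  have C : ∫ x in (p 0).1..(p (kf N)).1, cb (kk f x) ≤ ∫ x in a..b, cb (kk f x) := by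
    refine intervalIntegral.integral_mono_interval e0.1 (p_mono hD (Nat.zero_le _) le_rfl) ek.2 ?_ hI
    rw [← restrict_Ioo_eq_restrict_Ioc]
    exact (ae_restrict_mem measurableSet_Ioo).mono fun x hx => cb_nonneg (kk_nonneg R.cvx hx)
  refine le_trans ?_ C
  rw [← B]
  exact Finset.sum_le_sum fun i hi => key i (Finset.mem_range.mp hi)

end dat
end BL

end Part23

section Part24
set_option linter.all false
open scoped Classical

/-! ## Part 5c: regions from compact convex sets; the arcs set -/
namespace BL
open Topology

lemma tri_int {S : Set (ℝ × ℝ)} (hS : Convex ℝ S) {x z w : ℝ × ℝ} (hx : x ∈ S) (hz : z ∈ S) (hw : w ∈ S) (hd : dt (z - x) (w - x) ≠ 0) : (interior S).Nonempty := by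
  obtain ⟨d, hd'⟩ : ∃ d, d = dt (z - x) (w - x) := ⟨_, rfl⟩
  rw [← hd'] at hd
  have cont1 : Continuous fun y : ℝ × ℝ => dt (y - x) (w - x) / d := by unfold dt; fun_prop
  have cont2 : Continuous fun y : ℝ × ℝ => dt (z - x) (y - x) / d := by unfold dt; fun_prop
  have hU : IsOpen ({y : ℝ × ℝ | 0 < dt (y - x) (w - x) / d} ∩ {y | 0 < dt (z - x) (y - x) / d} ∩ {y | dt (y - x) (w - x) / d + dt (z - x) (y - x) / d < 1}) :=
    ((isOpen_lt continuous_const cont1).inter (isOpen_lt continuous_const cont2)).inter (isOpen_lt (cont1.add cont2) continuous_const)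
  refine ⟨x + (((1:ℝ)/3) • (z - x) + ((1:ℝ)/3) • (w - x)), mem_interior.mpr ⟨_, ?_, hU, ?_⟩⟩
  · rintro y ⟨⟨h1, h2⟩, h3⟩
    simp only [mem_setOf_eq] at h1 h2 h3
    have e : y = (1 - dt (y - x) (w - x) / d - dt (z - x) (y - x) / d) • x + ((dt (y - x) (w - x) / d) • z + (dt (z - x) (y - x) / d) • w) := by
      have hd2 := hd'
      simp only [dt, Prod.fst_sub, Prod.snd_sub] at hd2 ⊢
      ext
      · simp only [Prod.fst_add, Prod.smul_fst, smul_eq_mul]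
        field_simp; rw [hd2]; ring
      · simp only [Prod.snd_add, Prod.smul_snd, smul_eq_mul]
        field_simp; rw [hd2]; ring
    rw [e]
    have := hS.sum_mem (t := (Finset.univ : Finset (Fin 3))) (w := ![1 - dt (y - x) (w - x) / d - dt (z - x) (y - x) / d, dt (y - x) (w - x) / d, dt (z - x) (y - x) / d]) (z := ![x, z, w])
      (by intro i _; fin_cases i <;> simp <;> linarith) (by simp [Fin.sum_univ_three]; ring) (by intro i _; fin_cases i <;> simp [hx, hz, hw])
    simpa [Fin.sum_univ_three, add_assoc] using this
  · have e1 : dt (x + (((1:ℝ)/3) • (z - x) + ((1:ℝ)/3) • (w - x)) - x) (w - x) / d = 1/3 := by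
      rw [add_sub_cancel_left, dt_add_left, dt_smul_left, dt_smul_left, dt_self, ← hd']; field_simp; ring
    have e2 : dt (z - x) (x + (((1:ℝ)/3) • (z - x) + ((1:ℝ)/3) • (w - x)) - x) / d = 1/3 := by
      rw [add_sub_cancel_left, dt_add_right, dt_smul_right, dt_smul_right, dt_self, ← hd']; field_simp; ring
    simp only [mem_inter_iff, mem_setOf_eq, e1, e2]; norm_num

lemma fiber_nbhd {S : Set (ℝ × ℝ)} {z : ℝ × ℝ} (hz : z ∈ interior S) : ∃ e > 0, ∀ s t : ℝ, |s| ≤ e → |t| ≤ e → (z.1 + s, z.2 + t) ∈ S := by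
  obtain ⟨e, he, hs⟩ := Metric.isOpen_iff.mp isOpen_interior z hz
  refine ⟨e / 2, by positivity, fun s t h1 h2 => interior_subset (hs ?_)⟩
  rw [Metric.mem_ball, Prod.dist_eq, Real.dist_eq, Real.dist_eq]
  simp only [add_sub_cancel_left]
  exact max_lt (by linarith) (by linarith)

lemma exists_Rg {S : Set (ℝ × ℝ)} (hS : Convex ℝ S) (hc : IsCompact S) (hi : (interior S).Nonempty) : ∃ a b f g, Rg S a b f g := by
  obtain ⟨o, ho⟩ := hi
  have oS := interior_subset ho
  obtain ⟨za, hza, ha⟩ := hc.exists_isMinOn ⟨o, oS⟩ (f := fun z => z.1) continuous_fst.continuousOn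
  obtain ⟨zb, hzb, hb⟩ := hc.exists_isMaxOn ⟨o, oS⟩ (f := fun z => z.1) continuous_fst.continuousOn
  have hIoo : ∀ x ∈ Ioo za.1 zb.1, ∃ z ∈ interior S, z.1 = x := by
    intro x hx
    have aux : ∀ w ∈ S, w.1 ≠ o.1 → (∃ t : ℝ, 0 < t ∧ t ≤ 1 ∧ x = (1 - t) * w.1 + t * o.1) → ∃ z ∈ interior S, z.1 = x := by
      rintro w hw hne ⟨t, t0, t1, rfl⟩
      refine ⟨(1 - t) • w + t • o, ?_, by simp⟩
      have := hS.combo_self_interior_mem_interior hw ho (a := 1 - t) (b := t) (by linarith) t0 (by ring)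
      exact this
    rcases lt_trichotomy x o.1 with h | h | h
    · have hd : 0 < o.1 - za.1 := by linarith [hx.1]
      refine aux za hza (by linarith) ⟨(x - za.1) / (o.1 - za.1), div_pos (by linarith [hx.1]) hd, by rw [div_le_one hd]; linarith, ?_⟩
      field_simp; ring
    · exact ⟨o, ho, h.symm⟩
    · have hd : 0 < zb.1 - o.1 := by linarith [hx.2]
      refine aux zb hzb (by linarith) ⟨(zb.1 - x) / (zb.1 - o.1), div_pos (by linarith [hx.2]) hd, by rw [div_le_one hd]; linarith, ?_⟩
      field_simp; ring
  have hab : za.1 < zb.1 := by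
    obtain ⟨e, he, h⟩ := fiber_nbhd ho
    have h1 : za.1 ≤ o.1 + -e := ha (h (-e) 0 (by rw [abs_neg, abs_of_pos he]) (by simp [he.le]))
    have h2 : o.1 + e ≤ zb.1 := hb (h e 0 (by rw [abs_of_pos he]) (by simp [he.le]))
    linarith
  have hfib : ∀ x ∈ Icc za.1 zb.1, ∃ y, (x, y) ∈ S := by
    intro x hx
    rcases eq_or_lt_of_le hx.1 with h | h
    · exact ⟨za.2, by rw [← h]; exact hza⟩
    rcases eq_or_lt_of_le hx.2 with h' | h'
    · exact ⟨zb.2, by rw [h']; exact hzb⟩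
    obtain ⟨z, hz, rfl⟩ := hIoo x ⟨h, h'⟩
    exact ⟨z.2, interior_subset hz⟩
  have hmin : ∀ x, ∃ l u : ℝ, x ∈ Icc za.1 zb.1 → (x, l) ∈ S ∧ (x, u) ∈ S ∧ ∀ y, (x, y) ∈ S → l ≤ y ∧ y ≤ u := by
    intro x
    by_cases hx : x ∈ Icc za.1 zb.1
    · have hF : IsCompact (S ∩ {z | z.1 = x}) := hc.inter_right (isClosed_eq continuous_fst continuous_const)
      obtain ⟨y, hy⟩ := hfib x hx
      obtain ⟨l, hl, hl'⟩ := hF.exists_isMinOn ⟨_, hy, rfl⟩ (f := fun z => z.2) continuous_snd.continuousOn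
      obtain ⟨u, hu, hu'⟩ := hF.exists_isMaxOn ⟨_, hy, rfl⟩ (f := fun z => z.2) continuous_snd.continuousOn
      refine ⟨l.2, u.2, fun _ => ⟨?_, ?_, fun y hy => ⟨hl' ⟨hy, rfl⟩, hu' ⟨hy, rfl⟩⟩⟩⟩
      · rw [← (show l.1 = x from hl.2)]; exact hl.1
      · rw [← (show u.1 = x from hu.2)]; exact hu.1
    · exact ⟨0, 0, fun h => absurd h hx⟩
  choose f g hfg using hmin
  refine ⟨za.1, zb.1, f, g, hab, fun x y => ⟨fun h => ?_, fun h => ?_⟩, fun x hx => ?_, fun x hx => ?_, hS, hc⟩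
  · have hx : x ∈ Icc za.1 zb.1 := ⟨ha h, hb h⟩
    exact ⟨hx, (hfg x hx).2.2 y h⟩
  · obtain ⟨hx, h1, h2⟩ := h
    obtain ⟨m1, m2, -⟩ := hfg x hx
    rcases eq_or_lt_of_le (h1.trans h2) with h3 | h3
    · have : y = f x := by linarith
      rw [this]; exact m1
    have hne : g x - f x ≠ 0 := by linarith
    have := hS m1 m2 (a := (g x - y) / (g x - f x)) (b := (y - f x) / (g x - f x)) (div_nonneg (by linarith) (by linarith)) (div_nonneg (by linarith) (by linarith)) (by field_simp; ring)
    convert this using 1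
    ext
    · simp; field_simp; ring
    · simp; field_simp; ring
  · obtain ⟨m1, m2, m3⟩ := hfg x hx
    exact (m3 _ m2).1
  · obtain ⟨z, hz, rfl⟩ := hIoo x hx
    obtain ⟨m1, m2, m3⟩ := hfg z.1 (Ioo_subset_Icc_self hx)
    obtain ⟨e, he, h⟩ := fiber_nbhd hz
    have q1 := (m3 (z.2 + e) (by simpa using h 0 e (by simp [he.le]) (by rw [abs_of_pos he]))).2
    have q2 := (m3 z.2 (interior_subset hz)).1
    linarith

/-- Part (c): the convex set generated by the arcs. -/
theorem arcs_set {N : ℕ} {p p' : ℕ → ℝ × ℝ} {K : Set (ℝ × ℝ)} (hg : GoodPair N K p p') (hK : Convex ℝ K) (hKc : IsCompact K)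
    (h1 : Gen N p ⊆ K) (h2 : ∀ w ∈ Gen N p', rf w ∈ K) (hT : 0 < TT N p + TT N p') :
    ∃ S a b f g, S ⊆ K ∧ Rg S a b f g ∧ TT N p + TT N p' ≤ AL a b f g := by
  obtain ⟨S, hS⟩ : ∃ S, S = closure (convexHull ℝ (Gen N p ∪ {w | rf w ∈ Gen N p'})) := ⟨_, rfl⟩
  have hmin : ∀ C : Set (ℝ × ℝ), IsClosed C → Convex ℝ C → Gen N p ⊆ C → (∀ w ∈ Gen N p', rf w ∈ C) → S ⊆ C := by
    intro C c1 c2 c3 c4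
    rw [hS]
    refine closure_minimal (convexHull_min (union_subset c3 fun w hw => ?_) c2) c1
    have := c4 _ hw
    rwa [rf_rf] at this
  have hgen : Gen N p ∪ {w | rf w ∈ Gen N p'} ⊆ S := by rw [hS]; exact (subset_convexHull ℝ _).trans subset_closure
  have hSc : Convex ℝ S := by rw [hS]; exact (convex_convexHull ℝ _).closure
  have hSK : S ⊆ K := hmin K hKc.isClosed hK h1 h2
  have hScp : IsCompact S := hKc.of_isClosed_subset (by rw [hS]; exact isClosed_closure) hSK
  have hsum : ∀ q, Dat N q → 0 < TT N q → ∃ x ∈ Gen N q, ∃ z ∈ Gen N q, ∃ w ∈ Gen N q, dt (z - x) (w - x) ≠ 0 := by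
    intro q hq hT
    obtain ⟨i, hi, hne⟩ : ∃ i < kf N, al N q i * be N q i ≠ 0 := by
      by_contra hcon
      push Not at hcon
      have : TT N q = 0 := Finset.sum_eq_zero fun i hi => by rw [hcon i (Finset.mem_range.mp hi), mul_zero, cb_zero]
      linarith
    have hlt : (q i).1 < (q (i+1)).1 := by
      rcases (p_mono hq (Nat.le_succ i) hi).eq_or_lt with h | h
      · exfalso
        have e1 := mul_nonneg (hq i hi).1 (fan_fst i hi.le)
        have e2 := mul_nonneg (hq i hi).2 (fan_fst (i+1) hi)
        have hx := x_step (p := q) hi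
        rw [Nat.succ_eq_add_one] at h
        have z1 : al N q i * (cR (fan N i)).1 = 0 := by linarith
        have z2 : be N q i * (cR (fan N (i+1))).1 = 0 := by linarith
        apply hne
        have hd := fan_dt1 hi
        unfold dt at hd
        linear_combination (-(al N q i * be N q i)) * hd + be N q i * (cR (fan N (i+1))).2 * z1 - al N q i * (cR (fan N i)).2 * z2
      · exact h
    have hm : ∀ τ : ℝ, 0 < τ → τ < 1 → ga N q i τ ∈ Gen N q := fun τ t0 t1 => Or.inr (Or.inr ⟨i, τ, ⟨hi, t0, t1, hlt⟩, rfl⟩)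
    refine ⟨_, hm (1/4) (by norm_num) (by norm_num), _, hm (1/2) (by norm_num) (by norm_num), _, hm (3/4) (by norm_num) (by norm_num), ?_⟩
    have e : dt (ga N q i (1/2) - ga N q i (1/4)) (ga N q i (3/4) - ga N q i (1/4)) = al N q i * be N q i * dt (cR (fan N i)) (cR (fan N (i+1))) / 16 := by
      simp only [ga, dt, Prod.fst_add, Prod.snd_add, Prod.fst_sub, Prod.snd_sub, Prod.smul_fst, Prod.smul_snd, smul_eq_mul]; ring
    rw [e, fan_dt1 hi]
    simpa using hne
  have hInt0 : (interior S).Nonempty := by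
    rcases lt_or_ge 0 (TT N p) with h | h
    · obtain ⟨x, hx, z, hz, w, hw, hd⟩ := hsum p hg.1 h
      exact tri_int hSc (hgen (Or.inl hx)) (hgen (Or.inl hz)) (hgen (Or.inl hw)) hd
    · obtain ⟨x, hx, z, hz, w, hw, hd⟩ := hsum p' hg.2.1 (by linarith)
      have m : ∀ x ∈ Gen N p', rf x ∈ S := fun x hx => hgen (Or.inr (by simpa using hx))
      refine tri_int hSc (m x hx) (m z hz) (m w hw) ?_
      intro h0; apply hd
      simp only [dt, Prod.fst_sub, Prod.snd_sub, rf_fst, rf_snd] at h0 ⊢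
      linarith
  obtain ⟨a, b, f, g, R⟩ := exists_Rg hSc hScp hInt0
  refine ⟨S, a, b, f, g, hSK, R, ?_⟩
  obtain ⟨q, q0, qk, hq⟩ := R.exists_dat N
  obtain ⟨q', q0', qk', hq'⟩ := R.refl.exists_dat N
  have I := (R.low_le N q0 qk hq).2.1
  have I' := (R.refl.low_le N q0' qk' hq').2.1
  have Hc : ∀ t g0 : ℝ × ℝ, Convex ℝ {w : ℝ × ℝ | 0 ≤ dt t (w - g0)} ∧ IsClosed {w : ℝ × ℝ | 0 ≤ dt t (w - g0)} := by
    intro t g0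
    refine ⟨?_, isClosed_le continuous_const (by unfold dt; fun_prop)⟩
    have e : {w : ℝ × ℝ | 0 ≤ dt t (w - g0)} = {z | t.2 * z.1 + -t.1 * z.2 ≤ t.2 * g0.1 - t.1 * g0.2} := by
      ext w; simp only [mem_setOf_eq, dt, Prod.fst_sub, Prod.snd_sub]
      constructor <;> intro h <;> linarith
    rw [e]; exact hp_convex _ _ _
  have A := R.arc_side hg.1 (fun w hw => hgen (Or.inl hw)) (fun i τ V w hw => 
    hmin {w | 0 ≤ dt (tg N p i τ) (w - ga N p i τ)} (Hc _ _).2 (Hc _ _).1 (fun w hw => Gen_H hg.1 V hw) (fun w hw => Gen_H' hg V hw) hw) I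
  have A' := R.refl.arc_side hg.2.1 (fun w hw => hgen (Or.inr (by simpa using hw))) (fun i τ V w hw => by
    have := hmin {w | 0 ≤ dt (tg N p' i τ) (rf w - ga N p' i τ)} ((Hc _ _).2.preimage (f := rf) (by unfold rf; fun_prop)) (rf_convex (Hc _ _).1) (fun w hw => Gen_H' hg.swap V hw) 
      (fun w hw => by simpa using Gen_H hg.2.1 V hw) hw
    simpa using this) I'
  unfold AL; rw [intervalIntegral.integral_add I I']; linarith

end BL

end Part24

section Part25
set_option linter.all false
open scoped Classical

/-! ## Part 6a: transfer between the Euclidean plane and `ℝ × ℝ` -/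
namespace BL
open Topology

/-- Coordinates on the Euclidean plane. -/
def ee : E 2 ≃L[ℝ] ℝ × ℝ := LinearEquiv.toContinuousLinearEquiv
  { toFun := fun x => (x 0, x 1)
    invFun := fun z => WithLp.toLp 2 ![z.1, z.2]
    map_add' := fun x y => by simp
    map_smul' := fun c x => by simp
    left_inv := fun x => by ext i; fin_cases i <;> simp
    right_inv := fun z => by simp }

@[simp] lemma ee_fst (x : E 2) : (ee x).1 = x 0 := rfl
@[simp] lemma ee_snd (x : E 2) : (ee x).2 = x 1 := rfl
@[simp] lemma ee_symm0 (z : ℝ × ℝ) : ee.symm z 0 = z.1 := by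
  conv_rhs => rw [← ee.apply_symm_apply z]
  rfl
@[simp] lemma ee_symm1 (z : ℝ × ℝ) : ee.symm z 1 = z.2 := by
  conv_rhs => rw [← ee.apply_symm_apply z]
  rfl

lemma ee_mp : MeasurePreserving ee := by
  have := (volume_preserving_finTwoArrow ℝ).comp (PiLp.volume_preserving_ofLp (Fin 2))
  exact this

lemma ee_vol (S : Set (ℝ × ℝ)) : volume (ee ⁻¹' S) = volume S :=
  ee_mp.measure_preimage_emb ee.toHomeomorph.measurableEmbedding S

lemma ee_floating (S : Set (ℝ × ℝ)) (δ : ℝ) : floatingBody (ee ⁻¹' S) δ = ee ⁻¹' (FB S δ) := by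
  ext x
  simp only [floatingBody, FB, mem_setOf_eq, mem_preimage]
  refine and_congr_right fun hx => ⟨fun h u v c hv => ?_, fun h f c hv => ?_⟩
  · have := h ((u • ContinuousLinearMap.fst ℝ ℝ ℝ + v • ContinuousLinearMap.snd ℝ ℝ ℝ).comp (ee : E 2 →L[ℝ] ℝ × ℝ)) c (by
      rw [← ee_vol] at hv; convert hv using 2; ext y; simp)
    simpa using this
  · have hf : ∀ y : E 2, f y = f (ee.symm (1, 0)) * (ee y).1 + f (ee.symm (0, 1)) * (ee y).2 := by
      intro y
      have : y = (ee y).1 • ee.symm (1, 0) + (ee y).2 • ee.symm (0, 1) := by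
        ext i; fin_cases i <;> simp
      conv_lhs => rw [this]
      simp only [map_add, map_smul, smul_eq_mul]; ring
    rw [hf]
    refine h _ _ _ ?_
    rw [← ee_vol]; convert hv using 2
    ext y; simp only [mem_preimage, mem_setOf_eq, ← hf]

lemma cst_one : (4 * Real.sqrt 2 / 3) ^ ((2:ℝ)/3) * cb (9/32) = 1 := by
  rw [rpow23 (by positivity), ← cb_sq (by positivity), ← cb_mul (by positivity) (by norm_num)]
  have : (4 * Real.sqrt 2 / 3) ^ 2 * (9/32) = 1 := by
    rw [div_pow, mul_pow, Real.sq_sqrt (by norm_num)]; norm_num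
  rw [this, cb_one]

lemma ap_Rg {S : Set (ℝ × ℝ)} {a b f g} (R : Rg S a b f g) : affinePerimeter (ee ⁻¹' S) = AL a b f g := by
  have h := R.lim_FB
  have e : (fun δ : ℝ => ((volume (ee ⁻¹' S)).toReal - (volume (floatingBody (ee ⁻¹' S) δ)).toReal) / δ ^ ((2:ℝ)/3))
      = fun δ => ((volume S).toReal - (volume (FB S δ)).toReal)/δ^((2:ℝ)/3) := by
    ext δ; rw [ee_floating, ee_vol, ee_vol]
  unfold affinePerimeter
  rw [e, h.limUnder_eq, ← mul_assoc, cst_one, one_mul]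

lemma ap_flat {S : Set (ℝ × ℝ)} (hS : Convex ℝ S) (hc : IsCompact S) (hi : ¬ (interior S).Nonempty) : affinePerimeter (ee ⁻¹' S) = 0 := by
  have h0 : volume S = 0 := by
    have h := hS.addHaar_frontier volume
    rw [frontier, not_nonempty_iff_eq_empty.mp hi, diff_empty, hc.isClosed.closure_eq] at h
    exact h
  have e : (fun δ : ℝ => ((volume (ee ⁻¹' S)).toReal - (volume (floatingBody (ee ⁻¹' S) δ)).toReal) / δ ^ ((2:ℝ)/3))
      = fun δ => (0:ℝ) := by
    ext δ; rw [ee_floating, ee_vol, ee_vol, h0, measure_mono_null (FB_sub _ _) h0]; simp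
  unfold affinePerimeter
  rw [e, Tendsto.limUnder_eq (tendsto_const_nhds), mul_zero]

lemma ncard_LPn {K : Set (ℝ × ℝ)} (hK : Convex ℝ K) {n : ℕ} (hn : 0 < n) : (latticePolytopes 2 n (ee ⁻¹' K)).ncard = (LPn n K).ncard := by
  have n0 : (n:ℝ) ≠ 0 := by positivity
  obtain ⟨L, hL⟩ : ∃ L : ℝ × ℝ →ₗ[ℝ] E 2, ∀ z, L z = ee.symm ((1 / n : ℝ) • z) :=
    ⟨(ee.symm : ℝ × ℝ →L[ℝ] E 2).toLinearMap ∘ₗ ((1 / n : ℝ) • LinearMap.id), fun z => by simp⟩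
  have Linj : Function.Injective L := by
    intro x y h
    rw [hL, hL] at h
    exact smul_right_injective _ (by positivity : (1 / n : ℝ) ≠ 0) (ee.symm.injective h)
  have : latticePolytopes 2 n (ee ⁻¹' K) = (fun P => L '' P) '' LPn n K := by
    ext P
    constructor
    · rintro ⟨h1, h2, F, hF, rfl⟩
      have hF' : ∀ w : E 2, w ∈ F → ∀ i, ∃ z : ℤ, w i = z / n := fun w hw => hF hw
      choose! z hz using hF'
      have hz' : ∀ w ∈ F, L (cR (z w 0, z w 1)) = w := by
        intro w hw
        rw [hL]
        ext i; fin_cases i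
        · have := hz w hw 0; simp [this]; ring
        · have := hz w hw 1; simp [this]; ring
      refine ⟨convexHull ℝ (cR '' (F.image fun w => (z w 0, z w 1) : Finset (ℤ × ℤ))), ⟨F.image fun w => (z w 0, z w 1), ?_, rfl, ?_⟩, ?_⟩
      · rw [convexHull_nonempty_iff] at h1
        exact Finset.Nonempty.image (by simpa using h1) _
      · intro w hw
        obtain ⟨v, hv, rfl⟩ := Finset.mem_image.mp hw
        have := h2 (subset_convexHull ℝ _ hv)
        rw [← hz' v hv, hL] at this
        simpa using this
      · simp only []
        rw [L.image_convexHull]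
        congr 1
        ext w
        simp only [Finset.coe_image, mem_image, Finset.mem_coe]
        constructor
        · rintro ⟨_, ⟨_, ⟨v, hv, rfl⟩, rfl⟩, rfl⟩
          rw [hz' v hv]; exact hv
        · intro hw
          exact ⟨_, ⟨_, ⟨w, hw, rfl⟩, rfl⟩, hz' w hw⟩
    · rintro ⟨_, ⟨F, h0, rfl, hF⟩, rfl⟩
      have e : L '' (convexHull ℝ (cR '' (F : Set (ℤ × ℤ)))) = convexHull ℝ ((F.image fun w => L (cR w) : Finset (E 2)) : Set (E 2)) := by
        rw [L.image_convexHull, image_image]; simp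
      refine ⟨?_, ?_, F.image fun w => L (cR w), ?_, e⟩
      · simp only [e, convexHull_nonempty_iff]; simpa using h0
      · simp only [e]
        refine convexHull_min ?_ (hK.linear_preimage (ee : E 2 →L[ℝ] ℝ × ℝ).toLinearMap)
        intro w hw
        obtain ⟨v, hv, rfl⟩ := Finset.mem_image.mp hw
        have := hF v hv
        simpa [hL] using this
      · intro w hw
        obtain ⟨v, hv, rfl⟩ := Finset.mem_image.mp hw
        intro i; rw [hL]
        fin_cases i
        · exact ⟨v.1, by simp; ring⟩
        · exact ⟨v.2, by simp; ring⟩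
  rw [this, ncard_image_of_injective _ (image_injective.mpr Linj)]

end BL

end Part25

section Part26
set_option linter.all false
open scoped Classical

/-! ## Part 6b: assembly -/
namespace BL
open Topology

/-- Homothety with centre `o` and ratio `s`. -/
def hty (o : ℝ × ℝ) (s : ℝ) (z : ℝ × ℝ) : ℝ × ℝ := o + s • (z - o)

lemma hty_sub (o : ℝ × ℝ) (s : ℝ) (z w : ℝ × ℝ) : hty o s z - hty o s w = s • (z - w) := by unfold hty; module

lemma al_hty (N : ℕ) (o : ℝ × ℝ) (s : ℝ) (p : ℕ → ℝ × ℝ) (i : ℕ) : al N (fun i => hty o s (p i)) i = s * al N p i := by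
  simp only [al, hty_sub, dt_smul_left]
lemma be_hty (N : ℕ) (o : ℝ × ℝ) (s : ℝ) (p : ℕ → ℝ × ℝ) (i : ℕ) : be N (fun i => hty o s (p i)) i = s * be N p i := by
  simp only [be, hty_sub, dt_smul_right]

lemma Dat_hty {N : ℕ} (o : ℝ × ℝ) {s : ℝ} (hs : 0 ≤ s) {p : ℕ → ℝ × ℝ} (h : Dat N p) : Dat N (fun i => hty o s (p i)) := by
  intro i hi
  rw [al_hty, be_hty]
  exact ⟨mul_nonneg hs (h i hi).1, mul_nonneg hs (h i hi).2⟩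

lemma TT_hty {N : ℕ} (o : ℝ × ℝ) {s : ℝ} (hs : 0 ≤ s) {p : ℕ → ℝ × ℝ} (h : Dat N p) : TT N (fun i => hty o s (p i)) = cb s ^ 2 * TT N p := by
  unfold TT
  rw [Finset.mul_sum]
  refine Finset.sum_congr rfl fun i hi => ?_
  have hi := h i (Finset.mem_range.mp hi)
  rw [al_hty, be_hty, ← cb_sq hs, ← cb_mul (by positivity) (mul_nonneg (by norm_num) (mul_nonneg hi.1 hi.2))]
  congr 1; ring

lemma rf_hty (o : ℝ × ℝ) (s : ℝ) (z : ℝ × ℝ) : rf (hty (rf o) s z) = hty o s (rf z) := by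
  ext <;> simp [hty]; ring

lemma GoodPair.hty {N : ℕ} {K : Set (ℝ × ℝ)} {p p' : ℕ → ℝ × ℝ} (h : GoodPair N K p p') (o : ℝ × ℝ) {s : ℝ} (hs : 0 ≤ s) :
    GoodPair N (hty o s '' K) (fun i => hty o s (p i)) (fun i => BL.hty (rf o) s (p' i)) := by
  obtain ⟨h1, h2, h3, h4, h5, h6, h7, h8⟩ := h
  refine ⟨Dat_hty _ hs h1, Dat_hty _ hs h2, fun i hi => ⟨_, h3 i hi, rfl⟩, fun i hi => ⟨_, h4 i hi, (rf_hty _ _ _).symm⟩, ?_, ?_, ?_, ?_⟩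
  · simp [BL.hty, h5]
  · simp [BL.hty, h6]
  · simp [BL.hty]; nlinarith [mul_le_mul_of_nonneg_left h7 hs]
  · simp [BL.hty]; nlinarith [mul_le_mul_of_nonneg_left h8 hs]

lemma GoodPair.mono {N : ℕ} {K L : Set (ℝ × ℝ)} {p p' : ℕ → ℝ × ℝ} (h : GoodPair N K p p') (hKL : K ⊆ L) : GoodPair N L p p' := by
  obtain ⟨h1, h2, h3, h4, h5⟩ := h
  exact ⟨h1, h2, fun i hi => hKL (h3 i hi), fun i hi => hKL (h4 i hi), h5⟩

lemma hty_convex {K : Set (ℝ × ℝ)} (hK : Convex ℝ K) (o : ℝ × ℝ) (s : ℝ) : Convex ℝ (hty o s '' K) := by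
  rintro _ ⟨z, hz, rfl⟩ _ ⟨w, hw, rfl⟩ a b ha hb hab
  refine ⟨a • z + b • w, hK hz hw ha hb hab, ?_⟩
  obtain rfl : b = 1 - a := by linarith
  unfold hty; module

lemma hty_nbhd {K : Set (ℝ × ℝ)} (hK : Convex ℝ K) {o : ℝ × ℝ} {e η : ℝ} (hη : 0 < η) (hη1 : η < 1)
    (ho : ∀ s t : ℝ, |s| ≤ e → |t| ≤ e → (o.1 + s, o.2 + t) ∈ K) : ∀ z ∈ hty o (1 - η) '' K, ∀ w, nr (η * e) w z → w ∈ K := by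
  rintro _ ⟨z, hz, rfl⟩ w ⟨h1, h2⟩
  have b : ∀ x : ℝ, |x| ≤ η * e → |x / η| ≤ e := fun x hx => by
    rw [abs_div, abs_of_pos hη, div_le_iff₀ hη]; linarith
  have := hK hz (ho _ _ (b _ h1) (b _ h2)) (by linarith : 0 ≤ 1 - η) hη.le (by ring)
  convert this using 1
  ext
  · simp [hty]; field_simp; ring
  · simp [hty]; field_simp; ring

lemma gen_in {N : ℕ} {K0 K : Set (ℝ × ℝ)} (hK0 : Convex ℝ K0) {M r : ℝ} (hr : 0 ≤ r) (hM : ∀ z ∈ K0, |z.1| ≤ M ∧ |z.2| ≤ M)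
    (hKK : ∀ z ∈ K0, ∀ w, nr r w z → w ∈ K) (hN : 2 * M / (N + 1) ≤ r) {p : ℕ → ℝ × ℝ} (hD : Dat N p) (hp : ∀ i ≤ kf N, p i ∈ K0) :
    Gen N p ⊆ K := by
  have self : ∀ z ∈ K0, z ∈ K := fun z hz => hKK z hz z (by constructor <;> simp [hr])
  rintro w (rfl | rfl | ⟨i, τ, ⟨hi, t0, t1, -⟩, rfl⟩)
  · exact self _ (hp _ (Nat.zero_le _))
  · exact self _ (hp _ le_rfl)
  · have p1 := hp i hi.le
    have p2 := hp (i+1) hi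
    have d := hD i hi
    have bd : ∀ x y : ℝ, |x| ≤ M → |y| ≤ M → |x - y| ≤ 2 * M := fun x y hx hy => (abs_sub _ _).trans (by linarith)
    obtain ⟨τ', s0, s1, s2⟩ := seg_close hi (p := p i) (q := p (i+1)) (x := al N p i * (2 * τ - τ ^ 2)) (y := be N p i * τ ^ 2) (M := 2 * M)
      (mul_nonneg d.1 (by nlinarith)) (mul_le_of_le_one_right d.1 (by nlinarith [sq_nonneg (1 - τ)])) (mul_nonneg d.2 (by positivity)) (mul_le_of_le_one_right d.2 (by nlinarith))
      (bd _ _ (hM _ p2).1 (hM _ p1).1) (bd _ _ (hM _ p2).2 (hM _ p1).2)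
    exact hKK _ (conv_pt hK0 p1 p2 s0 s1) _ ⟨s2.1.trans hN, s2.2.trans hN⟩

lemma cpt_bound {K : Set (ℝ × ℝ)} (hKc : IsCompact K) : ∃ M > 0, ∀ z ∈ K, |z.1| ≤ M ∧ |z.2| ≤ M := by
  obtain ⟨M, hM⟩ := hKc.isBounded.exists_norm_le
  refine ⟨max M 1, by positivity, fun z hz => ?_⟩
  have := hM z hz
  rw [Prod.norm_def] at this
  exact ⟨((le_max_left _ _).trans this).trans (le_max_left _ _), ((le_max_right _ _).trans this).trans (le_max_left _ _)⟩

lemma TT_nonneg {N : ℕ} {p : ℕ → ℝ × ℝ} (hD : Dat N p) : 0 ≤ TT N p :=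
  Finset.sum_nonneg fun i hi => cb_nonneg (mul_nonneg (by norm_num) (mul_nonneg (hD i (Finset.mem_range.mp hi)).1 (hD i (Finset.mem_range.mp hi)).2))

lemma TT_bound {N : ℕ} {K : Set (ℝ × ℝ)} {M : ℝ} (hM : ∀ z ∈ K, |z.1| ≤ M ∧ |z.2| ≤ M) {p : ℕ → ℝ × ℝ} (hD : Dat N p) (hp : ∀ i ≤ kf N, p i ∈ K) :
    TT N p ≤ kf N * cb (4 * ((2 * M * fanW N) * (2 * M * fanW N))) := by
  unfold TT
  rw [← nsmul_eq_mul]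
  conv_rhs => rw [← Finset.card_range (kf N)]
  refine Finset.sum_le_card_nsmul _ _ _ fun i hi => ?_
  have hi := Finset.mem_range.mp hi
  have d := hD i hi
  have bd : ∀ x y : ℝ, |x| ≤ M → |y| ≤ M → |x - y| ≤ 2 * M := fun x y hx hy => (abs_sub _ _).trans (by linarith)
  have p1 := hM _ (hp i hi.le)
  have p2 := hM _ (hp (i+1) hi)
  have a1 : al N p i ≤ 2 * M * fanW N := (le_abs_self _).trans (dt_le_bound (bd _ _ p2.1 p1.1) (bd _ _ p2.2 p1.2) (fanW_ge N (Nat.succ_le_of_lt hi)))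
  have b1 : be N p i ≤ 2 * M * fanW N := by
    rw [be, dt_swap]
    exact (neg_le_abs _).trans (dt_le_bound (bd _ _ p2.1 p1.1) (bd _ _ p2.2 p1.2) (fanW_ge N hi.le))
  refine cb_mono (mul_nonneg (by norm_num) (mul_nonneg d.1 d.2)) ?_
  have := mul_le_mul a1 b1 d.2 (d.1.trans a1)
  linarith

lemma rf_bound {K : Set (ℝ × ℝ)} {M : ℝ} (hM : ∀ z ∈ K, |z.1| ≤ M ∧ |z.2| ≤ M) : ∀ z ∈ {z | rf z ∈ K}, |z.1| ≤ M ∧ |z.2| ≤ M := fun z hz => by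
  simpa using hM _ hz

lemma AL_bdd {K : Set (ℝ × ℝ)} (hKc : IsCompact K) : ∃ B, ∀ S a b f g, S ⊆ K → Rg S a b f g → AL a b f g ≤ B := by
  obtain ⟨M, M0, hM⟩ := cpt_bound hKc
  refine ⟨kf 0 * cb (4 * ((2 * M * fanW 0) * (2 * M * fanW 0))) + kf 0 * cb (4 * ((2 * M * fanW 0) * (2 * M * fanW 0))), fun S a b f g hS R => ?_⟩
  obtain ⟨p, p', hg, h⟩ := R.good 0
  have hg := hg.mono hS
  exact h.trans (add_le_add (TT_bound hM hg.1 hg.2.2.1) (TT_bound (rf_bound hM) hg.2.1 hg.2.2.2.1))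

lemma hty_bound {o : ℝ × ℝ} {s : ℝ} {K : Set (ℝ × ℝ)} {M : ℝ} (hM : ∀ z ∈ K, |z.1| ≤ M ∧ |z.2| ≤ M) (hKK : hty o s '' K ⊆ K) : ∀ z ∈ hty o s '' K, |z.1| ≤ M ∧ |z.2| ≤ M :=
  fun z hz => hM z (hKK hz)

lemma N_ex (C : ℝ) {r : ℝ} (hr : 0 < r) : ∃ N : ℕ, C / (N + 1) ≤ r := by
  obtain ⟨N, hN⟩ := exists_nat_ge (C / r)
  refine ⟨N, ?_⟩
  rw [div_le_iff₀ hr] at hN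
  rw [div_le_iff₀ (by positivity)]; nlinarith

theorem upper_fin {K : Set (ℝ × ℝ)} (hK : Convex ℝ K) (hKc : IsCompact K) (hKi : (interior K).Nonempty) {A : ℝ} (hA0 : 0 ≤ A)
    (hA : ∀ S a b f g, S ⊆ K → Rg S a b f g → AL a b f g ≤ A) {ε : ℝ} (hε : 0 < ε) :
    ∀ᶠ n : ℕ in atTop, (LPn n K).Finite ∧ Real.log ((LPn n K).ncard) ≤ (3 * cb (kap / 4) * A + ε) * cb n ^ 2 := by
  obtain ⟨o, hoi⟩ := hKi
  obtain ⟨e, he, ho⟩ := fiber_nbhd hoi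
  obtain ⟨M, M0, hM⟩ := cpt_bound hKc
  have c0 : Tendsto (fun η : ℝ => 3 * cb (kap / 4) * (A / cb (1 - η) ^ 2)) (𝓝[>] 0) (𝓝 (3 * cb (kap / 4) * A)) := by
    have : ContinuousAt (fun η : ℝ => 3 * cb (kap / 4) * (A / cb (1 - η) ^ 2)) 0 := by
      refine continuousAt_const.mul (continuousAt_const.div ((cb_cont.comp (continuous_const.sub continuous_id)).pow 2).continuousAt ?_)
      simp [cb_one]
    have h := this.tendsto.mono_left (nhdsWithin_le_nhds (s := Ioi 0))
    simpa [cb_one] using h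
  obtain ⟨η, hη2, hη0, hη1⟩ := ((c0.eventually (gt_mem_nhds (by linarith : 3 * cb (kap / 4) * A < 3 * cb (kap / 4) * A + ε / 2))).and (Ioo_mem_nhdsGT one_pos)).exists
  have cp : 0 < cb (1 - η) := cb_pos (by linarith)
  have hKK := hty_nbhd hK hη0 hη1 ho
  have hr : 0 < η * e := by positivity
  have hsub : hty o (1 - η) '' K ⊆ K := fun z hz => hKK z hz z (by constructor <;> simp [hr.le])
  obtain ⟨N, hN⟩ := N_ex (2 * M) hr
  have hT : ∀ p p', GoodPair N K p p' → TT N p + TT N p' ≤ A / cb (1 - η) ^ 2 := by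
    intro p p' hg
    have n1 := TT_nonneg hg.1
    have n2 := TT_nonneg hg.2.1
    rcases (add_nonneg n1 n2).eq_or_lt with h0 | h0
    · rw [← h0]; positivity
    have g := hg.hty o (s := 1 - η) (by linarith)
    have e1 := TT_hty o (by linarith : 0 ≤ 1 - η) hg.1
    have e2 := TT_hty (rf o) (by linarith : 0 ≤ 1 - η) hg.2.1
    obtain ⟨S, a, b, f, g', hS, R, h⟩ := arcs_set (g.mono hsub) hK hKc (gen_in (hty_convex hK o (1 - η)) hr.le (hty_bound hM hsub) hKK hN g.1 g.2.2.1)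
      (gen_in (K := {z | rf z ∈ K}) (rf_convex (hty_convex hK o (1 - η))) hr.le (rf_bound (hty_bound hM hsub)) 
        (fun z hz w hw => hKK _ hz _ ⟨hw.1, by simp only [rf_snd]; rw [← abs_neg]; convert hw.2 using 2; ring⟩) hN g.2.1 g.2.2.2.1) (by rw [e1, e2, ← mul_add]; positivity)
    rw [e1, e2, ← mul_add] at h
    rw [le_div_iff₀ (by positivity)]
    linarith [hA S a b f g' hS R]
  filter_upwards [upper_U N M0 hM (by positivity) hT (half_pos hε)] with n hn
  refine ⟨hn.1, hn.2.trans ?_⟩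
  refine mul_le_mul_of_nonneg_right ?_ (sq_nonneg _)
  linarith

theorem lower_fin {K : Set (ℝ × ℝ)} (hK : Convex ℝ K) (hKc : IsCompact K) (hKi : (interior K).Nonempty) {S a b f g} (hS : S ⊆ K) (R : Rg S a b f g)
    {ε : ℝ} (hε : 0 < ε) :
    ∀ᶠ n : ℕ in atTop, (LPn n K).Finite → (3 * cb (kap / 4) * AL a b f g - ε) * cb n ^ 2 ≤ Real.log ((LPn n K).ncard) := by
  obtain ⟨o, hoi⟩ := hKi
  obtain ⟨e, he, ho⟩ := fiber_nbhd hoi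
  obtain ⟨M, M0, hM⟩ := cpt_bound hKc
  have c0 : Tendsto (fun η : ℝ => 3 * cb (kap / 4) * (cb (1 - η) ^ 2 * AL a b f g)) (𝓝[>] 0) (𝓝 (3 * cb (kap / 4) * AL a b f g)) := by
    have : Continuous (fun η : ℝ => 3 * cb (kap / 4) * (cb (1 - η) ^ 2 * AL a b f g)) :=
      continuous_const.mul (((cb_cont.comp (continuous_const.sub continuous_id)).pow 2).mul continuous_const)
    have h := (this.tendsto 0).mono_left (nhdsWithin_le_nhds (s := Ioi 0))
    simpa [cb_one] using h
  obtain ⟨η, hη2, hη0, hη1⟩ := ((c0.eventually (lt_mem_nhds (by linarith : 3 * cb (kap / 4) * AL a b f g - ε / 2 < 3 * cb (kap / 4) * AL a b f g))).and (Ioo_mem_nhdsGT one_pos)).exists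
  have hKK := hty_nbhd hK hη0 hη1 ho
  obtain ⟨r, hr⟩ : ∃ r, r = min (η * e) 1 := ⟨_, rfl⟩
  have r0 : 0 < r := by rw [hr]; positivity
  have re : r ≤ η * e := hr ▸ min_le_left _ _
  have hKK' : ∀ z ∈ hty o (1 - η) '' K, ∀ w, nr r w z → w ∈ K := fun z hz w hw => hKK z hz w ⟨hw.1.trans re, hw.2.trans re⟩
  have hsub : hty o (1 - η) '' K ⊆ K := fun z hz => hKK' z hz z (by constructor <;> simp [r0.le])
  obtain ⟨N, hN⟩ := N_ex (8 * M + 4) (half_pos r0)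
  obtain ⟨p, p', hg, h⟩ := R.good N
  have hg := hg.mono hS
  have g := hg.hty o (s := 1 - η) (by linarith)
  have e1 := TT_hty o (by linarith : 0 ≤ 1 - η) hg.1
  have e2 := TT_hty (rf o) (by linarith : 0 ≤ 1 - η) hg.2.1
  filter_upwards [lower_L N (hty_convex hK o (1 - η)) (hty_bound hM hsub) r0 (hr ▸ min_le_right _ _) hN hKK' g (half_pos hε)] with n hn hf
  refine le_trans ?_ (hn hf)
  rw [e1, e2, ← mul_add]
  have k0 : 0 ≤ 3 * cb (kap / 4) := mul_nonneg (by norm_num) (cb_nonneg (by linarith [kap_pos]))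
  have := mul_le_mul_of_nonneg_left (mul_le_mul_of_nonneg_left h (sq_nonneg (cb (1 - η)))) k0
  refine mul_le_mul_of_nonneg_right ?_ (sq_nonneg _)
  linarith

theorem main_limit (K : Set (E 2)) (hKc : IsCompact K) (hKconv : Convex ℝ K) (hKint : (interior K).Nonempty) : Tendsto (fun n:ℕ => (n:ℝ)^(-(2:ℝ)/3) * Real.log ((latticePolytopes 2 n K).ncard)) atTop (nhds (3*((riemannZeta 3).re/(4*(riemannZeta 2).re))^((1:ℝ)/3) * maxAffinePerimeter K)) := by
  obtain ⟨K', rfl⟩ : ∃ K', K = ee ⁻¹' K' := ⟨ee.symm ⁻¹' K, by ext; simp⟩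
  have im : ee '' (ee ⁻¹' K') = K' := image_preimage_eq _ ee.surjective
  have hK : Convex ℝ K' := im ▸ hKconv.linear_image (ee : E 2 →L[ℝ] ℝ × ℝ).toLinearMap
  have hc : IsCompact K' := im ▸ hKc.image ee.continuous
  have hi : (interior K').Nonempty := by
    obtain ⟨x, hx⟩ := hKint
    have := ee.toHomeomorph.preimage_interior K'
    refine ⟨ee x, ?_⟩
    change x ∈ ee.toHomeomorph ⁻¹' (interior K')
    rw [this]; exact hx
  obtain ⟨C, hC⟩ : ∃ C, C = 3 * cb (kap / 4) := ⟨_, rfl⟩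
  have C0 : 0 ≤ C := hC ▸ mul_nonneg (by norm_num) (cb_nonneg (by linarith [kap_pos]))
  have eC : 3*((riemannZeta 3).re/(4*(riemannZeta 2).re))^((1:ℝ)/3) = C := by
    rw [hC, cb, kap]; congr 2; rw [div_div, mul_comm 4]
  rw [eC]
  have cases : ∀ S : Set (E 2), Convex ℝ S → IsCompact S → S ⊆ ee ⁻¹' K' →
      affinePerimeter S = 0 ∨ ∃ S' a b f g, S' ⊆ K' ∧ Rg S' a b f g ∧ affinePerimeter S = AL a b f g := by
    intro S hS hSc hSK
    obtain ⟨S', rfl⟩ : ∃ S', S = ee ⁻¹' S' := ⟨ee.symm ⁻¹' S, by ext; simp⟩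
    have im : ee '' (ee ⁻¹' S') = S' := image_preimage_eq _ ee.surjective
    have hS' : Convex ℝ S' := im ▸ hS.linear_image (ee : E 2 →L[ℝ] ℝ × ℝ).toLinearMap
    have hSc' : IsCompact S' := im ▸ hSc.image ee.continuous
    by_cases h : (interior S').Nonempty
    · obtain ⟨a, b, f, g, R⟩ := exists_Rg hS' hSc' h
      exact Or.inr ⟨S', a, b, f, g, (preimage_subset_preimage_iff (by simp [ee.surjective.range_eq])).mp hSK, R, ap_Rg R⟩
    · exact Or.inl (ap_flat hS' hSc' h)
  obtain ⟨B, hB⟩ := AL_bdd hc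
  obtain ⟨Z, hZ⟩ : ∃ Z, Z = {a | ∃ S, S ⊆ ee ⁻¹' K' ∧ Convex ℝ S ∧ IsCompact S ∧ a = affinePerimeter S} := ⟨_, rfl⟩
  have bdd : BddAbove Z := by
    refine ⟨max B 0, ?_⟩
    rw [hZ]
    rintro _ ⟨S, h1, h2, h3, rfl⟩
    rcases cases S h2 h3 h1 with h | ⟨S', a, b, f, g, h4, R, h⟩
    · rw [h]; exact le_max_right _ _
    · rw [h]; exact (hB _ _ _ _ _ h4 R).trans (le_max_left _ _)
  have z0 : 0 ∈ Z := by
    rw [hZ]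
    refine ⟨ee ⁻¹' ∅, by simp, by simp [convex_empty], by simp, ?_⟩
    rw [ap_flat convex_empty isCompact_empty (by simp)]
  obtain ⟨A, hA⟩ : ∃ A, A = sSup Z := ⟨_, rfl⟩
  have A0 : 0 ≤ A := hA ▸ le_csSup bdd z0
  have eA : maxAffinePerimeter (ee ⁻¹' K') = A := by rw [hA, hZ]; rfl
  have hAL : ∀ S a b f g, S ⊆ K' → Rg S a b f g → AL a b f g ≤ A := by
    intro S a b f g hS R
    rw [hA]
    refine le_csSup bdd ?_
    rw [hZ]
    refine ⟨ee ⁻¹' S, preimage_mono hS, R.cv.linear_preimage (ee : E 2 →L[ℝ] ℝ × ℝ).toLinearMap, ?_, (ap_Rg R).symm⟩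
    exact ee.toHomeomorph.isCompact_preimage.mpr R.cp
  rw [eA, Metric.tendsto_atTop']
  intro ε hε
  have up := upper_fin hK hc hi A0 hAL (half_pos hε)
  have lo : ∀ᶠ n : ℕ in atTop, (LPn n K').Finite → (C * A - ε / 2) * cb n ^ 2 ≤ Real.log ((LPn n K').ncard) := by
    obtain ⟨s, hs, hsl⟩ := exists_lt_of_lt_csSup ⟨0, z0⟩ (by rw [← hA]; linarith [div_pos hε (by linarith : 0 < 4 * (C + 1))] : A - ε / (4 * (C + 1)) < sSup Z)
    have hC1 : C * (ε / (4 * (C + 1))) ≤ ε / 4 := by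
      rw [← mul_div_assoc, div_le_div_iff₀ (by positivity) (by norm_num)]; nlinarith
    have hm := mul_le_mul_of_nonneg_left hsl.le C0
    rw [hZ] at hs
    obtain ⟨S, h1, h2, h3, rfl⟩ := hs
    rcases cases S h2 h3 h1 with h | ⟨S', a, b, f, g, h4, R, h⟩
    · refine Eventually.of_forall fun n _ => le_trans ?_ (Real.log_natCast_nonneg _)
      refine mul_nonpos_of_nonpos_of_nonneg ?_ (sq_nonneg _)
      rw [h] at hm; linarith
    · filter_upwards [lower_fin hK hc hi h4 R (by positivity : 0 < ε / 4)] with n hn hf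
      refine le_trans ?_ (hn hf)
      rw [h] at hm; rw [← hC]
      exact mul_le_mul_of_nonneg_right (by linarith) (sq_nonneg _)
  obtain ⟨n0, hn0⟩ := eventually_atTop.mp ((up.and lo).and (eventually_gt_atTop 0))
  refine ⟨n0, fun n hn => ?_⟩
  obtain ⟨⟨⟨hf, u⟩, l⟩, hnp⟩ := hn0 n hn.le
  have l := l hf
  rw [← hC] at u
  have np : (0:ℝ) < n := by exact_mod_cast hnp
  have cp : 0 < cb n := cb_pos np
  rw [ncard_LPn hK hnp, show (-(2:ℝ)/3) = -((2:ℝ)/3) by ring, Real.rpow_neg np.le, rpow23 np.le, Real.dist_eq, abs_lt, inv_mul_eq_div]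
  constructor
  · rw [lt_sub_iff_add_lt, lt_div_iff₀ (by positivity)]
    nlinarith [mul_pos hε (pow_pos cp 2)]
  · rw [sub_lt_iff_lt_add, div_lt_iff₀ (by positivity)]
    nlinarith [mul_pos hε (pow_pos cp 2)]

end BL

end Part26

/-- Theorem 3.1: for every planar convex body `K`,
`n^{-2/3} log |𝒫_n(K)| → 3 (ζ(3)/(4ζ(2)))^{1/3} A(K)`. -/
theorem limit_log_number_of_lattice_polygons (K : Set (E 2)) (hKc : IsCompact K)
    (hKconv : Convex ℝ K) (hKint : (interior K).Nonempty) :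
    Tendsto (fun n : ℕ => (n : ℝ) ^ (-(2 : ℝ) / 3) *
        Real.log ((latticePolytopes 2 n K).ncard)) atTop
      (nhds (3 * ((riemannZeta 3).re / (4 * (riemannZeta 2).re)) ^ ((1 : ℝ) / 3) *
        maxAffinePerimeter K)) := BL.main_limit K hKc hKconv hKint
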